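/- Let δ > 0 and set α* = (1+δ)/(5+9δ+4δ²). For every E > 0 and every ε > 0 there exists a weak solution (v,p) of the incompressible Euler equations on ℝ×𝕋³ such that: (i) v is Hölder continuous of exponent α jointly in time and space for every α < α*, and p is Hölder continuous of exponent α jointly in time and space for every α < 2α*; (ii) v and p vanish outside J×𝕋³ for some interval J ⊂ ℝ of length at most ε; (iii) sup_t ∫_{𝕋³} |v(t,x)|² dx ≥ E (in particular v is not identically zero). -/

import Mathlib

noncomputable section

open MeasureTheory

/-- Points of space; functions on the torus 𝕋³ = ℝ³/ℤ³ are identified with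
ℤ³-periodic functions on ℝ³. -/
abbrev Spc : Type := Fin 3 → ℝ

/-- The fundamental domain [0,1)³ of the torus. -/
def Tdom : Set Spc := Set.univ.pi fun _ => Set.Ico (0 : ℝ) 1

/-- ℤ³-periodicity of a function on ℝ³. -/
def Per {α : Type*} (f : Spc → α) : Prop :=
  ∀ (x : Spc) (k : Fin 3 → ℤ), f (fun i => x i + (k i : ℝ)) = f x

/-- Spatial partial derivative in direction `j`. -/
def pd {E : Type*} [NormedAddCommGroup E] [NormedSpace ℝ E]
    (j : Fin 3) (f : Spc → E) (x : Spc) : E :=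
  fderiv ℝ f x (Pi.single j 1)

/-- Time derivative. -/
def pt {E : Type*} [NormedAddCommGroup E] [NormedSpace ℝ E]
    (f : ℝ → Spc → E) (t : ℝ) (x : Spc) : E :=
  deriv (fun s => f s x) t

/-- Smooth test function on ℝ×𝕋³: smooth, ℤ³-periodic in space and
compactly supported in time. -/
def IsTest {E : Type*} [NormedAddCommGroup E] [NormedSpace ℝ E]
    (φ : ℝ → Spc → E) : Prop :=
  ContDiff ℝ (⊤ : ℕ∞) (fun q : ℝ × Spc => φ q.1 q.2) ∧ (∀ t, Per (φ t)) ∧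
    ∃ T : ℝ, ∀ t : ℝ, T < |t| → ∀ x, φ t x = 0

/-- Weak solution of the incompressible Euler equations on ℝ×𝕋³. -/
def IsWeakEuler (v : ℝ → Spc → Spc) (p : ℝ → Spc → ℝ) : Prop :=
  (∀ φ : ℝ → Spc → Spc, IsTest φ →
    (∫ t : ℝ, ∫ x in Tdom,
      ((∑ l, v t x l * pt (fun s y => φ s y l) t x) +
        (∑ j, ∑ l, v t x j * v t x l * pd j (fun y => φ t y l) x) +
        p t x * ∑ j, pd j (fun y => φ t y j) x)) = 0) ∧
  (∀ ψ : ℝ → Spc → ℝ, IsTest ψ →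
    (∫ t : ℝ, ∫ x in Tdom, ∑ j, v t x j * pd j (ψ t) x) = 0)

/-- Hölder continuity of exponent `α`, jointly in time and space. -/
def HolderTS {E : Type*} [NormedAddCommGroup E] (α : ℝ) (f : ℝ → Spc → E) : Prop :=
  ∃ C : ℝ, ∀ (t t' : ℝ) (x x' : Spc),
    ‖f t x - f t' x'‖ ≤ C * dist ((t, x) : ℝ × Spc) ((t', x') : ℝ × Spc) ^ α

noncomputable section
open MeasureTheory Set Filter Topology
open scoped ContDiff

namespace CI

section param
variable {V : Type} [NormedAddCommGroup V] [NormedSpace ℝ V] [FiniteDimensional ℝ V]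

/-- differentiation under the integral sign over `[0,1]` -/
theorem hasFDerivAt_param {E : Type} [NormedAddCommGroup E] [NormedSpace ℝ E] [CompleteSpace E]
    (F : V × ℝ → E) (hF : ContDiff ℝ 1 F) (x0 : V) :
    HasFDerivAt (fun x => ∫ u in (0:ℝ)..1, F (x, u))
      (∫ u in (0:ℝ)..1, (fderiv ℝ F (x0, u)).comp (ContinuousLinearMap.inl ℝ V ℝ)) x0 := by
  have hF' : Continuous (fun z : V × ℝ => (fderiv ℝ F z).comp (ContinuousLinearMap.inl ℝ V ℝ)) :=
    (hF.continuous_fderiv (by norm_num)).clm_comp continuous_const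
  have hK : IsCompact (Metric.closedBall x0 1 ×ˢ Icc (0:ℝ) 1) :=
    (isCompact_closedBall x0 1).prod isCompact_Icc
  obtain ⟨C, hC⟩ := hK.exists_bound_of_continuousOn hF'.continuousOn
  refine intervalIntegral.hasFDerivAt_integral_of_dominated_of_fderiv_le
    (μ := volume) (F := fun x u => F (x, u)) (F' := fun x u => (fderiv ℝ F (x, u)).comp (ContinuousLinearMap.inl ℝ V ℝ))
    (s := Metric.ball x0 1) (bound := fun _ => C)
    (Metric.ball_mem_nhds x0 one_pos) ?_ ?_ ?_ ?_ ?_ ?_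
  · refine Filter.Eventually.of_forall fun x => ?_
    exact (hF.continuous.comp (by fun_prop)).aestronglyMeasurable
  · exact (hF.continuous.comp (by fun_prop)).intervalIntegrable _ _
  · exact (hF'.comp (by fun_prop : Continuous fun u : ℝ => (x0, u))).aestronglyMeasurable
  · refine Filter.Eventually.of_forall fun u hu x hx => ?_
    rw [uIoc_of_le zero_le_one] at hu
    exact hC (x, u) ⟨Metric.ball_subset_closedBall hx, ⟨hu.1.le, hu.2⟩⟩
  · simp
  · refine Filter.Eventually.of_forall fun u hu x hx => ?_
    have h1 : HasFDerivAt F (fderiv ℝ F (x, u)) (x, u) :=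
      (hF.differentiable (by norm_num) (x, u)).hasFDerivAt
    exact h1.comp x (hasFDerivAt_prodMk_left x u)

theorem contDiff_param_nat (n : ℕ) : ∀ {E : Type} [NormedAddCommGroup E] [NormedSpace ℝ E]
    [CompleteSpace E] (F : V × ℝ → E) (_ : ContDiff ℝ ∞ F),
    ContDiff ℝ n (fun x => ∫ u in (0:ℝ)..1, F (x, u)) := by
  induction n with
  | zero =>
    intro E _ _ _ F hF
    have : Differentiable ℝ (fun x => ∫ u in (0:ℝ)..1, F (x, u)) := fun x =>
      (hasFDerivAt_param F (hF.of_le (by exact_mod_cast le_top)) x).differentiableAt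
    exact contDiff_zero.2 this.continuous
  | succ n ih =>
    intro E _ _ _ F hF
    have hd := hasFDerivAt_param F (hF.of_le (by exact_mod_cast le_top))
    rw [show ((n + 1 : ℕ) : WithTop ℕ∞) = (n : WithTop ℕ∞) + 1 by push_cast; rfl]
    rw [contDiff_succ_iff_fderiv]
    refine ⟨fun x => (hd x).differentiableAt, by simp, ?_⟩
    have : fderiv ℝ (fun x => ∫ u in (0:ℝ)..1, F (x, u)) = fun x => ∫ u in (0:ℝ)..1,
        (fun z : V × ℝ => (fderiv ℝ F z).comp (ContinuousLinearMap.inl ℝ V ℝ)) (x, u) := by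
      funext x; exact (hd x).fderiv
    rw [this]
    exact ih (E := V →L[ℝ] E) _ ((hF.fderiv_right (m := ∞) (by simp)).clm_comp contDiff_const)

theorem contDiff_param {E : Type} [NormedAddCommGroup E] [NormedSpace ℝ E]
    [CompleteSpace E] (F : V × ℝ → E) (hF : ContDiff ℝ ∞ F) :
    ContDiff ℝ ∞ (fun x => ∫ u in (0:ℝ)..1, F (x, u)) :=
  contDiff_infty.2 fun n => contDiff_param_nat n F hF

theorem fderiv_param {E : Type} [NormedAddCommGroup E] [NormedSpace ℝ E]
    [CompleteSpace E] (F : V × ℝ → E) (hF : ContDiff ℝ ∞ F) (x e : V) :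
    fderiv ℝ (fun x => ∫ u in (0:ℝ)..1, F (x, u)) x e
      = ∫ u in (0:ℝ)..1, fderiv ℝ (fun y => F (y, u)) x e := by
  have h1 : ContDiff ℝ 1 F := hF.of_le (by exact_mod_cast le_top)
  rw [(hasFDerivAt_param F h1 x).fderiv]
  have hF' : Continuous (fun u : ℝ => (fderiv ℝ F (x, u)).comp (ContinuousLinearMap.inl ℝ V ℝ)) :=
    ((h1.continuous_fderiv (by norm_num)).comp (by fun_prop)).clm_comp continuous_const
  rw [ContinuousLinearMap.intervalIntegral_apply (hF'.intervalIntegrable _ _)]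
  refine intervalIntegral.integral_congr fun u _ => ?_
  have h2 : HasFDerivAt F (fderiv ℝ F (x, u)) (x, u) :=
      (h1.differentiable (by norm_num) (x, u)).hasFDerivAt
  have h3 := (HasFDerivAt.comp (g := F) (f := fun y : V => (y, u)) x h2 (hasFDerivAt_prodMk_left x u)).fderiv
  simp only [Function.comp_def] at h3
  simp [h3]
end param

section ring
variable {V : Type} [NormedAddCommGroup V] [NormedSpace ℝ V]

/-- The algebra of smooth complex functions. -/
def SFo (V : Type) [NormedAddCommGroup V] [NormedSpace ℝ V] : Subalgebra ℂ (V → ℂ) where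
  carrier := {f | ContDiff ℝ ∞ f}
  mul_mem' := by
    intro a b ha hb
    exact ContDiff.mul (show ContDiff ℝ ∞ a from ha) (show ContDiff ℝ ∞ b from hb)
  add_mem' := by
    intro a b ha hb
    exact ContDiff.add (show ContDiff ℝ ∞ a from ha) (show ContDiff ℝ ∞ b from hb)
  algebraMap_mem' := by
    intro c
    exact (contDiff_const : ContDiff ℝ ∞ (fun _ : V => c))

theorem SFo.cd (f : SFo V) : ContDiff ℝ ∞ f.1 := f.2
theorem SFo.diff (f : SFo V) : Differentiable ℝ f.1 := (SFo.cd f).differentiable (by simp)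
theorem SFo.cont (f : SFo V) : Continuous f.1 := (SFo.cd f).continuous

@[ext] theorem SFo.ext' {f g : SFo V} (h : ∀ z, f.1 z = g.1 z) : f = g := Subtype.ext (funext h)

@[simp] theorem SFo.add_app (f g : SFo V) (z : V) : (f + g).1 z = f.1 z + g.1 z := rfl
@[simp] theorem SFo.sub_app (f g : SFo V) (z : V) : (f - g).1 z = f.1 z - g.1 z := rfl
@[simp] theorem SFo.neg_app (f : SFo V) (z : V) : (-f).1 z = - f.1 z := rfl
@[simp] theorem SFo.mul_app (f g : SFo V) (z : V) : (f * g).1 z = f.1 z * g.1 z := rfl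
@[simp] theorem SFo.smul_app (c : ℂ) (g : SFo V) (z : V) : (c • g).1 z = c * g.1 z := rfl
@[simp] theorem SFo.zero_app (z : V) : (0 : SFo V).1 z = 0 := rfl
@[simp] theorem SFo.one_app (z : V) : (1 : SFo V).1 z = 1 := rfl
@[simp] theorem SFo.pow_app (f : SFo V) (n : ℕ) (z : V) : (f ^ n).1 z = f.1 z ^ n := by
  simp
@[simp] theorem SFo.algebraMap_app (c : ℂ) (z : V) : (algebraMap ℂ (SFo V) c).1 z = c := rfl
@[simp] theorem SFo.sum_app {ι : Type*} (s : Finset ι) (f : ι → SFo V) (z : V) :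
    (∑ i ∈ s, f i).1 z = ∑ i ∈ s, (f i).1 z := by
  classical
  induction s using Finset.induction_on with
  | empty => simp
  | insert a s ha ih => simp [Finset.sum_insert ha, ih]

/-- directional derivative as a derivation -/
def dd (e : V) : Derivation ℂ (SFo V) (SFo V) :=
  Derivation.mk'
    { toFun := fun f => ⟨fun z => fderiv ℝ f.1 z e,
        ((SFo.cd f).fderiv_right (m := ∞) (by simp)).clm_apply contDiff_const⟩
      map_add' := by
        intro f g; ext z
        simp only [SFo.add_app]
        have : (f + g).1 = f.1 + g.1 := rfl
        rw [this, fderiv_add (SFo.diff f z) (SFo.diff g z)]; rfl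
      map_smul' := by
        intro c f; ext z
        have : (c • f).1 = fun z => c • f.1 z := rfl
        simp only [RingHom.id_apply, SFo.smul_app, this]
        rw [fderiv_fun_const_smul (SFo.diff f z)]; rfl }
    (by
      intro f g; ext z
      have : (f * g).1 = fun z => f.1 z * g.1 z := rfl
      simp only [LinearMap.coe_mk, AddHom.coe_mk, this, smul_eq_mul, SFo.add_app, SFo.mul_app]
      rw [fderiv_fun_mul (SFo.diff f z) (SFo.diff g z)]
      simp)

theorem dd_app (e : V) (f : SFo V) (z : V) : (dd e f).1 z = fderiv ℝ f.1 z e := rfl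

theorem dd_mul (e : V) (f g : SFo V) : dd e (f * g) = dd e f * g + f * dd e g := by
  rw [Derivation.leibniz, smul_eq_mul, smul_eq_mul]; ring

theorem Der_mul (D : Derivation ℂ (SFo V) (SFo V)) (f g : SFo V) :
    D (f * g) = D f * g + f * D g := by
  rw [Derivation.leibniz, smul_eq_mul, smul_eq_mul]; ring

theorem dd_comm (e e' : V) (f : SFo V) : dd e (dd e' f) = dd e' (dd e f) := by
  ext z
  have hs : IsSymmSndFDerivAt ℝ f.1 z :=
    ((SFo.cd f).contDiffAt).isSymmSndFDerivAt (by simp only [minSmoothness_of_isRCLikeNormedField]; exact WithTop.coe_le_coe.2 (le_top : (2:ℕ∞) ≤ ⊤))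
  have key : ∀ a b : V, (dd a (dd b f)).1 z = fderiv ℝ (fderiv ℝ f.1) z a b := by
    intro a b
    rw [dd_app]
    have : (dd b f).1 = fun z => fderiv ℝ f.1 z b := rfl
    have hd : DifferentiableAt ℝ (fderiv ℝ f.1) z :=
      (((SFo.cd f).fderiv_right (m := ∞) (by simp)).differentiable (by simp)) z
    rw [this, fderiv_clm_apply hd (differentiableAt_const _)]
    simp
  rw [key, key]
  exact hs e e'

theorem dd_add_dir (e e' : V) (f : SFo V) : dd (e + e') f = dd e f + dd e' f := by
  ext z; simp [dd_app]
theorem dd_smul_dir (c : ℝ) (e : V) (f : SFo V) : dd (c • e) f = (c : ℂ) • dd e f := by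
  ext z; simp [dd_app]
theorem dd_zero_dir (f : SFo V) : dd (0 : V) f = 0 := by ext z; simp [dd_app]

end ring

abbrev SF := SFo (ℝ × Spc)
abbrev Der := Derivation ℂ SF SF

def ex (j : Fin 3) : Spc := Pi.single j 1
/-- spatial derivative -/
def dx (j : Fin 3) : Derivation ℂ SF SF := dd ((0, ex j) : ℝ × Spc)
/-- time derivative -/
def dt : Derivation ℂ SF SF := dd ((1, 0) : ℝ × Spc)

theorem dx_mul (j) (f g : SF) : dx j (f * g) = dx j f * g + f * dx j g := dd_mul _ f g
theorem dt_mul (f g : SF) : dt (f * g) = dt f * g + f * dt g := dd_mul _ f g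
theorem dx_comm (i j) (f : SF) : dx i (dx j f) = dx j (dx i f) := dd_comm _ _ f
theorem dx_dt (i) (f : SF) : dx i (dt f) = dt (dx i f) := dd_comm _ _ f

/-- spatial periodicity -/
def PerS (f : SF) : Prop := ∀ (t : ℝ) (x : Spc) (k : Fin 3 → ℤ),
  f.1 (t, fun i => x i + (k i : ℝ)) = f.1 (t, x)

end CI
end

noncomputable section
open MeasureTheory Set Filter Topology
open scoped ContDiff

namespace CI
section sym
variable {V : Type} [NormedAddCommGroup V] [NormedSpace ℝ V] {ι : Type}

/-- context for symbol estimates -/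
structure Ctx (V : Type) [NormedAddCommGroup V] [NormedSpace ℝ V] (ι : Type) where
  L : ι → ℝ
  hL : ∀ i, 1 ≤ L i
  Dom : ι → Set V
  D : Fin 3 → Derivation ℂ (SFo V) (SFo V)
  Dt : ι → Derivation ℂ (SFo V) (SFo V)

variable (c : Ctx V ι)

/-- pointwise bound, uniform over the family -/
def Bd (A : ι → ℝ) (f : ι → SFo V) : Prop :=
  ∃ C : ℝ, 0 ≤ C ∧ ∀ i, ∀ z ∈ c.Dom i, ‖(f i).1 z‖ ≤ C * A i

def SymN : ℕ → (ι → ℝ) → (ι → SFo V) → Prop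
  | 0, A, f => Bd c A f
  | n+1, A, f => SymN n A f ∧ ∀ j, SymN n (A * c.L) (fun i => c.D j (f i))

def Sy : ℕ → (ι → ℝ) → (ι → SFo V) → Prop
  | 0, A, f => ∀ n, SymN c n A f
  | m+1, A, f => (∀ n, SymN c n A f) ∧ Sy m (A * c.L) (fun i => c.Dt i (f i))

variable {c} {A B : ι → ℝ} {f g : ι → SFo V}

theorem Bd.mono (C : ℝ) (hC : 0 ≤ C) (h : ∀ i, A i ≤ C * B i) (hf : Bd c A f) : Bd c B f := by
  obtain ⟨K, hK, H⟩ := hf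
  refine ⟨K * C, by positivity, fun i z hz => (H i z hz).trans ?_⟩
  rw [mul_assoc]; exact mul_le_mul_of_nonneg_left (h i) hK
theorem Bd.add (hf : Bd c A f) (hg : Bd c A g) : Bd c A (fun i => f i + g i) := by
  obtain ⟨K, hK, H⟩ := hf
  obtain ⟨K', hK', H'⟩ := hg
  refine ⟨K + K', by positivity, fun i z hz => ?_⟩
  rw [add_mul]; exact (norm_add_le _ _).trans (add_le_add (H i z hz) (H' i z hz))
theorem Bd.smul (a : ℂ) (hf : Bd c A f) : Bd c A (fun i => a • f i) := by
  obtain ⟨K, hK, H⟩ := hf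
  refine ⟨‖a‖ * K, by positivity, fun i z hz => ?_⟩
  rw [SFo.smul_app, norm_mul, mul_assoc]
  exact mul_le_mul_of_nonneg_left (H i z hz) (norm_nonneg _)
theorem Bd.mul (hf : Bd c A f) (hg : Bd c B g) : Bd c (A * B) (fun i => f i * g i) := by
  obtain ⟨K, hK, H⟩ := hf
  obtain ⟨K', hK', H'⟩ := hg
  refine ⟨K * K', by positivity, fun i z hz => ?_⟩
  rw [SFo.mul_app, norm_mul]
  calc _ ≤ (K * A i) * (K' * B i) := mul_le_mul (H i z hz) (H' i z hz) (norm_nonneg _)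
        ((norm_nonneg _).trans (H i z hz))
    _ = _ := by simp only [Pi.mul_apply]; ring
theorem Bd.zero (_ : ∀ i, 0 ≤ A i) : Bd c A (fun _ => 0) :=
  ⟨0, le_rfl, fun i z _ => by simp⟩
theorem Bd.one : Bd c 1 (fun _ => 1) := ⟨1, zero_le_one, fun i z _ => by simp⟩

theorem SymN.mono {n : ℕ} (C : ℝ) (hC : 0 ≤ C) (h : ∀ i, A i ≤ C * B i) (hf : SymN c n A f) :
    SymN c n B f := by
  induction n generalizing A B f with
  | zero => exact Bd.mono C hC h hf
  | succ n ih =>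
    refine ⟨ih h hf.1, fun j => ih (fun i => ?_) (hf.2 j)⟩
    have := mul_le_mul_of_nonneg_right (h i) (zero_le_one.trans (c.hL i))
    simpa [mul_assoc] using this
theorem SymN.add {n : ℕ} (hf : SymN c n A f) (hg : SymN c n A g) :
    SymN c n A (fun i => f i + g i) := by
  induction n generalizing A f g with
  | zero => exact Bd.add hf hg
  | succ n ih =>
    refine ⟨ih hf.1 hg.1, fun j => ?_⟩
    simp only [map_add]; exact ih (hf.2 j) (hg.2 j)
theorem SymN.smul {n : ℕ} (a : ℂ) (hf : SymN c n A f) : SymN c n A (fun i => a • f i) := by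
  induction n generalizing A f with
  | zero => exact Bd.smul a hf
  | succ n ih =>
    refine ⟨ih hf.1, fun j => ?_⟩
    simp only [Derivation.map_smul]; exact ih (hf.2 j)
theorem SymN.mul {n : ℕ} (hf : SymN c n A f) (hg : SymN c n B g) :
    SymN c n (A * B) (fun i => f i * g i) := by
  induction n generalizing A B f g with
  | zero => exact Bd.mul hf hg
  | succ n ih =>
    refine ⟨ih hf.1 hg.1, fun j => ?_⟩
    simp only [Der_mul]
    refine SymN.add ?_ ?_
    · rw [mul_right_comm]; exact ih (hf.2 j) hg.1
    · rw [mul_assoc]; exact ih hf.1 (hg.2 j)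
theorem SymN.neg {n : ℕ} (hf : SymN c n A f) : SymN c n A (fun i => - f i) := by
  have := hf.smul (-1); simpa using this
theorem SymN.sub {n : ℕ} (hf : SymN c n A f) (hg : SymN c n A g) :
    SymN c n A (fun i => f i - g i) := by
  simp only [sub_eq_add_neg]; exact hf.add hg.neg
theorem SymN.zero {n : ℕ} (hA : ∀ i, 0 ≤ A i) : SymN c n A (fun _ => 0) := by
  induction n generalizing A with
  | zero => exact Bd.zero hA
  | succ n ih =>
    refine ⟨ih hA, fun j => ?_⟩
    simp only [map_zero]
    exact ih fun i => mul_nonneg (hA i) (zero_le_one.trans (c.hL i))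

theorem Sy.symN {m : ℕ} (hf : Sy c m A f) (n : ℕ) : SymN c n A f := by
  cases m with
  | zero => exact hf n
  | succ m => exact hf.1 n
theorem Sy.bd {m : ℕ} (hf : Sy c m A f) : Bd c A f := hf.symN 0
theorem Sy.dt {m : ℕ} (hf : Sy c (m+1) A f) : Sy c m (A * c.L) (fun i => c.Dt i (f i)) := hf.2
theorem Sy.zero_of {m : ℕ} (hf : Sy c m A f) : Sy c 0 A f := hf.symN
theorem Sy.pred {m : ℕ} (hf : Sy c (m+1) A f) : Sy c m A f := by
  induction m generalizing A f with
  | zero => exact hf.1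
  | succ m ih => exact ⟨hf.1, ih hf.2⟩
theorem Sy.mono {m : ℕ} (C : ℝ) (hC : 0 ≤ C) (h : ∀ i, A i ≤ C * B i) (hf : Sy c m A f) :
    Sy c m B f := by
  induction m generalizing A B f with
  | zero => exact fun n => (hf n).mono C hC h
  | succ m ih =>
    refine ⟨fun n => (hf.1 n).mono C hC h, ih (fun i => ?_) hf.2⟩
    have := mul_le_mul_of_nonneg_right (h i) (zero_le_one.trans (c.hL i))
    simpa [mul_assoc] using this
theorem Sy.mono1 {m : ℕ} (hf : Sy c m A f) (h : ∀ i, A i ≤ B i) : Sy c m B f :=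
  hf.mono 1 zero_le_one (by simpa using h)
theorem Sy.add {m : ℕ} (hf : Sy c m A f) (hg : Sy c m A g) : Sy c m A (fun i => f i + g i) := by
  induction m generalizing A f g with
  | zero => exact fun n => (hf n).add (hg n)
  | succ m ih =>
    refine ⟨fun n => (hf.1 n).add (hg.1 n), ?_⟩
    simp only [map_add]; exact ih hf.2 hg.2
theorem Sy.smul {m : ℕ} (a : ℂ) (hf : Sy c m A f) : Sy c m A (fun i => a • f i) := by
  induction m generalizing A f with
  | zero => exact fun n => (hf n).smul a
  | succ m ih =>
    refine ⟨fun n => (hf.1 n).smul a, ?_⟩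
    simp only [Derivation.map_smul]; exact ih hf.2
theorem Sy.neg {m : ℕ} (hf : Sy c m A f) : Sy c m A (fun i => - f i) := by
  have := hf.smul (-1); simpa using this
theorem Sy.sub {m : ℕ} (hf : Sy c m A f) (hg : Sy c m A g) : Sy c m A (fun i => f i - g i) := by
  simp only [sub_eq_add_neg]; exact hf.add hg.neg
theorem Sy.mul {m : ℕ} (hf : Sy c m A f) (hg : Sy c m B g) :
    Sy c m (A * B) (fun i => f i * g i) := by
  induction m generalizing A B f g with
  | zero => exact fun n => (hf n).mul (hg n)
  | succ m ih =>
    refine ⟨fun n => (hf.1 n).mul (hg.1 n), ?_⟩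
    simp only [Der_mul]
    refine Sy.add ?_ ?_
    · rw [mul_right_comm]; exact ih hf.2 hg.pred
    · rw [mul_assoc]; exact ih hf.pred hg.2
theorem Sy.zero {m : ℕ} (hA : ∀ i, 0 ≤ A i) : Sy c m A (fun _ => 0) := by
  induction m generalizing A with
  | zero => exact fun n => SymN.zero hA
  | succ m ih =>
    refine ⟨fun n => SymN.zero hA, ?_⟩
    simp only [map_zero]
    exact ih fun i => mul_nonneg (hA i) (zero_le_one.trans (c.hL i))
theorem Sy.one {m : ℕ} : Sy c m 1 (fun _ => 1) := by
  have h0 : ∀ n, SymN c n 1 (fun _ => (1 : SFo V)) := by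
    intro n
    induction n with
    | zero => exact Bd.one
    | succ n ih =>
      refine ⟨ih, fun j => ?_⟩
      simp only [Derivation.map_one_eq_zero]
      exact SymN.zero fun i => by simpa using (zero_le_one.trans (c.hL i))
  cases m with
  | zero => exact h0
  | succ m =>
    refine ⟨h0, ?_⟩
    simp only [Derivation.map_one_eq_zero]
    exact Sy.zero fun i => by simpa using (zero_le_one.trans (c.hL i))
/-- multiplication by bounded constants depending on the index -/
theorem SymN.csmul {n : ℕ} (a : ι → ℂ) (ha : ∀ i, ‖a i‖ ≤ B i) (hf : SymN c n A f) :
    SymN c n (B * A) (fun i => a i • f i) := by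
  induction n generalizing A f with
  | zero =>
    obtain ⟨K, hK, H⟩ := hf
    refine ⟨K, hK, fun i z hz => ?_⟩
    rw [SFo.smul_app, norm_mul]
    calc _ ≤ B i * (K * A i) := mul_le_mul (ha i) (H i z hz) (norm_nonneg _)
          ((norm_nonneg _).trans (ha i))
      _ = _ := by simp only [Pi.mul_apply]; ring
  | succ n ih =>
    refine ⟨ih hf.1, fun j => ?_⟩
    simp only [Derivation.map_smul]
    rw [mul_assoc]; exact ih (hf.2 j)
theorem Sy.csmul {m : ℕ} (a : ι → ℂ) (ha : ∀ i, ‖a i‖ ≤ B i) (hf : Sy c m A f) :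
    Sy c m (B * A) (fun i => a i • f i) := by
  induction m generalizing A f with
  | zero => exact fun n => (hf n).csmul a ha
  | succ m ih =>
    refine ⟨fun n => (hf.1 n).csmul a ha, ?_⟩
    simp only [Derivation.map_smul]
    rw [mul_assoc]; exact ih hf.2
theorem Sy.sum {m : ℕ} {κ : Type*} (s : Finset κ) {f : κ → ι → SFo V} (hA : ∀ i, 0 ≤ A i)
    (hf : ∀ k ∈ s, Sy c m A (f k)) : Sy c m A (fun i => ∑ k ∈ s, f k i) := by
  classical
  induction s using Finset.induction_on with
  | empty => simpa using Sy.zero hA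
  | insert a s ha ih =>
    simp only [Finset.sum_insert ha]
    exact (hf a (by simp)).add (ih fun k hk => hf k (by simp [hk]))
theorem Sy.dx0 (hf : Sy c 0 A f) (j : Fin 3) : Sy c 0 (A * c.L) (fun i => c.D j (f i)) :=
  fun n => (hf (n+1)).2 j

/-- commutation of `D` and `Dt` -/
def CommOK (c : Ctx V ι) (G : Fin 3 → Fin 3 → ι → SFo V) : Prop :=
  ∀ i k f, c.Dt i (c.D k f) = c.D k (c.Dt i f) - ∑ l, G k l i * c.D l f

theorem Sy.dx {G : Fin 3 → Fin 3 → ι → SFo V} (hc : CommOK c G) {m : ℕ}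
    (hG : ∀ k l, Sy c (m-1) c.L (G k l)) (hA : ∀ i, 0 ≤ A i)
    (hf : Sy c m A f) (j : Fin 3) : Sy c m (A * c.L) (fun i => c.D j (f i)) := by
  induction m generalizing A f j with
  | zero => exact hf.dx0 j
  | succ m ih =>
    have hAL : ∀ i, 0 ≤ (A * c.L) i := fun i => mul_nonneg (hA i) (zero_le_one.trans (c.hL i))
    have hG' : ∀ k l, Sy c (m-1) c.L (G k l) := by
      intro k l
      cases m with
      | zero => exact hG k l
      | succ m => exact (hG k l).pred
    refine ⟨hf.zero_of.dx0 j, ?_⟩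
    simp only [hc _ _ _]
    refine Sy.sub (ih hG' hAL hf.2 j) (Sy.sum _ (fun i => ?_) fun l _ => ?_)
    · exact mul_nonneg (hAL i) (zero_le_one.trans (c.hL i))
    · rw [mul_comm (A * c.L)]
      exact (hG j l).mul (ih hG' hA hf.pred l)

/-- inverse square roots -/
theorem Der_rsqrt (D : Derivation ℂ (SFo V) (SFo V)) (s u : SFo V) (h : s * s * u = 1) :
    D s = (-(1/2) : ℂ) • (s * s * s * D u) := by
  have h1 := congrArg D h
  rw [Derivation.map_one_eq_zero, Der_mul, Der_mul] at h1
  have h2 : (2 : ℂ) • D s = - (s * s * s * D u) := by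
    calc (2:ℂ) • D s = 2 * (s * s * u) * D s := by rw [h, mul_one, two_smul]; ring
      _ = _ := by linear_combination s * h1
  rw [neg_smul, ← smul_neg, ← h2, smul_smul]; norm_num

theorem Sy.rsqrt {s u : ι → SFo V} (h : ∀ i, s i * s i * u i = 1) (hs : Bd c 1 s) {m : ℕ}
    (hu : Sy c m 1 u) : Sy c m 1 s := by
  have h0 : ∀ n, SymN c n 1 s := by
    intro n
    induction n with
    | zero => exact hs
    | succ n ih =>
      refine ⟨ih, fun j => ?_⟩
      simp only [Der_rsqrt _ _ _ (h _)]
      have := ((ih.mul ih).mul ih).mul ((hu.symN (n+1)).2 j)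
      simp only [one_mul] at this ⊢
      exact this.smul _
  induction m with
  | zero => exact h0
  | succ m ih =>
    refine ⟨h0, ?_⟩
    simp only [Der_rsqrt _ _ _ (h _)]
    have ih' := ih hu.pred
    have := ((ih'.mul ih').mul ih').mul hu.2
    simp only [one_mul] at this ⊢
    exact this.smul _

/-- transfer between contexts along a map commuting with the derivations -/
theorem Sy.pull {W : Type} [NormedAddCommGroup W] [NormedSpace ℝ W] {ι' : Type}
    {c' : Ctx W ι'} (π : ι' → ι) (T : ι' → SFo V → SFo W)
    (hL : ∀ i, c'.L i = c.L (π i))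
    (hD : ∀ i j f, c'.D j (T i f) = T i (c.D j f))
    (hDt : ∀ i f, c'.Dt i (T i f) = T i (c.Dt (π i) f))
    (hT : ∀ i, ∀ z ∈ c'.Dom i, ∃ y ∈ c.Dom (π i), ∀ f, (T i f).1 z = f.1 y)
    {m : ℕ} (hf : Sy c m A f) : Sy c' m (A ∘ π) (fun i => T i (f (π i))) := by
  have h0 : ∀ n, ∀ (A : ι → ℝ) (f : ι → SFo V), SymN c n A f →
      SymN c' n (A ∘ π) (fun i => T i (f (π i))) := by
    intro n
    induction n with
    | zero =>
      rintro A f ⟨K, hK, H⟩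
      refine ⟨K, hK, fun i z hz => ?_⟩
      obtain ⟨y, hy, e⟩ := hT i z hz
      rw [e]; exact H _ _ hy
    | succ n ih =>
      intro A f hf
      refine ⟨ih A f hf.1, fun j => ?_⟩
      simp only [hD]
      have := ih _ _ (hf.2 j)
      have e : (A * c.L) ∘ π = (A ∘ π) * c'.L := by funext i; simp [hL]
      rwa [e] at this
  induction m generalizing A f with
  | zero => exact fun n => h0 n A f (hf n)
  | succ m ih =>
    refine ⟨fun n => h0 n A f (hf.1 n), ?_⟩
    simp only [hDt]
    have := ih hf.2
    have e : (A * c.L) ∘ π = (A ∘ π) * c'.L := by funext i; simp [hL]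
    rwa [e] at this

end sym
end CI
end

noncomputable section
open MeasureTheory Set Filter Topology
open scoped ContDiff
set_option linter.unusedSectionVars false

namespace CI
section av
variable {V : Type} [NormedAddCommGroup V] [NormedSpace ℝ V] [FiniteDimensional ℝ V]

/-- smooth weights -/
abbrev Wt := {w : ℝ → ℝ // ContDiff ℝ ∞ w}

theorem Av_smooth (w : Wt) (e : V) (f : SFo V) :
    ContDiff ℝ ∞ (fun q : V × ℝ => (w.1 q.2 : ℂ) * f.1 (q.1 + q.2 • e)) := by
  refine ContDiff.mul ?_ ?_
  · exact Complex.ofRealCLM.contDiff.comp (w.2.comp contDiff_snd)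
  · exact (SFo.cd f).comp (contDiff_fst.add (contDiff_snd.smul contDiff_const))

theorem Av_ii (w : Wt) (e : V) (f : SFo V) (z : V) :
    IntervalIntegrable (fun s : ℝ => (w.1 s : ℂ) * f.1 (z + s • e)) volume 0 1 := by
  refine Continuous.intervalIntegrable ?_ _ _
  exact (Av_smooth w e f).continuous.comp (by fun_prop : Continuous fun s : ℝ => (z, s))

/-- weighted average in direction `e` -/
def Av (w : Wt) (e : V) : SFo V →ₗ[ℂ] SFo V where
  toFun f := ⟨fun z => ∫ s in (0:ℝ)..1, (w.1 s : ℂ) * f.1 (z + s • e),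
    contDiff_param _ (Av_smooth w e f)⟩
  map_add' f g := by
    ext z
    simp only [SFo.add_app, mul_add]
    exact intervalIntegral.integral_add (Av_ii w e f z) (Av_ii w e g z)
  map_smul' a f := by
    ext z
    simp only [SFo.smul_app, RingHom.id_apply]
    rw [← intervalIntegral.integral_const_mul]
    congr 1; funext s; ring

theorem Av_app (w : Wt) (e : V) (f : SFo V) (z : V) :
    (Av w e f).1 z = ∫ s in (0:ℝ)..1, (w.1 s : ℂ) * f.1 (z + s • e) := rfl

theorem Av_dd (w : Wt) (e d : V) (f : SFo V) : dd d (Av w e f) = Av w e (dd d f) := by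
  ext z
  rw [dd_app]
  have := fderiv_param _ (Av_smooth w e f) z d
  simp only at this
  refine this.trans ?_
  rw [Av_app]
  refine intervalIntegral.integral_congr fun s _ => ?_
  simp only [dd_app]
  have hd : DifferentiableAt ℝ (fun y => f.1 (y + s • e)) z :=
    DifferentiableAt.comp z (SFo.diff f _) (by fun_prop)
  rw [fderiv_const_mul hd]
  simp only [FunLike.coe_smul, Pi.smul_apply, smul_eq_mul]
  rw [fderiv_comp_add_right]

theorem Av_bd (w : Wt) : ∃ C : ℝ, 0 ≤ C ∧ ∀ (e : V) (f : SFo V) (z : V) (S : ℝ),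
    (∀ s ∈ Icc (0:ℝ) 1, ‖f.1 (z + s • e)‖ ≤ S) → ‖(Av w e f).1 z‖ ≤ C * S := by
  obtain ⟨C, hC⟩ := (isCompact_Icc (a := (0:ℝ)) (b := 1)).exists_bound_of_continuousOn
    (w.2.continuous.continuousOn)
  have hC0 : 0 ≤ C := (norm_nonneg _).trans (hC 0 (by simp))
  refine ⟨C, hC0, fun e f z S hS => ?_⟩
  have := intervalIntegral.norm_integral_le_of_norm_le_const (a := (0:ℝ)) (b := 1) (C := C * S)
    (f := fun s : ℝ => (w.1 s : ℂ) * f.1 (z + s • e)) (by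
      intro s hs
      rw [uIoc_of_le zero_le_one] at hs
      have hs' : s ∈ Icc (0:ℝ) 1 := ⟨hs.1.le, hs.2⟩
      rw [norm_mul, Complex.norm_real]
      exact mul_le_mul (hC s hs') (hS s hs') (norm_nonneg _) hC0)
  simpa [Av_app] using this

def Wt.d (w : Wt) : Wt := ⟨deriv w.1, by
  have := (contDiff_infty_iff_deriv.1 w.2).2
  exact this⟩

theorem Av_ibp (w : Wt) (e : V) (f : SFo V) (z : V) : (dd e (Av w e f)).1 z =
    (w.1 1 : ℂ) * f.1 (z + e) - (w.1 0 : ℂ) * f.1 z - (Av (Wt.d w) e f).1 z := by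
  rw [Av_dd, Av_app, Av_app]
  have h1 : ∀ s : ℝ, HasDerivAt (fun s : ℝ => (w.1 s : ℂ)) ((Wt.d w).1 s : ℂ) s := fun s =>
    ((w.2.differentiable (by simp) s).hasDerivAt).ofReal_comp
  have h2 : ∀ s : ℝ, HasDerivAt (fun s : ℝ => f.1 (z + s • e)) ((dd e f).1 (z + s • e)) s := by
    intro s
    have hf := (SFo.diff f (z + s • e)).hasFDerivAt
    have hl : HasDerivAt (fun s : ℝ => z + s • e) e s := by
      have := ((hasDerivAt_id s).smul_const e).const_add z
      simpa using this
    exact hf.comp_hasDerivAt s hl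
  have c1 : Continuous (fun s : ℝ => ((Wt.d w).1 s : ℂ)) :=
    Complex.continuous_ofReal.comp (Wt.d w).2.continuous
  have c2 : Continuous (fun s : ℝ => (dd e f).1 (z + s • e)) :=
    (SFo.cont _).comp (by fun_prop)
  have := intervalIntegral.integral_mul_deriv_eq_deriv_mul (a := 0) (b := 1)
    (fun s _ => h1 s) (fun s _ => h2 s) (c1.intervalIntegrable _ _) (c2.intervalIntegrable _ _)
  rw [this]; simp

end av

section closure
variable {V : Type} [NormedAddCommGroup V] [NormedSpace ℝ V]
/-- reality -/
def Rl (f : SFo V) : Prop := ∀ z, (f.1 z).im = 0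
/-- support -/
def Sp (S : Set V) (f : SFo V) : Prop := ∀ z ∉ S, f.1 z = 0
/-- invariance under translation by `k` -/
def Pk (k : V) (f : SFo V) : Prop := ∀ z, f.1 (z + k) = f.1 z

theorem dd_congr_nhds {f g : SFo V} {z : V} (h : f.1 =ᶠ[𝓝 z] g.1) (e : V) :
    (dd e f).1 z = (dd e g).1 z := by
  rw [dd_app, dd_app, h.fderiv_eq]

variable {f g : SFo V}
theorem Rl.zero : Rl (0 : SFo V) := fun z => by simp
theorem Rl.one : Rl (1 : SFo V) := fun z => by simp
theorem Rl.add (hf : Rl f) (hg : Rl g) : Rl (f + g) := fun z => by simp [hf z, hg z]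
theorem Rl.sub (hf : Rl f) (hg : Rl g) : Rl (f - g) := fun z => by simp [hf z, hg z]
theorem Rl.neg (hf : Rl f) : Rl (-f) := fun z => by simp [hf z]
theorem Rl.mul (hf : Rl f) (hg : Rl g) : Rl (f * g) := fun z => by simp [hf z, hg z]
theorem Rl.smul (c : ℝ) (hf : Rl f) : Rl ((c : ℂ) • f) := fun z => by simp [hf z]
theorem Rl.sum {κ : Type*} {s : Finset κ} {f : κ → SFo V} (h : ∀ k ∈ s, Rl (f k)) :
    Rl (∑ k ∈ s, f k) := fun z => by
  rw [SFo.sum_app, Complex.im_sum]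
  exact Finset.sum_eq_zero fun k hk => h k hk z
theorem Rl.dd (hf : Rl f) (e : V) : Rl (dd e f) := fun z => by
  rw [dd_app]
  have h : (fun z => Complex.imCLM (f.1 z)) = fun _ => 0 := by funext z; exact hf z
  have h2 : HasFDerivAt (fun z => Complex.imCLM (f.1 z)) (Complex.imCLM.comp (fderiv ℝ f.1 z)) z :=
    Complex.imCLM.hasFDerivAt.comp z (SFo.diff f z).hasFDerivAt
  rw [h] at h2
  have := h2.unique (hasFDerivAt_const 0 z)
  simpa using congrArg (fun l => l e) this
theorem Rl.re_eq (hf : Rl f) (z : V) : (((f.1 z).re : ℝ) : ℂ) = f.1 z :=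
  Complex.ext (by simp) (by simp [hf z])

variable {S : Set V}
theorem Sp.zero : Sp S (0 : SFo V) := fun z _ => by simp
theorem Sp.add (hf : Sp S f) (hg : Sp S g) : Sp S (f + g) := fun z h => by simp [hf z h, hg z h]
theorem Sp.sub (hf : Sp S f) (hg : Sp S g) : Sp S (f - g) := fun z h => by simp [hf z h, hg z h]
theorem Sp.neg (hf : Sp S f) : Sp S (-f) := fun z h => by simp [hf z h]
theorem Sp.mul_right (hf : Sp S f) (g : SFo V) : Sp S (f * g) := fun z h => by simp [hf z h]
theorem Sp.mul_left (hf : Sp S f) (g : SFo V) : Sp S (g * f) := fun z h => by simp [hf z h]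
theorem Sp.smul (c : ℂ) (hf : Sp S f) : Sp S (c • f) := fun z h => by simp [hf z h]
theorem Sp.sum {κ : Type*} {s : Finset κ} {f : κ → SFo V} (h : ∀ k ∈ s, Sp S (f k)) :
    Sp S (∑ k ∈ s, f k) := fun z hz => by
  rw [SFo.sum_app]
  exact Finset.sum_eq_zero fun k hk => h k hk z hz
theorem Sp.mono {T : Set V} (hf : Sp S f) (h : S ⊆ T) : Sp T f := fun z hz => hf z fun h' => hz (h h')
theorem Sp.dd (hS : IsClosed S) (hf : Sp S f) (e : V) : Sp S (dd e f) := fun z hz => by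
  have : f.1 =ᶠ[𝓝 z] (0 : SFo V).1 := by
    filter_upwards [hS.isOpen_compl.mem_nhds hz] with y hy
    exact hf y hy
  rw [dd_congr_nhds this]; simp

variable {k : V}
theorem Pk.const (c : ℂ) : Pk k (algebraMap ℂ (SFo V) c) := fun z => by simp
theorem Pk.zero : Pk k (0 : SFo V) := fun z => by simp
theorem Pk.one : Pk k (1 : SFo V) := fun z => by simp
theorem Pk.add (hf : Pk k f) (hg : Pk k g) : Pk k (f + g) := fun z => by simp [hf z, hg z]
theorem Pk.sub (hf : Pk k f) (hg : Pk k g) : Pk k (f - g) := fun z => by simp [hf z, hg z]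
theorem Pk.neg (hf : Pk k f) : Pk k (-f) := fun z => by simp [hf z]
theorem Pk.mul (hf : Pk k f) (hg : Pk k g) : Pk k (f * g) := fun z => by simp [hf z, hg z]
theorem Pk.smul (c : ℂ) (hf : Pk k f) : Pk k (c • f) := fun z => by simp [hf z]
theorem Pk.sum {κ : Type*} {s : Finset κ} {f : κ → SFo V} (h : ∀ a ∈ s, Pk k (f a)) :
    Pk k (∑ a ∈ s, f a) := fun z => by
  rw [SFo.sum_app, SFo.sum_app]
  exact Finset.sum_congr rfl fun a ha => h a ha z
theorem Pk.dd (hf : Pk k f) (e : V) : Pk k (dd e f) := fun z => by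
  rw [dd_app, dd_app]
  have : (fun z => f.1 (z + k)) = f.1 := by funext z; exact hf z
  conv_rhs => rw [← this]
  rw [fderiv_comp_add_right]

variable [FiniteDimensional ℝ V]
theorem Rl.Av (hf : Rl f) (w : Wt) (e : V) : Rl (Av w e f) := fun z => by
  have : (CI.Av w e f).1 z = ((∫ s in (0:ℝ)..1, w.1 s * (f.1 (z + s • e)).re : ℝ) : ℂ) := by
    rw [Av_app, ← intervalIntegral.integral_ofReal]
    refine intervalIntegral.integral_congr fun s _ => ?_
    simp only [Complex.ofReal_mul, hf.re_eq]
  rw [this]; simp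
theorem Pk.Av (hf : Pk k f) (w : Wt) (e : V) : Pk k (Av w e f) := fun z => by
  rw [Av_app, Av_app]
  refine intervalIntegral.integral_congr fun s _ => ?_
  have : z + k + s • e = (z + s • e) + k := by abel
  simp only [this, hf _]
theorem Sp.Av (hf : Sp S f) (w : Wt) (e : V) (h : ∀ z ∉ S, ∀ s : ℝ, z + s • e ∉ S) :
    Sp S (Av w e f) := fun z hz => by
  rw [Av_app]
  have : ∀ s : ℝ, (w.1 s : ℂ) * f.1 (z + s • e) = 0 := fun s => by rw [hf _ (h z hz s), mul_zero]
  simp [this]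
end closure

section antidiv
def one_w : Wt := ⟨fun _ => 1, contDiff_const⟩
def lin_w : Wt := ⟨fun s => s - 1/2, by fun_prop⟩
def eS (j : Fin 3) : ℝ × Spc := (0, ex j)
theorem dx_eq (j) : dx j = dd (eS j) := rfl
def Aop (j : Fin 3) : SF →ₗ[ℂ] SF := Av one_w (eS j)
def Pop (j : Fin 3) : SF →ₗ[ℂ] SF := Av lin_w (eS j)

theorem dx_A (j : Fin 3) {f : SF} (hf : Pk (eS j) f) : dx j (Aop j f) = 0 := by
  ext z
  rw [dx_eq, Aop, Av_ibp, hf z]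
  have : (Av (Wt.d one_w) (eS j) f).1 z = 0 := by
    rw [Av_app]; simp [Wt.d, one_w]
  rw [this]; simp [one_w]
theorem dx_P (j : Fin 3) {f : SF} (hf : Pk (eS j) f) : dx j (Pop j f) = f - Aop j f := by
  ext z
  rw [dx_eq, Pop, Av_ibp, hf z]
  have : (Av (Wt.d lin_w) (eS j) f).1 z = (Aop j f).1 z := by
    rw [Aop, Av_app, Av_app]; simp [Wt.d, one_w, lin_w]
  rw [this]; simp [lin_w]; ring
theorem dx_dx_PP (j : Fin 3) {f : SF} (hf : Pk (eS j) f) :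
    dx j (dx j (Pop j (Pop j f))) = f - Aop j f := by
  have h1 : Pk (eS j) (Pop j f) := hf.Av _ _
  have h2 : dx j (Pop j (Pop j f)) = Pop j (dx j (Pop j f)) := Av_dd _ _ _ _
  have h3 : Pk (eS j) (dx j (Pop j f)) := h1.dd _
  rw [h2, dx_P j h3]
  have h4 : Aop j (dx j (Pop j f)) = dx j (Aop j (Pop j f)) := (Av_dd _ _ _ _).symm
  rw [h4, dx_A j h1, sub_zero, dx_P j hf]

/-- elementary symmetric antidivergence of `∂ᵢ² g e_l` -/
def Sel (i l : Fin 3) (g : SF) (a b : Fin 3) : SF :=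
  (if a = i ∧ b = l then dx i g else 0) + (if a = l ∧ b = i then dx i g else 0)
    - (if a = i ∧ b = i then dx l g else 0)
theorem Sel_symm (i l g a b) : Sel i l g a b = Sel i l g b a := by
  unfold Sel
  simp only [and_comm (a := b = _)]; abel
theorem Sel_div (i l : Fin 3) (g : SF) (b : Fin 3) :
    ∑ a, dx a (Sel i l g a b) = if b = l then dx i (dx i g) else 0 := by
  have hc := dx_comm i l g
  unfold Sel
  simp only [map_add, map_sub, apply_ite (dx _), map_zero, Finset.sum_add_distrib,
    Finset.sum_sub_distrib, ite_and, Finset.sum_ite_eq', Finset.mem_univ, if_true]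
  by_cases h : b = i
  · subst h; simp [hc]
  · simp [h]

/-- antidivergence -/
def adiv (f : Fin 3 → SF) (a b : Fin 3) : SF :=
  ∑ l, (Sel 0 l (Pop 0 (Pop 0 (f l))) a b + Sel 1 l (Pop 1 (Pop 1 (Aop 0 (f l)))) a b
    + Sel 2 l (Pop 2 (Pop 2 (Aop 1 (Aop 0 (f l))))) a b)
theorem adiv_symm (f a b) : adiv f a b = adiv f b a := by
  unfold adiv
  simp only [Sel_symm _ _ _ a b]
theorem adiv_div (f : Fin 3 → SF) (hf : ∀ j l, Pk (eS j) (f l))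
    (h0 : ∀ l, Aop 2 (Aop 1 (Aop 0 (f l))) = 0) (b : Fin 3) :
    ∑ a, dx a (adiv f a b) = f b := by
  have h1 : ∀ l, dx 0 (dx 0 (Pop 0 (Pop 0 (f l)))) = f l - Aop 0 (f l) := fun l =>
    dx_dx_PP 0 (hf 0 l)
  have h2 : ∀ l, dx 1 (dx 1 (Pop 1 (Pop 1 (Aop 0 (f l))))) = Aop 0 (f l) - Aop 1 (Aop 0 (f l)) :=
    fun l => dx_dx_PP 1 ((hf 1 l).Av _ _)
  have h3 : ∀ l, dx 2 (dx 2 (Pop 2 (Pop 2 (Aop 1 (Aop 0 (f l)))))) = Aop 1 (Aop 0 (f l)) := by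
    intro l
    have := dx_dx_PP 2 (((hf 2 l).Av one_w (eS 0)).Av one_w (eS 1))
    refine this.trans ?_
    change Aop 1 (Aop 0 (f l)) - Aop 2 (Aop 1 (Aop 0 (f l))) = _
    rw [h0, sub_zero]
  unfold adiv
  simp only [map_sum, map_add]
  rw [Finset.sum_comm]
  simp only [Finset.sum_add_distrib, Sel_div, h1, h2, h3, Finset.sum_ite_eq, Finset.mem_univ,
    if_true]
  abel
theorem mean_dx (j : Fin 3) {f : SF} (hf : ∀ j, Pk (eS j) f) :
    Aop 2 (Aop 1 (Aop 0 (dx j f))) = 0 := by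
  have c : ∀ i (g : SF), Aop i (dx j g) = dx j (Aop i g) := fun i g => (Av_dd _ _ _ _).symm
  rw [c, c, c]
  fin_cases j
  · rw [← c, ← c]
    simp only [Fin.zero_eta]
    rw [dx_A 0 (hf 0)]; simp
  · rw [← c]
    change Aop 2 (dx 1 (Aop 1 (Aop 0 f))) = 0
    rw [dx_A 1 (f := Aop 0 f) ((hf 1).Av _ _)]; simp
  · exact dx_A 2 (((hf 2).Av _ _).Av _ _)

theorem dd_A (j : Fin 3) (e) (f : SF) : dd e (Aop j f) = Aop j (dd e f) := Av_dd _ _ _ _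
theorem dd_P (j : Fin 3) (e) (f : SF) : dd e (Pop j f) = Pop j (dd e f) := Av_dd _ _ _ _
theorem dd_Sel (e) (i l : Fin 3) (g : SF) (a b) : dd e (Sel i l g a b) = Sel i l (dd e g) a b := by
  unfold Sel
  simp only [map_add, map_sub, apply_ite (dd e), map_zero, dx_eq, dd_comm e]
theorem dd_adiv (e) (f : Fin 3 → SF) (a b) : dd e (adiv f a b) = adiv (fun l => dd e (f l)) a b := by
  unfold adiv
  simp only [map_sum, map_add, dd_Sel, dd_P, dd_A]

theorem bdA : ∃ C : ℝ, 0 ≤ C ∧ ∀ (f : SF) (S : ℝ), (∀ z, ‖f.1 z‖ ≤ S) →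
    ∀ j z, ‖(Aop j f).1 z‖ ≤ C * S := by
  obtain ⟨C, h0, h⟩ := Av_bd (V := ℝ × Spc) one_w
  exact ⟨C, h0, fun f S hS j z => h _ _ _ _ fun s _ => hS _⟩
theorem bdP : ∃ C : ℝ, 0 ≤ C ∧ ∀ (f : SF) (S : ℝ), (∀ z, ‖f.1 z‖ ≤ S) →
    ∀ j z, ‖(Pop j f).1 z‖ ≤ C * S := by
  obtain ⟨C, h0, h⟩ := Av_bd (V := ℝ × Spc) lin_w
  exact ⟨C, h0, fun f S hS j z => h _ _ _ _ fun s _ => hS _⟩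
theorem Sel_bd (i l : Fin 3) (g : SF) (S : ℝ) (h : ∀ m z, ‖(dx m g).1 z‖ ≤ S) (a b z) :
    ‖(Sel i l g a b).1 z‖ ≤ 3 * S := by
  have hS : 0 ≤ S := (norm_nonneg _).trans (h 0 z)
  have e : ∀ (p : Prop) [Decidable p] (m : Fin 3), ‖(if p then dx m g else 0).1 z‖ ≤ S := by
    intro p _ m
    split_ifs
    · exact h m z
    · simpa using hS
  unfold Sel
  rw [SFo.sub_app, SFo.add_app]
  refine (norm_sub_le _ _).trans ?_
  have := norm_add_le ((if a = i ∧ b = l then dx i g else 0).1 z)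
    ((if a = l ∧ b = i then dx i g else 0).1 z)
  linarith [e (a = i ∧ b = l) i, e (a = l ∧ b = i) i, e (a = i ∧ b = i) l]
theorem adiv_bd : ∃ C : ℝ, 0 ≤ C ∧ ∀ (f : Fin 3 → SF) (S : ℝ),
    (∀ l m z, ‖(dx m (f l)).1 z‖ ≤ S) → ∀ a b z, ‖(adiv f a b).1 z‖ ≤ C * S := by
  obtain ⟨C, hC, hA⟩ := bdA
  obtain ⟨D, hD, hP⟩ := bdP
  refine ⟨3 * (3 * (D * D) + 3 * (D * (D * C)) + 3 * (D * (D * (C * C)))), by positivity, ?_⟩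
  intro f S hS a b z
  have hc : ∀ j m (g : SF), dx m (Pop j g) = Pop j (dx m g) := fun j m g => dd_P _ _ _
  have hc' : ∀ j m (g : SF), dx m (Aop j g) = Aop j (dx m g) := fun j m g => dd_A _ _ _
  unfold adiv
  rw [SFo.sum_app]
  have : ∀ l ∈ (Finset.univ : Finset (Fin 3)), ‖(Sel 0 l (Pop 0 (Pop 0 (f l))) a b + Sel 1 l (Pop 1 (Pop 1 (Aop 0 (f l)))) a b
    + Sel 2 l (Pop 2 (Pop 2 (Aop 1 (Aop 0 (f l))))) a b).1 z‖ ≤ (3 * (D * D) + 3 * (D * (D * C)) + 3 * (D * (D * (C * C)))) * S := by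
    intro l _
    rw [SFo.add_app, SFo.add_app]
    have h1 := Sel_bd 0 l (Pop 0 (Pop 0 (f l))) (D * (D * S)) (by
      intro m z; rw [hc, hc]; exact hP _ _ (hP _ _ (hS l m) _) _ _) a b z
    have h2 := Sel_bd 1 l (Pop 1 (Pop 1 (Aop 0 (f l)))) (D * (D * (C * S))) (by
      intro m z; rw [hc, hc, hc']; exact hP _ _ (hP _ _ (hA _ _ (hS l m) _) _) _ _) a b z
    have h3 := Sel_bd 2 l (Pop 2 (Pop 2 (Aop 1 (Aop 0 (f l))))) (D * (D * (C * (C * S)))) (by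
      intro m z; rw [hc, hc, hc', hc']
      exact hP _ _ (hP _ _ (hA _ _ (hA _ _ (hS l m) _) _) _) _ _) a b z
    refine (norm_add_le _ _).trans ((add_le_add ((norm_add_le _ _).trans (add_le_add h1 h2)) h3).trans ?_)
    apply le_of_eq; ring
  refine (norm_sum_le_of_le _ this).trans ?_
  simp only [Finset.sum_const, Finset.card_univ, Fintype.card_fin, nsmul_eq_mul]
  apply le_of_eq; push_cast; ring

theorem Sel_pk {k} {i l : Fin 3} {g : SF} (h : Pk k g) (a b) : Pk k (Sel i l g a b) := by
  unfold Sel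
  refine Pk.sub (Pk.add ?_ ?_) ?_ <;> split_ifs <;> first | exact Pk.zero | exact h.dd _
theorem adiv_pk {k} {f : Fin 3 → SF} (h : ∀ l, Pk k (f l)) (a b) : Pk k (adiv f a b) :=
  Pk.sum fun l _ => ((Sel_pk (((h l).Av _ _).Av _ _) a b).add
    (Sel_pk ((((h l).Av _ _).Av _ _).Av _ _) a b)).add
    (Sel_pk (((((h l).Av _ _).Av _ _).Av _ _).Av _ _) a b)
/-- time slab -/
def TS (a b : ℝ) : Set (ℝ × Spc) := {z | z.1 ∈ Icc a b}
theorem TS_closed (a b) : IsClosed (TS a b) := isClosed_Icc.preimage continuous_fst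
theorem Sp.AvT {a b : ℝ} {f : SF} (h : Sp (TS a b) f) (w : Wt) (e : Spc) :
    Sp (TS a b) (CI.Av w (0, e) f) := h.Av _ _ fun z hz s => by simpa [TS] using hz
theorem Sel_sp {p q : ℝ} {i l : Fin 3} {g : SF} (h : Sp (TS p q) g) (a b) :
    Sp (TS p q) (Sel i l g a b) := by
  unfold Sel
  refine Sp.sub (Sp.add ?_ ?_) ?_ <;> split_ifs <;>
    first | exact Sp.zero | exact h.dd (TS_closed p q) _
theorem adiv_sp {p q : ℝ} {f : Fin 3 → SF} (h : ∀ l, Sp (TS p q) (f l)) (a b) :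
    Sp (TS p q) (adiv f a b) :=
  Sp.sum fun l _ => ((Sel_sp (((h l).AvT _ _).AvT _ _) a b).add
    (Sel_sp ((((h l).AvT _ _).AvT _ _).AvT _ _) a b)).add
    (Sel_sp (((((h l).AvT _ _).AvT _ _).AvT _ _).AvT _ _) a b)
end antidiv
end CI
end

noncomputable section
open MeasureTheory Set Filter Topology
open scoped ContDiff
set_option linter.unusedSectionVars false

namespace CI
section moll

def bump0 : ContDiffBump (1/2 : ℝ) := ⟨1/8, 1/4, by norm_num, by norm_num⟩
def phi0 : ℝ → ℝ := bump0.normed volume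
theorem phi0_smooth : ContDiff ℝ ∞ phi0 := bump0.contDiff_normed
theorem phi0_zero {s : ℝ} (h : s ∉ Ioo (1/4 : ℝ) (3/4)) : phi0 s = 0 := by
  have h1 : Function.support phi0 = Metric.ball (1/2 : ℝ) (1/4) := bump0.support_normed_eq (μ := volume)
  have h2 : s ∉ Function.support phi0 := by
    rw [h1, Real.ball_eq_Ioo]; convert h using 3 <;> norm_num
  simpa using h2
theorem phi0_int : ∫ s in (0:ℝ)..1, phi0 s = 1 := by
  have h : ∫ s, phi0 s = 1 := bump0.integral_normed
  rw [intervalIntegral.integral_of_le zero_le_one]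
  refine (setIntegral_eq_integral_of_forall_compl_eq_zero fun x hx =>
    phi0_zero fun h => hx ?_).trans h
  exact ⟨by linarith [h.1], by linarith [h.2]⟩
def phi (n : ℕ) : Wt := ⟨iteratedDeriv n phi0, by
  induction n with
  | zero => simpa using phi0_smooth
  | succ n ih => rw [iteratedDeriv_succ]; exact (contDiff_infty_iff_deriv.1 ih).2⟩
theorem phi_d (n : ℕ) : Wt.d (phi n) = phi (n+1) := by
  apply Subtype.ext; simp only [Wt.d, phi, iteratedDeriv_succ]
theorem phi_zero {s : ℝ} (h : s ∉ Icc (1/4 : ℝ) (3/4)) (n : ℕ) : (phi n).1 s = 0 := by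
  have : phi0 =ᶠ[𝓝 s] fun _ => 0 := by
    filter_upwards [isClosed_Icc.isOpen_compl.mem_nhds h] with y hy
    exact phi0_zero fun h' => hy ⟨h'.1.le, h'.2.le⟩
  simp only [phi]
  rw [this.iteratedDeriv_eq]; simp

/-- the mollifier -/
def Mo (L : ℝ) (a : Fin 3 → ℕ) : SF →ₗ[ℂ] SF :=
  Av (phi (a 0)) (L⁻¹ • eS 0) ∘ₗ Av (phi (a 1)) (L⁻¹ • eS 1) ∘ₗ Av (phi (a 2)) (L⁻¹ • eS 2)

theorem Mo_app (L a h) : Mo L a h = Av (phi (a 0)) (L⁻¹ • eS 0) (Av (phi (a 1)) (L⁻¹ • eS 1)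
    (Av (phi (a 2)) (L⁻¹ • eS 2) h)) := rfl
theorem dd_Mo (L a e h) : dd e (Mo L a h) = Mo L a (dd e h) := by
  simp only [Mo_app, Av_dd]
theorem dx_Av_phi {L : ℝ} (hL : 1 ≤ L) (n : ℕ) (j : Fin 3) (h : SF) :
    dx j (Av (phi n) (L⁻¹ • eS j) h) = -(L : ℂ) • Av (phi (n+1)) (L⁻¹ • eS j) h := by
  have h0 : (phi n).1 0 = 0 := phi_zero (by norm_num) n
  have h1 : (phi n).1 1 = 0 := phi_zero (by norm_num) n
  have hL0 : (L : ℂ) ≠ 0 := by exact_mod_cast (by linarith : L ≠ 0)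
  have h2 : dd (L⁻¹ • eS j) (Av (phi n) (L⁻¹ • eS j) h) = - Av (phi (n+1)) (L⁻¹ • eS j) h := by
    ext z; rw [Av_ibp, h0, h1, phi_d]; simp
  rw [dd_smul_dir] at h2
  rw [dx_eq, neg_smul, ← smul_neg, ← h2, smul_smul]
  push_cast; rw [mul_inv_cancel₀ hL0, one_smul]
theorem dx_Mo {L : ℝ} (hL : 1 ≤ L) (a : Fin 3 → ℕ) (j : Fin 3) (h : SF) :
    dx j (Mo L a h) = -(L : ℂ) • Mo L (a + Pi.single j 1) h := by
  simp only [Mo_app]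
  fin_cases j
  · simp only [Fin.zero_eta]
    rw [dx_Av_phi hL]; simp
  · simp only [Fin.mk_one]
    have := dx_Av_phi hL (a 1) 1 (Av (phi (a 2)) (L⁻¹ • eS 2) h)
    rw [dx_eq, Av_dd, ← dx_eq, this]; simp
  · have := dx_Av_phi hL (a 2) 2 h
    change dx 2 _ = _
    rw [dx_eq, Av_dd, Av_dd, ← dx_eq, this]; simp

theorem Mo_loc (a : Fin 3 → ℕ) : ∃ C : ℝ, 0 ≤ C ∧ ∀ (L : ℝ) (_ : 1 ≤ L) (h : SF) (z : ℝ × Spc) (S : ℝ),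
    (∀ y : Spc, ‖y - z.2‖ ≤ L⁻¹ → ‖h.1 (z.1, y)‖ ≤ S) → ‖(Mo L a h).1 z‖ ≤ C * S := by
  obtain ⟨C0, h0, H0⟩ := Av_bd (V := ℝ × Spc) (phi (a 0))
  obtain ⟨C1, h1, H1⟩ := Av_bd (V := ℝ × Spc) (phi (a 1))
  obtain ⟨C2, h2, H2⟩ := Av_bd (V := ℝ × Spc) (phi (a 2))
  refine ⟨C0 * (C1 * C2), by positivity, fun L hL h z S hS => ?_⟩
  rw [Mo_app, mul_assoc, mul_assoc]
  refine H0 _ _ _ _ fun s0 hs0 => H1 _ _ _ _ fun s1 hs1 => H2 _ _ _ _ fun s2 hs2 => ?_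
  have e : z + s0 • L⁻¹ • eS 0 + s1 • L⁻¹ • eS 1 + s2 • L⁻¹ • eS 2
    = (z.1, z.2 + s0 • L⁻¹ • ex 0 + s1 • L⁻¹ • ex 1 + s2 • L⁻¹ • ex 2) := by
    ext <;> simp [eS]
  rw [e]
  apply hS
  have hL0 : 0 ≤ L⁻¹ := by positivity
  rw [pi_norm_le_iff_of_nonneg hL0]
  intro i
  have key : ∀ s ∈ Icc (0:ℝ) 1, |s * L⁻¹| ≤ L⁻¹ := by
    intro s hs
    rw [abs_of_nonneg (mul_nonneg hs.1 hL0)]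
    exact mul_le_of_le_one_left hL0 hs.2
  have e2 : ∀ u v w : Spc, z.2 + u + v + w - z.2 = u + v + w := by intros; abel
  rw [e2]
  fin_cases i
  · simpa [ex] using key s0 hs0
  · simpa [ex] using key s1 hs1
  · simpa [ex] using key s2 hs2

theorem Mo_const (L : ℝ) (c : ℂ) : Mo L 0 (algebraMap ℂ SF c) = algebraMap ℂ SF c := by
  have : ∀ e : ℝ × Spc, Av (phi 0) e (algebraMap ℂ SF c) = algebraMap ℂ SF c := by
    intro e; ext z
    rw [Av_app]
    simp only [SFo.algebraMap_app, phi, iteratedDeriv_zero]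
    rw [intervalIntegral.integral_mul_const, intervalIntegral.integral_ofReal, phi0_int]; simp
  simp only [Mo_app, Pi.zero_apply, this]

theorem dd_space (y : Spc) (f : SF) : dd ((0, y) : ℝ × Spc) f = ∑ j, (y j : ℂ) • dx j f := by
  have : ((0, y) : ℝ × Spc) = y 0 • eS 0 + y 1 • eS 1 + y 2 • eS 2 := by
    ext i
    · simp [eS]
    · fin_cases i <;> simp [eS, ex]
  rw [this, dd_add_dir, dd_add_dir, dd_smul_dir, dd_smul_dir, dd_smul_dir, Fin.sum_univ_three]; rfl

theorem lip_space (f : SF) (S : ℝ) (h : ∀ j z, ‖(dx j f).1 z‖ ≤ S) (t : ℝ) (x y : Spc) :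
    ‖f.1 (t, y) - f.1 (t, x)‖ ≤ 3 * S * ‖y - x‖ := by
  have hS : 0 ≤ S := (norm_nonneg _).trans (h 0 (t, x))
  have hd : ∀ u : Spc, HasFDerivAt (fun u => f.1 (t, u))
      ((fderiv ℝ f.1 (t, u)).comp (ContinuousLinearMap.inr ℝ ℝ Spc)) u := fun u =>
    (SFo.diff f (t, u)).hasFDerivAt.comp u (hasFDerivAt_prodMk_right t u)
  refine Convex.norm_image_sub_le_of_norm_hasFDerivWithin_le (s := univ)
    (fun u _ => (hd u).hasFDerivWithinAt) (fun u _ => ?_) convex_univ (mem_univ x) (mem_univ y)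
  refine ContinuousLinearMap.opNorm_le_bound _ (by positivity) fun w => ?_
  have e : ((fderiv ℝ f.1 (t, u)).comp (ContinuousLinearMap.inr ℝ ℝ Spc)) w
      = (dd ((0, w) : ℝ × Spc) f).1 (t, u) := by simp [dd_app]
  rw [e, dd_space, SFo.sum_app]
  refine (norm_sum_le_of_le (f := fun j => ((w j : ℂ) • dx j f).1 (t, u)) (n := fun _ => ‖w‖ * S) Finset.univ fun j _ => ?_).trans ?_
  · rw [SFo.smul_app, norm_mul, Complex.norm_real]
    exact mul_le_mul (norm_le_pi_norm w j) (h j _) (norm_nonneg _) (norm_nonneg _)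
  · simp only [Finset.sum_const, Finset.card_univ, Fintype.card_fin, nsmul_eq_mul]
    apply le_of_eq; push_cast; ring
end moll
end CI
end

noncomputable section
open MeasureTheory Set Filter Topology
open scoped ContDiff
set_option linter.unusedSectionVars false

namespace CI
/-- integer translation vector -/
def kv (k : Fin 3 → ℤ) : ℝ × Spc := (0, fun i => (k i : ℝ))
theorem eS_kv (j : Fin 3) : eS j = kv (Pi.single j 1) := by
  ext i
  · simp [eS, kv]
  · by_cases h : i = j
    · subst h; simp [eS, kv, ex]
    · simp [eS, kv, ex, h]

/-- normalized Euler-Reynolds data -/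
structure Data (P : ℕ) where
  κ : ℝ
  L : ℝ
  N : ℕ
  v : Fin 3 → SF
  p : SF
  R : Fin 3 → Fin 3 → SF
  ta : ℝ
  tb : ℝ
  hκ0 : 0 < κ
  hκ1 : κ ≤ 1
  hL1 : 1 ≤ L
  hLP : L * κ ^ P ≤ 1
  hN : 2 * Real.pi * N * κ = L
  vR : ∀ l, Rl (v l)
  RR : ∀ a b, Rl (R a b)
  vP : ∀ l k, Pk (kv k) (v l)
  pP : ∀ k, Pk (kv k) p
  RP : ∀ a b k, Pk (kv k) (R a b)
  vS : ∀ l, Sp (TS ta tb) (v l)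
  pS : Sp (TS ta tb) p
  RS : ∀ a b, Sp (TS ta tb) (R a b)
  Rsym : ∀ a b, R a b = R b a
  div0 : ∑ a, dx a (v a) = 0
  er : ∀ b, dt (v b) + ∑ a, dx a (v a * v b) + dx b p = ∑ a, dx a (R a b)
  bR : ∀ a b z, ‖(R a b).1 z‖ ≤ 1
  bdR : ∀ j a b z, ‖(dx j (R a b)).1 z‖ ≤ κ * L
  bDR : ∀ a b z, ‖(dt (R a b) + ∑ j, v j * dx j (R a b)).1 z‖ ≤ κ * L
  bv : ∀ l z, ‖(v l).1 z‖ * κ ^ P ≤ 1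
  bdv : ∀ j l z, ‖(dx j (v l)).1 z‖ ≤ κ * L
  bdp : ∀ j z, ‖(dx j p).1 z‖ ≤ L

variable {P : ℕ}

def vl (i : Data P) (l : Fin 3) : SF := Mo i.L 0 (i.v l)

/-- coarse material derivative -/
def DT (i : Data P) : Der := dt + ∑ l, vl i l • dx l
theorem DT_app (i : Data P) (f : SF) : DT i f = dt f + ∑ l, vl i l * dx l f := by
  have : (∑ l, vl i l • dx l : Der) f = ∑ l, vl i l * dx l f := by
    rw [Fin.sum_univ_three, Fin.sum_univ_three]; rfl
  rw [DT, Derivation.add_apply, this]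

def c0 (P : ℕ) : Ctx (ℝ × Spc) (Data P) where
  L := Data.L
  hL := Data.hL1
  Dom _ := univ
  D := dx
  Dt := DT

/-- the weights -/
def wk : Data P → ℝ := Data.κ
def wL : Data P → ℝ := Data.L
def wV : Data P → ℝ := fun i => (i.κ ^ P)⁻¹
theorem wk_pos (i : Data P) : 0 < wk i := i.hκ0
theorem wk_le (i : Data P) : wk i ≤ 1 := i.hκ1
theorem wL_one (i : Data P) : 1 ≤ wL i := i.hL1
theorem wL_pos (i : Data P) : 0 < wL i := zero_lt_one.trans_le i.hL1
theorem wV_one (i : Data P) : 1 ≤ wV i := by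
  have := pow_le_one₀ (n := P) i.hκ0.le i.hκ1
  exact (one_le_inv₀ (pow_pos i.hκ0 P)).2 this
theorem wV_pos (i : Data P) : 0 < wV i := zero_lt_one.trans_le (wV_one i)

theorem comm_c0 : CommOK (c0 P) (fun k l i => dx k (vl i l)) := by
  intro i k f
  change DT i (dx k f) = dx k (DT i f) - ∑ l, dx k (vl i l) * dx l f
  simp only [DT_app, map_add, map_sum, dx_mul, Finset.sum_add_distrib, dx_dt, dx_comm k]
  abel

/-- basic symbol property of mollification -/
theorem Mo_sym {h : Data P → SF} {S : Data P → ℝ} (hh : Bd (c0 P) S h) (a : Fin 3 → ℕ) :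
    Sy (c0 P) 0 S (fun i => Mo i.L a (h i)) := by
  intro n
  obtain ⟨K, hK, H⟩ := hh
  induction n generalizing a with
  | zero =>
    obtain ⟨C, hC, HC⟩ := Mo_loc a
    refine ⟨C * K, by positivity, fun i z _ => ?_⟩
    rw [mul_assoc]
    exact HC i.L i.hL1 _ z _ fun y _ => H i _ (mem_univ _)
  | succ n ih =>
    refine ⟨ih a, fun j => ?_⟩
    change SymN (c0 P) n (S * (c0 P).L) (fun i => dx j (Mo i.L a (h i)))
    simp only [fun i : Data P => dx_Mo i.hL1 a j]
    rw [mul_comm]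
    refine (ih (a + Pi.single j 1)).csmul _ fun i => ?_
    rw [norm_neg, Complex.norm_real, Real.norm_of_nonneg (zero_le_one.trans i.hL1)]; rfl

theorem bd_dv (j l : Fin 3) : Bd (c0 P) (wk * wL) (fun i => dx j (i.v l)) :=
  ⟨1, zero_le_one, fun i z _ => by rw [one_mul]; exact i.bdv j l z⟩
theorem dx_vl (i : Data P) (j l : Fin 3) : dx j (vl i l) = Mo i.L 0 (dx j (i.v l)) := dd_Mo _ _ _ _
theorem sy_dvl (j l : Fin 3) : Sy (c0 P) 0 (wk * wL) (fun i => dx j (vl i l)) := by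
  simp only [dx_vl]; exact Mo_sym (bd_dv j l) 0

/-- comparison of `Mo f` with `f` nearby -/
theorem Mo_near : ∃ C : ℝ, 0 ≤ C ∧ ∀ (L : ℝ) (_ : 1 ≤ L) (f : SF) (S : ℝ)
    (_ : ∀ j z, ‖(dx j f).1 z‖ ≤ S) (z : ℝ × Spc) (y : Spc), ‖y - z.2‖ ≤ L⁻¹ →
    ‖(Mo L 0 f).1 z - f.1 (z.1, y)‖ ≤ C * (S * L⁻¹) := by
  obtain ⟨C, hC, HC⟩ := Mo_loc 0
  refine ⟨C * 3 + 3, by positivity, fun L hL f S hS z y hy => ?_⟩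
  have hS0 : 0 ≤ S := (norm_nonneg _).trans (hS 0 z)
  have h1 : (Mo L 0 f).1 z - f.1 z = (Mo L 0 (f - algebraMap ℂ SF (f.1 z))).1 z := by
    rw [map_sub, Mo_const]; simp
  have h2 : ∀ y : Spc, ‖y - z.2‖ ≤ L⁻¹ → ‖f.1 (z.1, y) - f.1 z‖ ≤ 3 * S * L⁻¹ := fun y hy =>
    (lip_space f S hS z.1 z.2 y).trans (mul_le_mul_of_nonneg_left hy (by positivity))
  have h3 : ‖(Mo L 0 f).1 z - f.1 z‖ ≤ C * (3 * S * L⁻¹) := by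
    rw [h1]
    refine HC L hL _ z _ fun y hy => ?_
    simpa using h2 y hy
  calc _ = ‖((Mo L 0 f).1 z - f.1 z) - (f.1 (z.1, y) - f.1 z)‖ := by congr 1; ring
    _ ≤ C * (3 * S * L⁻¹) + 3 * S * L⁻¹ := (norm_sub_le _ _).trans (add_le_add h3 (h2 y hy))
    _ = _ := by ring

theorem kL_inv (i : Data P) : i.κ * i.L * i.L⁻¹ = i.κ := by
  have := (wL_pos i).ne'
  exact mul_inv_cancel_right₀ this _

/-- the commutator -/
theorem com_sym {h : Data P → SF} {S : Data P → ℝ} (hh : Bd (c0 P) S h) (l : Fin 3) (a : Fin 3 → ℕ) :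
    Sy (c0 P) 0 (wk * S) (fun i => vl i l * Mo i.L a (h i) - Mo i.L a (i.v l * h i)) := by
  intro n
  induction n generalizing a with
  | zero =>
    obtain ⟨K, hK, H⟩ := hh
    obtain ⟨C, hC, HC⟩ := Mo_loc a
    obtain ⟨C', hC', HC'⟩ := Mo_near
    refine ⟨C * (C' * K), by positivity, fun i z _ => ?_⟩
    have e : (vl i l * Mo i.L a (h i) - Mo i.L a (i.v l * h i)).1 z
        = (Mo i.L a (((vl i l).1 z) • h i - i.v l * h i)).1 z := by
      rw [map_sub, map_smul]; simp
    rw [e]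
    have e2 : C * (C' * K) * ((wk * S : Data P → ℝ) i) = C * ((C' * (i.κ * i.L * i.L⁻¹)) * (K * S i)) := by
      rw [kL_inv]; simp only [Pi.mul_apply, wk]; ring
    rw [e2]
    refine HC i.L i.hL1 _ z _ fun y hy => ?_
    have e3 : (((vl i l).1 z) • h i - i.v l * h i).1 (z.1, y)
        = ((vl i l).1 z - (i.v l).1 (z.1, y)) * (h i).1 (z.1, y) := by simp; ring
    rw [e3, norm_mul]
    have e4 := HC' i.L i.hL1 (i.v l) (i.κ * i.L) (fun j z => i.bdv j l z) z y hy
    exact mul_le_mul e4 (H i _ (mem_univ _)) (norm_nonneg _) ((norm_nonneg _).trans e4)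
  | succ n ih =>
    refine ⟨ih a, fun j => ?_⟩
    have e : ∀ i, dx j (vl i l * Mo i.L a (h i) - Mo i.L a (i.v l * h i)) =
      dx j (vl i l) * Mo i.L a (h i) + (-(i.L : ℂ)) •
        (vl i l * Mo i.L (a + Pi.single j 1) (h i) - Mo i.L (a + Pi.single j 1) (i.v l * h i)) := by
      intro i
      rw [map_sub, dx_mul, dx_Mo i.hL1, dx_Mo i.hL1, smul_sub, mul_smul_comm]; abel
    change SymN (c0 P) n (wk * S * (c0 P).L) (fun i => dx j _)
    simp only [e]
    refine SymN.add ?_ ?_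
    · have := (sy_dvl (P := P) j l n).mul (Mo_sym hh a n)
      rwa [mul_right_comm] at this
    · rw [mul_comm (wk * S)]
      refine (ih (a + Pi.single j 1)).csmul _ fun i => ?_
      rw [norm_neg, Complex.norm_real, Real.norm_of_nonneg (zero_le_one.trans i.hL1)]; rfl

theorem DT_Mo (i : Data P) (h : SF) : DT i (Mo i.L 0 h) = Mo i.L 0 (dt h + ∑ m, i.v m * dx m h) +
    ∑ m, (vl i m * Mo i.L 0 (dx m h) - Mo i.L 0 (i.v m * dx m h)) := by
  have e1 : dt (Mo i.L 0 h) = Mo i.L 0 (dt h) := dd_Mo _ _ _ _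
  have e2 : ∀ m, dx m (Mo i.L 0 h) = Mo i.L 0 (dx m h) := fun m => dd_Mo _ _ _ _
  rw [DT_app, map_add, map_sum, Finset.sum_sub_distrib, e1]
  simp only [e2]; abel

theorem DT_Mo_sym {h : Data P → SF} {S S' : Data P → ℝ}
    (h1 : Bd (c0 P) S (fun i => dt (h i) + ∑ m, i.v m * dx m (h i)))
    (h2 : ∀ m, Bd (c0 P) S' (fun i => dx m (h i))) (h3 : ∀ i, wk i * S' i ≤ S i) (h4 : ∀ i, 0 ≤ S i) :
    Sy (c0 P) 0 S (fun i => DT i (Mo i.L 0 (h i))) := by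
  simp only [DT_Mo]
  refine Sy.add (Mo_sym h1 0) (Sy.sum _ h4 fun m _ => ?_)
  exact (com_sym (h2 m) m 0).mono1 h3

theorem material_v (i : Data P) (b : Fin 3) : dt (i.v b) + ∑ m, i.v m * dx m (i.v b)
    = ∑ a, dx a (i.R a b) - dx b i.p := by
  have h := i.er b
  have e : ∑ a, dx a (i.v a * i.v b) = ∑ m, i.v m * dx m (i.v b) := by
    simp only [dx_mul, Finset.sum_add_distrib]
    rw [← Finset.sum_mul, i.div0, zero_mul, zero_add]
  rw [e] at h
  rw [← h]; abel

theorem wkL_le (i : Data P) : wk i * wL i ≤ wL i :=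
  mul_le_of_le_one_left (wL_pos i).le (wk_le i)
theorem sy_Dvl (l : Fin 3) : Sy (c0 P) 0 wL (fun i => DT i (vl i l)) := by
  refine DT_Mo_sym (S' := wk * wL) ?_ (fun m => bd_dv m l) (fun i => ?_) (fun i => (wL_pos i).le)
  · simp only [material_v]
    refine ⟨4, by norm_num, fun i z _ => ?_⟩
    rw [SFo.sub_app, SFo.sum_app]
    refine (norm_sub_le _ _).trans ?_
    have h1 : ‖∑ a, (dx a (i.R a l)).1 z‖ ≤ ∑ a : Fin 3, wL i :=
      norm_sum_le_of_le _ fun a _ => (i.bdR a a l z).trans (wkL_le i)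
    have h2 := i.bdp l z
    simp at h1
    change _ ≤ 4 * i.L
    change _ ≤ 3 * i.L at h1
    linarith
  · simp only [Pi.mul_apply]
    exact (mul_le_of_le_one_left (mul_pos (wk_pos i) (wL_pos i)).le (wk_le i)).trans (wkL_le i)

theorem sy1_dvl (j l : Fin 3) : Sy (c0 P) 1 wL (fun i => dx j (vl i l)) := by
  refine ⟨((sy_dvl j l).mono1 (B := wL) wkL_le : Sy (c0 P) 0 wL _), ?_⟩
  have hc := comm_c0 (P := P)
  have e : ∀ i : Data P, (c0 P).Dt i (dx j (vl i l)) = dx j (DT i (vl i l)) -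
      ∑ m, dx j (vl i m) * dx m (vl i l) := fun i => hc i j (vl i l)
  simp only [e]
  refine Sy.sub ((sy_Dvl l).dx0 j) (Sy.sum _ (fun i => (mul_pos (wL_pos i) (wL_pos i)).le) fun m _ => ?_)
  exact ((sy_dvl j m).mono1 (B := wL) wkL_le).mul ((sy_dvl m l).mono1 (B := wL) wkL_le)

theorem bd_v (l : Fin 3) : Bd (c0 P) wV (fun i => i.v l) :=
  ⟨1, zero_le_one, fun i z _ => by
    rw [one_mul, wV, ← one_div, le_div_iff₀ (pow_pos i.hκ0 P)]; exact i.bv l z⟩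
theorem sy_vl (l : Fin 3) : Sy (c0 P) 0 wV (fun i => vl i l) := Mo_sym (bd_v l) 0

/-- mollified stress -/
def mR (i : Data P) (a b : Fin 3) : SF := Mo i.L 0 (i.R a b)
theorem sy_mR (a b : Fin 3) : Sy (c0 P) 0 1 (fun i => mR i a b) :=
  Mo_sym ⟨1, zero_le_one, fun i z _ => by simpa using i.bR a b z⟩ 0
theorem bd_dR (j a b : Fin 3) : Bd (c0 P) (wk * wL) (fun i => dx j (i.R a b)) :=
  ⟨1, zero_le_one, fun i z _ => by rw [one_mul]; exact i.bdR j a b z⟩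
theorem sy_dmR (j a b : Fin 3) : Sy (c0 P) 0 (wk * wL) (fun i => dx j (mR i a b)) := by
  have : ∀ i : Data P, dx j (mR i a b) = Mo i.L 0 (dx j (i.R a b)) := fun i => dd_Mo _ _ _ _
  simp only [this]; exact Mo_sym (bd_dR j a b) 0
theorem sy_DmR (a b : Fin 3) : Sy (c0 P) 0 (wk * wL) (fun i => DT i (mR i a b)) := by
  refine DT_Mo_sym (S' := wk * wL) ⟨1, zero_le_one, fun i z _ => ?_⟩ (fun m => bd_dR m a b)
    (fun i => ?_) (fun i => (mul_pos (wk_pos i) (wL_pos i)).le)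
  · rw [one_mul]; exact i.bDR a b z
  · simp only [Pi.mul_apply]
    exact (mul_le_of_le_one_left (mul_pos (wk_pos i) (wL_pos i)).le (wk_le i))
theorem mR_near (a b : Fin 3) : Bd (c0 P) wk (fun i => i.R a b - mR i a b) := by
  obtain ⟨C, hC, H⟩ := Mo_near
  refine ⟨C, hC, fun i z _ => ?_⟩
  rw [SFo.sub_app, norm_sub_rev]
  have := H i.L i.hL1 (i.R a b) (i.κ * i.L) (fun j z => i.bdR j a b z) z z.2 (by
    simpa using (zero_le_one.trans i.hL1))
  rwa [kL_inv] at this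
theorem vl_near (l : Fin 3) : Bd (c0 P) wk (fun i => i.v l - vl i l) := by
  obtain ⟨C, hC, H⟩ := Mo_near
  refine ⟨C, hC, fun i z _ => ?_⟩
  rw [SFo.sub_app, norm_sub_rev]
  have := H i.L i.hL1 (i.v l) (i.κ * i.L) (fun j z => i.bdv j l z) z z.2 (by
    simpa using (zero_le_one.trans i.hL1))
  rwa [kL_inv] at this
theorem vl_div (i : Data P) : ∑ a, dx a (vl i a) = 0 := by
  simp only [dx_vl, ← map_sum, i.div0, map_zero]
theorem vl_rl (i : Data P) (l) : Rl (vl i l) := (((i.vR l).Av _ _).Av _ _).Av _ _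
theorem mR_rl (i : Data P) (a b) : Rl (mR i a b) := (((i.RR a b).Av _ _).Av _ _).Av _ _
theorem vl_pk (i : Data P) (l k) : Pk (kv k) (vl i l) := (((i.vP l k).Av _ _).Av _ _).Av _ _
theorem mR_pk (i : Data P) (a b k) : Pk (kv k) (mR i a b) := (((i.RP a b k).Av _ _).Av _ _).Av _ _
theorem mR_symm (i : Data P) (a b) : mR i a b = mR i b a := by rw [mR, mR, i.Rsym]
theorem Mo_sp {p q L : ℝ} {f : SF} (h : Sp (TS p q) f) (a) : Sp (TS p q) (Mo L a f) := by
  have e : ∀ j, L⁻¹ • eS j = ((0, L⁻¹ • ex j) : ℝ × Spc) := fun j => by ext <;> simp [eS]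
  rw [Mo_app, e, e, e]
  exact ((h.AvT _ _).AvT _ _).AvT _ _
end CI
end

noncomputable section
open MeasureTheory Set Filter Topology
open scoped ContDiff
set_option linter.unusedSectionVars false

namespace CI
section pb
variable {V W : Type} [NormedAddCommGroup V] [NormedSpace ℝ V] [NormedAddCommGroup W] [NormedSpace ℝ W]
/-- pullback -/
def pb (Φ : V → W) (h : ContDiff ℝ ∞ Φ) (f : SFo W) : SFo V := ⟨fun z => f.1 (Φ z), (SFo.cd f).comp h⟩
theorem pb_app (Φ : V → W) (h : ContDiff ℝ ∞ Φ) (f : SFo W) (z) : (pb Φ h f).1 z = f.1 (Φ z) := rfl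
theorem dd_pb (Φ : V → W) (h : ContDiff ℝ ∞ Φ) (f : SFo W) (e z : V) :
    (dd e (pb Φ h f)).1 z = (dd (fderiv ℝ Φ z e) f).1 (Φ z) := by
  rw [dd_app, dd_app]
  have h1 := (SFo.diff f (Φ z)).hasFDerivAt.comp z ((h.differentiable (by simp)) z).hasFDerivAt
  have h2 : fderiv ℝ (pb Φ h f).1 z = _ := h1.fderiv
  rw [h2]; rfl
end pb

abbrev V5 := ℝ × (ℝ × Spc)
abbrev SF5 := SFo V5
def eT : V5 := (1, 0)
def e5 (e : ℝ × Spc) : V5 := (0, e)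

def emb (f : SF) : SF5 := pb (fun z : V5 => z.2) contDiff_snd f
def dg (f : SF5) : SF5 := pb (fun z : V5 => (z.2.1, z.2)) (by fun_prop) f
def sl (s : ℝ) (f : SF5) : SF := pb (fun z : ℝ × Spc => (s, z)) (by fun_prop) f

theorem dd_emb (e : ℝ × Spc) (f : SF) : dd (e5 e) (emb f) = emb (dd e f) := by
  ext z
  rw [emb, dd_pb]
  have : fderiv ℝ (fun z : V5 => z.2) z (e5 e) = e := by rw [fderiv_snd]; rfl
  rw [this]; rfl
theorem dd_sl (s : ℝ) (e : ℝ × Spc) (f : SF5) : dd e (sl s f) = sl s (dd (e5 e) f) := by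
  ext z
  rw [sl, dd_pb]
  have : fderiv ℝ (fun z : ℝ × Spc => (s, z)) z e = e5 e := by
    rw [(hasFDerivAt_prodMk_right s z).fderiv]; rfl
  rw [this]; rfl
theorem dd_dg (e : ℝ × Spc) (f : SF5) : dd (e5 e) (dg f) = dg (dd (e5 e) f + (e.1 : ℂ) • dd eT f) := by
  ext z
  rw [dg, dd_pb]
  have h1 : HasFDerivAt (fun z : V5 => (z.2.1, z.2))
    (((ContinuousLinearMap.fst ℝ ℝ Spc).comp (ContinuousLinearMap.snd ℝ ℝ (ℝ × Spc))).prod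
      (ContinuousLinearMap.snd ℝ ℝ (ℝ × Spc))) z :=
    (((ContinuousLinearMap.fst ℝ ℝ Spc).comp (ContinuousLinearMap.snd ℝ ℝ (ℝ × Spc))).prod
      (ContinuousLinearMap.snd ℝ ℝ (ℝ × Spc))).hasFDerivAt
  have : fderiv ℝ (fun z : V5 => (z.2.1, z.2)) z (e5 e) = e5 e + e.1 • eT := by
    rw [h1.fderiv]; ext <;> simp [e5, eT]
  rw [this, dd_add_dir, dd_smul_dir]; rfl
theorem sl_emb (s f) : sl s (emb f) = f := rfl
theorem emb_add (f g) : emb (f + g) = emb f + emb g := rfl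
theorem emb_mul (f g) : emb (f * g) = emb f * emb g := rfl
theorem emb_sum {κ : Type*} (s : Finset κ) (f : κ → SF) : emb (∑ k ∈ s, f k) = ∑ k ∈ s, emb (f k) := by
  ext z; simp [emb, pb_app]
theorem sl_mul (s f g) : sl s (f * g) = sl s f * sl s g := rfl
theorem sl_add (s f g) : sl s (f + g) = sl s f + sl s g := rfl
theorem sl_sum {κ : Type*} (s : Finset κ) (r : ℝ) (f : κ → SF5) :
    sl r (∑ k ∈ s, f k) = ∑ k ∈ s, sl r (f k) := by
  ext z; simp [sl, pb_app]

/-- the antiderivative in the first variable -/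
def HH (g : SF5) : SF5 := ⟨fun z => ∫ u in (0:ℝ)..1, g.1 (u * z.1, z.2), by
  refine contDiff_param (fun q : V5 × ℝ => g.1 (q.2 * q.1.1, q.1.2)) ?_
  exact (SFo.cd g).comp (by fun_prop)⟩
def sS : SF5 := ⟨fun z => (z.1 : ℂ), show ContDiff ℝ ∞ _ from Complex.ofRealCLM.contDiff.comp contDiff_fst⟩
def JJ (g : SF5) : SF5 := sS * HH g
theorem JJ_app (g : SF5) (s : ℝ) (z : ℝ × Spc) : (JJ g).1 (s, z) = ∫ r in (0:ℝ)..s, g.1 (r, z) := by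
  have := intervalIntegral.smul_integral_comp_mul_right (a := 0) (b := 1) (fun r => g.1 (r, z)) s
  simp only [zero_mul, one_mul] at this
  rw [← this]
  change (s : ℂ) * _ = _
  rw [Complex.real_smul]; rfl
theorem dd_HH (e : ℝ × Spc) (g : SF5) : dd (e5 e) (HH g) = HH (dd (e5 e) g) := by
  ext z
  have hs : ContDiff ℝ ∞ (fun q : V5 × ℝ => g.1 (q.2 * q.1.1, q.1.2)) :=
    (SFo.cd g).comp (by fun_prop)
  have := fderiv_param _ hs z (e5 e)
  rw [dd_app]
  refine this.trans ?_
  refine intervalIntegral.integral_congr fun u _ => ?_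
  have hΦ : ContDiff ℝ ∞ (fun y : V5 => ((u * y.1, y.2) : V5)) := by fun_prop
  have h2 := dd_pb _ hΦ g (e5 e) z
  have h3 : HasFDerivAt (fun y : V5 => ((u * y.1, y.2) : V5))
    ((u • ContinuousLinearMap.fst ℝ ℝ (ℝ × Spc)).prod (ContinuousLinearMap.snd ℝ ℝ (ℝ × Spc))) z :=
    ((u • ContinuousLinearMap.fst ℝ ℝ (ℝ × Spc)).prod (ContinuousLinearMap.snd ℝ ℝ (ℝ × Spc))).hasFDerivAt
  rw [h3.fderiv] at h2
  have h4 : ((u • ContinuousLinearMap.fst ℝ ℝ (ℝ × Spc)).prod (ContinuousLinearMap.snd ℝ ℝ (ℝ × Spc)))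
    (e5 e) = e5 e := by ext <;> simp [e5]
  rw [h4] at h2
  exact h2
theorem dd_JJ (e : ℝ × Spc) (g : SF5) : dd (e5 e) (JJ g) = JJ (dd (e5 e) g) := by
  have : dd (e5 e) sS = 0 := by
    ext z
    have h : HasFDerivAt sS.1 (Complex.ofRealCLM.comp (ContinuousLinearMap.fst ℝ ℝ (ℝ × Spc))) z :=
      (Complex.ofRealCLM.comp (ContinuousLinearMap.fst ℝ ℝ (ℝ × Spc))).hasFDerivAt
    rw [dd_app, h.fderiv]; simp [e5]
  rw [JJ, dd_mul, this, zero_mul, zero_add, dd_HH]; rfl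
theorem dd_line (f : SF5) (s : ℝ) (z : ℝ × Spc) :
    HasDerivAt (fun r => f.1 (r, z)) ((dd eT f).1 (s, z)) s := by
  have h1 : HasDerivAt (fun r : ℝ => ((r, z) : V5)) eT s := (hasDerivAt_id s).prodMk (hasDerivAt_const s z)
  exact (SFo.diff f (s, z)).hasFDerivAt.comp_hasDerivAt s h1
theorem line_cont (g : SF5) (z : ℝ × Spc) : Continuous fun r : ℝ => g.1 (r, z) :=
  (SFo.cont g).comp (by fun_prop)
theorem dT_JJ (g : SF5) : dd eT (JJ g) = g := by
  ext ⟨s, z⟩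
  have h := dd_line (JJ g) s z
  simp only [JJ_app] at h
  have h2 := (line_cont g z).integral_hasStrictDerivAt 0 s
  exact h.unique h2.hasDerivAt

/-- integral from `t` to `s` -/
def II (g : SF5) : SF5 := JJ g - dg (JJ g)
theorem II_app (g : SF5) (s : ℝ) (z : ℝ × Spc) : (II g).1 (s, z) = ∫ r in z.1..s, g.1 (r, z) := by
  have : (II g).1 (s, z) = (JJ g).1 (s, z) - (JJ g).1 (z.1, z) := rfl
  rw [this, JJ_app, JJ_app]
  exact intervalIntegral.integral_interval_sub_left ((line_cont g z).intervalIntegrable _ _)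
    ((line_cont g z).intervalIntegrable _ _)
theorem II_add (f g : SF5) : II (f + g) = II f + II g := by
  ext ⟨s, z⟩
  rw [SFo.add_app, II_app, II_app, II_app]
  exact intervalIntegral.integral_add ((line_cont f z).intervalIntegrable _ _)
    ((line_cont g z).intervalIntegrable _ _)
theorem II_emb (f : SF) (g : SF5) : II (emb f * g) = emb f * II g := by
  ext ⟨s, z⟩
  rw [SFo.mul_app, II_app, II_app]
  exact intervalIntegral.integral_const_mul (f.1 z) (fun r => g.1 (r, z))
theorem dg_add (f g : SF5) : dg (f + g) = dg f + dg g := rfl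
theorem dg_mul (f g : SF5) : dg (f * g) = dg f * dg g := rfl
theorem dg_smul (a : ℂ) (g : SF5) : dg (a • g) = a • dg g := rfl
theorem dg_emb (f) : dg (emb f) = emb f := rfl
theorem dg_II (g) : dg (II g) = 0 := by
  ext ⟨s, z⟩
  change (II g).1 (z.1, z) = 0
  rw [II_app]; simp
theorem dd_II (e : ℝ × Spc) (g : SF5) :
    dd (e5 e) (II g) = II (dd (e5 e) g) - (e.1 : ℂ) • dg g := by
  rw [II, map_sub, dd_dg, dd_JJ, dT_JJ, dg_add, dg_smul, II]; abel
theorem dT_II (g) : dd eT (II g) = g := by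
  rw [II, map_sub, dT_JJ]
  have : dd eT (dg (JJ g)) = 0 := by
    ext ⟨s, z⟩
    exact (dd_line (dg (JJ g)) s z).unique 
      (hasDerivAt_const s ((JJ g).1 (z.1, z)) : HasDerivAt (fun _ : ℝ => (JJ g).1 (z.1, z)) 0 s)
  rw [this, sub_zero]
theorem II_dT (g : SF5) : II (dd eT g) = g - dg g := by
  ext ⟨s, z⟩
  rw [II_app, SFo.sub_app]
  exact intervalIntegral.integral_eq_sub_of_hasDerivAt (fun r _ => dd_line g r z)
    ((line_cont _ z).intervalIntegrable _ _)
theorem II_rl {g : SF5} (h : Rl g) : Rl (II g) := by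
  rintro ⟨s, z⟩
  have : (II g).1 (s, z) = ((∫ r in z.1..s, (g.1 (r, z)).re : ℝ) : ℂ) := by
    rw [II_app, ← intervalIntegral.integral_ofReal]
    refine intervalIntegral.integral_congr fun r _ => ?_
    exact (h.re_eq _).symm
  rw [this]; simp
theorem II_norm (g : SF5) (s : ℝ) (z : ℝ × Spc) (B : ℝ)
    (h : ∀ r, |r - z.1| ≤ |s - z.1| → ‖g.1 (r, z)‖ ≤ B) : ‖(II g).1 (s, z)‖ ≤ B * |s - z.1| := by
  rw [II_app]
  refine intervalIntegral.norm_integral_le_of_norm_le_const fun r hr => h r ?_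
  have := abs_sub_left_of_mem_uIcc (uIoc_subset_uIcc hr)
  exact this

/-- real smooth maps, compositions -/
abbrev ZT := {Z : V5 → Spc // ContDiff ℝ ∞ Z}
def zc (Z : ZT) (l : Fin 3) : SF5 := ⟨fun z => (Z.1 z l : ℂ),
  Complex.ofRealCLM.contDiff.comp ((contDiff_apply ℝ ℝ l).comp Z.2)⟩
def cmp (f : SF) (Z : ZT) : SF5 := pb (fun z : V5 => ((z.1, Z.1 z) : ℝ × Spc)) (contDiff_fst.prodMk Z.2) f
theorem cmp_app (f Z z) : (cmp f Z).1 z = f.1 (z.1, Z.1 z) := rfl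
theorem cmp_add (f g Z) : cmp (f + g) Z = cmp f Z + cmp g Z := rfl
theorem cmp_mul (f g Z) : cmp (f * g) Z = cmp f Z * cmp g Z := rfl
theorem dd_cmp (e : V5) (f : SF) (Z : ZT) : dd e (cmp f Z) =
    (e.1 : ℂ) • cmp (dt f) Z + ∑ l, cmp (dx l f) Z * dd e (zc Z l) := by
  ext z
  have hd : HasFDerivAt Z.1 (fderiv ℝ Z.1 z) z := (Z.2.differentiable (by simp) z).hasFDerivAt
  have h1 : fderiv ℝ (fun z : V5 => ((z.1, Z.1 z) : ℝ × Spc)) z e = (e.1, fderiv ℝ Z.1 z e) := by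
    have : HasFDerivAt (fun z : V5 => ((z.1, Z.1 z) : ℝ × Spc)) _ z := hasFDerivAt_fst.prodMk hd
    rw [this.fderiv]; rfl
  have h2 : ∀ l, (dd e (zc Z l)).1 z = (fderiv ℝ Z.1 z e l : ℂ) := by
    intro l
    have h3 : HasFDerivAt (zc Z l).1 (Complex.ofRealCLM.comp
        ((ContinuousLinearMap.proj (R := ℝ) (φ := fun _ : Fin 3 => ℝ) l).comp (fderiv ℝ Z.1 z))) z :=
      Complex.ofRealCLM.hasFDerivAt.comp z
        ((ContinuousLinearMap.proj (R := ℝ) (φ := fun _ : Fin 3 => ℝ) l).hasFDerivAt.comp z hd)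
    rw [dd_app, h3.fderiv]; rfl
  rw [cmp, dd_pb, h1]
  have h4 : ((e.1, fderiv ℝ Z.1 z e) : ℝ × Spc) = e.1 • ((1, 0) : ℝ × Spc) + (0, fderiv ℝ Z.1 z e) := by
    ext <;> simp
  rw [h4, dd_add_dir, dd_smul_dir, dd_space]
  simp only [SFo.add_app, SFo.smul_app, SFo.sum_app, SFo.mul_app, h2, cmp_app]
  congr 1
  exact Finset.sum_congr rfl fun l _ => mul_comm _ _
end CI
end

noncomputable section
open MeasureTheory Set Filter Topology
open scoped ContDiff
set_option linter.unusedSectionVars false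

namespace CI
variable {P : ℕ}

def D5 (j : Fin 3) : Derivation ℂ SF5 SF5 := dd (e5 (eS j))
def DT5 (i : Data P) : Derivation ℂ SF5 SF5 := dd (e5 (1, 0)) + ∑ l, emb (vl i l) • D5 l
theorem DT5_app (i : Data P) (f : SF5) : DT5 i f = dd (e5 (1, 0)) f + ∑ l, emb (vl i l) * D5 l f := by
  have : (∑ l, emb (vl i l) • D5 l : Derivation ℂ SF5 SF5) f = ∑ l, emb (vl i l) * D5 l f := by
    rw [Fin.sum_univ_three, Fin.sum_univ_three]; rfl
  rw [DT5, Derivation.add_apply, this]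

def c5 (P : ℕ) : Ctx V5 (Data P) where
  L := Data.L
  hL := Data.hL1
  Dom i := {z | |z.1 - z.2.1| ≤ i.L⁻¹}
  D := D5
  Dt := DT5

theorem D5_emb (j : Fin 3) (f : SF) : D5 j (emb f) = emb (dx j f) := by
  rw [D5, dd_emb, dx_eq]
theorem D5_sl (s : ℝ) (j : Fin 3) (f : SF5) : dx j (sl s f) = sl s (D5 j f) := by
  rw [dx_eq, dd_sl]; rfl
theorem DT5_emb (i : Data P) (f : SF) : DT5 i (emb f) = emb (DT i f) := by
  rw [DT5_app, DT_app, dd_emb, emb_add, emb_sum]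
  simp only [D5_emb, emb_mul]; rfl
theorem DT5_sl (i : Data P) (s : ℝ) (f : SF5) : DT i (sl s f) = sl s (DT5 i f) := by
  rw [DT5_app, DT_app, sl_add, sl_sum]
  simp only [D5_sl, sl_mul, sl_emb]
  congr 1
  exact dd_sl s _ f
theorem D5_II (j : Fin 3) (g : SF5) : D5 j (II g) = II (D5 j g) := by
  rw [D5, dd_II]; simp [eS]
theorem II_sum {κ : Type*} (s : Finset κ) (f : κ → SF5) : II (∑ k ∈ s, f k) = ∑ k ∈ s, II (f k) := by
  classical
  induction s using Finset.induction_on with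
  | empty =>
    ext ⟨s, z⟩; rw [Finset.sum_empty, II_app]; simp
  | insert a s ha ih => rw [Finset.sum_insert ha, II_add, ih, Finset.sum_insert ha]
theorem dg_sum {κ : Type*} (s : Finset κ) (f : κ → SF5) : dg (∑ k ∈ s, f k) = ∑ k ∈ s, dg (f k) := by
  ext z; simp [dg, pb_app]
theorem DT5_II (i : Data P) (g : SF5) : DT5 i (II g) = II (DT5 i g) - dg g := by
  rw [DT5_app, DT5_app, dd_II, II_add, II_sum]
  simp only [D5_II, II_emb]
  simp; abel

theorem comm_c5 : CommOK (c5 P) (fun k l i => emb (dx k (vl i l))) := by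
  intro i k f
  change DT5 i (D5 k f) = D5 k (DT5 i f) - ∑ l, emb (dx k (vl i l)) * D5 l f
  have h1 : ∀ a b, dd (e5 a) (D5 b f) = D5 b (dd (e5 a) f) := fun a b => dd_comm _ _ _
  have h2 : ∀ l, D5 k (D5 l f) = D5 l (D5 k f) := fun l => dd_comm _ _ _
  simp only [DT5_app, map_add, map_sum, Der_mul, D5_emb, Finset.sum_add_distrib, h1, h2]
  abel

theorem emb_sy {m : ℕ} {A : Data P → ℝ} {f : Data P → SF} (hf : Sy (c0 P) m A f) :
    Sy (c5 P) m A (fun i => emb (f i)) :=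
  Sy.pull (c := c0 P) (c' := c5 P) id (fun _ => emb) (fun _ => rfl) (fun _ j f => D5_emb j f)
    (fun i f => DT5_emb i f) (fun _ z _ => ⟨z.2, mem_univ _, fun _ => rfl⟩) hf

theorem II_symN {A : Data P → ℝ} {g : Data P → SF5} {n : ℕ} (h : SymN (c5 P) n (A * wL) g) :
    SymN (c5 P) n A (fun i => II (g i)) := by
  induction n generalizing A g with
  | zero =>
    obtain ⟨C, hC, H⟩ := h
    refine ⟨C, hC, fun i z hz => ?_⟩
    obtain ⟨s, z⟩ := z
    have hz' : |s - z.1| ≤ i.L⁻¹ := hz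
    have h1 := II_norm (g i) s z (C * (A * wL : Data P → ℝ) i) fun r hr => H i (r, z) (hr.trans hz')
    have h0 : 0 ≤ C * (A * wL : Data P → ℝ) i := (norm_nonneg _).trans (H i (z.1, z) (by
      change |z.1 - z.1| ≤ i.L⁻¹
      rw [sub_self, abs_zero]; exact (abs_nonneg _).trans hz'))
    refine (h1.trans (mul_le_mul_of_nonneg_left hz' h0)).trans (le_of_eq ?_)
    have := (wL_pos i).ne'
    simp only [Pi.mul_apply, wL] at *
    field_simp
  | succ n ih =>
    refine ⟨ih h.1, fun j => ?_⟩
    change SymN (c5 P) n _ (fun i => D5 j (II (g i)))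
    simp only [D5_II]
    exact ih (h.2 j)
theorem II_sy {A : Data P → ℝ} {g : Data P → SF5} (h : Sy (c5 P) 0 (A * wL) g) :
    Sy (c5 P) 0 A (fun i => II (g i)) := fun n => II_symN (h n)

theorem D5_cmp (j : Fin 3) (f : SF) (Z : ZT) : D5 j (cmp f Z) = ∑ l, cmp (dx l f) Z * D5 j (zc Z l) := by
  rw [D5, dd_cmp]; simp [e5]
theorem DT5_cmp (i : Data P) (f : SF) (Z : ZT) :
    DT5 i (cmp f Z) = ∑ l, cmp (dx l f) Z * DT5 i (zc Z l) := by
  simp only [DT5_app, D5_cmp, mul_add, Finset.sum_add_distrib, Finset.mul_sum]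
  rw [dd_cmp]
  congr 1
  · simp [e5]
  · rw [Finset.sum_comm]
    exact Finset.sum_congr rfl fun _ _ => Finset.sum_congr rfl fun _ _ => by ring

theorem cmp_symN {A : Data P → ℝ} {f : Data P → SF} {Z : Data P → ZT}
    (hZ : ∀ j l, Sy (c5 P) 0 1 (fun i => D5 j (zc (Z i) l))) {n : ℕ} (hA : ∀ i, 0 ≤ A i)
    (hf : SymN (c0 P) n A f) : SymN (c5 P) n A (fun i => cmp (f i) (Z i)) := by
  induction n generalizing A f with
  | zero =>
    obtain ⟨C, hC, H⟩ := hf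
    exact ⟨C, hC, fun i z _ => H i _ (mem_univ _)⟩
  | succ n ih =>
    refine ⟨ih hA hf.1, fun j => ?_⟩
    change SymN (c5 P) n _ (fun i => D5 j (cmp (f i) (Z i)))
    simp only [D5_cmp, Fin.sum_univ_three]
    have hA2 : ∀ i, 0 ≤ (A * (c0 P).L) i := fun i => mul_nonneg (hA i) (zero_le_one.trans i.hL1)
    have key : ∀ l, SymN (c5 P) n (A * (c5 P).L) (fun i => cmp (dx l (f i)) (Z i) * D5 j (zc (Z i) l)) := by
      intro l
      have := (ih hA2 (hf.2 l)).mul (hZ j l n)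
      rw [mul_one] at this; exact this
    exact ((key 0).add (key 1)).add (key 2)
theorem cmp_sy {A : Data P → ℝ} {f : Data P → SF} {Z : Data P → ZT}
    (hZ : ∀ j l, Sy (c5 P) 0 1 (fun i => D5 j (zc (Z i) l))) (hA : ∀ i, 0 ≤ A i)
    (hf : Sy (c0 P) 0 A f) : Sy (c5 P) 0 A (fun i => cmp (f i) (Z i)) := fun n => cmp_symN hZ hA (hf n)

/-- coordinates -/
def Z0 : ZT := ⟨fun z => z.2.2, by fun_prop⟩
def xc (l : Fin 3) : SF5 := zc Z0 l
/-- Picard iterates of the backward flow -/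
def Zf (i : Data P) : ℕ → ZT
  | 0 => Z0
  | n+1 => ⟨fun z l => z.2.2 l + ((II (cmp (vl i l) (Zf i n))).1 z).re, by
      refine contDiff_pi.2 fun l => ?_
      exact (show ContDiff ℝ ∞ (fun z : V5 => z.2.2 l) by fun_prop).add
        (Complex.reCLM.contDiff.comp (SFo.cd (II (cmp (vl i l) (Zf i n)))))⟩
theorem cmp_rl {f : SF} (hf : Rl f) (Z : ZT) : Rl (cmp f Z) := fun _ => hf _
theorem zc_succ (i : Data P) (n : ℕ) (l : Fin 3) :
    zc (Zf i (n+1)) l = xc l + II (cmp (vl i l) (Zf i n)) := by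
  ext z
  have h := (II_rl (cmp_rl (vl_rl i l) (Zf i n))).re_eq z
  rw [SFo.add_app, ← h]
  exact Complex.ofReal_add _ _
theorem Zf_diag (i : Data P) (n : ℕ) (z : ℝ × Spc) : (Zf i n).1 (z.1, z) = z.2 := by
  cases n with
  | zero => rfl
  | succ n =>
    funext l
    change z.2 l + ((II (cmp (vl i l) (Zf i n))).1 (z.1, z)).re = z.2 l
    rw [II_app]; simp
theorem dg_cmp (i : Data P) (n : ℕ) (f : SF) : dg (cmp f (Zf i n)) = emb f := by
  ext z
  change f.1 (z.2.1, (Zf i n).1 (z.2.1, z.2)) = f.1 z.2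
  rw [Zf_diag]
theorem dd_xc (e : V5) (l : Fin 3) : dd e (xc l) = algebraMap ℂ SF5 (e.2.2 l) := by
  ext z
  have h3 : HasFDerivAt (xc l).1 (Complex.ofRealCLM.comp
        ((ContinuousLinearMap.proj (R := ℝ) (φ := fun _ : Fin 3 => ℝ) l).comp
        ((ContinuousLinearMap.snd ℝ ℝ Spc).comp (ContinuousLinearMap.snd ℝ ℝ (ℝ × Spc))))) z :=
    (Complex.ofRealCLM.comp
        ((ContinuousLinearMap.proj (R := ℝ) (φ := fun _ : Fin 3 => ℝ) l).comp
        ((ContinuousLinearMap.snd ℝ ℝ Spc).comp (ContinuousLinearMap.snd ℝ ℝ (ℝ × Spc))))).hasFDerivAt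
  rw [dd_app, h3.fderiv]; rfl
def del (j l : Fin 3) : ℂ := if j = l then 1 else 0
theorem D5_xc (j l : Fin 3) : D5 j (xc l) = algebraMap ℂ SF5 (del j l) := by
  rw [D5, dd_xc]
  congr 1
  simp [e5, eS, ex, del, Pi.single_apply, eq_comm]
  split_ifs <;> simp
theorem DT5_xc (i : Data P) (l : Fin 3) : DT5 i (xc l) = emb (vl i l) := by
  rw [DT5_app, dd_xc]
  simp only [D5_xc]
  ext z
  simp [e5, del]

theorem sy_const {ι V : Type} [NormedAddCommGroup V] [NormedSpace ℝ V] {c : Ctx V ι} {m : ℕ} (a : ℂ) :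
    Sy c m 1 (fun _ => algebraMap ℂ (SFo V) a) := by
  have := (Sy.one (c := c) (m := m)).smul a
  simpa [Algebra.algebraMap_eq_smul_one] using this

theorem zpos (i : Data P) : 0 ≤ (wk * wL : Data P → ℝ) i := (mul_pos (wk_pos i) (wL_pos i)).le
theorem D5_Z (n : ℕ) (j l : Fin 3) : Sy (c5 P) 0 1 (fun i => D5 j (zc (Zf i n) l)) ∧
    Sy (c5 P) 0 wk (fun i => D5 j (zc (Zf i n) l) - algebraMap ℂ SF5 (del j l)) := by
  induction n generalizing j l with
  | zero =>
    have h : ∀ i : Data P, D5 j (zc (Zf i 0) l) = algebraMap ℂ SF5 (del j l) := fun i => D5_xc j l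
    simp only [h, sub_self]
    exact ⟨sy_const _, Sy.zero fun i => (wk_pos i).le⟩
  | succ n ih =>
    have h2 : Sy (c5 P) 0 wk (fun i => D5 j (zc (Zf i (n+1)) l) - algebraMap ℂ SF5 (del j l)) := by
      simp only [zc_succ, map_add, D5_xc, add_sub_cancel_left, D5_II, D5_cmp]
      refine II_sy (Sy.sum _ zpos fun m _ => ?_)
      have := (cmp_sy (fun j l => (ih j l).1) zpos (sy_dvl m l)).mul (ih j m).1
      rwa [mul_one] at this
    refine ⟨?_, h2⟩
    have := (h2.mono1 (B := 1) wk_le).add (sy_const (del j l))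
    simpa using this

def En (i : Data P) (n : ℕ) (l : Fin 3) : SF5 := DT5 i (zc (Zf i n) l)
theorem En_zero (i : Data P) (l : Fin 3) : En i 0 l = emb (vl i l) := DT5_xc i l
theorem En_succ (i : Data P) (n : ℕ) (l : Fin 3) :
    En i (n+1) l = II (∑ m, cmp (dx m (vl i l)) (Zf i n) * En i n m) := by
  rw [En, zc_succ, map_add, DT5_xc, DT5_II, DT5_cmp, dg_cmp]
  simp only [En]; abel
theorem cmpn {A : Data P → ℝ} {f : Data P → SF} (n : ℕ) (hA : ∀ i, 0 ≤ A i) (hf : Sy (c0 P) 0 A f) :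
    Sy (c5 P) 0 A (fun i => cmp (f i) (Zf i n)) := cmp_sy (fun j l => (D5_Z n j l).1) hA hf
theorem En_sy (n : ℕ) (l : Fin 3) : Sy (c5 P) 0 (wk ^ n * wV) (fun i => En i n l) := by
  induction n generalizing l with
  | zero => simp only [En_zero, pow_zero, one_mul]; exact emb_sy (sy_vl l)
  | succ n ih =>
    simp only [En_succ]
    have hp : ∀ i, 0 ≤ (wk ^ (n+1) * wV * wL : Data P → ℝ) i := fun i =>
      (mul_pos (mul_pos (pow_pos (wk_pos i) _) (wV_pos i)) (wL_pos i)).le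
    refine II_sy (Sy.sum _ hp fun m _ => ?_)
    have := (cmpn n zpos (sy_dvl m l)).mul (ih m)
    convert this using 1
    ring
theorem dg_En (n : ℕ) (l : Fin 3) : Sy (c5 P) 0 (wk ^ n * wV) (fun i => dg (En i n l)) := by
  cases n with
  | zero =>
    simp only [En_zero, dg_emb, pow_zero, one_mul]; exact emb_sy (sy_vl l)
  | succ n =>
    simp only [En_succ, dg_II]
    exact Sy.zero fun i => (mul_pos (pow_pos (wk_pos i) _) (wV_pos i)).le
theorem DEn_sy (n : ℕ) (l : Fin 3) : Sy (c5 P) 0 (wk ^ n * (wV * wV) * wL) (fun i => DT5 i (En i n l)) := by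
  have hp : ∀ n i, 0 ≤ (wk ^ n * (wV * wV) * wL : Data P → ℝ) i := fun n i =>
      (mul_pos (mul_pos (pow_pos (wk_pos i) _) (mul_pos (wV_pos i) (wV_pos i))) (wL_pos i)).le
  induction n generalizing l with
  | zero =>
    simp only [En_zero, DT5_emb]
    refine (emb_sy (sy_Dvl l)).mono1 fun i => ?_
    simp only [Pi.mul_apply, pow_zero, one_mul]
    exact le_mul_of_one_le_left (wL_pos i).le (by nlinarith [wV_one i])
  | succ n ih =>
    simp only [En_succ, DT5_II, dg_sum, dg_mul, dg_cmp]
    refine Sy.sub (II_sy ?_) (Sy.sum _ (hp _) fun m _ => ?_)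
    · simp only [map_sum, Der_mul, DT5_cmp]
      have hp2 : ∀ i, 0 ≤ (wk ^ (n+1) * (wV * wV) * wL * wL : Data P → ℝ) i := fun i =>
        mul_nonneg (hp _ i) (wL_pos i).le
      refine Sy.sum _ hp2 fun m _ => Sy.add ?_ ?_
      · simp only [Finset.sum_mul]
        refine Sy.sum _ hp2 fun q _ => ?_
        have h1 := ((cmpn n (fun i => mul_nonneg (zpos i) (wL_pos i).le)
          ((sy_dvl (P := P) m l).dx0 q)).mul (En_sy n q)).mul (En_sy n m)
        refine h1.mono1 fun i => ?_
        change wk i * wL i * wL i * (wk i ^ n * wV i) * (wk i ^ n * wV i) ≤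
          wk i ^ (n+1) * (wV i * wV i) * wL i * wL i
        have e : wk i * wL i * wL i * (wk i ^ n * wV i) * (wk i ^ n * wV i) =
          wk i ^ n * (wk i ^ (n+1) * (wV i * wV i) * wL i * wL i) := by ring
        rw [e]
        exact mul_le_of_le_one_left (hp2 i) (pow_le_one₀ (wk_pos i).le (wk_le i))
      · have := (cmpn n zpos (sy_dvl m l)).mul (ih m)
        convert this using 1
        ring
    · have := (emb_sy (sy_dvl (P := P) m l)).mul (dg_En n m)
      refine this.mono1 fun i => ?_
      change wk i * wL i * (wk i ^ n * wV i) ≤ wk i ^ (n+1) * (wV i * wV i) * wL i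
      have e : wk i ^ (n+1) * (wV i * wV i) * wL i = (wk i * wL i * (wk i ^ n * wV i)) * wV i := by ring
      rw [e]
      exact le_mul_of_one_le_right (mul_nonneg (zpos i)
        (mul_pos (pow_pos (wk_pos i) _) (wV_pos i)).le) (wV_one i)
theorem wkV (i : Data P) : wk i ^ P * wV i = 1 := mul_inv_cancel₀ (pow_pos i.hκ0 P).ne'
abbrev NN (P : ℕ) : ℕ := (2 * P + 1) + 1
theorem wkNV (i : Data P) : wk i ^ NN P * (wV i * wV i) = wk i ^ 2 := by
  have : wk i ^ NN P * (wV i * wV i) = wk i ^ 2 * ((wk i ^ P * wV i) * (wk i ^ P * wV i)) := by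
    rw [NN, show 2 * P + 1 + 1 = P + P + 2 by ring, pow_add, pow_add]; ring
  rw [this, wkV]; ring
theorem E_sy1 (l : Fin 3) : Sy (c5 P) 1 (wk ^ 2) (fun i => En i (NN P) l) := by
  refine ⟨((En_sy (NN P) l).mono1 (B := wk ^ 2) fun i => ?_ : Sy (c5 P) 0 _ _),
    (DEn_sy (NN P) l).mono1 fun i => ?_⟩
  · change wk i ^ NN P * wV i ≤ wk i ^ 2
    rw [← wkNV]
    have := wV_one i
    exact mul_le_mul_of_nonneg_left (by nlinarith) (pow_pos (wk_pos i) _).le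
  · change wk i ^ NN P * (wV i * wV i) * wL i ≤ wk i ^ 2 * i.L
    rw [wkNV]; exact le_rfl

theorem Z_lip0 (n : ℕ) (l : Fin 3)
    (ih : ∀ l, Bd (c5 P) (wk ^ n * wV) (fun i => zc (Zf i (n+1)) l - zc (Zf i n) l)) :
    Bd (c5 P) (wk ^ (n+1) * wV * wL) (fun i => cmp (vl i l) (Zf i (n+1)) - cmp (vl i l) (Zf i n)) := by
  choose C hC H using ih
  obtain ⟨K, hK, HK⟩ : ∃ K : ℝ, 0 ≤ K ∧ ∀ j, ∀ i : Data P, ∀ z, ‖(dx j (vl i l)).1 z‖ ≤ K * (wk i * wL i) := by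
    choose K hK HK using fun j => (sy_dvl (P := P) j l).bd
    refine ⟨∑ j, K j, Finset.sum_nonneg fun j _ => hK j, fun j i z => (HK j i z (mem_univ _)).trans ?_⟩
    exact mul_le_mul_of_nonneg_right (Finset.single_le_sum (fun j _ => hK j) (Finset.mem_univ j)) (zpos i)
  refine ⟨3 * K * ∑ l, C l, by have := Finset.sum_nonneg fun l (_ : l ∈ Finset.univ) => hC l; positivity,
    fun i z hz => ?_⟩
  have h1 := lip_space (vl i l) _ (fun j z => HK j i z) z.1 ((Zf i n).1 z) ((Zf i (n+1)).1 z)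
  have h2 : ‖(Zf i (n+1)).1 z - (Zf i n).1 z‖ ≤ (∑ l, C l) * (wk ^ n * wV : Data P → ℝ) i := by
    have hp : 0 ≤ (wk ^ n * wV : Data P → ℝ) i := (mul_pos (pow_pos (wk_pos i) _) (wV_pos i)).le
    refine (pi_norm_le_iff_of_nonneg (mul_nonneg (Finset.sum_nonneg fun l _ => hC l) hp)).2 fun q => ?_
    have h3 := H q i z hz
    have h4 : (zc (Zf i (n+1)) q - zc (Zf i n) q).1 z = (((Zf i (n+1)).1 z - (Zf i n).1 z) q : ℝ) := by
      simp [zc]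
    rw [h4, Complex.norm_real] at h3
    refine h3.trans (mul_le_mul_of_nonneg_right (Finset.single_le_sum (fun j _ => hC j) (Finset.mem_univ q)) hp)
  have h5 : (cmp (vl i l) (Zf i (n+1)) - cmp (vl i l) (Zf i n)).1 z =
    (vl i l).1 (z.1, (Zf i (n+1)).1 z) - (vl i l).1 (z.1, (Zf i n).1 z) := by simp [cmp_app]
  rw [h5]
  refine h1.trans ((mul_le_mul_of_nonneg_left h2 (by have := zpos i; simp only [Pi.mul_apply] at this; positivity)).trans
    (le_of_eq ?_))
  simp only [Pi.mul_apply, Pi.pow_apply]; ring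
theorem Z_diff (n : ℕ) (l : Fin 3) : Bd (c5 P) (wk ^ n * wV) (fun i => zc (Zf i (n+1)) l - zc (Zf i n) l) := by
  induction n generalizing l with
  | zero =>
    have e : ∀ i : Data P, zc (Zf i (0+1)) l - zc (Zf i 0) l = II (cmp (vl i l) (Zf i 0)) := by
      intro i; rw [zc_succ]; exact add_sub_cancel_left _ _
    simp only [e]
    have h1 : ∀ i : Data P, wV i ≤ 1 * (wV * wL : Data P → ℝ) i := fun i => by
      rw [one_mul]; exact le_mul_of_one_le_right (wV_pos i).le (wL_one i)
    have := (II_sy ((cmpn 0 (fun i => (wV_pos i).le) (sy_vl l)).mono (B := wV * wL) 1 zero_le_one h1)).bd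
    simpa using this
  | succ n ih =>
    have e : ∀ i : Data P, zc (Zf i (n+1+1)) l - zc (Zf i (n+1)) l =
        II (cmp (vl i l) (Zf i (n+1)) + - cmp (vl i l) (Zf i n)) := by
      intro i
      rw [zc_succ, zc_succ, II_add]
      have : II (- cmp (vl i l) (Zf i n)) = - II (cmp (vl i l) (Zf i n)) := by
        ext ⟨s, z⟩
        rw [SFo.neg_app, II_app, II_app]; exact intervalIntegral.integral_neg
      rw [this]; abel
    simp only [e]
    have hm := Z_lip0 n l ih
    simp only [sub_eq_add_neg] at hm
    exact II_symN (n := 0) hm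
theorem Z_lip (n : ℕ) (l : Fin 3) :
    Bd (c5 P) (wk ^ (n+1) * wV * wL) (fun i => cmp (vl i l) (Zf i (n+1)) - cmp (vl i l) (Zf i n)) :=
  Z_lip0 n l fun l => Z_diff n l
end CI
end

noncomputable section
open MeasureTheory Set Filter Topology
open scoped ContDiff
set_option linter.unusedSectionVars false

namespace CI
section
variable {V : Type} [NormedAddCommGroup V] [NormedSpace ℝ V] {ι : Type} {c : Ctx V ι} {A B : ι → ℝ} {f g : ι → SFo V}
theorem Bd.neg (hf : Bd c A f) : Bd c A (fun i => - f i) := SymN.neg (n := 0) hf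
theorem Bd.sub (hf : Bd c A f) (hg : Bd c A g) : Bd c A (fun i => f i - g i) := SymN.sub (n := 0) hf hg
theorem Bd.sum {κ : Type*} (s : Finset κ) {f : κ → ι → SFo V} (hA : ∀ i, 0 ≤ A i)
    (hf : ∀ k ∈ s, Bd c A (f k)) : Bd c A (fun i => ∑ k ∈ s, f k i) := by
  classical
  induction s using Finset.induction_on with
  | empty => simpa using Bd.zero hA
  | insert a s ha ih =>
    simp only [Finset.sum_insert ha]
    exact Bd.add (hf a (Finset.mem_insert_self _ _)) (ih fun k hk => hf k (Finset.mem_insert_of_mem hk))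
end
variable {P : ℕ}

theorem wk2_le (i : Data P) : (wk ^ 2 : Data P → ℝ) i ≤ wk i := by
  have := wk_pos i
  have := wk_le i
  simp only [Pi.pow_apply]; nlinarith
theorem wk2_le1 (i : Data P) : (wk ^ 2 : Data P → ℝ) i ≤ (1 : Data P → ℝ) i := (wk2_le i).trans (wk_le i)

theorem cmp_sy1 {A : Data P → ℝ} {f : Data P → SF} (hA : ∀ i, 0 ≤ A i) (hf : Sy (c0 P) 0 A f) :
    Sy (c5 P) 1 A (fun i => cmp (f i) (Zf i (NN P))) := by
  have hA2 : ∀ i, 0 ≤ (A * wL : Data P → ℝ) i := fun i => mul_nonneg (hA i) (wL_pos i).le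
  refine ⟨cmpn _ hA hf, ?_⟩
  change Sy (c5 P) 0 (A * wL) (fun i => DT5 i (cmp (f i) (Zf i (NN P))))
  simp only [DT5_cmp]
  refine Sy.sum _ hA2 fun l _ => ?_
  have := (cmpn (NN P) hA2 (hf.dx0 l)).mul (((E_sy1 (P := P) l).zero_of).mono1 wk2_le1)
  rwa [mul_one] at this
theorem cmp_sy2 {A : Data P → ℝ} {f : Data P → SF} (hA : ∀ i, 0 ≤ A i) (hf : Sy (c0 P) 0 A f) :
    Sy (c5 P) 2 A (fun i => cmp (f i) (Zf i (NN P))) := by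
  have hA2 : ∀ i, 0 ≤ (A * wL : Data P → ℝ) i := fun i => mul_nonneg (hA i) (wL_pos i).le
  refine ⟨cmpn _ hA hf, ?_⟩
  change Sy (c5 P) 1 (A * wL) (fun i => DT5 i (cmp (f i) (Zf i (NN P))))
  simp only [DT5_cmp]
  refine Sy.sum _ hA2 fun l _ => ?_
  have := (cmp_sy1 hA2 (hf.dx0 l)).mul ((E_sy1 (P := P) l).mono1 wk2_le1)
  rwa [mul_one] at this

theorem DT5_D5Z (i : Data P) (j l : Fin 3) : DT5 i (D5 j (zc (Zf i (NN P)) l)) =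
    D5 j (En i (NN P) l) - ∑ m, emb (dx j (vl i m)) * D5 m (zc (Zf i (NN P)) l) := comm_c5 i j _
theorem Dconst {V : Type} [NormedAddCommGroup V] [NormedSpace ℝ V] (D : Derivation ℂ (SFo V) (SFo V)) (a : ℂ) :
    D (algebraMap ℂ (SFo V) a) = 0 := D.map_algebraMap a
theorem Z_sy1 (j l : Fin 3) :
    Sy (c5 P) 1 wk (fun i => D5 j (zc (Zf i (NN P)) l) - algebraMap ℂ SF5 (del j l)) := by
  refine ⟨(D5_Z (NN P) j l).2, ?_⟩
  change Sy (c5 P) 0 (wk * wL) (fun i => DT5 i (D5 j (zc (Zf i (NN P)) l) - algebraMap ℂ SF5 (del j l)))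
  simp only [map_sub, Dconst, sub_zero, DT5_D5Z]
  refine Sy.sub ?_ (Sy.sum _ zpos fun m _ => ?_)
  · exact ((E_sy1 l).mono1 (B := wk) wk2_le).zero_of.dx0 j
  · have := (emb_sy (sy_dvl (P := P) j m)).mul (D5_Z (NN P) m l).1
    rwa [mul_one] at this
theorem Z_sy1' (j l : Fin 3) : Sy (c5 P) 1 1 (fun i => D5 j (zc (Zf i (NN P)) l)) := by
  have := ((Z_sy1 (P := P) j l).mono1 (B := 1) wk_le).add (sy_const (del j l))
  simpa using this
theorem Z_sy2 (j l : Fin 3) : Sy (c5 P) 2 1 (fun i => D5 j (zc (Zf i (NN P)) l)) := by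
  refine ⟨(D5_Z (NN P) j l).1, ?_⟩
  change Sy (c5 P) 1 (1 * wL) (fun i => DT5 i (D5 j (zc (Zf i (NN P)) l)))
  simp only [DT5_D5Z, one_mul]
  refine Sy.sub ?_ (Sy.sum _ (fun i => (wL_pos i).le) fun m _ => ?_)
  · have := Sy.dx (comm_c5 (P := P)) (m := 1) (fun k l => ?_) (fun _ => zero_le_one)
      ((E_sy1 (P := P) l).mono1 (B := 1) wk2_le1) j
    · exact this.mono1 fun i => (one_mul (wL i)).le
    · exact (emb_sy (sy1_dvl (P := P) k l)).zero_of
  · have := (emb_sy (sy1_dvl (P := P) j m)).mul (Z_sy1' m l)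
    rwa [mul_one] at this

theorem mR_flow (a b : Fin 3) : Bd (c5 P) wk (fun i => cmp (mR i a b) (Zf i (NN P)) - emb (mR i a b)) := by
  have e : ∀ i : Data P, cmp (mR i a b) (Zf i (NN P)) - emb (mR i a b) =
      II (dd eT (cmp (mR i a b) (Zf i (NN P)))) := fun i => by rw [II_dT, dg_cmp]
  have e2 : ∀ i : Data P, dd eT (cmp (mR i a b) (Zf i (NN P))) =
      cmp (DT i (mR i a b)) (Zf i (NN P)) - ∑ l, cmp (dx l (mR i a b)) (Zf i (NN P)) *
        (cmp (vl i l) (Zf i (NN P)) - cmp (vl i l) (Zf i (2 * P + 1))) := by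
    intro i
    have hz : ∀ l, dd eT (zc (Zf i (NN P)) l) = cmp (vl i l) (Zf i (2 * P + 1)) := by
      intro l
      rw [NN, zc_succ, map_add, dT_II, dd_xc]
      simp [eT]
    rw [dd_cmp]
    simp only [hz]
    ext z
    simp [DT_app, cmp_app, eT, mul_sub]
    simp only [mul_comm]; ring
  simp only [e]
  refine II_symN (n := 0) ?_
  change Bd (c5 P) (wk * wL) _
  simp only [e2]
  refine Bd.sub (cmpn (NN P) zpos (sy_DmR a b)).bd ?_
  have key : ∀ l, Bd (c5 P) (wk * wL) (fun i => cmp (dx l (mR i a b)) (Zf i (NN P)) *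
        (cmp (vl i l) (Zf i (NN P)) - cmp (vl i l) (Zf i (2 * P + 1)))) := by
    intro l
    have h1 := (cmpn (NN P) zpos (sy_dmR (P := P) l a b)).bd
    have h2 := Z_lip (P := P) (2 * P + 1) l
    refine (h1.mul h2).mono 1 zero_le_one fun i => ?_
    rw [one_mul]
    change wk i * wL i * (wk i ^ (2 * P + 1 + 1) * wV i * wL i) ≤ wk i * wL i
    refine mul_le_of_le_one_right (zpos i) ?_
    have hL : wL i ≤ wV i := by
      have := i.hLP
      rw [wV, ← one_div, le_div_iff₀ (pow_pos i.hκ0 P)]; exact this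
    have h5 := wkNV i
    calc wk i ^ (2 * P + 1 + 1) * wV i * wL i ≤ wk i ^ (2 * P + 1 + 1) * wV i * wV i :=
          mul_le_mul_of_nonneg_left hL (mul_pos (pow_pos (wk_pos i) _) (wV_pos i)).le
      _ = wk i ^ 2 := by rw [← h5]; ring
      _ ≤ 1 := pow_le_one₀ (wk_pos i).le (wk_le i)
  exact Bd.sum _ zpos fun l _ => key l

/-- periodicity -/
theorem Zf_per (i : Data P) (n : ℕ) (k : Fin 3 → ℤ) (s : ℝ) (z : ℝ × Spc) :
    (Zf i n).1 (s, z + kv k) = (Zf i n).1 (s, z) + (kv k).2 := by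
  induction n generalizing s with
  | zero => rfl
  | succ n ih =>
    funext l
    change (z + kv k).2 l + ((II (cmp (vl i l) (Zf i n))).1 (s, z + kv k)).re =
      z.2 l + ((II (cmp (vl i l) (Zf i n))).1 (s, z)).re + (kv k).2 l
    have e : (II (cmp (vl i l) (Zf i n))).1 (s, z + kv k) = (II (cmp (vl i l) (Zf i n))).1 (s, z) := by
      rw [II_app, II_app]
      have : (z + kv k).1 = z.1 := by simp [kv]
      rw [this]
      refine intervalIntegral.integral_congr fun r _ => ?_
      simp only [cmp_app, ih]
      have := vl_pk i l k (r, (Zf i n).1 (r, z))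
      have e3 : ((r, (Zf i n).1 (r, z)) : ℝ × Spc) + kv k = (r, (Zf i n).1 (r, z) + (kv k).2) :=
        Prod.ext (by simp [kv]) rfl
      rw [e3] at this; exact this
    rw [e]; simp; ring

/-- general context over data -/
def cL {ι : Type} (π : ι → Data P) (Dm : ι → Set (ℝ × Spc)) : Ctx (ℝ × Spc) ι where
  L i := (π i).L
  hL i := (π i).hL1
  Dom := Dm
  D := dx
  Dt i := DT (π i)
def wl : Data P → ℝ := fun i => i.L / i.κ
theorem wL_le_wl (i : Data P) : wL i ≤ wl i := by
  rw [wl, le_div_iff₀ i.hκ0]; exact mul_le_of_le_one_right (wL_pos i).le i.hκ1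
theorem wl_one (i : Data P) : 1 ≤ wl i := (wL_one i).trans (wL_le_wl i)
theorem wl_pos (i : Data P) : 0 < wl i := (wL_pos i).trans_le (wL_le_wl i)
theorem wk_wl (i : Data P) : wk i * wl i = wL i := mul_div_cancel₀ _ i.hκ0.ne'
def cl {ι : Type} (π : ι → Data P) (Dm : ι → Set (ℝ × Spc)) : Ctx (ℝ × Spc) ι where
  L i := wl (π i)
  hL i := wl_one (π i)
  Dom := Dm
  D := dx
  Dt i := DT (π i)

section gen
variable {ι : Type} {π : ι → Data P} {Dm : ι → Set (ℝ × Spc)} {A : ι → ℝ} {f : ι → SF}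
theorem SymN.up {n : ℕ} (hA : ∀ i, 0 ≤ A i) (h : SymN (cL π Dm) n A f) : SymN (cl π Dm) n A f := by
  induction n generalizing A f with
  | zero => exact h
  | succ n ih =>
    refine ⟨ih hA h.1, fun j => ?_⟩
    have h1 := ih (fun i => mul_nonneg (hA i) (wL_pos (π i)).le) (h.2 j)
    exact h1.mono 1 zero_le_one fun i => by
      rw [one_mul]; exact mul_le_mul_of_nonneg_left (wL_le_wl (π i)) (hA i)
theorem Sy.up {m : ℕ} (hA : ∀ i, 0 ≤ A i) (h : Sy (cL π Dm) m A f) : Sy (cl π Dm) m A f := by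
  induction m generalizing A f with
  | zero => exact fun n => SymN.up hA (h n)
  | succ m ih =>
    refine ⟨fun n => SymN.up hA (h.symN n), ?_⟩
    have h1 := ih (fun i => mul_nonneg (hA i) (wL_pos (π i)).le) h.2
    exact h1.mono 1 zero_le_one fun i => by
      rw [one_mul]; exact mul_le_mul_of_nonneg_left (wL_le_wl (π i)) (hA i)
theorem comm_cL : CommOK (cL π Dm) (fun k l i => dx k (vl (π i) l)) := fun i k f => comm_c0 (π i) k f
theorem comm_cl : CommOK (cl π Dm) (fun k l i => dx k (vl (π i) l)) := fun i k f => comm_c0 (π i) k f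
theorem pull0 {m : ℕ} {A : Data P → ℝ} {f : Data P → SF} (hf : Sy (c0 P) m A f) :
    Sy (cL π Dm) m (A ∘ π) (fun i => f (π i)) :=
  Sy.pull (c := c0 P) (c' := cL π Dm) π (fun _ f => f) (fun _ => rfl) (fun _ _ _ => rfl)
    (fun _ _ => rfl) (fun _ z _ => ⟨z, mem_univ _, fun _ => rfl⟩) hf
theorem pullG {ι' : Type} (τ : ι' → ι) {Dm' : ι' → Set (ℝ × Spc)} (hD : ∀ i, Dm' i ⊆ Dm (τ i)) {m : ℕ}
    (hf : Sy (cL π Dm) m A f) :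
    Sy (cL (π ∘ τ) Dm') m (A ∘ τ) (fun i => f (τ i)) :=
  Sy.pull (c := cL π Dm) (c' := cL (π ∘ τ) Dm') τ (fun _ f => f) (fun _ => rfl) (fun _ _ _ => rfl)
    (fun _ _ => rfl) (fun i z hz => ⟨z, hD i hz, fun _ => rfl⟩) hf
/-- spatial derivative of symbols -/
theorem Sy.dxL {m : ℕ} (hm : m ≤ 2) (hA : ∀ i, 0 ≤ A i) (hf : Sy (cL π Dm) m A f) (j : Fin 3) :
    Sy (cL π Dm) m (A * (cL π Dm).L) (fun i => CI.dx j (f i)) := by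
  refine Sy.dx (c := cL π Dm) comm_cL (fun k l => ?_) hA hf j
  have h1 : Sy (cL π Dm) 1 (cL π Dm).L (fun i => CI.dx k (vl (π i) l)) := pull0 (sy1_dvl k l)
  interval_cases m
  · exact h1.zero_of
  · exact h1.zero_of
  · exact h1
end gen

/-- slabs -/
abbrev I1 (P : ℕ) := Data P × ℤ
def p1 : I1 P → Data P := Prod.fst
def Dj (q : I1 P) : Set (ℝ × Spc) := {z | |q.1.L * z.1 - q.2| ≤ 3/4}
abbrev c1 (P : ℕ) := cL (P := P) p1 Dj
def tj (q : I1 P) : ℝ := q.2 / q.1.L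
theorem Dj_closed (q : I1 P) : IsClosed (Dj q) := isClosed_le (by fun_prop) continuous_const
theorem pull5 {m : ℕ} {A : Data P → ℝ} {f : Data P → SF5} (hf : Sy (c5 P) m A f) :
    Sy (c1 P) m (A ∘ p1) (fun q => sl (tj q) (f (p1 q))) := by
  refine Sy.pull (c := c5 P) (c' := c1 P) p1 (fun q f => sl (tj q) f) (fun _ => rfl)
    (fun q j f => D5_sl _ _ _) (fun q f => DT5_sl _ _ _) (fun q z hz => ⟨(tj q, z), ?_, fun _ => rfl⟩) hf
  have hL := wL_pos q.1
  change |(q.2 : ℝ) / q.1.L - z.1| ≤ q.1.L⁻¹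
  have hz' : |q.1.L * z.1 - q.2| ≤ 3/4 := hz
  have e : (q.2 : ℝ) / q.1.L - z.1 = - (q.1.L * z.1 - q.2) * q.1.L⁻¹ := by
    have : q.1.L ≠ 0 := hL.ne'
    field_simp; ring
  have hi : (0:ℝ) < q.1.L⁻¹ := inv_pos.2 hL
  rw [e, abs_mul, abs_neg, abs_of_pos hi]
  nlinarith

def Xj (q : I1 P) (l : Fin 3) : SF := sl (tj q) (zc (Zf (p1 q) (NN P)) l)
def Ej (q : I1 P) (l : Fin 3) : SF := sl (tj q) (En (p1 q) (NN P) l)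
def Rj (q : I1 P) (a b : Fin 3) : SF := sl (tj q) (cmp (mR (p1 q) a b) (Zf (p1 q) (NN P)))
def gX (q : I1 P) (n l : Fin 3) : SF := dx n (Xj q l) - algebraMap ℂ SF (del n l)
theorem DT_Xj (q : I1 P) (l) : DT (p1 q) (Xj q l) = Ej q l := DT5_sl _ _ _
theorem Ej_sy (l : Fin 3) : Sy (c1 P) 1 ((wk ^ 2 : Data P → ℝ) ∘ p1) (fun q => Ej q l) := pull5 (E_sy1 l)
theorem gX_eq (q : I1 P) (n l) : gX q n l =
    sl (tj q) (D5 n (zc (Zf (p1 q) (NN P)) l) - algebraMap ℂ SF5 (del n l)) := by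
  rw [gX, Xj, D5_sl]; rfl
theorem gX_sy1 (n l : Fin 3) : Sy (c1 P) 1 (wk ∘ p1) (fun q => gX q n l) := by
  simp only [gX_eq]; exact pull5 (Z_sy1 n l)
theorem gX_sy2 (n l : Fin 3) : Sy (c1 P) 2 1 (fun q => gX q n l) := by
  simp only [gX_eq]
  exact pull5 (A := 1) ((Z_sy2 n l).sub (sy_const _))
theorem Rj_sy (a b : Fin 3) : Sy (c1 P) 2 1 (fun q => Rj q a b) :=
  pull5 (A := 1) (cmp_sy2 (fun _ => zero_le_one) (sy_mR a b))
theorem Rj_near (a b : Fin 3) : Bd (c1 P) (wk ∘ p1) (fun q => mR (p1 q) a b - Rj q a b) := by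
  obtain ⟨C, hC, H⟩ := mR_flow (P := P) a b
  refine ⟨C, hC, fun q z hz => ?_⟩
  have hd : ((tj q, z) : V5) ∈ (c5 P).Dom q.1 := by
    have hL := wL_pos q.1
    change |(q.2 : ℝ) / q.1.L - z.1| ≤ q.1.L⁻¹
    have hz' : |q.1.L * z.1 - q.2| ≤ 3/4 := hz
    have e : (q.2 : ℝ) / q.1.L - z.1 = - (q.1.L * z.1 - q.2) * q.1.L⁻¹ := by
      have : q.1.L ≠ 0 := hL.ne'
      field_simp; ring
    have hi : (0:ℝ) < q.1.L⁻¹ := inv_pos.2 hL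
    rw [e, abs_mul, abs_neg, abs_of_pos hi]
    nlinarith
  have := H q.1 _ hd
  rw [SFo.sub_app, norm_sub_rev]
  exact this
theorem Rj_bound : ∃ C : ℝ, 0 ≤ C ∧ ∀ (q : I1 P) a b z, ‖(Rj q a b).1 z‖ ≤ C := by
  choose C hC H using fun a b => (sy_mR (P := P) a b).bd
  refine ⟨∑ a, ∑ b, C a b, Finset.sum_nonneg fun a _ => Finset.sum_nonneg fun b _ => hC a b, fun q a b z => ?_⟩
  refine (H a b q.1 _ (mem_univ _)).trans ?_
  simp only [Pi.one_apply, mul_one]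
  exact (Finset.single_le_sum (fun b _ => hC a b) (Finset.mem_univ b)).trans
    (Finset.single_le_sum (f := fun a => ∑ b, C a b) (fun a _ => Finset.sum_nonneg fun b _ => hC a b) (Finset.mem_univ a))
theorem Rj_rl (q : I1 P) (a b) : Rl (Rj q a b) := fun _ => mR_rl q.1 a b _
theorem Rj_symm (q : I1 P) (a b) : Rj q a b = Rj q b a := by rw [Rj, Rj, mR_symm]
theorem Xj_rl (q : I1 P) (l) : Rl (Xj q l) := fun _ => Complex.ofReal_im _
theorem Xj_per (q : I1 P) (l) (k : Fin 3 → ℤ) (z) : (Xj q l).1 (z + kv k) = (Xj q l).1 z + k l := by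
  change (((Zf (p1 q) (NN P)).1 (tj q, z + kv k) l : ℝ) : ℂ) = ((Zf (p1 q) (NN P)).1 (tj q, z) l : ℝ) + _
  rw [Zf_per]; simp [kv]
theorem Rj_pk (q : I1 P) (a b) (k : Fin 3 → ℤ) : Pk (kv k) (Rj q a b) := by
  intro z
  change (mR (p1 q) a b).1 (tj q, (Zf (p1 q) (NN P)).1 (tj q, z + kv k)) =
    (mR (p1 q) a b).1 (tj q, (Zf (p1 q) (NN P)).1 (tj q, z))
  rw [Zf_per]
  have := mR_pk (p1 q) a b k (tj q, (Zf (p1 q) (NN P)).1 (tj q, z))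
  have e3 : ((tj q, (Zf (p1 q) (NN P)).1 (tj q, z)) : ℝ × Spc) + kv k =
      (tj q, (Zf (p1 q) (NN P)).1 (tj q, z) + (kv k).2) := Prod.ext (by simp [kv]) rfl
  rw [e3] at this; exact this
end CI
end

noncomputable section
open MeasureTheory Set Filter Topology
open scoped ContDiff
set_option linter.unusedSectionVars false

namespace CI
variable {P : ℕ}
section mode
variable {ι : Type} (π : ι → Data P) (Dm : ι → Set (ℝ × Spc))

/-- oscillating modes -/
structure Mode where
  e : ι → SF
  m : ι → Fin 3 → ℝ
  g : Fin 3 → ι → SF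
  h : ι → SF
  M : ℝ
  hM : ∀ i n, |m i n| ≤ M
  hm : ∀ i, m i = 0 ∨ 1 ≤ ∑ n, m i n ^ 2
  de : ∀ i n, dx n (e i) = (Complex.I * wl (π i)) • ((algebraMap ℂ SF (m i n) + g n i) * e i)
  De : ∀ i, DT (π i) (e i) = (Complex.I * wl (π i)) • (h i * e i)
  gs : ∀ n, Sy (cL π Dm) 1 (wk ∘ π) (g n)
  hs : Sy (cL π Dm) 1 ((wk ^ 2 : Data P → ℝ) ∘ π) h
  ne : ∀ i z, ‖(e i).1 z‖ = 1

variable {π Dm} (μ : Mode π Dm)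
variable {A : ι → ℝ}

theorem cexp_norm (i : ι) : ‖(Complex.I * wl (π i) : ℂ)‖ = wl (π i) := by
  rw [norm_mul, Complex.norm_I, one_mul, Complex.norm_real, Real.norm_of_nonneg (wl_pos _).le]
theorem sy_bconst {c : Ctx (ℝ × Spc) ι} {m : ℕ} (a : ι → ℂ) (M : ℝ) (ha : ∀ i, ‖a i‖ ≤ M) :
    Sy c m 1 (fun i => algebraMap ℂ SF (a i)) := by
  have h := (Sy.one (c := c) (m := m)).csmul (B := fun _ => |M|) a (fun i => (ha i).trans (le_abs_self M))
  have h2 := h.mono |M| (abs_nonneg _) (B := 1) (fun i => by simp)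
  simpa [Algebra.algebraMap_eq_smul_one] using h2

theorem wk_nonneg (i : ι) : 0 ≤ (wk ∘ π) i := (wk_pos _).le

theorem Mode.mg_sy (n : Fin 3) : Sy (cl π Dm) 1 1 (fun i => algebraMap ℂ SF (μ.m i n) + μ.g n i) := by
  refine Sy.add (sy_bconst _ μ.M fun i => ?_) ?_
  · rw [Complex.norm_real]; exact μ.hM i n
  · exact (Sy.up wk_nonneg (μ.gs n)).mono1 fun i => wk_le _
theorem Mode.h_sy : Sy (cl π Dm) 1 1 μ.h :=
  (Sy.up (fun i => (pow_pos (wk_pos (π i)) 2).le) μ.hs).mono1 fun i => pow_le_one₀ (wk_pos _).le (wk_le _)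

theorem Mode.e_sy : Sy (cl π Dm) 1 1 μ.e := by
  have h0 : Sy (cl π Dm) 0 1 μ.e := by
    intro n
    induction n with
    | zero => exact ⟨1, zero_le_one, fun i z _ => by simp [μ.ne]⟩
    | succ n ih =>
      refine ⟨ih, fun j => ?_⟩
      change SymN (cl π Dm) n _ (fun i => dx j (μ.e i))
      simp only [μ.de]
      have := (((μ.mg_sy j).symN n).mul ih).csmul (B := (cl π Dm).L) (fun i => Complex.I * wl (π i))
        (fun i => (cexp_norm i).le)
      simpa using this
  refine ⟨h0, ?_⟩
  change Sy (cl π Dm) 0 _ (fun i => DT (π i) (μ.e i))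
  simp only [μ.De]
  have := ((μ.h_sy.zero_of).mul h0).csmul (B := (cl π Dm).L) (fun i => Complex.I * wl (π i))
        (fun i => (cexp_norm i).le)
  simpa using this

def Mode.q (i : ι) : ℝ := (∑ n, μ.m i n ^ 2)⁻¹
theorem Mode.q_bd (i : ι) : |μ.q i| ≤ 1 := by
  rcases μ.hm i with h | h
  · simp [Mode.q, h]
  · rw [Mode.q, abs_of_nonneg (by positivity)]; exact inv_le_one_of_one_le₀ h

/-- symmetric solution of `S m = u` -/
def Mode.S (u : Fin 3 → ι → SF) (a b : Fin 3) (i : ι) : SF :=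
  ((μ.q i * μ.m i b : ℝ) : ℂ) • u a i + ((μ.q i * μ.m i a : ℝ) : ℂ) • u b i -
    ∑ n, ((μ.q i ^ 2 * μ.m i n * μ.m i a * μ.m i b : ℝ) : ℂ) • u n i
def Mode.ila (_ : Mode π Dm) (i : ι) : ℂ := (Complex.I * wl (π i))⁻¹
def Mode.T (u : Fin 3 → ι → SF) (b : Fin 3) (i : ι) : SF :=
  - ∑ a, (μ.S u a b i * μ.g a i + μ.ila i • dx a (μ.S u a b i))

theorem Mode.S_symm (u) (a b : Fin 3) (i : ι) : μ.S u a b i = μ.S u b a i := by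
  unfold Mode.S
  rw [add_comm]; congr 1
  refine Finset.sum_congr rfl fun n _ => ?_
  congr 2; ring

theorem Mode.S_m (u : Fin 3 → ι → SF) (i : ι) (hu : μ.m i = 0 → ∀ b, u b i = 0) (b : Fin 3) :
    ∑ a, (μ.m i a : ℂ) • μ.S u a b i = u b i := by
  rcases μ.hm i with h | h
  · rw [hu h]; simp [h]
  · have hq : μ.q i * ∑ n, μ.m i n ^ 2 = 1 := inv_mul_cancel₀ (by linarith)
    ext z
    simp only [SFo.sum_app, Mode.S, SFo.smul_app, SFo.add_app, SFo.sub_app]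
    have hq' : (μ.q i : ℂ) * (μ.m i 0 ^ 2 + μ.m i 1 ^ 2 + μ.m i 2 ^ 2) = 1 := by
      rw [Fin.sum_univ_three] at hq; exact_mod_cast hq
    simp only [Fin.sum_univ_three]
    push_cast
    generalize ((μ.q i : ℝ) : ℂ) = q at *
    generalize ((μ.m i 0 : ℝ) : ℂ) = m0 at *
    generalize ((μ.m i 1 : ℝ) : ℂ) = m1 at *
    generalize ((μ.m i 2 : ℝ) : ℂ) = m2 at *
    linear_combination ((u b i).1 z - q * (μ.m i b : ℂ) * (m0 * (u 0 i).1 z + m1 * (u 1 i).1 z + m2 * (u 2 i).1 z)) * hq'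

theorem Mode.ila_mul (i : ι) : μ.ila i * (Complex.I * wl (π i)) = 1 := by
  refine inv_mul_cancel₀ (mul_ne_zero Complex.I_ne_zero ?_)
  exact_mod_cast (wl_pos (π i)).ne'

theorem Mode.step (u : Fin 3 → ι → SF) (i : ι) (hu : μ.m i = 0 → ∀ b, u b i = 0) (b : Fin 3) :
    u b i * μ.e i = ∑ a, dx a ((μ.ila i • μ.S u a b i) * μ.e i) + μ.T u b i * μ.e i := by
  have key : ∀ a, dx a ((μ.ila i • μ.S u a b i) * μ.e i) =
      (μ.ila i • dx a (μ.S u a b i)) * μ.e i +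
      ((μ.m i a : ℂ) • μ.S u a b i + μ.S u a b i * μ.g a i) * μ.e i := by
    intro a
    rw [dx_mul, Derivation.map_smul, μ.de]
    congr 1
    rw [smul_mul_assoc, mul_smul_comm, smul_smul, μ.ila_mul, one_smul, Algebra.algebraMap_eq_smul_one, add_mul, mul_add, smul_mul_assoc, one_mul, mul_smul_comm, add_mul, smul_mul_assoc]
    ring
  simp only [key]
  simp only [Finset.sum_add_distrib, ← Finset.sum_mul, Mode.T, μ.S_m u i hu b]
  ring

theorem Mode.T_zero (u : Fin 3 → ι → SF) (i : ι) (h : μ.m i = 0) (b : Fin 3) : μ.T u b i = 0 := by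
  simp [Mode.T, Mode.S, h]

def Mode.Tn : ℕ → (Fin 3 → ι → SF) → (Fin 3 → ι → SF)
  | 0, u => u
  | n+1, u => Mode.T μ (Mode.Tn n u)
def Mode.St (N : ℕ) (u : Fin 3 → ι → SF) (a b : Fin 3) (i : ι) : SF :=
  ∑ n ∈ Finset.range N, μ.ila i • μ.S (μ.Tn n u) a b i

theorem Mode.St_symm (N u) (a b : Fin 3) (i : ι) : μ.St N u a b i = μ.St N u b a i := by
  unfold Mode.St; refine Finset.sum_congr rfl fun n _ => by rw [μ.S_symm]

theorem Mode.steps (N : ℕ) (u : Fin 3 → ι → SF) (i : ι) (hu : μ.m i = 0 → ∀ b, u b i = 0) (b : Fin 3) :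
    u b i * μ.e i = ∑ a, dx a (μ.St N u a b i * μ.e i) + μ.Tn N u b i * μ.e i := by
  induction N with
  | zero => simp [Mode.St, Mode.Tn]
  | succ N ih =>
    have hN : μ.m i = 0 → ∀ b, μ.Tn N u b i = 0 := by
      intro h b
      cases N with
      | zero => exact hu h b
      | succ N => exact μ.T_zero _ i h b
    rw [ih, μ.step _ i hN b]
    simp only [Mode.St, Finset.sum_range_succ, add_mul, map_add, Finset.sum_add_distrib]
    rw [add_assoc]; rfl

theorem Mode.q_real (μ : Mode π Dm) (i : ι) (a : Fin 3) : ‖((μ.q i * μ.m i a : ℝ) : ℂ)‖ ≤ |μ.M| := by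
  rw [Complex.norm_real, Real.norm_eq_abs, abs_mul]
  have h1 := μ.q_bd i
  have h2 := (μ.hM i a).trans (le_abs_self _)
  calc _ ≤ 1 * |μ.M| := mul_le_mul h1 h2 (abs_nonneg _) zero_le_one
    _ = _ := one_mul _

theorem Sy.bsmul {c : Ctx (ℝ × Spc) ι} {m : ℕ} {f : ι → SF} (a : ι → ℂ) (M : ℝ) (ha : ∀ i, ‖a i‖ ≤ M)
    (hf : Sy c m A f) : Sy c m A (fun i => a i • f i) := by
  have := (sy_bconst (c := c) (m := m) a M ha).mul hf
  simpa [Algebra.algebraMap_eq_smul_one] using this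

theorem Mode.S_sy (hA : ∀ i, 0 ≤ A i) {u : Fin 3 → ι → SF} (hu : ∀ b, Sy (cL π Dm) 1 A (u b)) (a b : Fin 3) :
    Sy (cL π Dm) 1 A (μ.S u a b) := by
  refine Sy.sub (Sy.add ?_ ?_) (Sy.sum _ hA fun n _ => ?_)
  · exact (hu a).bsmul _ |μ.M| fun i => μ.q_real i b
  · exact (hu b).bsmul _ |μ.M| fun i => μ.q_real i a
  · refine (hu n).bsmul _ (|μ.M| * |μ.M| * |μ.M|) fun i => ?_
    have e : μ.q i ^ 2 * μ.m i n * μ.m i a * μ.m i b = (μ.q i * μ.m i n) * (μ.q i * μ.m i a) * μ.m i b := by ring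
    rw [e, Complex.ofReal_mul, Complex.ofReal_mul, norm_mul, norm_mul]
    have h3 : ‖((μ.m i b : ℝ) : ℂ)‖ ≤ |μ.M| := by
      rw [Complex.norm_real]; exact (μ.hM i b).trans (le_abs_self _)
    have h1 := μ.q_real i n
    have h2 := μ.q_real i a
    gcongr

theorem Mode.ila_norm (i : ι) : ‖μ.ila i‖ = (wl (π i))⁻¹ := by
  rw [Mode.ila, norm_inv, cexp_norm]
theorem wL_il (i : Data P) : wL i * (wl i)⁻¹ = wk i := by
  rw [← wk_wl, mul_assoc, mul_inv_cancel₀ (wl_pos i).ne', mul_one]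

theorem Mode.T_sy (hA : ∀ i, 0 ≤ A i) {u : Fin 3 → ι → SF} (hu : ∀ b, Sy (cL π Dm) 1 A (u b)) (b : Fin 3) :
    Sy (cL π Dm) 1 (A * (wk ∘ π)) (μ.T u b) := by
  refine Sy.neg (Sy.sum _ (fun i => mul_nonneg (hA i) (wk_nonneg i)) fun a _ => Sy.add ?_ ?_)
  · exact (μ.S_sy hA hu a b).mul (μ.gs a)
  · have := (Sy.dxL (by norm_num) hA (μ.S_sy hA hu a b) a).csmul (B := fun i => (wl (π i))⁻¹) μ.ila
      (fun i => (μ.ila_norm i).le)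
    refine this.mono1 fun i => ?_
    simp only [Pi.mul_apply, Function.comp]
    rw [← wL_il (π i)]
    change (wl (π i))⁻¹ * (A i * wL (π i)) ≤ _
    exact le_of_eq (by ring)

theorem Mode.Tn_sy (hA : ∀ i, 0 ≤ A i) {u : Fin 3 → ι → SF} (hu : ∀ b, Sy (cL π Dm) 1 A (u b)) (N : ℕ) (b : Fin 3) :
    Sy (cL π Dm) 1 (A * (wk ∘ π) ^ N) (μ.Tn N u b) := by
  induction N generalizing b with
  | zero => simpa [Mode.Tn] using hu b
  | succ N ih =>
    have := μ.T_sy (A := A * (wk ∘ π) ^ N) (fun i => mul_nonneg (hA i) (pow_nonneg (wk_nonneg i) N)) ih b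
    rw [pow_succ, ← mul_assoc]; exact this

theorem Mode.St_sy {u : Fin 3 → ι → SF} (hu : ∀ b, Sy (cL π Dm) 1 (wL ∘ π) (u b)) (N : ℕ) (a b : Fin 3) :
    Sy (cL π Dm) 1 (wk ∘ π) (μ.St N u a b) := by
  have hA : ∀ i, 0 ≤ (wL ∘ π) i := fun i => (wL_pos _).le
  refine Sy.sum _ wk_nonneg fun n _ => ?_
  have h1 := μ.S_sy (A := (wL ∘ π) * (wk ∘ π) ^ n) (fun i => mul_nonneg (hA i) (pow_nonneg (wk_nonneg i) n))
    (fun b => μ.Tn_sy hA hu n b) a b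
  refine (h1.csmul (B := fun i => (wl (π i))⁻¹) μ.ila (fun i => (μ.ila_norm i).le)).mono1 fun i => ?_
  change (wl (π i))⁻¹ * (wL (π i) * wk (π i) ^ n) ≤ wk (π i)
  calc _ = wk (π i) * wk (π i) ^ n := by rw [← wL_il (π i)]; ring
    _ ≤ wk (π i) * 1 := mul_le_mul_of_nonneg_left (pow_le_one₀ (wk_pos _).le (wk_le _)) (wk_pos _).le
    _ = _ := mul_one _

/-- support -/
theorem Mode.S_sp {i : ι} {S : Set (ℝ × Spc)} {u : Fin 3 → ι → SF} (hu : ∀ b, Sp S (u b i)) (a b) :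
    Sp S (μ.S u a b i) :=
  (((hu a).smul _).add ((hu b).smul _)).sub (Sp.sum fun n _ => (hu n).smul _)
theorem Mode.T_sp {i : ι} {S : Set (ℝ × Spc)} (hS : IsClosed S) {u : Fin 3 → ι → SF} (hu : ∀ b, Sp S (u b i)) (b) :
    Sp S (μ.T u b i) :=
  (Sp.sum fun a _ => ((μ.S_sp hu a b).mul_right _).add (((μ.S_sp hu a b).dd hS _).smul _)).neg
theorem Mode.Tn_sp {i : ι} {S : Set (ℝ × Spc)} (hS : IsClosed S) {u : Fin 3 → ι → SF} (hu : ∀ b, Sp S (u b i)) (n : ℕ) (b) :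
    Sp S (μ.Tn n u b i) := by
  induction n generalizing b with
  | zero => exact hu b
  | succ n ih => exact μ.T_sp hS ih b
theorem Mode.St_sp {i : ι} {S : Set (ℝ × Spc)} (hS : IsClosed S) {u : Fin 3 → ι → SF} (hu : ∀ b, Sp S (u b i)) (n : ℕ) (a b) :
    Sp S (μ.St n u a b i) :=
  Sp.sum fun k _ => (μ.S_sp (fun b => μ.Tn_sp hS hu k b) a b).smul _
/-- periodicity -/
theorem Mode.S_pk {i : ι} {k : ℝ × Spc} {u : Fin 3 → ι → SF} (hu : ∀ b, Pk k (u b i)) (a b) :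
    Pk k (μ.S u a b i) :=
  (((hu a).smul _).add ((hu b).smul _)).sub (Pk.sum fun n _ => (hu n).smul _)
theorem Mode.T_pk {i : ι} {k : ℝ × Spc} (hg : ∀ a, Pk k (μ.g a i)) {u : Fin 3 → ι → SF} (hu : ∀ b, Pk k (u b i)) (b) :
    Pk k (μ.T u b i) :=
  (Pk.sum fun a _ => ((μ.S_pk hu a b).mul (hg a)).add (((μ.S_pk hu a b).dd _).smul _)).neg
theorem Mode.Tn_pk {i : ι} {k : ℝ × Spc} (hg : ∀ a, Pk k (μ.g a i)) {u : Fin 3 → ι → SF} (hu : ∀ b, Pk k (u b i)) (n : ℕ) (b) :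
    Pk k (μ.Tn n u b i) := by
  induction n generalizing b with
  | zero => exact hu b
  | succ n ih => exact μ.T_pk hg ih b
theorem Mode.St_pk {i : ι} {k : ℝ × Spc} (hg : ∀ a, Pk k (μ.g a i)) {u : Fin 3 → ι → SF} (hu : ∀ b, Pk k (u b i)) (n : ℕ) (a b) :
    Pk k (μ.St n u a b i) :=
  Pk.sum fun k _ => (μ.S_pk (fun b => μ.Tn_pk hg hu k b) a b).smul _

end mode

/-- contexts on all of space-time -/
abbrev cU (P : ℕ) := cl (P := P) id (fun _ => univ)

/-- locally finite sums -/
theorem sum_symN {τ : Type} {Dm : Data P × τ → Set (ℝ × Spc)} (hD : ∀ q, IsClosed (Dm q)) (J : Data P → Finset τ) (M : ℕ)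
    (hJ : ∀ i z, ∃ s : Finset τ, s.card ≤ M ∧ ∀ t ∈ J i, z ∈ Dm (i, t) → t ∈ s) (n : ℕ)
    {A : Data P → ℝ} (hA : ∀ i, 0 ≤ A i) {f : Data P × τ → SF}
    (hs : ∀ q, Sp (Dm q) (f q)) (hf : SymN (cl Prod.fst Dm) n (A ∘ Prod.fst) f) :
    SymN (cU P) n A (fun i => ∑ t ∈ J i, f (i, t)) := by
  classical
  induction n generalizing A f with
  | zero =>
    obtain ⟨C, hC, H⟩ := hf
    refine ⟨M * C, by positivity, fun i z _ => ?_⟩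
    obtain ⟨s, hs1, hs2⟩ := hJ i z
    rw [SFo.sum_app]
    have hb : ∀ t, ‖(f (i, t)).1 z‖ ≤ C * A i := by
      intro t
      by_cases hz : z ∈ Dm (i, t)
      · exact H (i, t) z hz
      · rw [hs _ z hz, norm_zero]; exact mul_nonneg hC (hA i)
    have e : ∑ t ∈ J i, (f (i, t)).1 z = ∑ t ∈ J i ∩ s, (f (i, t)).1 z := by
      refine (Finset.sum_subset Finset.inter_subset_left fun t h1 h2 => ?_).symm
      refine hs _ z fun hz => h2 (Finset.mem_inter.2 ⟨h1, hs2 t h1 hz⟩)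
    rw [e]
    refine (norm_sum_le_of_le _ fun t _ => hb t).trans ?_
    rw [Finset.sum_const, nsmul_eq_mul, mul_assoc]
    refine mul_le_mul_of_nonneg_right ?_ (mul_nonneg hC (hA i))
    exact_mod_cast (Finset.card_le_card Finset.inter_subset_right).trans hs1
  | succ n ih =>
    refine ⟨ih hA hs hf.1, fun j => ?_⟩
    change SymN (cU P) n _ (fun i => dx j (∑ t ∈ J i, f (i, t)))
    simp only [map_sum]
    exact ih (A := A * wl) (fun i => mul_nonneg (hA i) (wl_pos i).le) (fun q => (hs q).dd (hD q) _) (hf.2 j)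

theorem Sp.DT {S : Set (ℝ × Spc)} (hS : IsClosed S) {f : SF} (hf : Sp S f) (i : Data P) : Sp S (CI.DT i f) := by
  rw [DT_app]
  exact (hf.dd hS _).add (Sp.sum fun l _ => (hf.dd hS _).mul_left _)

theorem sum_sy {τ : Type} {Dm : Data P × τ → Set (ℝ × Spc)} (hD : ∀ q, IsClosed (Dm q)) (J : Data P → Finset τ) (M : ℕ)
    (hJ : ∀ i z, ∃ s : Finset τ, s.card ≤ M ∧ ∀ t ∈ J i, z ∈ Dm (i, t) → t ∈ s) (m : ℕ)
    {A : Data P → ℝ} (hA : ∀ i, 0 ≤ A i) {f : Data P × τ → SF}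
    (hs : ∀ q, Sp (Dm q) (f q)) (hf : Sy (cl Prod.fst Dm) m (A ∘ Prod.fst) f) :
    Sy (cU P) m A (fun i => ∑ t ∈ J i, f (i, t)) := by
  induction m generalizing A f with
  | zero => exact fun n => sum_symN hD J M hJ n hA hs (hf n)
  | succ m ih =>
    refine ⟨fun n => sum_symN hD J M hJ n hA hs (hf.1 n), ?_⟩
    change Sy (cU P) m _ (fun i => DT i (∑ t ∈ J i, f (i, t)))
    simp only [map_sum]
    exact ih (A := A * wl) (fun i => mul_nonneg (hA i) (wl_pos i).le) (fun q => (hs q).DT (hD q) q.1) hf.2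
end CI
end

noncomputable section
open MeasureTheory Set Filter Topology
open scoped ContDiff
set_option linter.unusedSectionVars false

namespace CI
variable {P : ℕ} {τ : Type}

/-- wave systems -/
structure WS (P : ℕ) (τ : Type) where
  Dm : Data P × τ → Set (ℝ × Spc)
  hD : ∀ q, IsClosed (Dm q)
  μ : Mode (P := P) Prod.fst Dm
  gs2 : ∀ n, Sy (cL Prod.fst Dm) 2 1 (μ.g n)
  J : Data P → Finset τ
  M : ℕ
  hJ : ∀ i z, ∃ s : Finset τ, s.card ≤ M ∧ ∀ t ∈ J i, z ∈ Dm (i, t) → t ∈ s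
  mz : τ → Fin 3 → ℤ
  hmz : ∀ q n, μ.m q n = mz q.2 n
  a : Data P × τ → SF
  as : Sy (cL Prod.fst Dm) 2 1 a
  aS : ∀ q, Sp (Dm q) (a q)
  aT : ∀ i, ∀ t ∈ J i, Sp (TS (i.ta - 2 / i.L) (i.tb + 2 / i.L)) (a (i, t))
  B : τ → Fin 3 → ℂ
  MB : ℝ
  hB : ∀ t c, ‖B t c‖ ≤ MB
  hcurl : ∀ t c, Complex.I * ((mz t (c+1) : ℂ) * B t (c+2) - (mz t (c+2) : ℂ) * B t (c+1)) = 5 * B t c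
  aP : ∀ q k, Pk (kv k) (a q)
  eP : ∀ q k, Pk (kv k) (μ.e q)
  gP : ∀ n q k, Pk (kv k) (μ.g n q)
  hP : ∀ q k, Pk (kv k) (μ.h q)
  rl : ∀ i c, Rl (∑ t ∈ J i, B t c • (a (i, t) * μ.e (i, t)))
  χ : Data P → SF
  hχ : ∀ i n, dx n (χ i) = 0
  Q : Data P → Fin 3 → Fin 3 → SF
  Qsym : ∀ i a b, Q i a b = Q i b a
  QP : ∀ i a b k, Pk (kv k) (Q i a b)
  QT : ∀ i a b, Sp (TS (i.ta - 2 / i.L) (i.tb + 2 / i.L)) (Q i a b)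
  Qk : ∀ a b, Bd (cU P) wk (fun i => mR i a b - Q i a b)
  Qd : ∀ a b j, Bd (cU P) wL (fun i => dx j (mR i a b - Q i a b))
  QD : ∀ a b, Bd (cU P) wL (fun i => DT i (mR i a b - Q i a b))
  hlow : ∀ i x y, (∑ t ∈ J i, ∑ t' ∈ J i, if mz t + mz t' = 0 then
      (1 / 2 * (B t x * B t' y + B t' x * B t y)) • (a (i, t) * a (i, t') * (μ.e (i, t) * μ.e (i, t')))
      else 0) = del x y • χ i - Q i x y

namespace WS
variable (S : WS P τ)
abbrev e (q : Data P × τ) : SF := S.μ.e q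
abbrev g (n : Fin 3) (q : Data P × τ) : SF := S.μ.g n q
def la (i : Data P) : ℂ := Complex.I * wl i

theorem de (q : Data P × τ) (n : Fin 3) :
    dx n (S.e q) = la q.1 • ((algebraMap ℂ SF (S.mz q.2 n) + S.g n q) * S.e q) := by
  have := S.μ.de q n
  rw [S.hmz, Complex.ofReal_intCast] at this; exact this
theorem De (q : Data P × τ) : DT q.1 (S.e q) = la q.1 • (S.μ.h q * S.e q) := S.μ.De q

/-- curl -/
def curl (F : Fin 3 → SF) (c : Fin 3) : SF := dx (c+1) (F (c+2)) - dx (c+2) (F (c+1))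
theorem div_curl (F : Fin 3 → SF) : ∑ c, dx c (curl F c) = 0 := by
  have e1 : (2:Fin 3) + 1 = 0 := rfl
  have e2 : (2:Fin 3) + 2 = 1 := rfl
  have e3 : (1:Fin 3) + 1 = 2 := rfl
  have e4 : (1:Fin 3) + 2 = 0 := rfl
  simp only [Fin.sum_univ_three, curl, map_sub, zero_add, e1, e2, e3, e4]
  rw [dx_comm 0 1, dx_comm 0 2, dx_comm 1 2]; abel

def Ψ (i : Data P) (c : Fin 3) : SF := ((5 * wl i)⁻¹ : ℂ) • ∑ t ∈ S.J i, S.B t c • (S.a (i, t) * S.e (i, t))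
def w (i : Data P) (c : Fin 3) : SF := curl (S.Ψ i) c
theorem w_div (i : Data P) : ∑ c, dx c (S.w i c) = 0 := div_curl _

def cc (q : Data P × τ) (c : Fin 3) : SF :=
  ((5 * wl q.1)⁻¹ : ℂ) • (S.B q.2 (c+2) • dx (c+1) (S.a q) - S.B q.2 (c+1) • dx (c+2) (S.a q)) +
  (Complex.I / 5) • (S.a q * (S.B q.2 (c+2) • S.g (c+1) q - S.B q.2 (c+1) • S.g (c+2) q))
def b (q : Data P × τ) (c : Fin 3) : SF := S.B q.2 c • S.a q + S.cc q c

theorem w_eq (i : Data P) (c : Fin 3) : S.w i c = ∑ t ∈ S.J i, S.b (i, t) c * S.e (i, t) := by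
  have hl : (wl i : ℂ) ≠ 0 := by exact_mod_cast (wl_pos i).ne'
  unfold w curl Ψ
  simp only [Derivation.map_smul, map_sum]
  rw [← smul_sub, ← Finset.sum_sub_distrib, Finset.smul_sum]
  refine Finset.sum_congr rfl fun t _ => ?_
  rw [dx_mul, dx_mul, S.de, S.de]
  ext z
  have hc := S.hcurl t c
  simp only [b, cc, la, SFo.smul_app, SFo.sub_app, SFo.add_app, SFo.mul_app, SFo.algebraMap_app]
  have h5 : (5 * (wl i : ℂ))⁻¹ * (wl i) = 5⁻¹ := by field_simp
  generalize (dx (c+1) (S.a (i,t))).1 z = a1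
  generalize (dx (c+2) (S.a (i,t))).1 z = a2
  generalize (S.a (i,t)).1 z = a at *
  generalize (S.e (i,t)).1 z = e at *
  generalize (S.g (c+1) (i,t)).1 z = g1
  generalize (S.g (c+2) (i,t)).1 z = g2
  generalize ((5 * (wl i : ℂ))⁻¹) = l5 at *
  generalize (wl i : ℂ) = l at *
  linear_combination (a * e / 5) * hc + (S.B t (c+2) * a * Complex.I * (S.mz t (c+1) + g1) * e
    - S.B t (c+1) * a * Complex.I * (S.mz t (c+2) + g2) * e) * h5

def u1 (c : Fin 3) (q : Data P × τ) : SF :=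
  DT q.1 (S.b q c) + la q.1 • (S.μ.h q * S.b q c) + ∑ d, S.b q d * dx d (vl q.1 c)

theorem lin_part (i : Data P) (c : Fin 3) :
    dt (S.w i c) + ∑ d, dx d (vl i d * S.w i c + S.w i d * vl i c) =
      ∑ t ∈ S.J i, S.u1 c (i, t) * S.e (i, t) := by
  have h1 : dt (S.w i c) + ∑ d, dx d (vl i d * S.w i c + S.w i d * vl i c) =
      DT i (S.w i c) + ∑ d, S.w i d * dx d (vl i c) := by
    rw [DT_app]
    simp only [map_add, dx_mul, Finset.sum_add_distrib]
    rw [← Finset.sum_mul, ← Finset.sum_mul, vl_div, S.w_div]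
    simp only [zero_mul, zero_add]; abel
  rw [h1]
  simp only [S.w_eq, map_sum, Finset.sum_mul]
  rw [Finset.sum_comm, ← Finset.sum_add_distrib]
  refine Finset.sum_congr rfl fun t _ => ?_
  rw [Der_mul, S.De (i, t)]
  simp only [u1, add_mul, Finset.sum_mul]
  rw [mul_smul_comm, smul_mul_assoc, add_assoc, add_assoc]
  congr 1
  congr 1
  · congr 1; ring
  · refine Finset.sum_congr rfl fun d _ => by ring

/-! pairs -/
def D2 (q : Data P × (τ × τ)) : Set (ℝ × Spc) := S.Dm (q.1, q.2.1) ∩ S.Dm (q.1, q.2.2)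
theorem D2_closed (q) : IsClosed (S.D2 q) := (S.hD _).inter (S.hD _)
def r1 (q : Data P × (τ × τ)) : Data P × τ := (q.1, q.2.1)
def r2 (q : Data P × (τ × τ)) : Data P × τ := (q.1, q.2.2)

theorem pair1 {m : ℕ} {A : Data P → ℝ} {f : Data P × τ → SF} (h : Sy (cL Prod.fst S.Dm) m (A ∘ Prod.fst) f) :
    Sy (cL Prod.fst S.D2) m (A ∘ Prod.fst) (fun q => f (r1 q)) :=
  pullG (π := Prod.fst) (Dm := S.Dm) r1 (Dm' := S.D2) (fun _ => inter_subset_left) h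
theorem pair2 {m : ℕ} {A : Data P → ℝ} {f : Data P × τ → SF} (h : Sy (cL Prod.fst S.Dm) m (A ∘ Prod.fst) f) :
    Sy (cL Prod.fst S.D2) m (A ∘ Prod.fst) (fun q => f (r2 q)) :=
  pullG (π := Prod.fst) (Dm := S.Dm) r2 (Dm' := S.D2) (fun _ => inter_subset_right) h

def μ2 : Mode (P := P) Prod.fst S.D2 where
  e q := S.e (r1 q) * S.e (r2 q)
  m q n := ((S.mz q.2.1 + S.mz q.2.2) n : ℤ)
  g n q := S.g n (r1 q) + S.g n (r2 q)
  h q := S.μ.h (r1 q) + S.μ.h (r2 q)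
  M := S.μ.M + S.μ.M
  hM q n := by
    have h1 := S.μ.hM (r1 q) n
    have h2 := S.μ.hM (r2 q) n
    rw [S.hmz] at h1 h2
    simp only [Pi.add_apply, Int.cast_add]
    exact (abs_add_le _ _).trans (add_le_add h1 h2)
  hm q := by
    by_cases h : S.mz q.2.1 + S.mz q.2.2 = 0
    · left; funext n; rw [h]; simp
    · right
      obtain ⟨n, hn⟩ := Function.ne_iff.1 h
      have h1 : (1:ℤ) ≤ (S.mz q.2.1 + S.mz q.2.2) n ^ 2 := by
        have : (S.mz q.2.1 + S.mz q.2.2) n ≠ 0 := hn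
        have := sq_pos_of_ne_zero this
        omega
      have h2 : (1:ℝ) ≤ (((S.mz q.2.1 + S.mz q.2.2) n : ℤ) : ℝ) ^ 2 := by exact_mod_cast h1
      exact h2.trans (Finset.single_le_sum (f := fun n => (((S.mz q.2.1 + S.mz q.2.2) n : ℤ) : ℝ) ^ 2)
        (fun n _ => sq_nonneg _) (Finset.mem_univ n))
  de q n := by
    rw [dx_mul, S.de, S.de]
    ext z
    simp only [la, r1, r2, SFo.smul_app, SFo.add_app, SFo.mul_app, SFo.algebraMap_app, Pi.add_apply]
    push_cast; ring
  De q := by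
    have h1 := S.De (r1 q)
    have h2 := S.De (r2 q)
    simp only [r1, r2] at h1 h2 ⊢
    rw [Der_mul, h1, h2]
    ext z
    simp only [la, SFo.smul_app, SFo.add_app, SFo.mul_app]
    ring
  gs n := (S.pair1 (S.μ.gs n)).add (S.pair2 (S.μ.gs n))
  hs := (S.pair1 S.μ.hs).add (S.pair2 S.μ.hs)
  ne q z := by rw [SFo.mul_app, norm_mul, S.μ.ne, S.μ.ne, one_mul]

def A2 (q : Data P × (τ × τ)) : SF := S.a (r1 q) * S.a (r2 q)
def MM (s : τ × τ) (x y : Fin 3) : ℂ := 1 / 2 * (S.B s.1 x * S.B s.2 y + S.B s.2 x * S.B s.1 y)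
def BB (s : τ × τ) : ℂ := ∑ n, S.B s.1 n * S.B s.2 n

theorem beltrami {k k' B B' : Fin 3 → ℂ}
    (h : ∀ c, Complex.I * (k (c+1) * B (c+2) - k (c+2) * B (c+1)) = 5 * B c)
    (h' : ∀ c, Complex.I * (k' (c+1) * B' (c+2) - k' (c+2) * B' (c+1)) = 5 * B' c) (y : Fin 3) :
    ∑ n, (k n + k' n) * (1 / 2 * (B n * B' y + B' n * B y)) = 1 / 2 * (∑ n, B n * B' n) * (k y + k' y) := by
  have e1 : (2:Fin 3) + 1 = 0 := rfl
  have e2 : (2:Fin 3) + 2 = 1 := rfl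
  have e3 : (1:Fin 3) + 1 = 2 := rfl
  have e4 : (1:Fin 3) + 2 = 0 := rfl
  have a0 := h 0; have a1 := h 1; have a2 := h 2
  have b0 := h' 0; have b1 := h' 1; have b2 := h' 2
  simp only [zero_add, e1, e2, e3, e4] at a0 a1 a2 b0 b1 b2
  have c0 : k 0 * B 0 + k 1 * B 1 + k 2 * B 2 = 0 := by linear_combination (-1/5) * (k 0 * a0 + k 1 * a1 + k 2 * a2)
  have c1 : k' 0 * B' 0 + k' 1 * B' 1 + k' 2 * B' 2 = 0 := by
    linear_combination (-1/5) * (k' 0 * b0 + k' 1 * b1 + k' 2 * b2)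
  have hI : Complex.I * Complex.I = -1 := Complex.I_mul_I
  have d0 : k 1 * B 2 - k 2 * B 1 = - 5 * Complex.I * B 0 := by linear_combination (- Complex.I) * a0 + (k 1 * B 2 - k 2 * B 1) * hI
  have d1 : k 2 * B 0 - k 0 * B 2 = - 5 * Complex.I * B 1 := by linear_combination (- Complex.I) * a1 + (k 2 * B 0 - k 0 * B 2) * hI
  have d2 : k 0 * B 1 - k 1 * B 0 = - 5 * Complex.I * B 2 := by linear_combination (- Complex.I) * a2 + (k 0 * B 1 - k 1 * B 0) * hI
  have f0 : k' 1 * B' 2 - k' 2 * B' 1 = - 5 * Complex.I * B' 0 := by linear_combination (- Complex.I) * b0 + (k' 1 * B' 2 - k' 2 * B' 1) * hI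
  have f1 : k' 2 * B' 0 - k' 0 * B' 2 = - 5 * Complex.I * B' 1 := by linear_combination (- Complex.I) * b1 + (k' 2 * B' 0 - k' 0 * B' 2) * hI
  have f2 : k' 0 * B' 1 - k' 1 * B' 0 = - 5 * Complex.I * B' 2 := by linear_combination (- Complex.I) * b2 + (k' 0 * B' 1 - k' 1 * B' 0) * hI
  simp only [Fin.sum_univ_three]
  fin_cases y <;> simp only [Fin.zero_eta, Fin.mk_one, Fin.reduceFinMk]
  · linear_combination (1/2) * (B' 0 * c0 + B 0 * c1) - (1/2) * (B 1 * f2 - B 2 * f1 + B' 1 * d2 - B' 2 * d1)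
  · linear_combination (1/2) * (B' 1 * c0 + B 1 * c1) - (1/2) * (B 2 * f0 - B 0 * f2 + B' 2 * d0 - B' 0 * d2)
  · linear_combination (1/2) * (B' 2 * c0 + B 2 * c1) - (1/2) * (B 0 * f1 - B 1 * f0 + B' 0 * d1 - B' 1 * d0)

open Classical in
def u2 (y : Fin 3) (q : Data P × (τ × τ)) : SF :=
  if S.mz q.2.1 + S.mz q.2.2 = 0 then 0 else
    (∑ n, S.MM q.2 n y • dx n (S.A2 q)) - (1 / 2 * S.BB q.2) • dx y (S.A2 q) +
      la q.1 • (S.A2 q * ((∑ n, S.MM q.2 n y • S.μ2.g n q) - (1 / 2 * S.BB q.2) • S.μ2.g y q))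
open Classical in
def pc (s : τ × τ) : ℂ := if S.mz s.1 + S.mz s.2 = 0 then 0 else - (1 / 2 * S.BB s)
def pi (i : Data P) : SF := ∑ s ∈ S.J i ×ˢ S.J i, S.pc s • (S.A2 (i, s) * S.μ2.e (i, s))
def wp (i : Data P) (c : Fin 3) : SF := ∑ t ∈ S.J i, S.B t c • (S.a (i, t) * S.e (i, t))

theorem high (q : Data P × (τ × τ)) (h : ¬ S.mz q.2.1 + S.mz q.2.2 = 0) (y : Fin 3) :
    ∑ n, dx n (S.MM q.2 n y • (S.A2 q * S.μ2.e q)) + dx y (S.pc q.2 • (S.A2 q * S.μ2.e q)) =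
      S.u2 y q * S.μ2.e q := by
  have hb := beltrami (k := fun n => (S.mz q.2.1 n : ℂ)) (k' := fun n => (S.mz q.2.2 n : ℂ)) (S.hcurl q.2.1) (S.hcurl q.2.2) y
  have hd : ∀ n, dx n (S.A2 q * S.μ2.e q) = dx n (S.A2 q) * S.μ2.e q + S.A2 q * (la q.1 •
    ((algebraMap ℂ SF ((S.mz q.2.1 n : ℂ) + (S.mz q.2.2 n : ℂ)) + S.μ2.g n q) * S.μ2.e q)) := by
    intro n
    rw [dx_mul, S.μ2.de]
    congr 4
    congr 1
    simp [μ2]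
  simp only [Derivation.map_smul, hd, u2, pc, if_neg h]
  ext z
  simp only [SFo.sum_app, SFo.smul_app, SFo.add_app, SFo.sub_app, SFo.mul_app, SFo.algebraMap_app, Fin.sum_univ_three] at hb ⊢
  simp only [MM, BB, Fin.sum_univ_three] at hb ⊢
  generalize (S.μ2.e q).1 z = e
  generalize (S.A2 q).1 z = a
  generalize la q.1 = l
  linear_combination (l * a * e) * hb

theorem wpwp (i : Data P) (x y : Fin 3) :
    S.wp i x * S.wp i y = ∑ s ∈ S.J i ×ˢ S.J i, S.MM s x y • (S.A2 (i, s) * S.μ2.e (i, s)) := by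
  have h : ∀ x y : Fin 3, S.wp i x * S.wp i y = ∑ s ∈ S.J i ×ˢ S.J i, (S.B s.1 x * S.B s.2 y) •
      (S.A2 (i, s) * S.μ2.e (i, s)) := by
    intro x y
    rw [wp, wp, Finset.sum_mul_sum, Finset.sum_product]
    refine Finset.sum_congr rfl fun t _ => Finset.sum_congr rfl fun t' _ => ?_
    ext z
    simp only [A2, μ2, r1, r2, SFo.smul_app, SFo.mul_app]; ring
  have h2 : S.wp i x * S.wp i y = (1/2 : ℂ) • (S.wp i x * S.wp i y + S.wp i y * S.wp i x) := by
    rw [mul_comm (S.wp i y), ← two_smul ℂ, smul_smul]; norm_num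
  rw [h2, h, h, ← Finset.sum_add_distrib, Finset.smul_sum]
  refine Finset.sum_congr rfl fun s _ => ?_
  rw [← add_smul, smul_smul]; congr 1; rw [MM]; ring

theorem quad_part (i : Data P) (y : Fin 3) :
    ∑ x, dx x (S.wp i x * S.wp i y) + dx y (S.pi i) =
      (- ∑ x, dx x (S.Q i x y)) + ∑ s ∈ S.J i ×ˢ S.J i, S.u2 y (i, s) * S.μ2.e (i, s) := by
  classical
  have hl : ∀ x, (∑ s ∈ S.J i ×ˢ S.J i, if S.mz s.1 + S.mz s.2 = 0 then
      S.MM s x y • (S.A2 (i, s) * S.μ2.e (i, s)) else 0) = del x y • S.χ i - S.Q i x y := by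
    intro x
    rw [← S.hlow, Finset.sum_product]
    rfl
  have hQ : ∀ x, - dx x (S.Q i x y) = dx x (∑ s ∈ S.J i ×ˢ S.J i, if S.mz s.1 + S.mz s.2 = 0 then
      S.MM s x y • (S.A2 (i, s) * S.μ2.e (i, s)) else 0) := by
    intro x
    rw [hl, map_sub, Derivation.map_smul, S.hχ, smul_zero, zero_sub]
  rw [← Finset.sum_neg_distrib]
  simp only [hQ, wpwp, pi, map_sum]
  rw [Finset.sum_comm, Finset.sum_comm (s := Finset.univ), ← Finset.sum_add_distrib, ← Finset.sum_add_distrib]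
  refine Finset.sum_congr rfl fun s _ => ?_
  by_cases h : S.mz s.1 + S.mz s.2 = 0
  · simp [h, pc, u2]
  · have := S.high (i, s) h y
    simp only [if_neg h, map_zero, Finset.sum_const_zero, zero_add]
    exact this
end WS
end CI
end

noncomputable section
open MeasureTheory Set Filter Topology
open scoped ContDiff
set_option linter.unusedSectionVars false

namespace CI
variable {P : ℕ} {τ : Type}
namespace WS
variable (S : WS P τ)
abbrev k1 : Ctx (ℝ × Spc) (Data P × τ) := cL Prod.fst S.Dm
abbrev k2 : Ctx (ℝ × Spc) (Data P × (τ × τ)) := cL Prod.fst S.D2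

theorem la_norm (i : Data P) : ‖la i‖ = wl i := by
  rw [la, norm_mul, Complex.norm_I, one_mul, Complex.norm_real, Real.norm_of_nonneg (wl_pos _).le]
theorem l5_norm (i : Data P) : ‖((5 * wl i)⁻¹ : ℂ)‖ ≤ (wl i)⁻¹ := by
  have := wl_pos i
  rw [norm_inv, norm_mul, Complex.norm_real, Real.norm_of_nonneg this.le]
  norm_num
  have : 0 < (wl i)⁻¹ := inv_pos.2 this
  linarith
theorem Bs (c : Fin 3) (q : Data P × τ) : ‖S.B q.2 c‖ ≤ S.MB := S.hB _ _

theorem cc_h1 (n : Fin 3) : Sy S.k1 2 (wL ∘ Prod.fst) (fun q => dx n (S.a q)) :=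
    (Sy.dxL le_rfl (fun _ => zero_le_one) S.as n).mono1 fun q => by simp [cL, wL]
theorem cc_h2 (c : Fin 3) : Sy S.k1 2 (wL ∘ Prod.fst) (fun q => S.B q.2 (c+2) • dx (c+1) (S.a q) - S.B q.2 (c+1) • dx (c+2) (S.a q)) :=
    ((S.cc_h1 (c+1)).bsmul _ S.MB (S.Bs (c+2))).sub ((S.cc_h1 (c+2)).bsmul _ S.MB (S.Bs (c+1)))
theorem cc_a (c : Fin 3) : Sy S.k1 2 (wk ∘ Prod.fst) (fun q => ((5 * wl q.1)⁻¹ : ℂ) •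
    (S.B q.2 (c+2) • dx (c+1) (S.a q) - S.B q.2 (c+1) • dx (c+2) (S.a q))) := by
  have h4 : ∀ q : Data P × τ, ‖(fun q : Data P × τ => ((5 * wl q.1)⁻¹ : ℂ)) q‖ ≤ (fun q : Data P × τ => (wl q.1)⁻¹) q := by
    intro q
    exact l5_norm q.1
  have h3 := (S.cc_h2 c).csmul _ h4
  refine h3.mono1 fun q => ?_
  have : (wl q.1)⁻¹ * wL q.1 = wk q.1 := by rw [← wk_wl]; field_simp [(wl_pos q.1).ne']
  exact this.le
theorem cc_b {m : ℕ} {A : Data P × τ → ℝ} (ha : Sy S.k1 m 1 S.a) (h : ∀ n, Sy S.k1 m A (S.g n)) (c : Fin 3) :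
    Sy S.k1 m A (fun q => (Complex.I / 5) •
      (S.a q * (S.B q.2 (c+2) • S.g (c+1) q - S.B q.2 (c+1) • S.g (c+2) q))) := by
  refine Sy.smul _ ?_
  have := ha.mul (((h (c+1)).bsmul _ S.MB (S.Bs (c+2))).sub ((h (c+2)).bsmul _ S.MB (S.Bs (c+1))))
  rwa [one_mul] at this
theorem cc1 (c : Fin 3) : Sy S.k1 1 (wk ∘ Prod.fst) (fun q => S.cc q c) :=
  (S.cc_a c).pred.add (S.cc_b S.as.pred S.μ.gs c)
theorem cc2 (c : Fin 3) : Sy S.k1 2 1 (fun q => S.cc q c) :=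
  ((S.cc_a c).mono1 fun q => wk_le q.1).add (S.cc_b S.as S.gs2 c)
theorem b2 (c : Fin 3) : Sy S.k1 2 1 (fun q => S.b q c) :=
  (S.as.bsmul _ S.MB (S.Bs c)).add (S.cc2 c)
theorem wkl (i : Data P) : wl i * wk i = wL i := by rw [mul_comm, wk_wl]
theorem u1_sy (c : Fin 3) : Sy S.k1 1 (wL ∘ Prod.fst) (S.u1 c) := by
  refine Sy.add (Sy.add ?_ ?_) (Sy.sum _ (fun q => (wL_pos _).le) fun d _ => ?_)
  · exact (S.b2 c).dt.mono1 fun q => by simp [cL, wL]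
  · refine ((S.μ.hs.mul (S.b2 c).pred).csmul (B := fun q => wl q.1) (fun q => la q.1) (fun q => (la_norm q.1).le)).mono1 fun q => ?_
    change wl q.1 * (wk q.1 ^ 2 * 1) ≤ wL q.1
    rw [mul_one, sq, ← mul_assoc, wkl]
    exact mul_le_of_le_one_right (wL_pos _).le (wk_le _)
  · have := (S.b2 d).pred.mul (pull0 (π := Prod.fst) (Dm := S.Dm) (sy1_dvl (P := P) d c))
    rwa [one_mul] at this

theorem A2_sy : Sy S.k2 2 1 S.A2 := by
  have := (S.pair1 (A := 1) S.as).mul (S.pair2 (A := 1) S.as)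
  exact this.mono1 fun q => by simp
theorem MM_bd (x y : Fin 3) (q : Data P × (τ × τ)) : ‖S.MM q.2 x y‖ ≤ S.MB * S.MB := by
  have hb := fun t c => S.hB t c
  have h0 : 0 ≤ S.MB := (norm_nonneg _).trans (hb q.2.1 0)
  rw [MM, norm_mul]
  have h1 : ‖S.B q.2.1 x * S.B q.2.2 y‖ ≤ S.MB * S.MB := by
    rw [norm_mul]; exact mul_le_mul (hb _ _) (hb _ _) (norm_nonneg _) h0
  have h2 : ‖S.B q.2.2 x * S.B q.2.1 y‖ ≤ S.MB * S.MB := by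
    rw [norm_mul]; exact mul_le_mul (hb _ _) (hb _ _) (norm_nonneg _) h0
  have h3 := (norm_add_le (S.B q.2.1 x * S.B q.2.2 y) (S.B q.2.2 x * S.B q.2.1 y))
  norm_num; linarith
theorem BB_bd (q : Data P × (τ × τ)) : ‖1 / 2 * S.BB q.2‖ ≤ 2 * (S.MB * S.MB) := by
  have hb := fun t c => S.hB t c
  have h0 : 0 ≤ S.MB := (norm_nonneg _).trans (hb q.2.1 0)
  have h1 : ‖S.BB q.2‖ ≤ ∑ n : Fin 3, S.MB * S.MB := norm_sum_le_of_le _ fun n _ => by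
    rw [norm_mul]; exact mul_le_mul (hb _ _) (hb _ _) (norm_nonneg _) h0
  rw [norm_mul]
  have h2 : 0 ≤ S.MB * S.MB := mul_nonneg h0 h0
  simp at h1
  norm_num; linarith
theorem u2_sy (y : Fin 3) : Sy S.k2 1 (wL ∘ Prod.fst) (S.u2 y) := by
  classical
  have e : S.u2 y = fun q => (if S.mz q.2.1 + S.mz q.2.2 = 0 then (0:ℂ) else 1) •
    ((∑ n, S.MM q.2 n y • dx n (S.A2 q)) - (1 / 2 * S.BB q.2) • dx y (S.A2 q) +
      la q.1 • (S.A2 q * ((∑ n, S.MM q.2 n y • S.μ2.g n q) - (1 / 2 * S.BB q.2) • S.μ2.g y q))) := by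
    funext q
    by_cases h : S.mz q.2.1 + S.mz q.2.2 = 0 <;> simp [u2, h]
  rw [e]
  have hd : ∀ n, Sy S.k2 1 (wL ∘ Prod.fst) (fun q => dx n (S.A2 q)) := fun n =>
    (Sy.dxL le_rfl (fun _ => zero_le_one) S.A2_sy n).pred.mono1 fun q => by simp [cL, wL]
  refine Sy.bsmul _ 1 (fun q => by split_ifs <;> simp) (Sy.add (Sy.sub (Sy.sum _ (fun q => (wL_pos _).le) fun n _ => ?_) ?_) ?_)
  · exact (hd n).bsmul _ _ (S.MM_bd n y)
  · exact (hd y).bsmul _ _ S.BB_bd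
  · have hg : Sy S.k2 1 (wk ∘ Prod.fst) (fun q => (∑ n, S.MM q.2 n y • S.μ2.g n q)) :=
      Sy.sum _ (fun q => (wk_pos q.1).le) fun n _ => (S.μ2.gs n).bsmul _ _ (S.MM_bd n y)
    refine ((S.A2_sy.pred.mul (hg.sub ((S.μ2.gs y).bsmul _ _ S.BB_bd))).csmul (B := fun q => wl q.1) (fun q => la q.1) (fun q => (la_norm q.1).le)).mono1 fun q => ?_
    change wl q.1 * (1 * wk q.1) ≤ wL q.1
    rw [one_mul, wkl]

/-! supports -/
theorem cc_sp {T : Set (ℝ × Spc)} (hT : IsClosed T) (q) (h : Sp T (S.a q)) (c) : Sp T (S.cc q c) :=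
  (((((h.dd hT _).smul _).sub ((h.dd hT _).smul _))).smul _).add ((h.mul_right _).smul _)
theorem b_sp {T : Set (ℝ × Spc)} (hT : IsClosed T) (q) (h : Sp T (S.a q)) (c) : Sp T (S.b q c) :=
  (h.smul _).add (S.cc_sp hT q h c)
theorem u1_sp {T : Set (ℝ × Spc)} (hT : IsClosed T) (q) (h : Sp T (S.a q)) (c) : Sp T (S.u1 c q) :=
  (((S.b_sp hT q h c).DT hT q.1).add (((S.b_sp hT q h c).mul_left _).smul _)).add
    (Sp.sum fun d _ => (S.b_sp hT q h d).mul_right _)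
theorem u2_sp {T : Set (ℝ × Spc)} (hT : IsClosed T) (q) (h : Sp T (S.A2 q)) (c) : Sp T (S.u2 c q) := by
  unfold u2
  split_ifs
  · exact Sp.zero
  · exact ((Sp.sum fun n _ => (h.dd hT _).smul _).sub ((h.dd hT _).smul _)).add ((h.mul_right _).smul _)
theorem A2_sp (q) : Sp (S.D2 q) (S.A2 q) := fun z hz => by
  by_cases h : z ∈ S.Dm (q.1, q.2.1)
  · exact (S.aS (r2 q)).mul_left _ z fun h2 => hz ⟨h, h2⟩
  · exact (S.aS (r1 q)).mul_right _ z h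
/-! periodicity -/
theorem DT_pk {f : SF} {k} (i : Data P) (h : Pk (kv k) f) : Pk (kv k) (DT i f) := by
  rw [DT_app]; exact (h.dd _).add (Pk.sum fun l _ => (vl_pk i l k).mul (h.dd _))
theorem cc_pk (q k c) : Pk (kv k) (S.cc q c) :=
  ((((((S.aP q k).dd _).smul _).sub (((S.aP q k).dd _).smul _)))).smul _ |>.add
    (((S.aP q k).mul (((S.gP _ q k).smul _).sub ((S.gP _ q k).smul _))).smul _)
theorem b_pk (q k c) : Pk (kv k) (S.b q c) := ((S.aP q k).smul _).add (S.cc_pk q k c)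
theorem u1_pk (q k c) : Pk (kv k) (S.u1 c q) :=
  ((DT_pk _ (S.b_pk q k c)).add (((S.hP q k).mul (S.b_pk q k c)).smul _)).add
    (Pk.sum fun d _ => (S.b_pk q k d).mul ((vl_pk q.1 c k).dd _))
theorem A2_pk (q k) : Pk (kv k) (S.A2 q) := (S.aP _ k).mul (S.aP _ k)
theorem g2_pk (n q k) : Pk (kv k) (S.μ2.g n q) := (S.gP _ _ k).add (S.gP _ _ k)
theorem e2_pk (q k) : Pk (kv k) (S.μ2.e q) := (S.eP _ k).mul (S.eP _ k)
theorem u2_pk (q k c) : Pk (kv k) (S.u2 c q) := by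
  unfold u2
  split_ifs
  · exact Pk.zero
  · exact ((Pk.sum fun n _ => ((S.A2_pk q k).dd _).smul _).sub (((S.A2_pk q k).dd _).smul _)).add
      (((S.A2_pk q k).mul ((Pk.sum fun n _ => (S.g2_pk n q k).smul _).sub ((S.g2_pk c q k).smul _))).smul _)

/-! global fields -/
def N0 (P : ℕ) : ℕ := 4 * P + 4
def F1 (i : Data P) (x y : Fin 3) : SF := ∑ t ∈ S.J i, S.μ.St (N0 P) S.u1 x y (i, t) * S.e (i, t)
def F2 (i : Data P) (x y : Fin 3) : SF :=
  ∑ s ∈ S.J i ×ˢ S.J i, S.μ2.St (N0 P) S.u2 x y (i, s) * S.μ2.e (i, s)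
def G1 (i : Data P) (y : Fin 3) : SF := ∑ t ∈ S.J i, S.μ.Tn (N0 P) S.u1 y (i, t) * S.e (i, t)
def G2 (i : Data P) (y : Fin 3) : SF :=
  ∑ s ∈ S.J i ×ˢ S.J i, S.μ2.Tn (N0 P) S.u2 y (i, s) * S.μ2.e (i, s)
def rem (i : Data P) (y : Fin 3) : SF := S.G1 i y + S.G2 i y

theorem hJ2 (i : Data P) (z : ℝ × Spc) : ∃ s : Finset (τ × τ), s.card ≤ S.M * S.M ∧
    ∀ t ∈ S.J i ×ˢ S.J i, z ∈ S.D2 (i, t) → t ∈ s := by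
  obtain ⟨s, h1, h2⟩ := S.hJ i z
  refine ⟨s ×ˢ s, ?_, fun t ht hz => ?_⟩
  · rw [Finset.card_product]; exact Nat.mul_le_mul h1 h1
  · rw [Finset.mem_product] at ht ⊢
    exact ⟨h2 _ ht.1 hz.1, h2 _ ht.2 hz.2⟩

theorem sum1 {m : ℕ} {A : Data P → ℝ} (hA : ∀ i, 0 ≤ A i) {f : Data P × τ → SF}
    (hs : ∀ q, Sp (S.Dm q) (f q)) (hf : Sy (cl Prod.fst S.Dm) m (A ∘ Prod.fst) f) :
    Sy (cU P) m A (fun i => ∑ t ∈ S.J i, f (i, t)) := sum_sy S.hD S.J S.M S.hJ m hA hs hf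
theorem sum2 {m : ℕ} {A : Data P → ℝ} (hA : ∀ i, 0 ≤ A i) {f : Data P × (τ × τ) → SF}
    (hs : ∀ q, Sp (S.D2 q) (f q)) (hf : Sy (cl Prod.fst S.D2) m (A ∘ Prod.fst) f) :
    Sy (cU P) m A (fun i => ∑ t ∈ S.J i ×ˢ S.J i, f (i, t)) :=
  sum_sy S.D2_closed (fun i => S.J i ×ˢ S.J i) (S.M * S.M) S.hJ2 m hA hs hf

theorem wk_nn (i : Data P) : 0 ≤ wk i := (wk_pos i).le
theorem F1_sy (x y) : Sy (cU P) 1 wk (fun i => S.F1 i x y) := by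
  refine S.sum1 wk_nn (fun q => (S.μ.St_sp (S.hD q) (fun c => S.u1_sp (S.hD q) q (S.aS q) c) _ x y).mul_right _) ?_
  have := (Sy.up (fun q => wk_nn q.1) (S.μ.St_sy S.u1_sy (N0 P) x y)).mul S.μ.e_sy
  rwa [mul_one] at this
theorem F2_sy (x y) : Sy (cU P) 1 wk (fun i => S.F2 i x y) := by
  refine S.sum2 wk_nn (fun q => (S.μ2.St_sp (S.D2_closed q) (fun c => S.u2_sp (S.D2_closed q) q (S.A2_sp q) c) _ x y).mul_right _) ?_
  have := (Sy.up (fun q => wk_nn q.1) (S.μ2.St_sy S.u2_sy (N0 P) x y)).mul S.μ2.e_sy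
  rwa [mul_one] at this
def wr : Data P → ℝ := wL * wk ^ N0 P
theorem wr_nn (i : Data P) : 0 ≤ wr i := mul_nonneg (wL_pos i).le (pow_nonneg (wk_nn i) _)
theorem G1_sy (y) : Sy (cU P) 1 wr (fun i => S.G1 i y) := by
  refine S.sum1 wr_nn (fun q => (S.μ.Tn_sp (S.hD q) (fun c => S.u1_sp (S.hD q) q (S.aS q) c) _ y).mul_right _) ?_
  have := (Sy.up (fun q => wr_nn q.1) (S.μ.Tn_sy (A := wL ∘ Prod.fst) (fun q => (wL_pos q.1).le) S.u1_sy (N0 P) y)).mul S.μ.e_sy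
  rwa [mul_one] at this
theorem G2_sy (y) : Sy (cU P) 1 wr (fun i => S.G2 i y) := by
  refine S.sum2 wr_nn (fun q => (S.μ2.Tn_sp (S.D2_closed q) (fun c => S.u2_sp (S.D2_closed q) q (S.A2_sp q) c) _ y).mul_right _) ?_
  have := (Sy.up (fun q => wr_nn q.1) (S.μ2.Tn_sy (A := wL ∘ Prod.fst) (fun q => (wL_pos q.1).le) S.u2_sy (N0 P) y)).mul S.μ2.e_sy
  rwa [mul_one] at this
theorem rem_sy (y) : Sy (cU P) 1 wr (fun i => S.rem i y) := (S.G1_sy y).add (S.G2_sy y)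
theorem nn1 (i : Data P) : 0 ≤ (1 : Data P → ℝ) i := zero_le_one
theorem w_sy (c) : Sy (cU P) 1 1 (fun i => S.w i c) := by
  simp only [S.w_eq]
  refine S.sum1 nn1 (fun q => (S.b_sp (S.hD q) q (S.aS q) c).mul_right _) ?_
  have := (Sy.up (fun q => zero_le_one) (S.b2 c).pred).mul S.μ.e_sy
  rwa [mul_one] at this
theorem wp_sy (c) : Sy (cU P) 1 1 (fun i => S.wp i c) := by
  refine S.sum1 (f := fun q => S.B q.2 c • (S.a q * S.e q)) nn1 (fun q => ((S.aS q).mul_right _).smul _) ?_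
  have := (Sy.up (fun q => zero_le_one) S.as.pred).mul S.μ.e_sy
  rw [mul_one] at this
  exact this.bsmul _ _ (S.Bs c)
theorem wd_eq (i : Data P) (c : Fin 3) : S.w i c - S.wp i c = ∑ t ∈ S.J i, S.cc (i, t) c * S.e (i, t) := by
  rw [S.w_eq, wp, ← Finset.sum_sub_distrib]
  refine Finset.sum_congr rfl fun t _ => ?_
  rw [b, add_mul, smul_mul_assoc, add_sub_cancel_left]
theorem wd_sy (c) : Sy (cU P) 1 wk (fun i => S.w i c - S.wp i c) := by
  simp only [S.wd_eq]
  refine S.sum1 wk_nn (fun q => (S.cc_sp (S.hD q) q (S.aS q) c).mul_right _) ?_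
  have := (Sy.up (fun q => wk_nn q.1) (S.cc1 c)).mul S.μ.e_sy
  rwa [mul_one] at this
theorem pi_sy : Sy (cU P) 1 1 (fun i => S.pi i) := by
  refine S.sum2 (f := fun q => S.pc q.2 • (S.A2 q * S.μ2.e q)) nn1 (fun q => ((S.A2_sp q).mul_right _).smul _) ?_
  have := (Sy.up (fun q => zero_le_one) S.A2_sy.pred).mul S.μ2.e_sy
  rw [mul_one] at this
  refine this.bsmul _ (2 * (S.MB * S.MB)) fun q => ?_
  have h := S.BB_bd q
  rw [pc]; split_ifs
  · rw [norm_zero]; exact (norm_nonneg _).trans h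
  · rw [norm_neg]; exact h
end WS
end CI
end

noncomputable section
open MeasureTheory Set Filter Topology
open scoped ContDiff
set_option linter.unusedSectionVars false

namespace CI
variable {P : ℕ} {τ : Type}

/-- the class of admissible error terms -/
structure Y (f : Data P → SF) : Prop where
  k : Bd (cU P) wk f
  d : ∀ j, Bd (cU P) wL (fun i => dx j (f i))
  D : Bd (cU P) wL (fun i => DT i (f i))

section Ycl
variable {f g : Data P → SF}
theorem Y.add (hf : Y f) (hg : Y g) : Y (fun i => f i + g i) where
  k := hf.k.add hg.k
  d j := by simp only [map_add]; exact (hf.d j).add (hg.d j)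
  D := by simp only [map_add]; exact hf.D.add hg.D
theorem Y.of_sy (hf : Sy (cU P) 1 wk f) : Y f where
  k := hf.bd
  d j := ((hf.symN 1).2 j : Bd (cU P) (wk * wl) _).mono 1 zero_le_one fun i => by
    rw [one_mul]; exact (wk_wl i).le
  D := (hf.dt.bd : Bd (cU P) (wk * wl) _).mono 1 zero_le_one fun i => by
    rw [one_mul]; exact (wk_wl i).le
theorem Y.mul (hf : Y f) (hg : Sy (cU P) 1 1 g) : Y (fun i => f i * g i) where
  k := by have := hf.k.mul hg.bd; rwa [mul_one] at this
  d j := by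
    simp only [dx_mul]
    have h1 := (hf.d j).mul hg.bd
    rw [mul_one] at h1
    refine h1.add ((hf.k.mul ((hg.symN 1).2 j : Bd (cU P) (1 * wl) _)).mono 1 zero_le_one fun i => ?_)
    rw [one_mul, one_mul]; exact (wk_wl i).le
  D := by
    simp only [Der_mul]
    have h1 := hf.D.mul hg.bd
    rw [mul_one] at h1
    refine h1.add ((hf.k.mul (hg.dt.bd : Bd (cU P) (1 * wl) _)).mono 1 zero_le_one fun i => ?_)
    rw [one_mul, one_mul]; exact (wk_wl i).le
theorem Bd.c0 {A : Data P → ℝ} (h : Bd (CI.c0 P) A f) : Bd (cU P) A f := h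
theorem bd_kL (h : Bd (CI.c0 P) (wk * wL) f) : Bd (cU P) wL f :=
  h.c0.mono 1 zero_le_one fun i => by rw [one_mul]; exact wkL_le i
end Ycl

theorem DT_diff (i : Data P) (f : SF) : DT i f = (dt f + ∑ m, i.v m * dx m f) - ∑ m, (i.v m - vl i m) * dx m f := by
  rw [DT_app]; simp only [sub_mul, Finset.sum_sub_distrib]; abel

theorem bd_near_dx {f : Data P → SF} (m : Fin 3) (h : Bd (c0 P) (wk * wL) f) :
    Bd (cU P) wL (fun i => (i.v m - vl i m) * f i) :=
  ((vl_near m).c0.mul (bd_kL h)).mono 1 zero_le_one fun i => by rw [one_mul]; exact wkL_le i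

theorem bd_mat_v (l : Fin 3) : Bd (cU P) wL (fun i => dt (i.v l) + ∑ m, i.v m * dx m (i.v l)) := by
  simp only [material_v]
  refine Bd.sub (Bd.sum _ (fun i => (wL_pos i).le) fun a _ => bd_kL (bd_dR a a l)) ?_
  exact ⟨1, zero_le_one, fun i z _ => by rw [one_mul]; exact i.bdp l z⟩

theorem Y_v (l : Fin 3) : Y (P := P) (fun i => i.v l - vl i l) where
  k := vl_near l
  d j := by simp only [map_sub]; exact (bd_kL (bd_dv j l)).sub (bd_kL (sy_dvl j l).bd)
  D := by
    simp only [map_sub]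
    refine Bd.sub ?_ (sy_Dvl l).bd
    simp only [DT_diff]
    exact (bd_mat_v l).sub (Bd.sum _ (fun i => (wL_pos i).le) fun m _ => bd_near_dx m (bd_dv m l))
theorem Y_R (a b : Fin 3) : Y (P := P) (fun i => i.R a b - mR i a b) where
  k := mR_near a b
  d j := by simp only [map_sub]; exact (bd_kL (bd_dR j a b)).sub (bd_kL (sy_dmR j a b).bd)
  D := by
    simp only [map_sub]
    refine Bd.sub ?_ (bd_kL (sy_DmR a b).bd)
    simp only [DT_diff]
    refine Bd.sub ?_ (Bd.sum _ (fun i => (wL_pos i).le) fun m _ => bd_near_dx m (bd_dR m a b))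
    exact ⟨1, zero_le_one, fun i z _ => by rw [one_mul]; exact (i.bDR a b z).trans (wkL_le i)⟩

/-! antidivergence of a tiny remainder -/
theorem tiny (i : Data P) : wV i * (i.L ^ 3 * i.κ ^ (4 * P + 2)) ≤ i.κ := by
  have h1 := i.hLP
  have h0 := pow_pos i.hκ0 P
  have h2 : 0 ≤ i.L * i.κ ^ P := mul_nonneg (wL_pos i).le h0.le
  have h3 : (i.L * i.κ ^ P) ^ 3 ≤ 1 := pow_le_one₀ h2 h1
  have e : wV i * (i.L ^ 3 * i.κ ^ (4 * P + 2)) = (i.L * i.κ ^ P) ^ 3 * (i.κ * i.κ) := by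
    rw [wV]; field_simp; ring
  rw [e]
  have : i.κ * i.κ ≤ i.κ := mul_le_of_le_one_left i.hκ0.le i.hκ1
  calc _ ≤ 1 * (i.κ * i.κ) := mul_le_mul_of_nonneg_right h3 (mul_self_nonneg _)
    _ ≤ _ := by rw [one_mul]; exact this
theorem tiny2 (i : Data P) : wV i * (WS.wr i * wl i * wl i) ≤ wk i := by
  have e : WS.wr i * wl i * wl i = i.L ^ 3 * i.κ ^ (4 * P + 2) := by
    have := i.hκ0.ne'
    simp only [WS.wr, WS.N0, wl, wL, wk, Pi.mul_apply, Pi.pow_apply]; field_simp; ring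
  rw [e]; exact tiny i
theorem wrl_nn (i : Data P) : 0 ≤ WS.wr i * wl i * wl i :=
  mul_nonneg (mul_nonneg (WS.wr_nn i) (wl_pos i).le) (wl_pos i).le
theorem tiny1 (i : Data P) : WS.wr i * wl i * wl i ≤ wk i :=
  (le_mul_of_one_le_left (wrl_nn i) (wV_one i)).trans (tiny2 i)
theorem tiny0 (i : Data P) : WS.wr i * wl i ≤ wk i :=
  (le_mul_of_one_le_right (mul_nonneg (WS.wr_nn i) (wl_pos i).le) (wl_one i)).trans (tiny1 i)

theorem adiv_Bd {A : Data P → ℝ} {f : Data P → Fin 3 → SF} (h : ∀ l m, Bd (cU P) A (fun i => dx m (f i l))) (a b) :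
    Bd (cU P) A (fun i => adiv (f i) a b) := by
  choose C hC H using h
  obtain ⟨K, hK, HK⟩ := adiv_bd
  refine ⟨K * ∑ l, ∑ m, C l m, mul_nonneg hK (Finset.sum_nonneg fun l _ => Finset.sum_nonneg fun m _ => hC l m), fun i z _ => ?_⟩
  by_cases hA : 0 ≤ A i
  · rw [mul_assoc]
    refine HK _ _ (fun l m z => (H l m i z (mem_univ _)).trans (mul_le_mul_of_nonneg_right ?_ hA)) a b z
    exact (Finset.single_le_sum (f := fun m => C l m) (fun m _ => hC l m) (Finset.mem_univ m)).trans
      (Finset.single_le_sum (f := fun l => ∑ m, C l m) (fun l _ => Finset.sum_nonneg fun m _ => hC l m) (Finset.mem_univ l))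
  · have hz : ∀ l m z, ‖(dx m (f i l)).1 z‖ ≤ 0 := fun l m z => (H l m i z (mem_univ _)).trans
      (mul_nonpos_of_nonneg_of_nonpos (hC l m) (not_le.1 hA).le)
    have h1 := HK (f i) 0 hz a b z
    have h2 := H 0 0 i z (mem_univ _)
    by_cases hs : ∑ l, ∑ m, C l m = 0
    · simpa [hs] using h1
    · exfalso
      refine hs (Finset.sum_eq_zero fun l _ => Finset.sum_eq_zero fun m _ => ?_)
      by_contra hne
      have hp : 0 < C l m := lt_of_le_of_ne (hC l m) (Ne.symm hne)
      have h3 := (norm_nonneg _).trans (H l m i z (mem_univ _))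
      nlinarith [not_le.1 hA]

theorem Y_adiv {f : Fin 3 → Data P → SF} (hf : ∀ l, Sy (cU P) 1 WS.wr (f l)) (a b) :
    Y (fun i => adiv (fun l => f l i) a b) := by
  have d1 : ∀ l m, Bd (cU P) (WS.wr * wl) (fun i => dx m (f l i)) := fun l m => ((hf l).symN 1).2 m
  have d2 : ∀ l m n, Bd (cU P) (WS.wr * wl * wl) (fun i => dx n (dx m (f l i))) := fun l m => (((hf l).symN 2).2 m).2
  have dD : ∀ l m, Bd (cU P) (WS.wr * wl * wl) (fun i => dx m (DT i (f l i))) := fun l m => ((hf l).dt.symN 1).2 m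
  have kk : ∀ i : Data P, wk i ≤ 1 * wL i := fun i => by rw [one_mul]; exact (wk_le i).trans (wL_one i)
  have A1 : ∀ m, Bd (cU P) (WS.wr * wl * wl) (fun i => adiv (fun l => dx m (f l i)) a b) := fun m =>
    adiv_Bd (fun l n => d2 l m n) a b
  have dv : ∀ l, Bd (cU P) wV (fun i => vl i l) := fun l => (sy_vl l).bd
  have dt1 : ∀ l m, Bd (cU P) wk (fun i => dx m (dt (f l i))) := by
    intro l m
    have e : ∀ i, dt (f l i) = DT i (f l i) - ∑ n, vl i n * dx n (f l i) := fun i => by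
      rw [DT_app]; abel
    simp only [e, map_sub, map_sum, dx_mul]
    refine ((dD l m).mono 1 zero_le_one fun i => ?_).sub (Bd.sum _ (fun i => (wk_pos i).le) fun n _ => Bd.add ?_ ?_)
    · rw [one_mul]; exact tiny1 i
    · refine ((bd_kL (sy_dvl m n).bd).mul (d1 l n)).mono 1 zero_le_one fun i => ?_
      rw [one_mul]
      refine le_trans ?_ (tiny1 i)
      simp only [Pi.mul_apply]
      rw [mul_comm]
      exact mul_le_mul_of_nonneg_left (wL_le_wl i) (mul_nonneg (WS.wr_nn i) (wl_pos i).le)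
    · refine ((dv n).mul (d2 l n m)).mono 1 zero_le_one fun i => ?_
      rw [one_mul]; exact tiny2 i
  refine ⟨?_, fun j => ?_, ?_⟩
  · exact (adiv_Bd d1 a b).mono 1 zero_le_one fun i => by rw [one_mul]; exact tiny0 i
  · simp only [dx_eq, dd_adiv]
    exact (A1 j).mono 1 zero_le_one fun i => (tiny1 i).trans (kk i)
  · have e : ∀ i, DT i (adiv (fun l => f l i) a b) = adiv (fun l => dt (f l i)) a b +
        ∑ m, vl i m * adiv (fun l => dx m (f l i)) a b := fun i => by
      rw [DT_app]
      congr 1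
      · exact dd_adiv _ _ _ _
      · exact Finset.sum_congr rfl fun m _ => by rw [dx_eq, dd_adiv]
    simp only [e]
    refine Bd.add ((adiv_Bd dt1 a b).mono 1 zero_le_one kk) (Bd.sum _ (fun i => (wL_pos i).le) fun m _ => ?_)
    exact ((dv m).mul (A1 m)).mono 1 zero_le_one fun i => (tiny2 i).trans (kk i)

/-! real part -/
def reS (f : SF) : SF := ⟨fun z => (((f.1 z).re : ℝ) : ℂ), by
  have h : ContDiff ℝ ∞ f.1 := SFo.cd f
  have : ContDiff ℝ ∞ (fun z => (Complex.ofRealCLM.comp Complex.reCLM) (f.1 z)) :=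
    (Complex.ofRealCLM.comp Complex.reCLM).contDiff.comp h
  exact this⟩
theorem reS_app (f : SF) (z) : (reS f).1 z = (((f.1 z).re : ℝ) : ℂ) := rfl
theorem reS_rl (f : SF) : Rl (reS f) := fun _ => Complex.ofReal_im _
theorem reS_of {f : SF} (h : Rl f) : reS f = f := by ext z; exact h.re_eq z
theorem reS_add (f g : SF) : reS (f + g) = reS f + reS g := by ext z; simp [reS_app]
theorem reS_sub (f g : SF) : reS (f - g) = reS f - reS g := by ext z; simp [reS_app]
theorem reS_zero : reS 0 = 0 := by ext z; simp [reS_app]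
theorem reS_sum {κ : Type*} (s : Finset κ) (f : κ → SF) : reS (∑ k ∈ s, f k) = ∑ k ∈ s, reS (f k) := by
  ext z; simp [reS_app, SFo.sum_app]
theorem reS_mul {g : SF} (hg : Rl g) (f : SF) : reS (g * f) = g * reS f := by
  ext z
  rw [SFo.mul_app, reS_app, reS_app, SFo.mul_app, Complex.mul_re, hg z, ← hg.re_eq z]
  push_cast; simp
theorem reS_dd (e) (f : SF) : dd e (reS f) = reS (dd e f) := by
  ext z
  rw [reS_app, dd_app, dd_app]
  have h := ((Complex.ofRealCLM.comp Complex.reCLM).hasFDerivAt (x := f.1 z)).comp z (SFo.diff f z).hasFDerivAt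
  have h' : HasFDerivAt (reS f).1 ((Complex.ofRealCLM.comp Complex.reCLM).comp (fderiv ℝ f.1 z)) z := h
  rw [h'.fderiv]; rfl
theorem reS_norm (f : SF) (z) : ‖(reS f).1 z‖ ≤ ‖f.1 z‖ := by
  rw [reS_app, Complex.norm_real]; exact Complex.abs_re_le_norm _
theorem reS_pk {k} {f : SF} (h : Pk k f) : Pk k (reS f) := fun z => by rw [reS_app, reS_app, h z]
theorem reS_sp {S} {f : SF} (h : Sp S f) : Sp S (reS f) := fun z hz => by rw [reS_app, h z hz]; simp
theorem reS_dx (j) (f : SF) : dx j (reS f) = reS (dx j f) := reS_dd _ _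
theorem reS_dt (f : SF) : dt (reS f) = reS (dt f) := reS_dd _ _
end CI
end

noncomputable section
open MeasureTheory Set Filter Topology
open scoped ContDiff
set_option linter.unusedSectionVars false

namespace CI
variable {P : ℕ} {τ : Type}
abbrev TT (i : Data P) : Set (ℝ × Spc) := TS (i.ta - 2 / i.L) (i.tb + 2 / i.L)
theorem TT_closed (i : Data P) : IsClosed (TT i) := TS_closed _ _
theorem TS_TT (i : Data P) : TS i.ta i.tb ⊆ TT i := fun z hz => by
  have : 0 ≤ 2 / i.L := div_nonneg zero_le_two (wL_pos i).le
  exact ⟨by linarith [hz.1], by linarith [hz.2]⟩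

namespace WS
variable (S : WS P τ)

/-! supports and periods of the global objects -/
theorem aT2 (i : Data P) (s) (hs : s ∈ S.J i ×ˢ S.J i) : Sp (TT i) (S.A2 (i, s)) :=
  (S.aT i s.1 (Finset.mem_product.1 hs).1).mul_right _
theorem w_T (i c) : Sp (TT i) (S.w i c) := by
  rw [w_eq]; exact Sp.sum fun t ht => (S.b_sp (TT_closed i) (i, t) (S.aT i t ht) c).mul_right _
theorem wp_T (i c) : Sp (TT i) (S.wp i c) := Sp.sum fun t ht => ((S.aT i t ht).mul_right _).smul _
theorem pi_T (i) : Sp (TT i) (S.pi i) := Sp.sum fun s hs => ((S.aT2 i s hs).mul_right _).smul _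
theorem F1_T (i x y) : Sp (TT i) (S.F1 i x y) := Sp.sum fun t ht =>
  (S.μ.St_sp (TT_closed i) (fun c => S.u1_sp (TT_closed i) (i, t) (S.aT i t ht) c) _ x y).mul_right _
theorem F2_T (i x y) : Sp (TT i) (S.F2 i x y) := Sp.sum fun s hs =>
  (S.μ2.St_sp (TT_closed i) (fun c => S.u2_sp (TT_closed i) (i, s) (S.aT2 i s hs) c) _ x y).mul_right _
theorem rem_T (i y) : Sp (TT i) (S.rem i y) := Sp.add
  (Sp.sum fun t ht =>
    (S.μ.Tn_sp (TT_closed i) (fun c => S.u1_sp (TT_closed i) (i, t) (S.aT i t ht) c) _ y).mul_right _)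
  (Sp.sum fun s hs =>
    (S.μ2.Tn_sp (TT_closed i) (fun c => S.u2_sp (TT_closed i) (i, s) (S.aT2 i s hs) c) _ y).mul_right _)
theorem Ψ_P (i c k) : Pk (kv k) (S.Ψ i c) :=
  (Pk.sum fun t _ => ((S.aP (i, t) k).mul (S.eP (i, t) k)).smul _).smul _
theorem w_P (i c k) : Pk (kv k) (S.w i c) := ((S.Ψ_P i _ k).dd _).sub ((S.Ψ_P i _ k).dd _)
theorem wp_P (i c k) : Pk (kv k) (S.wp i c) := Pk.sum fun t _ => ((S.aP (i, t) k).mul (S.eP (i, t) k)).smul _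
theorem pi_P (i k) : Pk (kv k) (S.pi i) := Pk.sum fun s _ => ((S.A2_pk (i, s) k).mul (S.e2_pk (i, s) k)).smul _
theorem F1_P (i x y k) : Pk (kv k) (S.F1 i x y) := Pk.sum fun t _ =>
  (S.μ.St_pk (fun a => S.gP a (i, t) k) (fun c => S.u1_pk (i, t) k c) _ x y).mul (S.eP _ k)
theorem F2_P (i x y k) : Pk (kv k) (S.F2 i x y) := Pk.sum fun s _ =>
  (S.μ2.St_pk (fun a => S.g2_pk a (i, s) k) (fun c => S.u2_pk (i, s) k c) _ x y).mul (S.e2_pk _ k)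
theorem rem_P (i y k) : Pk (kv k) (S.rem i y) := Pk.add
  (Pk.sum fun t _ => (S.μ.Tn_pk (fun a => S.gP a (i, t) k) (fun c => S.u1_pk (i, t) k c) _ y).mul (S.eP _ k))
  (Pk.sum fun s _ => (S.μ2.Tn_pk (fun a => S.g2_pk a (i, s) k) (fun c => S.u2_pk (i, s) k c) _ y).mul (S.e2_pk _ k))

theorem w_rl (i c) : Rl (S.w i c) := by
  have h : ∀ c, Rl (S.Ψ i c) := fun c => by
    have := (S.rl i c).smul ((5 * wl i)⁻¹)
    push_cast at this; exact this
  exact ((h _).dd _).sub ((h _).dd _)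

theorem steps1 (i : Data P) (y : Fin 3) :
    ∑ t ∈ S.J i, S.u1 y (i, t) * S.e (i, t) = ∑ x, dx x (S.F1 i x y) + S.G1 i y := by
  simp only [F1, G1, map_sum]
  rw [Finset.sum_comm, ← Finset.sum_add_distrib]
  refine Finset.sum_congr rfl fun t _ => S.μ.steps (N0 P) S.u1 (i, t) (fun hm b => ?_) y
  have hmz : ∀ n, S.mz t n = 0 := fun n => by
    have h1 := S.hmz (i, t) n
    rw [hm] at h1
    have h1' : ((S.mz t n : ℤ) : ℝ) = 0 := h1.symm
    exact_mod_cast h1'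
  have hB : ∀ c, S.B t c = 0 := fun c => by
    have := S.hcurl t c
    rw [hmz, hmz] at this
    simpa using this.symm
  have hb : ∀ c, S.b (i, t) c = 0 := fun c => by simp [WS.b, cc, hB]
  simp [u1, hb]
theorem steps2 (i : Data P) (y : Fin 3) :
    ∑ s ∈ S.J i ×ˢ S.J i, S.u2 y (i, s) * S.μ2.e (i, s) = ∑ x, dx x (S.F2 i x y) + S.G2 i y := by
  simp only [F2, G2, map_sum]
  rw [Finset.sum_comm, ← Finset.sum_add_distrib]
  refine Finset.sum_congr rfl fun s _ => S.μ2.steps (N0 P) S.u2 (i, s) (fun hm b => ?_) y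
  have : S.mz s.1 + S.mz s.2 = 0 := by
    funext n
    have h1 := congrFun hm n
    change (((S.mz s.1 + S.mz s.2) n : ℤ) : ℝ) = 0 at h1
    exact_mod_cast h1
  simp [u2, this]

theorem rem_eq (i : Data P) (y : Fin 3) : S.rem i y =
    dt (S.w i y) + (∑ x, dx x (vl i x * S.w i y + S.w i x * vl i y) + ∑ x, dx x (S.wp i x * S.wp i y)
     + dx y (S.pi i) + ∑ x, dx x (S.Q i x y) - ∑ x, dx x (S.F1 i x y) - ∑ x, dx x (S.F2 i x y)) := by
  have h1 := S.lin_part i y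
  have h2 := S.quad_part i y
  rw [steps1] at h1
  rw [steps2] at h2
  have e1 : S.G1 i y = dt (S.w i y) + ∑ x, dx x (vl i x * S.w i y + S.w i x * vl i y) - ∑ x, dx x (S.F1 i x y) := by
    rw [h1]; abel
  have e2 : S.G2 i y = ∑ x, dx x (S.wp i x * S.wp i y) + dx y (S.pi i) + ∑ x, dx x (S.Q i x y) - ∑ x, dx x (S.F2 i x y) := by
    rw [h2]; abel
  rw [rem, e1, e2]; abel

theorem rem_mean (i : Data P) (y : Fin 3) : Aop 2 (Aop 1 (Aop 0 (S.rem i y))) = 0 := by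
  have md : ∀ (j : Fin 3) {f : SF}, (∀ k, Pk (kv k) f) → Aop 2 (Aop 1 (Aop 0 (dx j f))) = 0 := fun j f hf =>
    mean_dx j fun l => by rw [eS_kv]; exact hf _
  have hw : dt (S.w i y) = dx (y+1) (dt (S.Ψ i (y+2))) - dx (y+2) (dt (S.Ψ i (y+1))) := by
    rw [dx_dt, dx_dt, ← map_sub]; rfl
  rw [rem_eq, hw]
  simp only [map_add, map_sub, map_sum]
  have hΨ : ∀ c k, Pk (kv k) (dt (S.Ψ i c)) := fun c k => (S.Ψ_P i c k).dd _
  rw [md _ (hΨ _), md _ (hΨ _), md y (S.pi_P i)]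
  have h1 : ∀ a b x, Aop 2 (Aop 1 (Aop 0 (dx x (vl i a * S.w i b)))) = 0 := fun a b x =>
    md x fun k => (vl_pk i a k).mul (S.w_P i b k)
  have h1' : ∀ a b x, Aop 2 (Aop 1 (Aop 0 (dx x (S.w i b * vl i a)))) = 0 := fun a b x =>
    md x fun k => (S.w_P i b k).mul (vl_pk i a k)
  have h2 : ∀ a b x, Aop 2 (Aop 1 (Aop 0 (dx x (S.wp i a * S.wp i b)))) = 0 := fun a b x =>
    md x fun k => (S.wp_P i a k).mul (S.wp_P i b k)
  have h3 : ∀ x, Aop 2 (Aop 1 (Aop 0 (dx x (S.Q i x y)))) = 0 := fun x => md x fun k => S.QP i x y k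
  have h4 : ∀ x, Aop 2 (Aop 1 (Aop 0 (dx x (S.F1 i x y)))) = 0 := fun x => md x fun k => S.F1_P i x y k
  have h5 : ∀ x, Aop 2 (Aop 1 (Aop 0 (dx x (S.F2 i x y)))) = 0 := fun x => md x fun k => S.F2_P i x y k
  simp only [h1, h1', h2, h3, h4, h5, Finset.sum_const_zero, add_zero, sub_zero]

/-- the new (complex) stress -/
def RC (i : Data P) (a b : Fin 3) : SF :=
  (i.R a b - mR i a b) + (mR i a b - S.Q i a b) +
  ((i.v a - vl i a) * S.w i b + (i.v b - vl i b) * S.w i a) +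
  ((S.w i a - S.wp i a) * S.w i b + (S.w i b - S.wp i b) * S.wp i a) +
  (S.F1 i a b + S.F2 i a b) + adiv (fun l => S.rem i l) a b

theorem RC_Y (a b) : Y (fun i => S.RC i a b) := by
  refine ((((Y.add (Y_R a b) ⟨S.Qk a b, S.Qd a b, S.QD a b⟩).add ?_).add ?_).add ?_).add (Y_adiv S.rem_sy a b)
  · exact ((Y_v a).mul (S.w_sy b)).add ((Y_v b).mul (S.w_sy a))
  · exact ((Y.of_sy (S.wd_sy a)).mul (S.w_sy b)).add ((Y.of_sy (S.wd_sy b)).mul (S.wp_sy a))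
  · exact (Y.of_sy (S.F1_sy a b)).add (Y.of_sy (S.F2_sy a b))

theorem RC_div (i : Data P) (b) : dt (i.v b + S.w i b) + ∑ a, dx a ((i.v a + S.w i a) * (i.v b + S.w i b))
    + dx b (i.p + S.pi i) = ∑ a, dx a (S.RC i a b) := by
  have h0 := i.er b
  have h1 := S.rem_eq i b
  have h2 := adiv_div (fun l => S.rem i l) (fun j l => by rw [eS_kv]; exact S.rem_P i l _) (S.rem_mean i) b
  have e1 : ∀ a, (i.v a + S.w i a) * (i.v b + S.w i b) = i.v a * i.v b + (vl i a * S.w i b + S.w i a * vl i b) +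
     S.wp i a * S.wp i b + ((i.v a - vl i a) * S.w i b + (i.v b - vl i b) * S.w i a) +
     ((S.w i a - S.wp i a) * S.w i b + (S.w i b - S.wp i b) * S.wp i a) := fun a => by ring
  simp only [e1, RC, map_add, map_sub (dx _), Finset.sum_add_distrib, Finset.sum_sub_distrib] at h0 h1 h2 ⊢
  rw [h2, h1]
  have h0' : dt (i.v b) = ∑ a, dx a (i.R a b) - ∑ a, dx a (i.v a * i.v b) - dx b i.p := by rw [← h0]; abel
  rw [h0']; abel

theorem RC_symm (i a b) : S.RC i a b = S.RC i b a := by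
  have h1 : S.F1 i a b = S.F1 i b a := Finset.sum_congr rfl fun t _ => by rw [S.μ.St_symm]
  have h2 : S.F2 i a b = S.F2 i b a := Finset.sum_congr rfl fun t _ => by rw [S.μ2.St_symm]
  rw [RC, RC, i.Rsym a b, mR_symm i a b, S.Qsym i a b, h1, h2, adiv_symm _ a b]
  ring
theorem RC_P (i a b k) : Pk (kv k) (S.RC i a b) := by
  have hv := fun a => (i.vP a k).sub (vl_pk i a k)
  have hw := fun a => S.w_P i a k
  have hp := fun a => S.wp_P i a k
  exact (((((((i.RP a b k).sub (mR_pk i a b k)).add ((mR_pk i a b k).sub (S.QP i a b k)))).add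
    (((hv a).mul (hw b)).add ((hv b).mul (hw a)))).add
    ((((hw a).sub (hp a)).mul (hw b)).add (((hw b).sub (hp b)).mul (hp a)))).add
    ((S.F1_P i a b k).add (S.F2_P i a b k))).add (adiv_pk (fun l => S.rem_P i l k) a b)
theorem RC_T (i a b) : Sp (TT i) (S.RC i a b) := by
  have hw := fun a => S.w_T i a
  have hm : Sp (TT i) (mR i a b) := (Mo_sp (i.RS a b) 0).mono (TS_TT i)
  have hR : Sp (TT i) (i.R a b) := (i.RS a b).mono (TS_TT i)
  exact (((((hR.sub hm).add (hm.sub (S.QT i a b))).add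
    (((hw b).mul_left _).add ((hw a).mul_left _))).add
    (((hw b).mul_left _).add ((S.wp_T i a).mul_left _))).add
    ((S.F1_T i a b).add (S.F2_T i a b))).add (adiv_sp (fun l => S.rem_T i l) a b)
end WS

/-- the outcome of one step of the iteration -/
structure Out (C : ℝ) (i : Data P) (w : Fin 3 → SF) (q : SF) (R : Fin 3 → Fin 3 → SF) : Prop where
  wR : ∀ l, Rl (w l)
  qR : Rl q
  RR : ∀ a b, Rl (R a b)
  wP : ∀ l k, Pk (kv k) (w l)
  qP : ∀ k, Pk (kv k) q
  RP : ∀ a b k, Pk (kv k) (R a b)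
  wS : ∀ l, Sp (TT i) (w l)
  qS : Sp (TT i) q
  RS : ∀ a b, Sp (TT i) (R a b)
  Rsym : ∀ a b, R a b = R b a
  div0 : ∑ a, dx a (w a) = 0
  er : ∀ b, dt (i.v b + w b) + ∑ a, dx a ((i.v a + w a) * (i.v b + w b)) + dx b (i.p + q) = ∑ a, dx a (R a b)
  bw : ∀ l z, ‖(w l).1 z‖ ≤ C
  bdw : ∀ j l z, ‖(dx j (w l)).1 z‖ ≤ C * wl i
  btw : ∀ l z, ‖(dt (w l)).1 z‖ ≤ C * wl i * (1 + ∑ m, ‖(i.v m).1 z‖)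
  bq : ∀ z, ‖q.1 z‖ ≤ C
  bdq : ∀ j z, ‖(dx j q).1 z‖ ≤ C * wl i
  btq : ∀ z, ‖(dt q).1 z‖ ≤ C * wl i * (1 + ∑ m, ‖(i.v m).1 z‖)
  bR : ∀ a b z, ‖(R a b).1 z‖ ≤ C * i.κ
  bdR : ∀ j a b z, ‖(dx j (R a b)).1 z‖ ≤ C * i.L
  bDR : ∀ a b z, ‖(dt (R a b) + ∑ j, (i.v j + w j) * dx j (R a b)).1 z‖ ≤ C * i.L

/-- all constants at once -/
theorem Bd.fin {κ : Type} [Finite κ] {A : Data P → ℝ} {f : κ → Data P → SF} (h : ∀ k, Bd (cU P) A (f k)) :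
    ∃ C, 0 ≤ C ∧ ∀ k i z, 0 ≤ A i → ‖(f k i).1 z‖ ≤ C * A i := by
  have := Fintype.ofFinite κ
  choose C hC H using h
  refine ⟨∑ k, C k, Finset.sum_nonneg fun k _ => hC k, fun k i z hA => (H k i z (mem_univ _)).trans ?_⟩
  exact mul_le_mul_of_nonneg_right (Finset.single_le_sum (f := C) (fun k _ => hC k) (Finset.mem_univ k)) hA

theorem dt_bound {f : Data P → SF} (hf : Sy (cU P) 1 1 f) :
    ∃ C, 0 ≤ C ∧ ∀ (i : Data P) z, ‖(dt (f i)).1 z‖ ≤ C * wl i * (1 + ∑ m, ‖(i.v m).1 z‖) := by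
  obtain ⟨C1, h1, H1⟩ := (hf.dt.bd : Bd (cU P) (1 * wl) _)
  obtain ⟨C2, h2, H2⟩ := Bd.fin (κ := Fin 3) (fun j => ((hf.symN 1).2 j : Bd (cU P) (1 * wl) (fun i => dx j (f i))))
  obtain ⟨C3, h3, H3⟩ := Bd.fin (κ := Fin 3) (fun m => (vl_near (P := P) m : Bd (cU P) wk _))
  refine ⟨C1 + C2 * (3 * C3 + 1), by positivity, fun i z => ?_⟩
  have e : (dt (f i)).1 z = (DT i (f i)).1 z - ∑ m, (vl i m).1 z * (dx m (f i)).1 z := by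
    rw [DT_app]; simp [SFo.sum_app]
  have k1 : ‖(DT i (f i)).1 z‖ ≤ C1 * wl i := by
    have := H1 i z (mem_univ _)
    change _ ≤ C1 * (1 * wl i) at this
    rwa [one_mul] at this
  have hl := wl_pos i
  have k2 : ∀ m, ‖(dx m (f i)).1 z‖ ≤ C2 * wl i := fun m => by
    have := H2 m i z (show (0:ℝ) ≤ 1 * wl i by rw [one_mul]; exact hl.le)
    change _ ≤ C2 * (1 * wl i) at this
    rwa [one_mul] at this
  have k3 : ∀ m, ‖(vl i m).1 z‖ ≤ C3 + ‖(i.v m).1 z‖ := fun m => by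
    have := (H3 m i z (wk_pos i).le).trans (mul_le_of_le_one_right h3 (wk_le i))
    rw [SFo.sub_app] at this
    have := norm_sub_norm_le ((vl i m).1 z) ((i.v m).1 z)
    rw [norm_sub_rev] at this
    linarith
  have k4 : ‖∑ m, (vl i m).1 z * (dx m (f i)).1 z‖ ≤ ∑ m, (C3 + ‖(i.v m).1 z‖) * (C2 * wl i) :=
    norm_sum_le_of_le _ fun m _ => by
      rw [norm_mul]; exact mul_le_mul (k3 m) (k2 m) (norm_nonneg _) ((norm_nonneg _).trans (k3 m))
  rw [e]
  refine (norm_sub_le _ _).trans ((add_le_add k1 k4).trans ?_)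
  rw [← Finset.sum_mul, Finset.sum_add_distrib]
  have hs : 0 ≤ ∑ m, ‖(i.v m).1 z‖ := Finset.sum_nonneg fun m _ => norm_nonneg _
  simp only [Finset.sum_const, Finset.card_univ, Fintype.card_fin, nsmul_eq_mul]
  push_cast
  generalize (∑ m, ‖(i.v m).1 z‖) = s at *
  generalize wl i = l at *
  have : 0 ≤ C1 * l * s := by positivity
  have : 0 ≤ C2 * l * C3 * s := by positivity
  have : 0 ≤ C2 * l := by positivity
  nlinarith

theorem WS.step (S : WS P τ) : ∃ C, 1 ≤ C ∧ ∀ i : Data P, ∃ w q R, Out C i w q R := by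
  obtain ⟨c1, h1, H1⟩ := Bd.fin (fun l => (S.w_sy l).bd)
  obtain ⟨c2, h2, H2⟩ := Bd.fin (κ := Fin 3 × Fin 3) (fun l => (((S.w_sy l.2).symN 1).2 l.1 : Bd (cU P) (1 * wl) (fun i => dx l.1 (S.w i l.2))))
  choose c3 h3 H3 using fun l => dt_bound (S.w_sy l)
  obtain ⟨c4, h4, H4⟩ := S.pi_sy.bd
  obtain ⟨c5, h5, H5⟩ := Bd.fin (fun j => ((S.pi_sy.symN 1).2 j : Bd (cU P) (1 * wl) (fun i => dx j (S.pi i))))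
  obtain ⟨c6, h6, H6⟩ := dt_bound S.pi_sy
  obtain ⟨c7, h7, H7⟩ := Bd.fin (κ := Fin 3 × Fin 3) (fun a => (S.RC_Y a.1 a.2).k)
  obtain ⟨c8, h8, H8⟩ := Bd.fin (κ := Fin 3 × Fin 3 × Fin 3) (fun a => (S.RC_Y a.2.1 a.2.2).d a.1)
  have hY : ∀ a : Fin 3 × Fin 3, Bd (cU P) wL (fun i => dt (S.RC i a.1 a.2) + ∑ j, (i.v j + S.w i j) * dx j (S.RC i a.1 a.2)) := by
    intro a
    have e : ∀ i, dt (S.RC i a.1 a.2) + ∑ j, (i.v j + S.w i j) * dx j (S.RC i a.1 a.2) =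
      DT i (S.RC i a.1 a.2) + ∑ j, ((i.v j - vl i j) + S.w i j) * dx j (S.RC i a.1 a.2) := fun i => by
      rw [DT_app, add_assoc, ← Finset.sum_add_distrib]
      congr 1
      exact Finset.sum_congr rfl fun j _ => by ring
    simp only [e]
    refine (S.RC_Y a.1 a.2).D.add (Bd.sum _ (fun i => (wL_pos i).le) fun j _ => ?_)
    have hb : Bd (cU P) 1 (fun i => (i.v j - vl i j) + S.w i j) :=
      ((Y_v j).k.mono 1 zero_le_one fun i => by simpa using wk_le i).add (S.w_sy j).bd
    have := hb.mul ((S.RC_Y a.1 a.2).d j)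
    rwa [one_mul] at this
  obtain ⟨c9, h9, H9⟩ := Bd.fin hY
  have h3' : 0 ≤ ∑ l, c3 l := Finset.sum_nonneg fun l _ => h3 l
  refine ⟨1 + c1 + c2 + (∑ l, c3 l) + c4 + c5 + c6 + c7 + c8 + c9, by linarith, fun i => ?_⟩
  set C := 1 + c1 + c2 + (∑ l, c3 l) + c4 + c5 + c6 + c7 + c8 + c9 with hC
  have hl := wl_pos i
  have hL := wL_pos i
  have hs : ∀ z, 0 ≤ 1 + ∑ m, ‖(i.v m).1 z‖ := fun z => by
    have : 0 ≤ ∑ m, ‖(i.v m).1 z‖ := Finset.sum_nonneg fun m _ => norm_nonneg _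
    linarith
  have mm : ∀ {x y : ℝ}, x ≤ C → 0 ≤ y → x * y ≤ C * y := fun h hy => mul_le_mul_of_nonneg_right h hy
  refine ⟨S.w i, reS (S.pi i), fun a b => reS (S.RC i a b), ?_⟩
  refine
  { wR := S.w_rl i
    qR := reS_rl _
    RR := fun a b => reS_rl _
    wP := fun l k => S.w_P i l k
    qP := fun k => reS_pk (S.pi_P i k)
    RP := fun a b k => reS_pk (S.RC_P i a b k)
    wS := S.w_T i
    qS := reS_sp (S.pi_T i)
    RS := fun a b => reS_sp (S.RC_T i a b)
    Rsym := fun a b => by rw [S.RC_symm]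
    div0 := S.w_div i
    er := fun b => ?_
    bw := fun l z => ?_
    bdw := fun j l z => ?_
    btw := fun l z => ?_
    bq := fun z => ?_
    bdq := fun j z => ?_
    btq := fun z => ?_
    bR := fun a b z => ?_
    bdR := fun j a b z => ?_
    bDR := fun a b z => ?_ }
  · have hv : ∀ a, Rl (i.v a + S.w i a) := fun a => (i.vR a).add (S.w_rl i a)
    have hp : Rl (dx b i.p) := by
      have : dx b i.p = ∑ a, dx a (i.R a b) - ∑ a, dx a (i.v a * i.v b) - dt (i.v b) := by
        rw [← i.er b]; abel
      rw [this]
      exact ((Rl.sum fun a _ => (i.RR a b).dd _).sub (Rl.sum fun a _ => ((i.vR a).mul (i.vR b)).dd _)).sub ((i.vR b).dd _)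
    have h := congrArg reS (S.RC_div i b)
    rw [reS_add, reS_add, reS_sum, reS_sum] at h
    rw [map_add (dx b), reS_add, reS_of hp] at h
    rw [map_add (dx b), reS_dx]
    have ht : Rl (dt (i.v b + S.w i b)) := (hv b).dd _
    rw [reS_of ht] at h
    have h' : ∀ a, reS (dx a ((i.v a + S.w i a) * (i.v b + S.w i b))) = dx a ((i.v a + S.w i a) * (i.v b + S.w i b)) := fun a =>
      reS_of (((hv a).mul (hv b)).dd _)
    simp only [h'] at h
    simp only [reS_dx]
    exact h
  · exact (H1 l i z zero_le_one).trans (by simp; linarith)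
  · have := H2 (j, l) i z (show (0:ℝ) ≤ 1 * wl i by rw [one_mul]; exact hl.le)
    change _ ≤ c2 * (1 * wl i) at this
    rw [one_mul] at this
    exact this.trans (mm (by linarith) hl.le)
  · refine (H3 l i z).trans ?_
    rw [mul_assoc, mul_assoc]
    refine mm ?_ (mul_nonneg hl.le (hs z))
    have := Finset.single_le_sum (f := c3) (fun l _ => h3 l) (Finset.mem_univ l)
    linarith
  · refine (reS_norm _ z).trans ((H4 i z (mem_univ _)).trans (by simp; linarith))
  · have := H5 j i z (show (0:ℝ) ≤ 1 * wl i by rw [one_mul]; exact hl.le)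
    change _ ≤ c5 * (1 * wl i) at this
    rw [one_mul] at this
    rw [reS_dx]
    exact (reS_norm _ z).trans (this.trans (mm (by linarith) hl.le))
  · rw [reS_dt]
    refine (reS_norm _ z).trans ((H6 i z).trans ?_)
    rw [mul_assoc, mul_assoc]
    exact mm (by linarith) (mul_nonneg hl.le (hs z))
  · exact (reS_norm _ z).trans ((H7 (a, b) i z (wk_pos i).le).trans (mm (by linarith) (wk_pos i).le))
  · rw [reS_dx]
    exact (reS_norm _ z).trans ((H8 (j, a, b) i z hL.le).trans (mm (by linarith) hL.le))
  · have e : dt (reS (S.RC i a b)) + ∑ j, (i.v j + S.w i j) * dx j (reS (S.RC i a b)) =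
      reS (dt (S.RC i a b) + ∑ j, (i.v j + S.w i j) * dx j (S.RC i a b)) := by
      rw [reS_add, reS_sum, reS_dt]
      congr 1
      exact Finset.sum_congr rfl fun j _ => by rw [reS_mul ((i.vR j).add (S.w_rl i j)), reS_dx]
    rw [e]
    exact (reS_norm _ z).trans ((H9 (a, b) i z hL.le).trans (mm (by linarith) hL.le))
end CI
end

noncomputable section
open MeasureTheory Set Filter Topology
open scoped ContDiff
set_option linter.unusedSectionVars false

namespace CI
variable {P : ℕ}

/-! ### temporal cutoffs -/
def sgm (s : ℝ) : ℝ := Real.smoothTransition (2 * s - 1 / 2)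
def eta (s : ℝ) : ℝ := Real.sin (Real.pi / 2 * sgm (1 + s)) * Real.cos (Real.pi / 2 * sgm s)
theorem sgm_cd : ContDiff ℝ ∞ sgm := Real.smoothTransition.contDiff.comp (by fun_prop)
theorem eta_cd : ContDiff ℝ ∞ eta := by
  have h1 : ContDiff ℝ ∞ (fun s : ℝ => sgm (1 + s)) := sgm_cd.comp (by fun_prop)
  exact (Real.contDiff_sin.comp (contDiff_const.mul h1)).mul (Real.contDiff_cos.comp (contDiff_const.mul sgm_cd))
theorem sgm0 {s : ℝ} (h : s ≤ 1/4) : sgm s = 0 := Real.smoothTransition.zero_of_nonpos (by linarith)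
theorem sgm1 {s : ℝ} (h : 3/4 ≤ s) : sgm s = 1 := Real.smoothTransition.one_of_one_le (by linarith)
theorem eta_supp {s : ℝ} (h : 3/4 < |s|) : eta s = 0 := by
  rcases lt_abs.1 h with h | h
  · rw [eta, sgm1 h.le, mul_one, Real.cos_pi_div_two, mul_zero]
  · rw [eta, sgm0 (s := 1 + s) (by linarith), mul_zero, Real.sin_zero, zero_mul]
theorem eta_sq {r : ℝ} (h0 : 0 ≤ r) (h1 : r ≤ 1) : eta r ^ 2 + eta (r - 1) ^ 2 = 1 := by
  have e1 : eta r = Real.cos (Real.pi / 2 * sgm r) := by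
    rw [eta, sgm1 (s := 1 + r) (by linarith), mul_one, Real.sin_pi_div_two, one_mul]
  have e2 : eta (r - 1) = Real.sin (Real.pi / 2 * sgm r) := by
    rw [eta, sgm0 (s := r - 1) (by linarith), mul_zero, Real.cos_zero, mul_one]
    congr 3; ring
  rw [e1, e2]; exact Real.cos_sq_add_sin_sq _

def ets (n : ℕ) : ℝ → ℝ := iteratedDeriv n eta
theorem ets_cd (n : ℕ) : ContDiff ℝ ∞ (ets n) := by
  induction n with
  | zero => simpa [ets] using eta_cd
  | succ n ih =>
    rw [ets, iteratedDeriv_succ]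
    exact (contDiff_infty_iff_deriv.1 ih).2
theorem ets_deriv (n : ℕ) (s : ℝ) : HasDerivAt (ets n) (ets (n+1) s) s := by
  rw [ets, ets, iteratedDeriv_succ]
  exact ((ets_cd n).differentiable (by simp) s).hasDerivAt
theorem ets_bd (n : ℕ) : ∃ C, ∀ s, |ets n s| ≤ C := by
  have hs : HasCompactSupport (ets n) := by
    have h0 : HasCompactSupport eta := HasCompactSupport.of_support_subset_isCompact (isCompact_Icc (a := (-3/4:ℝ)) (b := 3/4)) fun s hs => by
      by_contra h
      exact hs (eta_supp (by
        by_contra h'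
        rw [not_lt, abs_le] at h'
        exact h ⟨by linarith [h'.1], h'.2⟩))
    induction n with
    | zero => simpa [ets] using h0
    | succ n ih => rw [ets, iteratedDeriv_succ]; exact ih.deriv
  obtain ⟨C, hC⟩ := hs.exists_bound_of_continuous (ets_cd n).continuous
  exact ⟨C, fun s => by simpa using hC s⟩

def etF (n : ℕ) (q : I1 P) : SF := ⟨fun z => ((ets n (q.1.L * z.1 - q.2) : ℝ) : ℂ), by
  change ContDiff ℝ ∞ _
  exact Complex.ofRealCLM.contDiff.comp ((ets_cd n).comp (by fun_prop))⟩
theorem etF_app (n : ℕ) (q : I1 P) (z) : (etF n q).1 z = ((ets n (q.1.L * z.1 - q.2) : ℝ) : ℂ) := rfl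
theorem etF_line (n : ℕ) (q : I1 P) (z e : ℝ × Spc) :
    (dd e (etF n q)).1 z = ((e.1 * q.1.L : ℝ) : ℂ) * (etF (n+1) q).1 z := by
  have h1 : HasDerivAt (fun r : ℝ => (etF n q).1 (z + r • e)) ((dd e (etF n q)).1 z) 0 := by
    rw [dd_app]
    have := (SFo.diff (etF n q) (z + (0:ℝ) • e)).hasFDerivAt.comp_hasDerivAt (0:ℝ)
      (((hasDerivAt_id (0:ℝ)).smul_const e).const_add z)
    simpa [Function.comp_def] using this
  have h2 : HasDerivAt (fun r : ℝ => (etF n q).1 (z + r • e)) (((ets (n+1) (q.1.L * z.1 - q.2) * (q.1.L * e.1) : ℝ)) : ℂ) 0 := by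
    apply HasDerivAt.ofReal_comp
    have hl : HasDerivAt (fun r : ℝ => q.1.L * (z.1 + r * e.1) - q.2) (q.1.L * e.1) 0 := by
      have := ((((hasDerivAt_id (0:ℝ)).mul_const e.1).const_add z.1).const_mul q.1.L).sub_const (q.2 : ℝ)
      simpa using this
    have h0 := ets_deriv n (q.1.L * (z.1 + (0:ℝ) * e.1) - q.2)
    have := h0.comp (0:ℝ) hl
    simpa [Function.comp_def] using this
  rw [h1.unique h2, etF_app]; push_cast; ring
theorem etF_dx (n : ℕ) (q : I1 P) (j) : dx j (etF n q) = 0 := by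
  ext z
  rw [dx_eq, etF_line]; simp [eS]
theorem etF_dt (n : ℕ) (q : I1 P) : dt (etF n q) = (q.1.L : ℂ) • etF (n+1) q := by
  ext z
  have := etF_line n q z (1, 0)
  change (dd (1,0) (etF n q)).1 z = _
  rw [this]; simp
theorem etF_DT (n : ℕ) (q : I1 P) : DT (p1 q) (etF n q) = (q.1.L : ℂ) • etF (n+1) q := by
  rw [DT_app, etF_dt]; simp [etF_dx]
theorem etF_sy (m n : ℕ) : Sy (c1 P) m 1 (etF n) := by
  have h0 : ∀ n k, SymN (c1 P) k 1 (etF n) := by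
    intro n k
    induction k with
    | zero =>
      obtain ⟨C, hC⟩ := ets_bd n
      exact ⟨|C|, abs_nonneg _, fun q z _ => by
        rw [etF_app, Complex.norm_real, Pi.one_apply, mul_one]; exact (hC _).trans (le_abs_self _)⟩
    | succ k ih =>
      refine ⟨ih, fun j => ?_⟩
      change SymN (c1 P) k _ (fun q => dx j (etF n q))
      simp only [etF_dx]
      exact SymN.zero fun q => by simpa using (zero_le_one.trans ((c1 P).hL q))
  induction m generalizing n with
  | zero => exact h0 n
  | succ m ih =>
    refine ⟨h0 n, ?_⟩
    change Sy (c1 P) m _ (fun q => DT (p1 q) (etF n q))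
    simp only [etF_DT]
    have := (ih (n+1)).csmul (B := (c1 P).L) (fun q : I1 P => (q.1.L : ℂ)) (fun q => by
      rw [Complex.norm_real]
      exact (Real.norm_of_nonneg (wL_pos q.1).le).le)
    rwa [mul_comm] at this
theorem etF_sp (q : I1 P) : Sp (Dj q) (etF 0 q) := fun z hz => by
  rw [etF_app, ets, iteratedDeriv_zero, eta_supp, Complex.ofReal_zero]
  simpa [Dj] using hz
theorem etF_rl (n : ℕ) (q : I1 P) : Rl (etF n q) := fun z => Complex.ofReal_im _
theorem etF_pk (n : ℕ) (q : I1 P) (k) : Pk (kv k) (etF n q) := fun z => by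
  rw [etF_app, etF_app]; simp [kv]
theorem etF_disj (i : Data P) {j j' : ℤ} (h : 2 ≤ |j - j'|) : etF 0 (i, j) * etF 0 (i, j') = 0 := by
  ext z
  rw [SFo.mul_app, SFo.zero_app]
  by_cases h1 : z ∈ Dj (i, j)
  · by_cases h2 : z ∈ Dj (i, j')
    · exfalso
      have a1 := abs_le.1 (show |i.L * z.1 - j| ≤ 3/4 from h1)
      have a2 := abs_le.1 (show |i.L * z.1 - j'| ≤ 3/4 from h2)
      have h' : (2:ℝ) ≤ |((j - j' : ℤ) : ℝ)| := by exact_mod_cast h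
      push_cast at h'
      rcases le_abs.1 h' with h' | h' <;> linarith [a1.1, a1.2, a2.1, a2.2]
    · rw [etF_sp _ z h2, mul_zero]
  · rw [etF_sp _ z h1, zero_mul]

def Jz (i : Data P) : Finset ℤ := Finset.Icc (⌈i.L * i.ta⌉ - 1) (⌊i.L * i.tb⌋ + 1)
theorem Dj_TT (i : Data P) {j : ℤ} (hj : j ∈ Jz i) : Dj (i, j) ⊆ TT i := fun z hz => by
  have a1 := abs_le.1 (show |i.L * z.1 - j| ≤ 3/4 from hz)
  have hL := wL_pos i
  change 0 < i.L at hL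
  obtain ⟨h1, h2⟩ := Finset.mem_Icc.1 hj
  have h1' : ((⌈i.L * i.ta⌉ - 1 : ℤ) : ℝ) ≤ j := by exact_mod_cast h1
  have h2' : (j : ℝ) ≤ ((⌊i.L * i.tb⌋ + 1 : ℤ) : ℝ) := by exact_mod_cast h2
  push_cast at h1' h2'
  have h3 := Int.le_ceil (i.L * i.ta)
  have h4 := Int.floor_le (i.L * i.tb)
  have e : i.L * (2 / i.L) = 2 := by field_simp
  constructor
  · have : i.L * (i.ta - 2 / i.L) ≤ i.L * z.1 := by rw [mul_sub, e]; linarith [a1.1]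
    exact le_of_mul_le_mul_left this hL
  · have : i.L * z.1 ≤ i.L * (i.tb + 2 / i.L) := by rw [mul_add, e]; linarith [a1.2]
    exact le_of_mul_le_mul_left this hL
theorem eta_one (i : Data P) (z : ℝ × Spc) (hz : z ∈ TS i.ta i.tb) :
    ∑ j ∈ Jz i, (etF 0 (i, j)).1 z ^ 2 = 1 := by
  have hL := wL_pos i
  change 0 < i.L at hL
  set n := ⌊i.L * z.1⌋ with hn
  have f1 := Int.floor_le (i.L * z.1)
  have f2 := Int.lt_floor_add_one (i.L * z.1)
  have m1 : ⌈i.L * i.ta⌉ ≤ n + 1 := by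
    rw [Int.ceil_le]; push_cast
    have := mul_le_mul_of_nonneg_left hz.1 hL.le
    linarith
  have m2 : n ≤ ⌊i.L * i.tb⌋ := Int.floor_le_floor (mul_le_mul_of_nonneg_left hz.2 hL.le)
  have hsub : ({n, n+1} : Finset ℤ) ⊆ Jz i := by
    intro j hj
    rw [Finset.mem_insert, Finset.mem_singleton] at hj
    rw [Jz, Finset.mem_Icc]
    rcases hj with rfl | rfl <;> constructor <;> linarith
  rw [← Finset.sum_subset hsub]
  · rw [Finset.sum_pair (by linarith)]
    have := eta_sq (r := i.L * z.1 - n) (by linarith) (by linarith)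
    rw [etF_app, etF_app]
    simp only [ets, iteratedDeriv_zero]
    have e : i.L * z.1 - ((n + 1 : ℤ) : ℝ) = i.L * z.1 - n - 1 := by push_cast; ring
    rw [e]
    exact_mod_cast this
  · intro j _ hj
    rw [etF_sp (i, j) z, zero_pow two_ne_zero]
    intro h
    have a1 := abs_le.1 (show |i.L * z.1 - j| ≤ 3/4 from h)
    apply hj
    rw [Finset.mem_insert, Finset.mem_singleton]
    have b1 : n - 1 < j := by
      have : (n:ℝ) - 1 < j := by linarith [a1.2]
      exact_mod_cast this
    have b2 : j < n + 2 := by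
      have : (j:ℝ) < n + 2 := by linarith [a1.1]
      exact_mod_cast this
    omega
theorem Jz_fin (i : Data P) (z : ℝ × Spc) : ∃ s : Finset ℤ, s.card ≤ 3 ∧ ∀ j ∈ Jz i, z ∈ Dj (i, j) → j ∈ s := by
  refine ⟨Finset.Icc (⌊i.L * z.1⌋ - 1) (⌊i.L * z.1⌋ + 1), by rw [Int.card_Icc]; omega, fun j _ h => ?_⟩
  have f1 := Int.floor_le (i.L * z.1)
  have f2 := Int.lt_floor_add_one (i.L * z.1)
  have a1 := abs_le.1 (show |i.L * z.1 - j| ≤ 3/4 from h)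
  rw [Finset.mem_Icc]
  have b1 : ⌊i.L * z.1⌋ - 1 < j := by
    have : ((⌊i.L * z.1⌋ : ℤ):ℝ) - 1 < j := by linarith [a1.2]
    exact_mod_cast this
  have b2 : j < ⌊i.L * z.1⌋ + 2 := by
    have : (j:ℝ) < (⌊i.L * z.1⌋ : ℤ) + 2 := by linarith [a1.1]
    exact_mod_cast this
  omega
end CI
end

noncomputable section
open MeasureTheory Set Filter Topology
open scoped ContDiff
set_option linter.unusedSectionVars false

namespace CI
variable {P : ℕ}

/-! ### exponentials and square roots -/
section
variable {V : Type} [NormedAddCommGroup V] [NormedSpace ℝ V]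
def sexp (f : SFo V) : SFo V := ⟨fun z => Complex.exp (f.1 z), by
  have h : ContDiff ℝ ∞ (fun w : ℂ => Complex.exp w) := (Complex.contDiff_exp (𝕜 := ℂ)).restrict_scalars ℝ
  exact h.comp (SFo.cd f)⟩
theorem sexp_dd (f : SFo V) (e : V) : dd e (sexp f) = dd e f * sexp f := by
  ext z
  rw [SFo.mul_app, dd_app, dd_app]
  have h1 := (SFo.diff f z).hasFDerivAt
  have h2 := h1.cexp
  have h3 : fderiv ℝ (sexp f).1 z = Complex.exp (f.1 z) • fderiv ℝ f.1 z := h2.fderiv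
  rw [h3]
  simp only [smul_apply, smul_eq_mul]
  rw [mul_comm]; rfl
def srs (u : SFo V) (h : ∀ z, 1 ≤ (u.1 z).re) : SFo V := ⟨fun z => (((Real.sqrt (u.1 z).re)⁻¹ : ℝ) : ℂ), by
  have h1 : ContDiff ℝ ∞ (fun z => (u.1 z).re) := Complex.reCLM.contDiff.comp (SFo.cd u)
  have hz : ∀ z, (u.1 z).re ≠ 0 := fun z => by linarith [h z]
  exact Complex.ofRealCLM.contDiff.comp ((h1.sqrt hz).inv fun z => (Real.sqrt_pos.2 (by linarith [h z])).ne')⟩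
theorem srs_mul (u : SFo V) (h) (hr : Rl u) : srs u h * srs u h * u = 1 := by
  ext z
  rw [SFo.mul_app, SFo.mul_app, SFo.one_app]
  have h1 : u.1 z = (((u.1 z).re : ℝ) : ℂ) := (Complex.ext rfl (by simp [hr z]))
  have hp : 0 < (u.1 z).re := by linarith [h z]
  rw [h1]
  change (((Real.sqrt (u.1 z).re)⁻¹ : ℝ) : ℂ) * (((Real.sqrt (u.1 z).re)⁻¹ : ℝ) : ℂ) * _ = 1
  norm_cast
  rw [← mul_inv, Real.mul_self_sqrt hp.le, inv_mul_cancel₀ hp.ne']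
theorem srs_norm (u : SFo V) (h) (z) : ‖(srs u h).1 z‖ ≤ 1 := by
  change ‖(((Real.sqrt (u.1 z).re)⁻¹ : ℝ) : ℂ)‖ ≤ 1
  rw [Complex.norm_real, Real.norm_of_nonneg (by positivity)]
  exact inv_le_one_of_one_le₀ (Real.one_le_sqrt.2 (h z))
end
theorem sexp_DT (i : Data P) (f : SF) : DT i (sexp f) = DT i f * sexp f := by
  rw [DT_app, DT_app, add_mul, Finset.sum_mul]
  congr 1
  · exact sexp_dd f _
  · exact Finset.sum_congr rfl fun l _ => by rw [dx_eq, sexp_dd, mul_assoc]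

/-! ### wave vectors -/
abbrev K := Fin 3 × Bool × Bool
def sgb (b : Bool) : ℤ := if b then 1 else -1
def pp (b : Bool) : ℤ := if b then 3 else 4
def qq (b : Bool) : ℤ := if b then 4 else 3
def kz (b : Bool) (k : K) (n : Fin 3) : ℤ :=
  sgb k.2.2 * (if n = k.1 then pp b else if n = k.1 + 1 then sgb k.2.1 * qq b else 0)
def bar (k : K) : K := (k.1, k.2.1, !k.2.2)
def kB (b : Bool) (k : K) (n : Fin 3) : ℂ :=
  if n = k.1 + 2 then 1 else Complex.I * (sgb k.2.2 : ℂ) / 5 * (if n = k.1 then sgb k.2.1 * qq b else -(pp b))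
theorem kz_zero : ∀ b b' k k', (∀ n, kz b k n + kz b' k' n = 0) → b = b' ∧ k' = bar k := by decide
theorem kz_sq : ∀ b k, ∑ n, kz b k n ^ 2 = 25 := by decide
theorem kz_le : ∀ b k n, |kz b k n| ≤ 4 := by decide
theorem kz_bar : ∀ b k n, kz b k n + kz b (bar k) n = 0 := by decide
theorem bar_ne : ∀ k, bar (bar k) = k := by decide
theorem kB_curl (b : Bool) (k : K) (c : Fin 3) :
    Complex.I * ((kz b k (c+1) : ℂ) * kB b k (c+2) - (kz b k (c+2) : ℂ) * kB b k (c+1)) = 5 * kB b k c := by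
  obtain ⟨d, s, σ⟩ := k
  fin_cases b <;> fin_cases s <;> fin_cases σ <;> fin_cases d <;> fin_cases c <;>
    simp [kz, kB, sgb, pp, qq] <;> (try ring_nf) <;> (try simp [Complex.I_sq])
theorem kB_norm (b : Bool) (k : K) (c : Fin 3) : ‖kB b k c‖ ≤ 1 := by
  have h1 : ‖(sgb k.2.2 : ℂ)‖ = 1 := by
    rcases k.2.2 <;> simp [sgb]
  have h2 : ‖(sgb k.2.1 : ℂ)‖ = 1 := by
    rcases k.2.1 <;> simp [sgb]
  have h3 : ‖(pp b : ℂ)‖ ≤ 4 := by rcases b <;> simp [pp]; norm_num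
  have h4 : ‖(qq b : ℂ)‖ ≤ 4 := by rcases b <;> simp [qq]; norm_num
  have h5 : ‖(5:ℂ)‖ = 5 := by simp
  unfold kB
  split_ifs
  · simp
  all_goals push_cast
  · rw [norm_mul, norm_div, norm_mul, norm_mul, h1, h2, Complex.norm_I, h5]; linarith
  · rw [norm_mul, norm_div, norm_mul, norm_neg, h1, Complex.norm_I, h5]; linarith
theorem kB_bar (b : Bool) (k : K) (c : Fin 3) : kB b (bar k) c = star (kB b k c) := by
  obtain ⟨d, s, σ⟩ := k
  have h : (sgb (!σ) : ℂ) = - (sgb σ : ℂ) := by cases σ <;> simp [sgb]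
  change (if c = d + 2 then (1:ℂ) else Complex.I * (sgb (!σ) : ℂ) / 5 * ((if c = d then sgb s * qq b else -(pp b) : ℤ) : ℂ)) =
    star (if c = d + 2 then (1:ℂ) else Complex.I * (sgb σ : ℂ) / 5 * ((if c = d then sgb s * qq b else -(pp b) : ℤ) : ℂ))
  rw [h]
  by_cases h1 : c = d + 2
  · simp [h1]
  · simp only [if_neg h1]
    by_cases h2 : c = d
    · simp only [if_pos h2]; simp
    · simp only [if_neg h2]; simp

/-- amplitudes -/
def rrv (ρ : ℂ) (R : Fin 3 → Fin 3 → ℂ) (x : Fin 3) : ℂ := 25 / 2 * (R x x + ρ / 2 - (R 0 0 + R 1 1 + R 2 2) / 2)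
def alv (b : Bool) (ρ : ℂ) (R : Fin 3 → Fin 3 → ℂ) (c : Fin 3) (s : Bool) : ℂ :=
  ((pp b : ℂ) ^ 4 * rrv ρ R c - (pp b : ℂ) ^ 2 * (qq b : ℂ) ^ 2 * rrv ρ R (c + 2) + (qq b : ℂ) ^ 4 * rrv ρ R (c + 1)) / 9650
   + (sgb s : ℂ) * 25 / 48 * R c (c + 1)
theorem alv_sum (b : Bool) (ρ : ℂ) (R : Fin 3 → Fin 3 → ℂ) (hR : ∀ a b, R a b = R b a) (x y : Fin 3) :
    ∑ k : K, (1 / 2 * (kB b k x * kB b (bar k) y + kB b (bar k) x * kB b k y)) * alv b ρ R k.1 k.2.1 =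
      del x y * ρ - R x y := by
  have e10 := hR 1 0
  have e20 := hR 2 0
  have e21 := hR 2 1
  simp only [Fintype.sum_prod_type, Fin.sum_univ_three, Fintype.sum_bool, kB_bar]
  fin_cases b <;> fin_cases x <;> fin_cases y <;>
    simp [kB, alv, rrv, sgb, pp, qq, del, e10, e20, e21] <;> ring_nf <;> (try simp [Complex.I_sq]) <;> (try ring)
end CI
end

noncomputable section
open MeasureTheory Set Filter Topology
open scoped ContDiff
set_option linter.unusedSectionVars false

namespace CI
variable {P : ℕ}
def par (j : ℤ) : Bool := decide (j % 2 = 0)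
abbrev I2 (P : ℕ) := Data P × (ℤ × K)
def r2 (q : I2 P) : I1 P := (q.1, q.2.1)
def D2 (q : I2 P) : Set (ℝ × Spc) := Dj (r2 q)
abbrev c2 (P : ℕ) : Ctx (ℝ × Spc) (I2 P) := cL (P := P) Prod.fst D2
theorem pull2 {m : ℕ} {A : I1 P → ℝ} {f : I1 P → SF} (hf : Sy (c1 P) m A f) :
    Sy (c2 P) m (A ∘ r2) (fun q => f (r2 q)) :=
  pullG (π := p1) (Dm := Dj) (r2 (P := P)) (Dm' := D2) (fun _ => subset_rfl) hf
/-- wave vector of an index -/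
def kq (q : ℤ × K) (n : Fin 3) : ℤ := kz (par q.1) q.2 n
theorem kq_norm (q : ℤ × K) (n) : ‖(kq q n : ℂ)‖ ≤ 4 := by
  rw [Complex.norm_intCast]; exact_mod_cast kz_le (par q.1) q.2 n

def ph (q : I2 P) : SF := (Complex.I * wl q.1) • ∑ l, (kq q.2 l : ℂ) • Xj (r2 q) l
def eW (q : I2 P) : SF := sexp (ph q)
def gW (n : Fin 3) (q : I2 P) : SF := ∑ l, (kq q.2 l : ℂ) • gX (r2 q) n l
def hW (q : I2 P) : SF := ∑ l, (kq q.2 l : ℂ) • Ej (r2 q) l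

theorem ph_re (q : I2 P) (z) : ((ph q).1 z).re = 0 := by
  have h : Rl (∑ l, (kq q.2 l : ℂ) • Xj (r2 q) l) := Rl.sum fun l _ => by
    have := (Xj_rl (r2 q) l).smul (kq q.2 l : ℝ)
    push_cast at this; exact this
  have := h z
  rw [ph, SFo.smul_app, mul_assoc]
  generalize ((∑ l, (kq q.2 l : ℂ) • Xj (r2 q) l : SF)).1 z = y at *
  simp [Complex.mul_re, Complex.mul_im, this]
theorem eW_norm (q : I2 P) (z) : ‖(eW q).1 z‖ = 1 := by
  change ‖Complex.exp ((ph q).1 z)‖ = 1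
  rw [Complex.norm_exp, ph_re, Real.exp_zero]
def mW : Mode (P := P) (Prod.fst : I2 P → Data P) D2 where
  e := eW
  m q n := kq q.2 n
  g := gW
  h := hW
  M := 4
  hM q n := by exact_mod_cast kz_le (par q.2.1) q.2.2 n
  hm q := Or.inr (by
    have : ∑ n, (kq q.2 n) ^ 2 = 25 := kz_sq _ _
    have h2 : (∑ n, ((kq q.2 n : ℤ) : ℝ) ^ 2) = 25 := by exact_mod_cast this
    rw [h2]; norm_num)
  de q n := by
    have h : dx n (ph q) = (Complex.I * wl q.1) • (algebraMap ℂ SF ((kq q.2 n : ℝ) : ℂ) + gW n q) := by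
      rw [ph, Derivation.map_smul, map_sum]
      congr 1
      have : ∀ l, dx n ((kq q.2 l : ℂ) • Xj (r2 q) l) = algebraMap ℂ SF ((kq q.2 l : ℂ) * del n l) + (kq q.2 l : ℂ) • gX (r2 q) n l := fun l => by
        rw [Derivation.map_smul, gX, smul_sub, map_mul, ← Algebra.smul_def]; abel
      simp only [this, Finset.sum_add_distrib, gW]
      congr 1
      rw [← map_sum]
      congr 1
      simp [del]
    rw [eW, dx_eq, sexp_dd, ← dx_eq, h, smul_mul_assoc]
  De q := by
    have h : DT q.1 (ph q) = (Complex.I * wl q.1) • hW q := by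
      rw [ph, Derivation.map_smul, map_sum]
      simp only [Derivation.map_smul]
      congr 1
      exact Finset.sum_congr rfl fun l _ => by
        rw [show DT q.1 (Xj (r2 q) l) = Ej (r2 q) l from DT_Xj (r2 q) l]
    rw [eW, sexp_DT, h, smul_mul_assoc]
  gs n := Sy.sum _ (fun q => (wk_pos q.1).le) fun l _ =>
    Sy.bsmul _ 4 (fun q => kq_norm q.2 l) (pull2 (gX_sy1 n l))
  hs := Sy.sum _ (fun q => (pow_pos (wk_pos q.1) 2).le) fun l _ =>
    Sy.bsmul _ 4 (fun q => kq_norm q.2 l) (pull2 (Ej_sy l))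
  ne := eW_norm
theorem gW_sy2 (n : Fin 3) : Sy (c2 P) 2 1 (gW n) := Sy.sum _ (fun q => zero_le_one) fun l _ =>
    Sy.bsmul _ 4 (fun q => kq_norm q.2 l) (pull2 (gX_sy2 n l))
theorem wl_N (i : Data P) : wl i = 2 * Real.pi * i.N := by
  rw [wl, ← i.hN, mul_div_cancel_right₀ _ i.hκ0.ne']
theorem eW_pk (q : I2 P) (k) : Pk (kv k) (eW q) := by
  intro z
  change Complex.exp ((ph q).1 (z + kv k)) = Complex.exp ((ph q).1 z)
  have : (ph q).1 (z + kv k) = (ph q).1 z + ((q.1.N * ∑ l, kq q.2 l * k l : ℤ) : ℂ) * (2 * Real.pi * Complex.I) := by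
    simp only [ph, SFo.smul_app, SFo.sum_app, Xj_per, wl_N]
    push_cast
    simp only [mul_add, Finset.sum_add_distrib]
    ring
  rw [this, Complex.exp_add, Complex.exp_int_mul_two_pi_mul_I, mul_one]
theorem gX_pk (q : I1 P) (n l) (k) : Pk (kv k) (gX q n l) := by
  have h : Pk (kv k) (dx n (Xj q l)) := by
    intro z
    have hf : (fun y => (Xj q l).1 (y + kv k)) = fun y => (Xj q l).1 y + k l := funext fun y => Xj_per q l k y
    have h1 := congrArg (fun f : ℝ × Spc → ℂ => fderiv ℝ f z (eS n)) hf
    simp only [fderiv_comp_add_right, fderiv_add_const] at h1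
    rw [dx_eq, dd_app, dd_app]; exact h1
  intro z
  rw [gX, SFo.sub_app, SFo.sub_app, h z]; rfl
theorem gW_pk (n) (q : I2 P) (k) : Pk (kv k) (gW n q) := Pk.sum fun l _ => (gX_pk _ n l k).smul _
theorem hW_pk (q : I2 P) (k) : Pk (kv k) (hW q) := Pk.sum fun l _ => by
  suffices hE : Pk (kv k) (Ej (r2 q) l) from hE.smul _
  rw [← DT_Xj, DT_app]
  have h0 : ∀ e : ℝ × Spc, Pk (kv k) (dd e (Xj (r2 q) l)) := by
    intro e z
    have hf : (fun y => (Xj (r2 q) l).1 (y + kv k)) = fun y => (Xj (r2 q) l).1 y + k l := funext fun y => Xj_per (r2 q) l k y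
    have h1 := congrArg (fun f : ℝ × Spc → ℂ => fderiv ℝ f z e) hf
    simp only [fderiv_comp_add_right, fderiv_add_const] at h1
    rw [dd_app, dd_app]; exact h1
  refine Pk.add (h0 _) (Pk.sum fun m _ => (vl_pk _ m k).mul ?_)
  rw [dx_eq]; exact h0 _

/-! amplitudes -/
def rrS (ρ : ℝ) (R : Fin 3 → Fin 3 → SF) (x : Fin 3) : SF :=
  (25 / 2 : ℂ) • (R x x + algebraMap ℂ SF (ρ / 2 : ℂ) - (1 / 2 : ℂ) • (R 0 0 + R 1 1 + R 2 2))
def alS (b : Bool) (ρ : ℝ) (R : Fin 3 → Fin 3 → SF) (c : Fin 3) (s : Bool) : SF :=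
  ((pp b : ℂ) ^ 4 / 9650) • rrS ρ R c - ((pp b : ℂ) ^ 2 * (qq b : ℂ) ^ 2 / 9650) • rrS ρ R (c + 2) +
    ((qq b : ℂ) ^ 4 / 9650) • rrS ρ R (c + 1) + ((sgb s : ℂ) * 25 / 48) • R c (c + 1)
theorem alS_app (b ρ R c s) (z) : (alS b ρ R c s).1 z = alv b ρ (fun x y => (R x y).1 z) c s := by
  simp only [alS, rrS, alv, rrv, SFo.add_app, SFo.sub_app, SFo.smul_app, SFo.algebraMap_app]; ring
theorem rl_of {a : ℂ} (h : a.im = 0) {f : SF} (hf : Rl f) : Rl (a • f) := by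
  have := hf.smul a.re
  have e : ((a.re : ℝ) : ℂ) = a := Complex.ext rfl (by simp [h])
  rwa [e] at this
theorem alS_rl (b ρ c s) {R : Fin 3 → Fin 3 → SF} (hR : ∀ x y, Rl (R x y)) : Rl (alS b ρ R c s) := by
  have h1 : ∀ x, Rl (rrS ρ R x) := fun x => by
    refine rl_of (by norm_num) (Rl.sub (Rl.add (hR _ _) fun z => ?_) (rl_of (by norm_num) (((hR _ _).add (hR _ _)).add (hR _ _))))
    rw [SFo.algebraMap_app]
    have : ((ρ : ℂ) / 2) = ((ρ / 2 : ℝ) : ℂ) := by push_cast; rfl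
    rw [this, Complex.ofReal_im]
  have ip : ∀ n : ℤ, ∀ k : ℕ, ∃ y : ℝ, (n : ℂ) ^ k = y := fun n k => ⟨(n:ℝ) ^ k, by push_cast; rfl⟩
  refine (((rl_of ?_ (h1 _)).sub (rl_of ?_ (h1 _))).add (rl_of ?_ (h1 _))).add (rl_of ?_ (hR _ _)) <;>
  first
  | (have : ((pp b : ℂ) ^ 4 / 9650) = (((pp b : ℝ) ^ 4 / 9650 : ℝ) : ℂ) := by push_cast; rfl)
    rw [this, Complex.ofReal_im]
  | (have : ((pp b : ℂ) ^ 2 * (qq b : ℂ) ^ 2 / 9650) = (((pp b : ℝ) ^ 2 * (qq b : ℝ) ^ 2 / 9650 : ℝ) : ℂ) := by push_cast; rfl)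
    rw [this, Complex.ofReal_im]
  | (have : ((qq b : ℂ) ^ 4 / 9650) = (((qq b : ℝ) ^ 4 / 9650 : ℝ) : ℂ) := by push_cast; rfl)
    rw [this, Complex.ofReal_im]
  | (have : ((sgb s : ℂ) * 25 / 48) = (((sgb s : ℝ) * 25 / 48 : ℝ) : ℂ) := by push_cast; rfl)
    rw [this, Complex.ofReal_im]
theorem alv_low (b c s) {R : Fin 3 → Fin 3 → ℂ} {C : ℝ} (hC : 0 ≤ C) (hR : ∀ x y, ‖R x y‖ ≤ C) (ρ : ℝ) (hρ : ρ = 32 * (C + 1)) :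
    1 ≤ (alv b ρ R c s).re := by
  have e : alv b ρ R c s = ((ρ / 8 : ℝ) : ℂ) + alv b 0 R c s := by
    cases b <;> simp [alv, rrv, pp, qq] <;> ring
  have hr : ∀ x, ‖rrv 0 R x‖ ≤ 125 / 4 * C := fun x => by
    have : rrv 0 R x = 25 / 2 * R x x - 25 / 4 * R 0 0 - 25 / 4 * R 1 1 - 25 / 4 * R 2 2 := by rw [rrv]; ring
    rw [this]
    have n1 : ∀ x, ‖(25 / 2 : ℂ) * R x x‖ ≤ 25 / 2 * C := fun x => by
      rw [norm_mul]; norm_num; exact hR x x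
    have n2 : ∀ x, ‖(25 / 4 : ℂ) * R x x‖ ≤ 25 / 4 * C := fun x => by
      rw [norm_mul]; norm_num; exact hR x x
    have a1 := norm_sub_le (25 / 2 * R x x - 25 / 4 * R 0 0 - 25 / 4 * R 1 1) (25 / 4 * R 2 2)
    have a2 := norm_sub_le (25 / 2 * R x x - 25 / 4 * R 0 0) (25 / 4 * R 1 1)
    have a3 := norm_sub_le (25 / 2 * R x x) (25 / 4 * R 0 0)
    linarith [n1 x, n2 0, n2 1, n2 2]
  have hs : ‖(sgb s : ℂ) * 25 / 48 * R c (c+1)‖ ≤ C := by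
    have : ‖(sgb s : ℂ)‖ = 1 := by cases s <;> simp [sgb]
    rw [norm_mul, norm_div, norm_mul, this]; norm_num
    linarith [hR c (c+1)]
  have hp : ∀ m : ℕ, m ≤ 256 → ∀ x, ‖((m : ℂ) / 9650) * rrv 0 R x‖ ≤ C := fun m hm x => by
    rw [norm_mul, norm_div, Complex.norm_natCast]; norm_num
    have : (m:ℝ) ≤ 256 := by exact_mod_cast hm
    have h2 : (m:ℝ) / 9650 * ‖rrv 0 R x‖ ≤ 256 / 9650 * (125 / 4 * C) :=
      mul_le_mul (by linarith) (hr x) (norm_nonneg _) (by norm_num)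
    linarith
  have hb : ‖alv b 0 R c s‖ ≤ 4 * C := by
    obtain ⟨m1, m2, m3, k1, k2, k3, e⟩ : ∃ m1 m2 m3 : ℕ, m1 ≤ 256 ∧ m2 ≤ 256 ∧ m3 ≤ 256 ∧ alv b 0 R c s =
      ((m1:ℂ) / 9650) * rrv 0 R c - ((m2:ℂ) / 9650) * rrv 0 R (c + 2) + ((m3:ℂ) / 9650) * rrv 0 R (c + 1) + (sgb s : ℂ) * 25 / 48 * R c (c+1) := by
      cases b
      · refine ⟨256, 144, 81, by norm_num, by norm_num, by norm_num, ?_⟩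
        simp [alv, pp, qq]; ring
      · refine ⟨81, 144, 256, by norm_num, by norm_num, by norm_num, ?_⟩
        simp [alv, pp, qq]; ring
    rw [e]
    have a1 := norm_add_le (((m1:ℂ) / 9650) * rrv 0 R c - ((m2:ℂ) / 9650) * rrv 0 R (c + 2) + ((m3:ℂ) / 9650) * rrv 0 R (c + 1)) ((sgb s : ℂ) * 25 / 48 * R c (c+1))
    have a2 := norm_add_le (((m1:ℂ) / 9650) * rrv 0 R c - ((m2:ℂ) / 9650) * rrv 0 R (c + 2)) (((m3:ℂ) / 9650) * rrv 0 R (c + 1))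
    have a3 := norm_sub_le (((m1:ℂ) / 9650) * rrv 0 R c) (((m2:ℂ) / 9650) * rrv 0 R (c + 2))
    linarith [hp m1 k1 c, hp m2 k2 (c+2), hp m3 k3 (c+1)]
  rw [e, Complex.add_re, Complex.ofReal_re]
  have := (abs_le.1 ((Complex.abs_re_le_norm (alv b 0 R c s)).trans hb)).1
  linarith

def CR (P : ℕ) : ℝ := (Rj_bound (P := P)).choose
theorem CR0 : 0 ≤ CR P := (Rj_bound (P := P)).choose_spec.1
theorem CR1 (q : I1 P) (a b z) : ‖(Rj q a b).1 z‖ ≤ CR P := (Rj_bound (P := P)).choose_spec.2 q a b z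
def rho (P : ℕ) : ℝ := 32 * (CR P + 1)
def uW (q : I2 P) : SF := alS (par q.2.1) (rho P) (Rj (r2 q)) q.2.2.1 q.2.2.2.1
theorem uW_rl (q : I2 P) : Rl (uW q) := alS_rl _ _ _ _ (Rj_rl _)
theorem uW_low (q : I2 P) (z) : 1 ≤ ((uW q).1 z).re := by
  rw [uW, alS_app]; exact alv_low _ _ _ CR0 (fun x y => CR1 _ x y z) _ rfl
def sW (q : I2 P) : SF := srs (uW q) (uW_low q)
def aW (q : I2 P) : SF := etF 0 (r2 q) * (uW q * sW q)
theorem uW_sy : Sy (c2 P) 2 1 uW := by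
  have h1 : ∀ x : Fin 3, Sy (c2 P) 2 1 (fun q => rrS (rho P) (Rj (r2 q)) x) := fun x => by
    have hR : ∀ a b, Sy (c2 P) 2 1 (fun q => Rj (r2 q) a b) := fun a b => pull2 (Rj_sy a b)
    exact (((hR x x).add (sy_const _)).sub ((((hR 0 0).add (hR 1 1)).add (hR 2 2)).smul _)).smul _
  have h1' : ∀ f : K → Fin 3, Sy (c2 P) 2 1 (fun q => rrS (rho P) (Rj (r2 q)) (f q.2.2)) := fun f => by
    have e : (fun q : I2 P => rrS (rho P) (Rj (r2 q)) (f q.2.2)) =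
      fun q => ∑ x, (if x = f q.2.2 then (1:ℂ) else 0) • rrS (rho P) (Rj (r2 q)) x := by
      funext q; simp
    rw [e]
    exact Sy.sum _ (fun q => zero_le_one) fun x _ => Sy.bsmul _ 1 (fun q => by split_ifs <;> simp) (h1 x)
  have hR : Sy (c2 P) 2 1 (fun q => Rj (r2 q) q.2.2.1 (q.2.2.1 + 1)) := by
    have e : (fun q : I2 P => Rj (r2 q) q.2.2.1 (q.2.2.1 + 1)) =
      fun q => ∑ x, (if x = q.2.2.1 then (1:ℂ) else 0) • Rj (r2 q) x (x + 1) := by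
      funext q; simp
    rw [e]
    exact Sy.sum _ (fun q => zero_le_one) fun x _ => Sy.bsmul _ 1 (fun q => by split_ifs <;> simp) (pull2 (Rj_sy x (x+1)))
  have hp : ∀ b, ‖(pp b : ℂ)‖ ≤ 4 := fun b => by cases b <;> simp [pp]; norm_num
  have hq : ∀ b, ‖(qq b : ℂ)‖ ≤ 4 := fun b => by cases b <;> simp [qq]; norm_num
  have p4 : ∀ {x : ℂ} (n : ℕ), ‖x‖ ≤ 4 → ‖x ^ n‖ ≤ 4 ^ n := fun n hx => by
    rw [norm_pow]; exact pow_le_pow_left₀ (norm_nonneg _) hx n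
  refine (((Sy.bsmul _ (4 ^ 4) (fun q => ?_) (h1' fun k => k.1)).sub (Sy.bsmul _ (4 ^ 2 * 4 ^ 2) (fun q => ?_) (h1' fun k => k.1 + 2))).add
    (Sy.bsmul _ (4 ^ 4) (fun q => ?_) (h1' fun k => k.1 + 1))).add (Sy.bsmul _ 1 (fun q => ?_) hR)
  · rw [norm_div]; norm_num
    exact div_le_of_le_mul₀ (by norm_num) (by norm_num) (by have := p4 4 (hp (par q.2.1)); rw [norm_pow, Complex.norm_intCast] at this; linarith)
  · rw [norm_div, norm_mul]
    have := mul_le_mul (p4 2 (hp (par q.2.1))) (p4 2 (hq (par q.2.1))) (norm_nonneg _) (by norm_num)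
    refine (div_le_self (by positivity) ?_).trans this
    norm_num
  · rw [norm_div]; norm_num
    exact div_le_of_le_mul₀ (by norm_num) (by norm_num) (by have := p4 4 (hq (par q.2.1)); rw [norm_pow, Complex.norm_intCast] at this; linarith)
  · have : ‖(sgb q.2.2.2.1 : ℂ)‖ = 1 := by rcases q.2.2.2.1 <;> simp [sgb]
    rw [norm_div, norm_mul, this]; norm_num
theorem sW_mul (q : I2 P) : sW q * sW q * uW q = 1 := srs_mul _ _ (uW_rl q)
theorem sW_sy : Sy (c2 P) 2 1 sW := Sy.rsqrt sW_mul ⟨1, zero_le_one, fun q z _ => by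
  rw [Pi.one_apply, mul_one]; exact srs_norm _ (uW_low q) z⟩ uW_sy
theorem aW_sy : Sy (c2 P) 2 1 aW := by
  have := (pull2 (etF_sy (P := P) 2 0)).mul (uW_sy.mul sW_sy)
  exact this.mono1 fun q => by simp
theorem aW_sq (q : I2 P) : aW q * aW q = etF 0 (r2 q) ^ 2 * uW q := by
  have := sW_mul q
  rw [aW]; linear_combination etF 0 (r2 q) ^ 2 * uW q * this
theorem sW_rl (q : I2 P) : Rl (sW q) := fun z => Complex.ofReal_im _
theorem aW_rl (q : I2 P) : Rl (aW q) := (etF_rl _ _).mul ((uW_rl q).mul (sW_rl q))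
theorem aW_bar (i : Data P) (j : ℤ) (k : K) : aW (i, j, bar k) = aW (i, j, k) := by
  have h : uW (i, j, bar k) = uW (i, j, k) := by unfold uW r2 bar; rfl
  have h2 : ∀ (u u' : SF) (hu) (hu'), u = u' → srs u hu = srs u' hu' := by
    intro u u' hu hu' e; subst e; rfl
  rw [aW, aW, sW, sW, h2 _ _ (uW_low _) (uW_low (i, j, k)) h, h]; rfl
theorem uW_pk (q : I2 P) (k) : Pk (kv k) (uW q) := fun z => by
  rw [uW, alS_app, alS_app]
  congr 1; funext x y; exact Rj_pk _ x y k z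
theorem aW_pk (q : I2 P) (k) : Pk (kv k) (aW q) := (etF_pk _ _ k).mul ((uW_pk q k).mul fun z => by
  change (((Real.sqrt ((uW q).1 (z + kv k)).re)⁻¹ : ℝ) : ℂ) = (((Real.sqrt ((uW q).1 z).re)⁻¹ : ℝ) : ℂ)
  rw [uW_pk q k z])
theorem aW_sp (q : I2 P) : Sp (D2 q) (aW q) := (etF_sp _).mul_right _
theorem eW_bar (i : Data P) (j : ℤ) (k : K) : eW (i, j, k) * eW (i, j, bar k) = 1 := by
  ext z
  rw [SFo.mul_app, SFo.one_app]
  change Complex.exp ((ph (i, j, k)).1 z) * Complex.exp ((ph (i, j, bar k)).1 z) = 1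
  rw [← Complex.exp_add]
  have : (ph (i, j, k)).1 z + (ph (i, j, bar k)).1 z = 0 := by
    have h : ∀ l, (kq (j, bar k) l : ℂ) = - (kq (j, k) l : ℂ) := fun l => by
      have := kz_bar (par j) k l
      have h2 : kq (j, bar k) l = - kq (j, k) l := by rw [kq, kq]; linarith
      rw [h2]; push_cast; rfl
    simp only [ph, SFo.smul_app, SFo.sum_app, h, r2]
    simp
  rw [this, Complex.exp_zero]
theorem eW_star (i : Data P) (j : ℤ) (k : K) (z) : (eW (i, j, bar k)).1 z = star ((eW (i, j, k)).1 z) := by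
  have h1 : (eW (i, j, k)).1 z * (eW (i, j, bar k)).1 z = 1 := by
    have := congrArg (fun f : SF => f.1 z) (eW_bar i j k)
    simpa using this
  have h2 : (eW (i, j, k)).1 z * star ((eW (i, j, k)).1 z) = 1 := by
    have := Complex.mul_conj ((eW (i, j, k)).1 z)
    rw [Complex.normSq_eq_norm_sq, eW_norm] at this
    simpa using this
  have h0 : (eW (i, j, k)).1 z ≠ 0 := left_ne_zero_of_mul_eq_one h1
  exact mul_left_cancel₀ h0 (h1.trans h2.symm)
end CI
end

noncomputable section
open MeasureTheory Set Filter Topology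
open scoped ContDiff
set_option linter.unusedSectionVars false

namespace CI
variable {P : ℕ}
theorem wkL_le1 (q : I1 P) : ((wk * wL : Data P → ℝ) ∘ p1) q ≤ (wL ∘ p1) q :=
  mul_le_of_le_one_left (wL_pos q.1).le (wk_le q.1)
def QQ (i : Data P) (a b : Fin 3) : SF := ∑ j ∈ Jz i, etF 0 (i, j) ^ 2 * Rj (i, j) a b
def fQ (a b : Fin 3) (q : I1 P) : SF := etF 0 q ^ 2 * (mR q.1 a b - Rj q a b)
theorem mR_T (i : Data P) (a b) : Sp (TS i.ta i.tb) (mR i a b) := Mo_sp (i.RS a b) _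
theorem fQ_sum (i : Data P) (a b) : mR i a b - QQ i a b = ∑ j ∈ Jz i, fQ a b (i, j) := by
  have : mR i a b = ∑ j ∈ Jz i, etF 0 (i, j) ^ 2 * mR i a b := by
    rw [← Finset.sum_mul]
    ext z
    rw [SFo.mul_app, SFo.sum_app]
    simp only [SFo.pow_app]
    by_cases hz : z ∈ TS i.ta i.tb
    · rw [eta_one i z hz, one_mul]
    · rw [mR_T i a b z hz, mul_zero]
  conv_lhs => rw [this]
  rw [QQ, ← Finset.sum_sub_distrib]
  exact Finset.sum_congr rfl fun j _ => by rw [fQ, mul_sub]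
theorem et2_sp (q : I1 P) : Sp (Dj q) (etF 0 q ^ 2) := by rw [sq]; exact (etF_sp q).mul_right _
theorem fQ_sp (a b) (q : I1 P) : Sp (Dj q) (fQ a b q) := (et2_sp q).mul_right _
theorem dif_sy (a b : Fin 3) : Sy (c1 P) 0 1 (fun q => mR (p1 q) a b - Rj q a b) :=
  (pull0 (π := p1) (Dm := Dj) (sy_mR (P := P) a b)).sub (Rj_sy a b).zero_of
theorem et2_sy : Sy (c1 P) 1 1 (fun q => etF 0 q ^ 2) := by
  have := (etF_sy (P := P) 1 0).mul (etF_sy (P := P) 1 0)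
  simp only [sq]
  exact this.mono1 fun q => by simp
theorem sumB {A : Data P → ℝ} (hA : ∀ i, 0 ≤ A i) {f : I1 P → SF} (hs : ∀ q, Sp (Dj q) (f q))
    (hf : Bd (c1 P) (A ∘ p1) f) : Bd (cU P) A (fun i => ∑ j ∈ Jz i, f (i, j)) :=
  sum_symN (Dm := Dj) Dj_closed Jz 3 Jz_fin 0 hA hs hf
theorem Qk0 (a b) : Bd (cU P) wk (fun i => mR i a b - QQ i a b) := by
  simp only [fQ_sum]
  refine sumB (fun i => (wk_pos i).le) (fQ_sp a b) ?_
  exact (et2_sy.bd.mul (Rj_near (P := P) a b)).mono 1 zero_le_one fun q => by simp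
theorem Qd0 (a b j) : Bd (cU P) wL (fun i => dx j (mR i a b - QQ i a b)) := by
  simp only [fQ_sum, map_sum]
  refine sumB (f := fun q => dx j (fQ a b q)) (fun i => (wL_pos i).le) (fun q => (fQ_sp a b q).dd (Dj_closed q) _) ?_
  have := (et2_sy.zero_of.mul (dif_sy (P := P) a b)) 1
  exact Bd.mono 1 zero_le_one (fun q => by simp [cL, wL]) (this.2 j)
theorem QD0 (a b) : Bd (cU P) wL (fun i => DT i (mR i a b - QQ i a b)) := by
  simp only [fQ_sum, map_sum]
  refine sumB (f := fun q => DT q.1 (fQ a b q)) (fun i => (wL_pos i).le) (fun q => (fQ_sp a b q).DT (Dj_closed q) _) ?_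
  have e : (fun q : I1 P => DT q.1 (fQ a b q)) = fun q => DT q.1 (etF 0 q ^ 2) * (mR q.1 a b - Rj q a b) +
      etF 0 q ^ 2 * (DT q.1 (mR q.1 a b) - DT q.1 (Rj q a b)) := by
    funext q; rw [fQ, Der_mul, map_sub]
  rw [e]
  have h1 : Bd (c1 P) (wL ∘ p1) (fun q => DT q.1 (etF 0 q ^ 2)) :=
    Bd.mono 1 zero_le_one (fun q => by simp [cL, wL]) (et2_sy (P := P)).dt.bd
  have h2 : Bd (c1 P) (wL ∘ p1) (fun q => DT q.1 (mR q.1 a b)) :=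
    Bd.mono 1 zero_le_one (fun q => by rw [one_mul]; exact wkL_le1 q) (pull0 (π := p1) (Dm := Dj) (sy_DmR (P := P) a b)).bd
  have h3 : Bd (c1 P) (wL ∘ p1) (fun q => DT q.1 (Rj q a b)) :=
    Bd.mono 1 zero_le_one (fun q => by simp [cL, wL]) (Rj_sy (P := P) a b).dt.bd
  exact ((h1.mul (dif_sy (P := P) a b).bd).mono 1 zero_le_one fun q => by simp).add
    ((et2_sy.bd.mul (h2.sub h3)).mono 1 zero_le_one fun q => by simp)

theorem rl_pair (f : K → SF) (h : ∀ k z, (f (bar k)).1 z = star ((f k).1 z)) : Rl (∑ k, f k) := by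
  intro z
  have e : ∑ k, (f k).1 z = ∑ k, star ((f k).1 z) := by
    rw [← (Equiv.sum_comp (⟨bar, bar, bar_ne, bar_ne⟩ : K ≃ K) (fun k => (f k).1 z))]
    exact Finset.sum_congr rfl fun k _ => h k z
  rw [SFo.sum_app]
  have h2 := congrArg Complex.im e
  rw [Complex.im_sum, Complex.im_sum] at h2
  simp only [RCLike.star_def, Complex.conj_im, Finset.sum_neg_distrib] at h2
  rw [Complex.im_sum]; linarith

theorem low0 (i : Data P) (x y : Fin 3) : (∑ t ∈ Jz i ×ˢ (Finset.univ : Finset K), ∑ t' ∈ Jz i ×ˢ (Finset.univ : Finset K),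
      if kq t + kq t' = 0 then
      (1 / 2 * (kB (par t.1) t.2 x * kB (par t'.1) t'.2 y + kB (par t'.1) t'.2 x * kB (par t.1) t.2 y)) •
        (aW (i, t) * aW (i, t') * (eW (i, t) * eW (i, t')))
      else 0) = del x y • ((rho P : ℂ) • ∑ j ∈ Jz i, etF 0 (i, j) ^ 2) - QQ i x y := by
  have key : ∀ t ∈ Jz i ×ˢ (Finset.univ : Finset K), (∑ t' ∈ Jz i ×ˢ (Finset.univ : Finset K),
      if kq t + kq t' = 0 then
      (1 / 2 * (kB (par t.1) t.2 x * kB (par t'.1) t'.2 y + kB (par t'.1) t'.2 x * kB (par t.1) t.2 y)) •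
        (aW (i, t) * aW (i, t') * (eW (i, t) * eW (i, t')))
      else 0) = (1 / 2 * (kB (par t.1) t.2 x * kB (par t.1) (bar t.2) y + kB (par t.1) (bar t.2) x * kB (par t.1) t.2 y)) •
        (etF 0 (i, t.1) ^ 2 * uW (i, t)) := by
    rintro ⟨j, k⟩ ht
    have hj := (Finset.mem_product.1 ht).1
    rw [Finset.sum_eq_single (j, bar k)]
    · rw [if_pos (by funext n; exact kz_bar (par j) k n), aW_bar, eW_bar, mul_one, aW_sq]; rfl
    · rintro ⟨j', k'⟩ hb hne
      split_ifs with h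
      · obtain ⟨h1, h2⟩ := kz_zero (par j) (par j') k k' (fun n => congrFun h n)
        have hj' : j ≠ j' := fun e => hne (by rw [h2, e])
        have hd : 2 ≤ |j - j'| := by
          have hp : (j % 2 = 0) ↔ (j' % 2 = 0) := decide_eq_decide.1 h1
          rw [le_abs]; omega
        have := etF_disj i hd
        have e0 : aW (i, j, k) * aW (i, j', k') = 0 := by
          change etF 0 (i, j) * _ * (etF 0 (i, j') * _) = 0
          rw [mul_mul_mul_comm, this, zero_mul]
        rw [e0, zero_mul, smul_zero]
      · rfl
    · intro h; exact (h (Finset.mem_product.2 ⟨hj, Finset.mem_univ (bar k)⟩)).elim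
  rw [Finset.sum_congr rfl key, Finset.sum_product, QQ, Finset.smul_sum, Finset.smul_sum, ← Finset.sum_sub_distrib]
  refine Finset.sum_congr rfl fun j _ => ?_
  ext z
  have h := alv_sum (par j) (rho P) (fun a b => (Rj (i, j) a b).1 z) (fun a b => by rw [Rj_symm]) x y
  have hu : ∀ k : K, (uW (i, j, k)).1 z = alv (par j) (rho P) (fun a b => (Rj (i, j) a b).1 z) k.1 k.2.1 := fun k => by
    rw [uW, alS_app]; rfl
  simp only [SFo.sum_app, SFo.smul_app, SFo.sub_app, SFo.mul_app, SFo.pow_app, hu]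
  have e : ∀ a b c : ℂ, a * (b * c) = b * (a * c) := fun a b c => by ring
  simp only [fun k : K => e (1 / 2 * (kB (par j) k x * kB (par j) (bar k) y + kB (par j) (bar k) x * kB (par j) k y))]
  rw [← Finset.mul_sum, h]; ring

def WSc (P : ℕ) : WS P (ℤ × K) where
  Dm := D2
  hD q := Dj_closed _
  μ := mW
  gs2 := gW_sy2
  J i := Jz i ×ˢ Finset.univ
  M := 36
  hJ i z := by
    obtain ⟨s, h1, h2⟩ := Jz_fin i z
    refine ⟨s ×ˢ Finset.univ, ?_, fun t ht hz => Finset.mem_product.2 ⟨h2 t.1 (Finset.mem_product.1 ht).1 hz, Finset.mem_univ _⟩⟩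
    rw [Finset.card_product]
    have : (Finset.univ : Finset K).card = 12 := by decide
    rw [this]; omega
  mz := kq
  hmz q n := rfl
  a := aW
  as := aW_sy
  aS := aW_sp
  aT i t ht := (aW_sp (i, t)).mono (Dj_TT i (Finset.mem_product.1 ht).1)
  B t := kB (par t.1) t.2
  MB := 1
  hB t c := kB_norm _ _ _
  hcurl t c := kB_curl _ _ _
  aP := aW_pk
  eP := eW_pk
  gP := gW_pk
  hP := hW_pk
  rl i c := by
    rw [Finset.sum_product]
    refine Rl.sum fun j _ => rl_pair (fun k => kB (par j) k c • (aW (i, j, k) * eW (i, j, k))) fun k z => ?_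
    have h1 : star ((aW (i, j, k)).1 z) = (aW (i, j, k)).1 z := Complex.conj_eq_iff_im.2 (aW_rl _ z)
    simp only [SFo.smul_app, SFo.mul_app, kB_bar, aW_bar, eW_star, star_mul', h1]
  χ i := (rho P : ℂ) • ∑ j ∈ Jz i, etF 0 (i, j) ^ 2
  hχ i n := by
    simp [map_sum, sq, dx_mul, etF_dx]
  Q := QQ
  Qsym i a b := Finset.sum_congr rfl fun j _ => by rw [Rj_symm]
  QP i a b k := Pk.sum fun j _ => by
    rw [sq]; exact ((etF_pk _ _ k).mul (etF_pk _ _ k)).mul (Rj_pk _ a b k)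
  QT i a b := Sp.sum fun j hj => ((et2_sp (i, j)).mul_right _).mono (Dj_TT i hj)
  Qk := Qk0
  Qd := Qd0
  QD := QD0
  hlow := low0

theorem step_thm (P : ℕ) : ∃ C, 1 ≤ C ∧ ∀ i : Data P, ∃ w q R, Out C i w q R := (WSc P).step
end CI
end

noncomputable section
open MeasureTheory Set Filter Topology
open scoped ContDiff
set_option linter.unusedSectionVars false

namespace CI
/-! time rescaling -/
def scm (c : ℝ) (z : ℝ × Spc) : ℝ × Spc := (c * z.1, z.2)
theorem scm_cd (c : ℝ) : ContDiff ℝ ∞ (scm c) := (contDiff_const.mul contDiff_fst).prodMk contDiff_snd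
def sc (c : ℝ) (f : SF) : SF := ⟨fun z => f.1 (scm c z), (SFo.cd f).comp (scm_cd c)⟩
theorem sc_app (c : ℝ) (f : SF) (z) : (sc c f).1 z = f.1 (scm c z) := rfl
theorem sc_dd (c : ℝ) (f : SF) (e : ℝ × Spc) (z) : (dd e (sc c f)).1 z = fderiv ℝ f.1 (scm c z) (scm c e) := by
  rw [dd_app]
  have h1 : HasFDerivAt (scm c) ((c • ContinuousLinearMap.fst ℝ ℝ Spc).prod (ContinuousLinearMap.snd ℝ ℝ Spc)) z := by
    have := ((c • ContinuousLinearMap.fst ℝ ℝ Spc).prod (ContinuousLinearMap.snd ℝ ℝ Spc)).hasFDerivAt (x := z)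
    exact this
  have h2 := ((SFo.diff f (scm c z)).hasFDerivAt).comp z h1
  have : (sc c f).1 = f.1 ∘ scm c := rfl
  rw [this, h2.fderiv]; rfl
theorem sc_dx (c : ℝ) (f : SF) (j) : dx j (sc c f) = sc c (dx j f) := by
  ext z
  rw [dx_eq, sc_dd, sc_app, dd_app]
  congr 1
  simp [scm, eS]
theorem sc_dt (c : ℝ) (f : SF) : dt (sc c f) = (c : ℂ) • sc c (dt f) := by
  ext z
  change (dd (1, 0) (sc c f)).1 z = (c : ℂ) * (dd (1, 0) f).1 (scm c z)
  rw [sc_dd, dd_app]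
  have : scm c (1, 0) = c • ((1, 0) : ℝ × Spc) := by simp [scm]
  rw [this, map_smul]; simp
theorem sc_add (c) (f g : SF) : sc c (f + g) = sc c f + sc c g := rfl
theorem sc_mul (c) (f g : SF) : sc c (f * g) = sc c f * sc c g := rfl
theorem sc_zero (c) : sc c 0 = 0 := rfl
theorem sc_smul (c) (a : ℂ) (f : SF) : sc c (a • f) = a • sc c f := rfl
theorem sc_sum {τ : Type} (c) (s : Finset τ) (f : τ → SF) : sc c (∑ i ∈ s, f i) = ∑ i ∈ s, sc c (f i) := by
  classical
  induction s using Finset.induction_on with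
  | empty => simp [sc_zero]
  | insert a s ha ih => rw [Finset.sum_insert ha, Finset.sum_insert ha, sc_add, ih]
theorem sc_sc {c d : ℝ} (h : c * d = 1) (f : SF) : sc c (sc d f) = f := by
  ext z
  have : scm d (scm c z) = z := by
    refine Prod.ext ?_ rfl
    change d * (c * z.1) = z.1
    rw [← mul_assoc, mul_comm d, h, one_mul]
  change f.1 (scm d (scm c z)) = f.1 z
  rw [this]
theorem sc_rl (c) {f : SF} (h : Rl f) : Rl (sc c f) := fun z => h _
theorem sc_pk (c) {f : SF} {k} (h : Pk (kv k) f) : Pk (kv k) (sc c f) := fun z => by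
  have := h (scm c z)
  change f.1 (scm c (z + kv k)) = f.1 (scm c z)
  have e : scm c (z + kv k) = scm c z + kv k := by
    refine Prod.ext ?_ rfl
    simp [scm, kv]
  rw [e, this]
theorem sc_sp (c : ℝ) {f : SF} {a b a' b' : ℝ} (h : Sp (TS a b) f) (hh : ∀ t, c * t ∈ Icc a b → t ∈ Icc a' b') :
    Sp (TS a' b') (sc c f) := fun z hz => h _ fun h' => hz (hh _ h')

structure Tr where
  v : Fin 3 → SF
  p : SF
  R : Fin 3 → Fin 3 → SF
structure Eu (T : ℝ) (F : Tr) : Prop where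
  vR : ∀ l, Rl (F.v l)
  pR : Rl F.p
  RR : ∀ a b, Rl (F.R a b)
  vP : ∀ l k, Pk (kv k) (F.v l)
  pP : ∀ k, Pk (kv k) F.p
  RP : ∀ a b k, Pk (kv k) (F.R a b)
  vS : ∀ l, Sp (TS (-T) T) (F.v l)
  pS : Sp (TS (-T) T) F.p
  RS : ∀ a b, Sp (TS (-T) T) (F.R a b)
  Rsym : ∀ a b, F.R a b = F.R b a
  div0 : ∑ a, dx a (F.v a) = 0
  er : ∀ b, dt (F.v b) + ∑ a, dx a (F.v a * F.v b) + dx b F.p = ∑ a, dx a (F.R a b)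
def Tr.sc (c : ℝ) (F : Tr) : Tr :=
  ⟨fun l => (c : ℂ) • CI.sc c (F.v l), ((c : ℂ) ^ 2) • CI.sc c F.p, fun a b => ((c : ℂ) ^ 2) • CI.sc c (F.R a b)⟩
theorem Eu.sc {T T' : ℝ} {F : Tr} (h : Eu T F) (c : ℝ) (hT : ∀ t, c * t ∈ Icc (-T) T → t ∈ Icc (-T') T') : Eu T' (F.sc c) where
  vR l := (sc_rl c (h.vR l)).smul c
  pR := by have := (sc_rl c h.pR).smul (c ^ 2); push_cast at this; exact this
  RR a b := by have := (sc_rl c (h.RR a b)).smul (c ^ 2); push_cast at this; exact this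
  vP l k := (sc_pk c (h.vP l k)).smul _
  pP k := (sc_pk c (h.pP k)).smul _
  RP a b k := (sc_pk c (h.RP a b k)).smul _
  vS l := (sc_sp c (h.vS l) hT).smul _
  pS := (sc_sp c h.pS hT).smul _
  RS a b := (sc_sp c (h.RS a b) hT).smul _
  Rsym a b := by simp only [Tr.sc, h.Rsym a b]
  div0 := by
    simp only [Tr.sc, Derivation.map_smul, sc_dx, ← Finset.smul_sum, ← sc_sum, h.div0, sc_zero, smul_zero]
  er b := by
    have := congrArg (fun f => ((c : ℂ) ^ 2) • CI.sc c f) (h.er b)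
    simp only [sc_add, sc_sum, smul_add] at this
    simp only [Tr.sc, Derivation.map_smul, sc_dx, sc_dt, ← Finset.smul_sum, smul_mul_smul_comm, ← sc_mul]
    rw [← this, smul_smul, sq]

theorem Tr.sc_DR (F : Tr) (c : ℝ) (a b) : dt ((F.sc c).R a b) + ∑ j, (F.sc c).v j * dx j ((F.sc c).R a b) =
    ((c : ℂ) ^ 3) • CI.sc c (dt (F.R a b) + ∑ j, F.v j * dx j (F.R a b)) := by
  simp only [Tr.sc, Derivation.map_smul, sc_dx, sc_dt, sc_add, sc_sum, smul_mul_smul_comm, ← sc_mul, ← Finset.smul_sum, smul_smul, smul_add]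
  congr 2 <;> ring
/-- quantitative bounds -/
structure Ok (c G H U : ℝ) (F : Tr) : Prop where
  bR : ∀ a b z, ‖(F.R a b).1 z‖ ≤ c ^ 2
  bdR : ∀ j a b z, ‖(dx j (F.R a b)).1 z‖ ≤ c ^ 2 * G
  bDR : ∀ a b z, ‖(dt (F.R a b) + ∑ j, F.v j * dx j (F.R a b)).1 z‖ ≤ c ^ 3 * G
  bv : ∀ l z, ‖(F.v l).1 z‖ ≤ U
  bdv : ∀ j l z, ‖(dx j (F.v l)).1 z‖ ≤ c * G
  bdp : ∀ j z, ‖(dx j F.p).1 z‖ ≤ c ^ 2 * H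
/-- increments -/
structure Nx (C c κ L : ℝ) (F F' : Tr) : Prop where
  bw : ∀ l z, ‖(F'.v l - F.v l).1 z‖ ≤ C * c
  bdw : ∀ j l z, ‖(dx j (F'.v l - F.v l)).1 z‖ ≤ C * c * (L / κ)
  btw : ∀ l z, ‖(dt (F'.v l - F.v l)).1 z‖ ≤ C * c * (L / κ) * (c + ∑ m, ‖(F.v m).1 z‖)
  bq : ∀ z, ‖(F'.p - F.p).1 z‖ ≤ C * c ^ 2
  bdq : ∀ j z, ‖(dx j (F'.p - F.p)).1 z‖ ≤ C * c ^ 2 * (L / κ)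
  btq : ∀ z, ‖(dt (F'.p - F.p)).1 z‖ ≤ C * c ^ 2 * (L / κ) * (c + ∑ m, ‖(F.v m).1 z‖)
  bR : ∀ a b z, ‖(F'.R a b).1 z‖ ≤ C * c ^ 2 * κ
  bdR : ∀ j a b z, ‖(dx j (F'.R a b)).1 z‖ ≤ C * c ^ 2 * L
  bDR : ∀ a b z, ‖(dt (F'.R a b) + ∑ j, F'.v j * dx j (F'.R a b)).1 z‖ ≤ C * c ^ 3 * L

theorem ok_step (P : ℕ) : ∃ C, 1 ≤ C ∧ ∀ (κ L c U T : ℝ) (N : ℕ) (F : Tr), 0 < κ → κ ≤ 1 → 1 ≤ L → L * κ ^ P ≤ 1 →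
    2 * Real.pi * N * κ = L → 0 < c → U * κ ^ P ≤ c → Eu T F → Ok c (κ * L) L U F →
    ∃ F', Eu (T + 2 / (L * c)) F' ∧ Nx C c κ L F F' := by
  obtain ⟨C, hC, H⟩ := step_thm P
  refine ⟨C, hC, fun κ L c U T N F hκ hκ1 hL hLP hN hc hU hE hO => ?_⟩
  have hc0 : (c : ℂ) ≠ 0 := by exact_mod_cast hc.ne'
  have hT : ∀ t, c⁻¹ * t ∈ Icc (-T) T → t ∈ Icc (-(c * T)) (c * T) := fun t ht => by
    have h1 := mul_le_mul_of_nonneg_left ht.1 hc.le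
    have h2 := mul_le_mul_of_nonneg_left ht.2 hc.le
    rw [mul_inv_cancel_left₀ hc.ne'] at h1 h2
    exact ⟨by linarith, h2⟩
  have hG := hE.sc c⁻¹ hT
  have nn : ∀ (k : ℕ) (f : SF) (B : ℝ), (∀ z, ‖f.1 z‖ ≤ c ^ k * B) → ∀ z, ‖((((c⁻¹ : ℝ) : ℂ) ^ k) • sc c⁻¹ f).1 z‖ ≤ B := by
    intro k f B h z
    rw [SFo.smul_app, norm_mul, norm_pow, Complex.norm_real, Real.norm_of_nonneg (inv_pos.2 hc).le, inv_pow, inv_mul_le_iff₀ (by positivity)]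
    exact h _
  let i : Data P :=
    { κ := κ, L := L, N := N, v := (F.sc c⁻¹).v, p := (F.sc c⁻¹).p, R := (F.sc c⁻¹).R, ta := -(c * T), tb := c * T
      hκ0 := hκ, hκ1 := hκ1, hL1 := hL, hLP := hLP, hN := hN, vR := hG.vR, RR := hG.RR, vP := hG.vP, pP := hG.pP
      RP := hG.RP, vS := hG.vS, pS := hG.pS, RS := hG.RS, Rsym := hG.Rsym, div0 := hG.div0, er := hG.er
      bR := fun a b => nn 2 _ 1 fun z => by simpa using hO.bR a b z
      bdR := fun j a b => by
        rw [show dx j ((F.sc c⁻¹).R a b) = (((c⁻¹ : ℝ) : ℂ) ^ 2) • sc c⁻¹ (dx j (F.R a b)) by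
          simp only [Tr.sc, Derivation.map_smul, sc_dx]]
        exact nn 2 _ _ fun z => hO.bdR j a b z
      bDR := fun a b => by
        rw [Tr.sc_DR]
        exact nn 3 _ _ fun z => hO.bDR a b z
      bv := fun l z => by
        have := nn 1 (F.v l) (c⁻¹ * U) (fun z => by rw [pow_one, mul_inv_cancel_left₀ hc.ne']; exact hO.bv l z) z
        rw [pow_one] at this
        refine (mul_le_mul_of_nonneg_right this (by positivity)).trans ?_
        rw [mul_assoc, inv_mul_le_iff₀ hc, mul_one]; exact hU
      bdv := fun j l => by
        rw [show dx j ((F.sc c⁻¹).v l) = (((c⁻¹ : ℝ) : ℂ) ^ 1) • sc c⁻¹ (dx j (F.v l)) by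
          simp only [Tr.sc, Derivation.map_smul, sc_dx, pow_one]]
        exact nn 1 _ _ fun z => by rw [pow_one]; exact hO.bdv j l z
      bdp := fun j => by
        rw [show dx j ((F.sc c⁻¹).p) = (((c⁻¹ : ℝ) : ℂ) ^ 2) • sc c⁻¹ (dx j F.p) by
          simp only [Tr.sc, Derivation.map_smul, sc_dx]]
        exact nn 2 _ _ fun z => hO.bdp j z }
  obtain ⟨w, q, R, O⟩ := H i
  have hLc : 0 < L * c := mul_pos (by linarith) hc
  let F1 : Tr := ⟨fun l => (F.sc c⁻¹).v l + w l, (F.sc c⁻¹).p + q, R⟩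
  have hT1 : TS (-(c * T)) (c * T) ⊆ TT i := TS_TT i
  have et : TT i = TS (-(c * T + 2 / L)) (c * T + 2 / L) := by
    change TS (-(c*T) - 2 / L) (c*T + 2/L) = _
    congr 1; ring
  have e1 : Eu (c * T + 2 / L) F1 :=
    { vR := fun l => (hG.vR l).add (O.wR l), pR := hG.pR.add O.qR, RR := O.RR
      vP := fun l k => (hG.vP l k).add (O.wP l k), pP := fun k => (hG.pP k).add (O.qP k), RP := O.RP
      vS := fun l => et ▸ ((hG.vS l).mono hT1).add (O.wS l), pS := et ▸ (hG.pS.mono hT1).add O.qS, RS := fun a b => et ▸ O.RS a b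
      Rsym := O.Rsym
      div0 := by simp only [F1, map_add, Finset.sum_add_distrib, hG.div0, O.div0, add_zero]
      er := O.er }
  have hT2 : ∀ t, c * t ∈ Icc (-(c * T + 2 / L)) (c * T + 2 / L) → t ∈ Icc (-(T + 2 / (L * c))) (T + 2 / (L * c)) := fun t ht => by
    have e : c * (T + 2 / (L * c)) = c * T + 2 / L := by field_simp
    constructor
    · refine le_of_mul_le_mul_left (a := c) ?_ hc; rw [mul_neg, e]; exact ht.1
    · refine le_of_mul_le_mul_left (a := c) ?_ hc; rw [e]; exact ht.2
  have hci : c * c⁻¹ = 1 := mul_inv_cancel₀ hc.ne'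
  have hciC : (c : ℂ) * ((c⁻¹ : ℝ) : ℂ) = 1 := by rw [← Complex.ofReal_mul, hci, Complex.ofReal_one]
  have ev : ∀ l, (F1.sc c).v l = F.v l + (c : ℂ) • sc c (w l) := fun l => by
    simp only [F1, Tr.sc, sc_add, smul_add, sc_smul, smul_smul, hciC, one_smul, sc_sc hci]
  have ep : (F1.sc c).p = F.p + ((c : ℂ) ^ 2) • sc c q := by
    simp only [F1, Tr.sc, sc_add, smul_add, sc_smul, smul_smul, ← mul_pow, hciC, one_smul, sc_sc hci, one_pow]
  have mm : ∀ (k : ℕ) (f : SF) (B : ℝ) z, (‖f.1 (scm c z)‖ ≤ B) → ‖((((c : ℝ) : ℂ) ^ k) • sc c f).1 z‖ ≤ c ^ k * B := by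
    intro k f B z h
    rw [SFo.smul_app, norm_mul, norm_pow, Complex.norm_real, Real.norm_of_nonneg hc.le]
    exact mul_le_mul_of_nonneg_left h (by positivity)
  have vs : ∀ z, c * (1 + ∑ m, ‖(i.v m).1 (scm c z)‖) = c + ∑ m, ‖(F.v m).1 z‖ := fun z => by
    rw [mul_add, mul_one, Finset.mul_sum]
    congr 1
    refine Finset.sum_congr rfl fun m _ => ?_
    change c * ‖((c⁻¹ : ℝ) : ℂ) * (sc c (sc c⁻¹ (F.v m))).1 z‖ = _
    rw [sc_sc hci, norm_mul, Complex.norm_real, Real.norm_of_nonneg (inv_pos.2 hc).le, mul_inv_cancel_left₀ hc.ne']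
  refine ⟨F1.sc c, e1.sc c hT2, ?_⟩
  have eL : wl i = L / κ := rfl
  constructor
  · intro l z
    rw [ev, add_sub_cancel_left]
    have := mm 1 (w l) C z (O.bw l _)
    simp only [pow_one] at this; linarith
  · intro j l z
    rw [ev, add_sub_cancel_left, Derivation.map_smul, sc_dx]
    have := mm 1 _ _ z (O.bdw j l _)
    simp only [pow_one, eL] at this; linarith
  · intro l z
    rw [ev, add_sub_cancel_left, Derivation.map_smul, sc_dt, smul_smul, ← sq, ← vs]
    have := mm 2 _ _ z (O.btw l _)
    rw [eL] at this; refine this.trans (le_of_eq ?_); ring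
  · intro z
    rw [ep, add_sub_cancel_left]
    have := mm 2 q C z (O.bq _)
    linarith
  · intro j z
    rw [ep, add_sub_cancel_left, Derivation.map_smul, sc_dx]
    have := mm 2 _ _ z (O.bdq j _)
    rw [eL] at this; linarith
  · intro z
    rw [ep, add_sub_cancel_left, Derivation.map_smul, sc_dt, smul_smul, ← pow_succ, ← vs]
    have := mm 3 _ _ z (O.btq _)
    rw [eL] at this; refine this.trans (le_of_eq ?_); ring
  · intro a b z
    have := mm 2 _ _ z (O.bR a b _)
    refine this.trans (le_of_eq ?_); change c ^ 2 * (C * κ) = _; ring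
  · intro j a b z
    have := mm 2 _ _ z (O.bdR j a b _)
    rw [show dx j ((F1.sc c).R a b) = (((c : ℝ) : ℂ) ^ 2) • sc c (dx j (R a b)) by
          simp only [F1, Tr.sc, Derivation.map_smul, sc_dx]]
    refine this.trans (le_of_eq ?_); change c ^ 2 * (C * L) = _; ring
  · intro a b z
    have := mm 3 _ _ z (O.bDR a b _)
    rw [Tr.sc_DR]
    refine this.trans (le_of_eq ?_); change c ^ 3 * (C * L) = _; ring
end CI
end

noncomputable section
open MeasureTheory Set Filter Topology
open scoped ContDiff
set_option linter.unusedSectionVars false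

namespace CI
theorem ok_next {C c c' κ κ' L L' U U' : ℝ} {F F' : Tr} (hC : 1 ≤ C) (hc0 : 0 < c) (hc' : 0 < c')
    (hκ : 0 < κ) (hκ0 : 0 < κ') (hκ' : κ' ≤ κ) (hκ1 : κ ≤ 1) (hL : 0 < L)
    (h1 : C * c ^ 2 * κ ≤ c' ^ 2) (h2 : 2 * C * c * (L / κ) ≤ c' * (κ' * L')) (hU : U + C * c ≤ U')
    (hO : Ok c (κ * L) L U F) (hN : Nx C c κ L F F') : Ok c' (κ' * L') L' U' F' := by
  have hl : 0 < L / κ := div_pos hL hκ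
  have hLl : L ≤ L / κ := by rw [le_div_iff₀ hκ]; nlinarith
  have hLe : L = κ * (L / κ) := by field_simp
  have hX : 0 < C * c * (L / κ) := by positivity
  have hck : c * κ ≤ c' := by
    refine le_of_sq_le_sq ?_ hc'.le |> fun h => h
    have : (c * κ) ^ 2 = c ^ 2 * κ * κ := by ring
    rw [this]
    have h3 : 0 < c ^ 2 * κ := by positivity
    nlinarith
  have add_bd : ∀ (f g : SF) z (A B : ℝ), ‖f.1 z‖ ≤ A → ‖(g - f).1 z‖ ≤ B → ‖g.1 z‖ ≤ A + B := by
    intro f g z A B h h'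
    have e : g.1 z = f.1 z + (g - f).1 z := by rw [SFo.sub_app]; ring
    rw [e]; exact (norm_add_le _ _).trans (add_le_add h h')
  constructor
  · intro a b z; exact (hN.bR a b z).trans h1
  · intro j a b z
    refine (hN.bdR j a b z).trans ?_
    have := mul_le_mul_of_nonneg_left h2 hc'.le
    have e : C * c ^ 2 * L = (c * κ) * (C * c * (L / κ)) := by field_simp
    have := mul_le_mul_of_nonneg_right hck hX.le
    rw [e]; nlinarith
  · intro a b z
    refine (hN.bDR a b z).trans ?_
    have h3 := mul_le_mul_of_nonneg_left h2 (sq_nonneg c')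
    have h4 := mul_le_mul_of_nonneg_right h1 hX.le
    have e : (C * c ^ 2 * κ) * (C * c * (L / κ)) = C * (C * c ^ 3 * L) := by field_simp
    have : 0 < C * c ^ 3 * L := by positivity
    nlinarith
  · intro l z; exact (add_bd _ _ z _ _ (hO.bv l z) (hN.bw l z)).trans hU
  · intro j l z
    have h3 := hN.bdw j l z
    rw [map_sub] at h3
    refine (add_bd _ _ z _ _ (hO.bdv j l z) h3).trans (le_trans ?_ h2)
    have : c * (κ * L) ≤ C * c * (L / κ) := by
      have : κ * L ≤ L / κ := le_trans (by nlinarith) hLl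
      have h5 : c * (κ * L) ≤ c * (L / κ) := mul_le_mul_of_nonneg_left this hc0.le
      have h6 : 0 < c * (L / κ) := by positivity
      nlinarith
    linarith
  · intro j z
    have h3 := hN.bdq j z
    rw [map_sub] at h3
    refine (add_bd _ _ z _ _ (hO.bdp j z) h3).trans ?_
    have h5 : c ^ 2 * L ≤ C * c ^ 2 * (L / κ) := by
      have h6 : c ^ 2 * L ≤ c ^ 2 * (L / κ) := mul_le_mul_of_nonneg_left hLl (sq_nonneg c)
      have h7 : 0 < c ^ 2 * (L / κ) := by positivity
      nlinarith
    have h8 : c * κ' ≤ c' := (mul_le_mul_of_nonneg_left hκ' hc0.le).trans hck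
    have h9 : c * (c' * (κ' * L')) ≤ c' ^ 2 * L' := by
      have hL' : 0 ≤ L' := by
        by_contra hh
        push Not at hh
        have : c' * (κ' * L') < 0 := mul_neg_of_pos_of_neg hc' (mul_neg_of_pos_of_neg hκ0 hh)
        linarith
      have := mul_le_mul_of_nonneg_right h8 (mul_nonneg hc'.le hL')
      linarith
    have := mul_le_mul_of_nonneg_left h2 hc0.le
    nlinarith

/-! parameters -/
structure Pm where
  β : ℝ
  s : ℝ
  h : ℝ
  Z : ℝ
  hβ : 0 < β
  hs : 0 < s
  hs1 : s < 1
  hh : 2 * h * β = 1 - s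
  hZ : Z * β = 2 * (1 + β) + 1 / 2
namespace Pm
variable (π : Pm)
def b : ℝ := 1 + π.β
def κ (_ : Pm) (y : ℝ) : ℝ := Real.exp (-y)
def c (y : ℝ) : ℝ := Real.exp (-(π.h * y))
def N (y : ℝ) : ℕ := ⌈Real.exp (π.Z * y)⌉₊
def la (y : ℝ) : ℝ := 2 * Real.pi * π.N y
def L (y : ℝ) : ℝ := 2 * Real.pi * π.N y * π.κ y
theorem h_pos : 0 < π.h := by
  have := π.hh; have := π.hs1; have := π.hβ
  by_contra hh; push Not at hh; nlinarith
theorem gap : (π.Z - 2 - 3 * π.h) * π.β = 1 + 3 / 2 * π.s := by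
  have := π.hh; have := π.hZ; linarith
theorem gap_pos : 0 < π.Z - 2 - 3 * π.h := by
  have := π.gap; have := π.hs; have := π.hβ
  by_contra hh; push Not at hh; nlinarith
theorem Z_pos : 2 < π.Z := by linarith [π.gap_pos, π.h_pos]
theorem κ_pos (y) : 0 < π.κ y := Real.exp_pos _
theorem c_pos (y) : 0 < π.c y := Real.exp_pos _
theorem N_low (y) : Real.exp (π.Z * y) ≤ π.N y := Nat.le_ceil _
theorem N_up {y : ℝ} (hy : 0 ≤ y) : (π.N y : ℝ) ≤ 2 * Real.exp (π.Z * y) := by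
  have h1 := (Nat.ceil_lt_add_one (Real.exp_pos (π.Z * y)).le).le
  have h2 : 1 ≤ Real.exp (π.Z * y) := Real.one_le_exp (mul_nonneg (by linarith [π.Z_pos]) hy)
  have : (π.N y : ℝ) ≤ Real.exp (π.Z * y) + 1 := h1
  linarith
theorem la_eq (y) : π.L y / π.κ y = π.la y := by
  rw [L, la, mul_div_cancel_right₀ _ (π.κ_pos y).ne']
theorem la_low (y) : Real.exp (π.Z * y) ≤ π.la y := by
  have h1 := π.N_low y
  have := Real.pi_gt_three
  have h2 := Real.exp_pos (π.Z * y)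
  rw [la]; nlinarith
theorem la_up {y : ℝ} (hy : 0 ≤ y) : π.la y ≤ 16 * Real.exp (π.Z * y) := by
  have h1 := π.N_up hy
  have := Real.pi_lt_four
  have := Real.pi_pos
  have h2 := Real.exp_pos (π.Z * y)
  rw [la]; nlinarith
theorem L_low (y) : Real.exp ((π.Z - 1) * y) ≤ π.L y := by
  have e : Real.exp ((π.Z - 1) * y) = Real.exp (π.Z * y) * π.κ y := by
    rw [κ, ← Real.exp_add]; congr 1; ring
  rw [e]
  exact mul_le_mul_of_nonneg_right (π.la_low y) (π.κ_pos y).le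
theorem L_up {y : ℝ} (hy : 0 ≤ y) : π.L y ≤ 16 * Real.exp ((π.Z - 1) * y) := by
  have e : Real.exp ((π.Z - 1) * y) = Real.exp (π.Z * y) * π.κ y := by
    rw [κ, ← Real.exp_add]; congr 1; ring
  rw [e, ← mul_assoc]
  exact mul_le_mul_of_nonneg_right (π.la_up hy) (π.κ_pos y).le
theorem ev (k M : ℝ) (hk : 0 < k) : ∀ᶠ y : ℝ in atTop, M ≤ Real.exp (k * y) :=
  (Real.tendsto_exp_atTop.comp (tendsto_id.const_mul_atTop hk)).eventually_ge_atTop M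

/-- requirements for one step -/
structure Good (C : ℝ) (P : ℕ) (y : ℝ) : Prop where
  y0 : 0 ≤ y
  g1 : C * π.c y ^ 2 * π.κ y ≤ π.c (π.b * y) ^ 2
  g2 : 2 * C * π.c y * (π.L y / π.κ y) ≤ π.c (π.b * y) * (π.κ (π.b * y) * π.L (π.b * y))
  g3 : Real.exp y + C * π.c y ≤ Real.exp (π.b * y)
  g4 : 1 ≤ π.L y
  g5 : π.L y * π.κ y ^ P ≤ 1
  g6 : Real.exp y * π.κ y ^ P ≤ π.c y
  g7 : 2 / (π.L y * π.c y) ≤ Real.exp (-y)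
theorem good_ev (C : ℝ) (hC : 1 ≤ C) (P : ℕ) (hP : π.Z + π.h + 1 ≤ P) : ∀ᶠ y : ℝ in atTop, π.Good C P y := by
  have hβ := π.hβ
  filter_upwards [eventually_ge_atTop 0, ev π.s C π.hs, ev (π.s / 2) (32 * C) (by linarith [π.hs]), ev π.β 2 π.hβ,
    ev 1 C one_pos, ev 1 16 one_pos, ev (π.Z - 2 - π.h) 2 (by linarith [π.gap_pos, π.h_pos])] with y y0 e1 e2 e3 e4 e5 e6
  rw [one_mul] at e4 e5
  have hZ := π.Z_pos
  have hh := π.h_pos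
  have hZy : 0 ≤ (π.Z - 2) * y := mul_nonneg (by linarith) y0
  have kP : π.κ y ^ P = Real.exp (-(P * y)) := by rw [κ, ← Real.exp_nat_mul]; congr 1; ring
  have hPy : (π.Z + π.h + 1) * y ≤ P * y := mul_le_mul_of_nonneg_right hP y0
  have hhy : 0 ≤ π.h * y := mul_nonneg hh.le y0
  have c1 : π.c y ≤ 1 := Real.exp_le_one_iff.2 (by linarith)
  refine ⟨y0, ?_, ?_, ?_, ?_, ?_, ?_, ?_⟩
  · have : π.c (π.b * y) ^ 2 = Real.exp (π.s * y) * (π.c y ^ 2 * π.κ y) := by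
      simp only [c, κ, b, ← Real.exp_nat_mul, ← Real.exp_add]
      congr 1; push_cast
      linear_combination (-y) * π.hh
    rw [this, mul_assoc]
    exact mul_le_mul_of_nonneg_right e1 (mul_nonneg (sq_nonneg _) (π.κ_pos y).le)
  · rw [π.la_eq]
    have h1 : 2 * C * π.c y * π.la y ≤ 2 * C * π.c y * (16 * Real.exp (π.Z * y)) :=
      mul_le_mul_of_nonneg_left (π.la_up y0) (by have := π.c_pos y; positivity)
    have h2 : π.c (π.b * y) * (π.κ (π.b * y) * Real.exp ((π.Z - 1) * (π.b * y))) ≤ π.c (π.b * y) * (π.κ (π.b * y) * π.L (π.b * y)) :=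
      mul_le_mul_of_nonneg_left (mul_le_mul_of_nonneg_left (π.L_low _) (π.κ_pos _).le) (π.c_pos _).le
    refine h1.trans (le_trans ?_ h2)
    have e : π.c (π.b * y) * (π.κ (π.b * y) * Real.exp ((π.Z - 1) * (π.b * y))) = Real.exp (π.s / 2 * y) * (π.c y * Real.exp (π.Z * y)) := by
      simp only [c, κ, b, ← Real.exp_add]
      congr 1
      linear_combination y * π.hZ - y / 2 * π.hh
    rw [e]
    have := mul_le_mul_of_nonneg_right e2 (mul_pos (π.c_pos y) (Real.exp_pos (π.Z * y))).le
    linarith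
  · have : Real.exp (π.b * y) = Real.exp (π.β * y) * Real.exp y := by rw [← Real.exp_add, b]; congr 1; ring
    rw [this]
    have := mul_le_mul_of_nonneg_right e3 (Real.exp_pos y).le
    nlinarith
  · refine le_trans ?_ (π.L_low y)
    exact Real.one_le_exp (mul_nonneg (by linarith) y0)
  · rw [kP]
    refine (mul_le_mul_of_nonneg_right (π.L_up y0) (Real.exp_pos _).le).trans ?_
    refine (mul_le_mul_of_nonneg_right (mul_le_mul_of_nonneg_right e5 (Real.exp_pos _).le) (Real.exp_pos _).le).trans ?_
    rw [← Real.exp_add, ← Real.exp_add]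
    exact Real.exp_le_one_iff.2 (by linarith)
  · rw [kP, c, ← Real.exp_add]
    exact Real.exp_le_exp.2 (by nlinarith)
  · rw [div_le_iff₀ (mul_pos ((Real.exp_pos _).trans_le (π.L_low y)) (π.c_pos y))]
    have h1 : Real.exp ((π.Z - 1) * y) * π.c y ≤ π.L y * π.c y := mul_le_mul_of_nonneg_right (π.L_low y) (π.c_pos y).le
    refine le_trans ?_ (mul_le_mul_of_nonneg_left h1 (Real.exp_pos _).le)
    rw [c, ← Real.exp_add, ← Real.exp_add]
    exact e6.trans (Real.exp_le_exp.2 (by linarith))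
end Pm

theorem Eu.mono {T T' : ℝ} {F : Tr} (h : Eu T F) (hT : T ≤ T') : Eu T' F := by
  have hs : ∀ f : SF, Sp (TS (-T) T) f → Sp (TS (-T') T') f := fun f hf z hz => hf z fun hz' =>
    hz ⟨by linarith [hz'.1], by linarith [hz'.2]⟩
  exact ⟨h.vR, h.pR, h.RR, h.vP, h.pP, h.RP, fun l => hs _ (h.vS l), hs _ h.pS, fun a b => hs _ (h.RS a b), h.Rsym, h.div0, h.er⟩

/-- state after q steps -/
structure St (π : Pm) (y T : ℝ) (F : Tr) : Prop where
  eu : Eu T F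
  ok : Ok (π.c y) (π.κ y * π.L y) (π.L y) (Real.exp y) F
theorem st_step (π : Pm) (P : ℕ) : ∃ C, 1 ≤ C ∧ ∀ y T F, π.Good C P y → St π y T F →
    ∃ F', St π (π.b * y) (T + Real.exp (-y)) F' ∧ Nx C (π.c y) (π.κ y) (π.L y) F F' := by
  obtain ⟨C, hC, H⟩ := ok_step P
  refine ⟨C, hC, fun y T F g h => ?_⟩
  have k1 : π.κ y ≤ 1 := Real.exp_le_one_iff.2 (by linarith [g.y0])
  have kb : π.κ (π.b * y) ≤ π.κ y := Real.exp_le_exp.2 (by have := π.hβ; have := g.y0; rw [Pm.b]; nlinarith)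
  obtain ⟨F', hF, hN⟩ := H (π.κ y) (π.L y) (π.c y) (Real.exp y) T (π.N y) F (π.κ_pos y) k1 g.g4 g.g5 rfl (π.c_pos y) g.g6 h.eu h.ok
  exact ⟨F', ⟨hF.mono (by linarith [g.g7]), ok_next hC (π.c_pos _) (π.c_pos _) (π.κ_pos _) (π.κ_pos _) kb k1
    (by linarith [g.g4]) g.g1 g.g2 g.g3 h.ok hN⟩, hN⟩
def Pm.yq (π : Pm) (a : ℝ) (q : ℕ) : ℝ := π.b ^ q * a
def Tq (π : Pm) (a T : ℝ) (q : ℕ) : ℝ := T + ∑ r ∈ Finset.range q, Real.exp (-(π.yq a r))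
theorem st_seq (π : Pm) (P : ℕ) : ∃ C, 1 ≤ C ∧ ∀ a T F0, 0 ≤ a → (∀ y, a ≤ y → π.Good C P y) → St π a T F0 →
    ∃ F : ℕ → Tr, F 0 = F0 ∧ ∀ q, St π (π.yq a q) (Tq π a T q) (F q) ∧
      Nx C (π.c (π.yq a q)) (π.κ (π.yq a q)) (π.L (π.yq a q)) (F q) (F (q + 1)) := by
  obtain ⟨C, hC, H⟩ := st_step π P
  refine ⟨C, hC, fun a T F0 ha hg h0 => ?_⟩
  have hy : ∀ q, a ≤ π.yq a q := fun q => by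
    have : 1 ≤ π.b ^ q := one_le_pow₀ (by rw [Pm.b]; linarith [π.hβ])
    rw [Pm.yq]; nlinarith
  choose! G hG1 hG2 using fun (q : ℕ) (F : Tr) (h : St π (π.yq a q) (Tq π a T q) F) =>
    H (π.yq a q) (Tq π a T q) F (hg _ (hy q)) h
  let F : ℕ → Tr := fun q => Nat.rec F0 (fun q F => G q F) q
  have hF : ∀ q, St π (π.yq a q) (Tq π a T q) (F q) := by
    intro q
    induction q with
    | zero =>
      have e : F 0 = F0 := rfl
      rw [e]; simpa [Pm.yq, Tq] using h0
    | succ q ih =>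
      have := hG1 q (F q) ih
      have e1 : π.b * π.yq a q = π.yq a (q + 1) := by simp only [Pm.yq]; ring
      have e2 : Tq π a T q + Real.exp (-(π.yq a q)) = Tq π a T (q + 1) := by
        simp only [Tq, Finset.sum_range_succ]; ring
      rw [e1, e2] at this
      exact this
  exact ⟨F, rfl, fun q => ⟨hF q, hG2 q (F q) (hF q)⟩⟩
end CI
end

noncomputable section
open MeasureTheory Set Filter Topology
open scoped ContDiff
set_option linter.unusedSectionVars false

namespace CI
/-! sums over the iteration scales -/
theorem yq_low (π : Pm) {a : ℝ} (ha : 0 ≤ a) (q : ℕ) : a + q * (π.β * a) ≤ π.yq a q := by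
  have h := one_add_mul_le_pow (a := π.β) (by linarith [π.hβ]) q
  have := mul_le_mul_of_nonneg_right h ha
  rw [Pm.yq, Pm.b]; linarith
theorem yq_ge (π : Pm) {a : ℝ} (ha : 0 ≤ a) (q : ℕ) : a ≤ π.yq a q := by
  have := yq_low π ha q
  have : 0 ≤ q * (π.β * a) := by have := π.hβ; positivity
  linarith
theorem exp_yq (π : Pm) {a k : ℝ} (ha : 0 ≤ a) (hk : 0 ≤ k) (q : ℕ) :
    Real.exp (-(k * π.yq a q)) ≤ Real.exp (-(k * a)) * Real.exp (-(k * (π.β * a))) ^ q := by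
  rw [← Real.exp_nat_mul, ← Real.exp_add]
  refine Real.exp_le_exp.2 ?_
  have := mul_le_mul_of_nonneg_left (yq_low π ha q) hk
  linarith
theorem sum_yq (π : Pm) {a k : ℝ} (ha : 0 < a) (hk : 0 < k) : Summable fun q => Real.exp (-(k * π.yq a q)) := by
  have hp : 0 < k * (π.β * a) := by have := π.hβ; positivity
  have hr : Real.exp (-(k * (π.β * a))) < 1 := by rw [← Real.exp_zero]; exact Real.exp_lt_exp.2 (by linarith)
  exact Summable.of_nonneg_of_le (fun q => (Real.exp_pos _).le) (exp_yq π ha.le hk.le)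
    ((summable_geometric_of_lt_one (Real.exp_pos _).le hr).mul_left _)
theorem tsum_yq (π : Pm) {a k : ℝ} (ha : 0 < a) (hk : 0 < k) (h2 : 2 ≤ Real.exp (k * π.β * a)) :
    ∑' q, Real.exp (-(k * π.yq a q)) ≤ 2 * Real.exp (-(k * a)) := by
  have e : Real.exp (-(k * (π.β * a))) ≤ 1 / 2 := by
    rw [Real.exp_neg, ← mul_assoc, one_div]
    exact inv_anti₀ two_pos h2
  have hs : Summable fun q : ℕ => Real.exp (-(k * a)) * (1 / 2 : ℝ) ^ q := summable_geometric_two.mul_left _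
  refine ((sum_yq π ha hk).tsum_le_tsum (fun q => (exp_yq π ha.le hk.le q).trans ?_) hs).trans ?_
  · exact mul_le_mul_of_nonneg_left (pow_le_pow_left₀ (Real.exp_pos _).le e q) (Real.exp_pos _).le
  · rw [tsum_mul_left, tsum_geometric_two, mul_comm]
/-! limits -/
theorem lim_fun {X : Type} (f : ℕ → X → ℂ) (e : ℕ → ℝ) (he : Summable e)
    (h : ∀ q z, ‖f (q + 1) z - f q z‖ ≤ e q) :
    ∃ g : X → ℂ, (∀ z, Tendsto (fun q => f q z) atTop (𝓝 (g z))) ∧ (∀ q z, ‖g z - f q z‖ ≤ ∑' m, e (q + m)) ∧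
      TendstoUniformly f g atTop := by
  have hd : ∀ z q, dist (f q z) (f (q + 1) z) ≤ e q := fun z q => by rw [dist_comm, dist_eq_norm]; exact h q z
  choose g hg using fun z => cauchySeq_tendsto_of_complete (cauchySeq_of_dist_le_of_summable e (hd z) he)
  have hb : ∀ q z, ‖g z - f q z‖ ≤ ∑' m, e (q + m) := fun q z => by
    have := dist_le_tsum_of_dist_le_of_tendsto e (hd z) he (hg z) q
    rwa [dist_comm, dist_eq_norm] at this
  refine ⟨g, hg, hb, ?_⟩
  rw [Metric.tendstoUniformly_iff]
  intro ε hε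
  have h0 := tendsto_sum_nat_add e
  filter_upwards [h0.eventually (gt_mem_nhds hε)] with q hq z
  rw [dist_eq_norm]
  refine (hb q z).trans_lt ?_
  simpa [add_comm] using hq
theorem lim_holder {X : Type} [PseudoMetricSpace X] (f : ℕ → X → ℂ) (g : X → ℂ) (H : ℕ → ℝ) (H0 α : ℝ) (hs : Summable H)
    (hH : ∀ q, 0 ≤ H q)
    (h0 : ∀ z z', ‖f 0 z - f 0 z'‖ ≤ H0 * dist z z' ^ α)
    (h : ∀ q z z', ‖(f (q + 1) z - f q z) - (f (q + 1) z' - f q z')‖ ≤ H q * dist z z' ^ α)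
    (hg : ∀ z, Tendsto (fun q => f q z) atTop (𝓝 (g z))) (z z') :
    ‖g z - g z'‖ ≤ (H0 + ∑' q, H q) * dist z z' ^ α := by
  have hi : ∀ q, ‖f q z - f q z'‖ ≤ (H0 + ∑ r ∈ Finset.range q, H r) * dist z z' ^ α := by
    intro q
    induction q with
    | zero => simpa using h0 z z'
    | succ q ih =>
      have e : f (q + 1) z - f (q + 1) z' = (f q z - f q z') + ((f (q + 1) z - f q z) - (f (q + 1) z' - f q z')) := by ring
      rw [e, Finset.sum_range_succ]
      refine (norm_add_le _ _).trans ((add_le_add ih (h q z z')).trans (le_of_eq ?_))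
      ring
  refine le_of_tendsto' ((hg z).sub (hg z')).norm fun q => (hi q).trans ?_
  refine mul_le_mul_of_nonneg_right ?_ (Real.rpow_nonneg dist_nonneg _)
  linarith [hs.sum_le_tsum (Finset.range q) (fun i _ => hH i)]
theorem interp {X B e lam d α : ℝ} (hα : 0 < α) (hα1 : α ≤ 1) (he : 0 ≤ e) (hl : 0 ≤ lam) (hd : 0 ≤ d) (hB : 0 ≤ B)
    (h1 : X ≤ B * e) (h2 : X ≤ B * e * lam * d) : X ≤ B * e * lam ^ α * d ^ α := by
  rw [mul_assoc, ← Real.mul_rpow hl hd]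
  have hBe : 0 ≤ B * e := mul_nonneg hB he
  rcases le_total (lam * d) 1 with h | h
  · refine h2.trans ?_
    rw [mul_assoc]
    refine mul_le_mul_of_nonneg_left ?_ hBe
    exact Real.self_le_rpow_of_le_one (mul_nonneg hl hd) h hα1
  · refine h1.trans ?_
    have := Real.one_le_rpow h hα.le
    nlinarith
/-- Lipschitz bound from partial derivatives -/
theorem sf_lip (f : SF) {D : ℝ} (ht : ∀ z, ‖(dt f).1 z‖ ≤ D) (hx : ∀ j z, ‖(dx j f).1 z‖ ≤ D) (z z') :
    ‖f.1 z - f.1 z'‖ ≤ 4 * D * dist z z' := by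
  have hD : 0 ≤ D := (norm_nonneg _).trans (ht z)
  rw [dist_eq_norm]
  refine Convex.norm_image_sub_le_of_norm_fderiv_le (𝕜 := ℝ) (s := univ) (fun w _ => SFo.diff f w) (fun w _ => ?_) convex_univ (mem_univ _) (mem_univ _)
  refine ContinuousLinearMap.opNorm_le_bound _ (by linarith) fun u => ?_
  have e : u = u.1 • ((1, 0) : ℝ × Spc) + ∑ j, u.2 j • eS j := by
    refine Prod.ext ?_ ?_
    · simp [eS, Prod.fst_sum]
    · ext i
      simp [eS, ex, Prod.snd_sum, Finset.sum_apply, Pi.single_apply]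
  have e2 : fderiv ℝ f.1 w u = u.1 • (dt f).1 w + ∑ j, u.2 j • (dx j f).1 w := by
    conv_lhs => rw [e]
    rw [map_add, map_smul, map_sum]
    simp only [map_smul, dx_eq, dd_app]
    rfl
  rw [e2]
  have hu : ∀ j, ‖u.2 j‖ ≤ ‖u‖ := fun j => (norm_le_pi_norm u.2 j).trans (norm_snd_le u)
  have h1 : ‖u.1 • (dt f).1 w‖ ≤ D * ‖u‖ := by
    rw [norm_smul, mul_comm]; exact mul_le_mul (ht w) (norm_fst_le u) (norm_nonneg _) hD
  have h2 : ‖∑ j, u.2 j • (dx j f).1 w‖ ≤ ∑ j : Fin 3, D * ‖u‖ := by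
    refine norm_sum_le_of_le _ fun j _ => ?_
    rw [norm_smul, mul_comm]; exact mul_le_mul (hx j w) (hu j) (norm_nonneg _) hD
  refine (norm_add_le _ _).trans ((add_le_add h1 h2).trans (le_of_eq ?_))
  simp; ring
end CI
end

noncomputable section
open MeasureTheory Set Filter Topology
open scoped ContDiff
set_option linter.unusedSectionVars false

namespace CI
/-! integration over the torus -/
theorem Tdom_ae : Tdom =ᵐ[volume] Icc (0 : Spc) 1 := Measure.univ_pi_Ico_ae_eq_Icc
theorem Tdom_vol : volume Tdom = 1 := by
  rw [measure_congr Tdom_ae, Real.volume_Icc_pi]; simp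
theorem Tdom_meas : MeasurableSet Tdom := MeasurableSet.univ_pi fun _ => measurableSet_Ico
instance : IsProbabilityMeasure (volume.restrict Tdom) := ⟨by simp [Tdom_vol]⟩
theorem int_cd {E : Type} [NormedAddCommGroup E] {f : Spc → E} (hf : Continuous f) : Integrable f (volume.restrict Tdom) := by
  have : IntegrableOn f (Icc (0 : Spc) 1) := hf.continuousOn.integrableOn_compact isCompact_Icc
  exact this.congr_set_ae Tdom_ae
theorem int_dx0 (f : Spc → ℂ) (hf : ContDiff ℝ 1 f) (hp : Per f) (j : Fin 3) : ∫ x in Tdom, fderiv ℝ f x (ex j) = 0 := by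
  rw [setIntegral_congr_set Tdom_ae]
  have hc : Continuous fun x => fderiv ℝ f x (ex j) := (hf.continuous_fderiv (by simp)).clm_apply continuous_const
  have key := integral_divergence_of_hasFDerivAt_off_countable' (n := 2) (a := (0 : Spc)) (b := 1) (E := ℂ)
    (by intro i; simp) (fun i => if i = j then f else 0) (fun i x => if i = j then fderiv ℝ f x else 0) ∅ countable_empty
    (fun i => by
      by_cases h : i = j
      · simp only [h, if_true]; exact hf.continuous.continuousOn
      · simp only [h, if_false]; exact continuousOn_const)
    (fun x _ i => by
      by_cases h : i = j
      · simp only [h, if_true]; exact (hf.differentiable (by simp) x).hasFDerivAt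
      · simp only [h, if_false]; exact hasFDerivAt_const _ _)
    (by
      refine (Continuous.continuousOn ?_).integrableOn_compact isCompact_Icc
      refine continuous_finsetSum _ fun i _ => ?_
      by_cases h : i = j
      · subst h; simp only [if_true]; exact hc
      · simp only [h, if_false]; exact continuous_const)
  have e : ∀ x, (∑ i, (if i = j then fderiv ℝ f x else 0) (Pi.single i 1)) = fderiv ℝ f x (ex j) := by
    intro x
    rw [Finset.sum_eq_single j]
    · simp [ex]
    · intro i _ h; simp [h]
    · simp
  simp only [e] at key
  rw [key]
  refine Finset.sum_eq_zero fun i _ => ?_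
  by_cases h : i = j
  · subst h
    simp only [if_true]
    rw [sub_eq_zero]
    congr 1
    ext x
    have := hp (i.insertNth ((0 : Spc) i) x) (Pi.single i 1)
    rw [← this]
    congr 1
    ext k
    rcases Fin.eq_self_or_eq_succAbove i k with hk | ⟨m, hk⟩
    · subst hk; simp
    · subst hk; simp
  · simp [h]
theorem slice_dx (G : SF) (t : ℝ) (j) (x : Spc) : (dx j G).1 (t, x) = fderiv ℝ (fun x : Spc => G.1 (t, x)) x (ex j) := by
  have h1 : HasFDerivAt (fun x : Spc => ((t, x) : ℝ × Spc)) (ContinuousLinearMap.inr ℝ ℝ Spc) x := hasFDerivAt_prodMk_right t x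
  have h2 := (SFo.diff G (t, x)).hasFDerivAt.comp x h1
  have e : (fun x : Spc => G.1 (t, x)) = G.1 ∘ (fun x : Spc => ((t, x) : ℝ × Spc)) := rfl
  rw [e, h2.fderiv, dx_eq, dd_app]
  rfl
theorem int_dxG (G : SF) (hp : ∀ k, Pk (kv k) G) (t : ℝ) (j) : ∫ x in Tdom, (dx j G).1 (t, x) = 0 := by
  have hc : ContDiff ℝ 1 (fun x : Spc => G.1 (t, x)) := ((SFo.cd G).comp (contDiff_const.prodMk contDiff_id)).of_le (by simp)
  rw [← int_dx0 _ hc (fun x k => by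
    have := hp k (t, x)
    rw [← this]; simp only [kv, Prod.mk_add_mk, add_zero]; rfl) j]
  simp only [slice_dx]
def mu : Measure (ℝ × Spc) := (volume : Measure ℝ).prod (volume.restrict Tdom)
instance : SFinite mu := by unfold mu; infer_instance
theorem int_mu {f : ℝ × Spc → ℂ} (hf : Continuous f) {T : ℝ} (hs : ∀ z, z ∉ TS (-T) T → f z = 0) : Integrable f mu := by
  have h1 : IntegrableOn f (Icc (-T) T ×ˢ Icc (0 : Spc) 1) (volume.prod volume) :=
    hf.continuousOn.integrableOn_compact (isCompact_Icc.prod isCompact_Icc)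
  have h2 : IntegrableOn f (Icc (-T) T ×ˢ univ) mu := by
    rw [IntegrableOn, mu, ← Measure.prod_restrict, Measure.restrict_univ]
    rw [IntegrableOn, ← Measure.prod_restrict] at h1
    rwa [Measure.restrict_congr_set Tdom_ae]
  rw [← integrableOn_iff_integrable_of_support_subset (s := Icc (-T) T ×ˢ univ)]
  · exact h2
  · intro z hz
    by_contra h
    exact hz (hs z fun h' => h ⟨h', mem_univ _⟩)
theorem it_mu {f : ℝ × Spc → ℂ} (hf : Continuous f) {T : ℝ} (hs : ∀ z, z ∉ TS (-T) T → f z = 0) :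
    ∫ t : ℝ, ∫ x in Tdom, f (t, x) = ∫ z, f z ∂mu := by
  rw [mu, integral_prod _ (int_mu hf hs)]
theorem mu_dx (G : SF) {T : ℝ} (hp : ∀ k, Pk (kv k) G) (hs : Sp (TS (-T) T) G) (j) : ∫ z, (dx j G).1 z ∂mu = 0 := by
  have hs' : ∀ z, z ∉ TS (-T) T → (dx j G).1 z = 0 := by
    have := Sp.dd (TS_closed _ _) hs (eS j)
    rwa [← dx_eq] at this
  rw [← it_mu (SFo.cd (dx j G)).continuous hs']
  simp [int_dxG G hp]
theorem mu_dt (G : SF) {T : ℝ} (hs : Sp (TS (-T) T) G) : ∫ z, (dt G).1 z ∂mu = 0 := by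
  have hs' : ∀ z, z ∉ TS (-T) T → (dt G).1 z = 0 := Sp.dd (TS_closed _ _) hs (1, 0)
  have hi := int_mu (SFo.cd (dt G)).continuous hs'
  rw [mu] at hi ⊢
  rw [integral_prod_symm _ hi]
  have : ∀ x : Spc, ∫ t : ℝ, (dt G).1 (t, x) = 0 := by
    intro x
    have hI : ∀ f : SF, Sp (TS (-T) T) f → Integrable (fun t : ℝ => f.1 (t, x)) := by
      intro f hf
      have hc : Continuous fun t : ℝ => f.1 (t, x) := (SFo.cd f).continuous.comp (by fun_prop)
      refine hc.integrable_of_hasCompactSupport (HasCompactSupport.intro (isCompact_Icc (a := -T) (b := T)) fun t ht => hf _ ht)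
    refine integral_eq_zero_of_hasDerivAt_of_integrable (f := fun t : ℝ => G.1 (t, x)) (fun t => ?_) (hI _ hs') (hI _ hs)
    have h1 : HasDerivAt (fun t : ℝ => ((t, x) : ℝ × Spc)) (1, 0) t := (hasDerivAt_id t).prodMk (hasDerivAt_const t x)
    exact (SFo.diff G (t, x)).hasFDerivAt.comp_hasDerivAt t h1
  simp [this]

def cst (f : ℝ → Spc → ℝ) (hf : ContDiff ℝ (⊤ : ℕ∞) fun q : ℝ × Spc => f q.1 q.2) : SF :=
  ⟨fun z => (f z.1 z.2 : ℂ), Complex.ofRealCLM.contDiff.comp hf⟩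
theorem cst_dd (f) (hf) (e z) : (dd e (cst f hf)).1 z = ((fderiv ℝ (fun q : ℝ × Spc => f q.1 q.2) z e : ℝ) : ℂ) := by
  rw [dd_app]
  have h2 := Complex.ofRealCLM.hasFDerivAt.comp z ((hf.differentiable (by simp)) z).hasFDerivAt
  have e : (cst f hf).1 = Complex.ofRealCLM ∘ fun q : ℝ × Spc => f q.1 q.2 := rfl
  rw [e, h2.fderiv]; rfl
theorem cst_dt (f) (hf) (t x) : (dt (cst f hf)).1 (t, x) = ((pt f t x : ℝ) : ℂ) := by
  have := cst_dd f hf (1, 0) (t, x)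
  refine this.trans ?_
  congr 1
  have h1 : HasDerivAt (fun t : ℝ => ((t, x) : ℝ × Spc)) (1, 0) t := (hasDerivAt_id t).prodMk (hasDerivAt_const t x)
  exact (((hf.differentiable (by simp)) (t, x)).hasFDerivAt.comp_hasDerivAt t h1).deriv.symm
theorem cst_dx (f) (hf) (j t x) : (dx j (cst f hf)).1 (t, x) = ((pd j (f t) x : ℝ) : ℂ) := by
  rw [dx_eq, cst_dd]
  congr 1
  have h1 : HasFDerivAt (fun x : Spc => ((t, x) : ℝ × Spc)) (ContinuousLinearMap.inr ℝ ℝ Spc) x := hasFDerivAt_prodMk_right t x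
  have h2 := ((hf.differentiable (by simp)) (t, x)).hasFDerivAt.comp x h1
  have e : f t = (fun q : ℝ × Spc => f q.1 q.2) ∘ (fun x : Spc => ((t, x) : ℝ × Spc)) := rfl
  rw [pd, e, h2.fderiv]
  rfl
theorem cst_pk (f : ℝ → Spc → ℝ) (hf) (hp : ∀ t, Per (f t)) (k) : Pk (kv k) (cst f hf) := fun z => by
  have := hp z.1 z.2 k
  change ((f (z + kv k).1 (z + kv k).2 : ℝ) : ℂ) = _
  have e1 : (z + kv k).1 = z.1 := by simp [kv]
  rw [e1]
  exact congrArg Complex.ofReal this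
/-- the weak identity for a smooth triple -/
theorem weak_q {T : ℝ} {F : Tr} (h : Eu T F) (Φ : Fin 3 → SF) (hΦ : ∀ l k, Pk (kv k) (Φ l)) :
    ∫ z, (∑ l, F.v l * dt (Φ l) + ∑ j, ∑ l, F.v j * F.v l * dx j (Φ l) + F.p * ∑ j, dx j (Φ j)
      - ∑ j, ∑ l, F.R j l * dx j (Φ l)).1 z ∂mu = 0 := by
  have e : ∑ l, F.v l * dt (Φ l) + ∑ j, ∑ l, F.v j * F.v l * dx j (Φ l) + F.p * ∑ j, dx j (Φ j)
      - ∑ j, ∑ l, F.R j l * dx j (Φ l) = dt (∑ l, F.v l * Φ l) + ∑ j, dx j (∑ l, F.v j * F.v l * Φ l + F.p * Φ j - ∑ l, F.R j l * Φ l) := by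
    have h1 : ∑ l, Φ l * (dt (F.v l) + ∑ a, dx a (F.v a * F.v l) + dx l F.p - ∑ a, dx a (F.R a l)) = 0 :=
      Finset.sum_eq_zero fun l _ => by rw [h.er l, sub_self, mul_zero]
    rw [← sub_eq_zero, ← neg_eq_zero, ← h1]
    simp only [map_sum, map_add, map_sub, dt_mul, dx_mul, Fin.sum_univ_three]
    ring
  rw [e]
  have sv : Sp (TS (-T) T) (∑ l, F.v l * Φ l) := Sp.sum fun l _ => (h.vS l).mul_right _
  have sj : ∀ j, Sp (TS (-T) T) (∑ l, F.v j * F.v l * Φ l + F.p * Φ j - ∑ l, F.R j l * Φ l) := fun j =>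
    ((Sp.sum fun l _ => ((h.vS j).mul_right _).mul_right _).add (h.pS.mul_right _)).sub (Sp.sum fun l _ => (h.RS j l).mul_right _)
  have pj : ∀ j k, Pk (kv k) (∑ l, F.v j * F.v l * Φ l + F.p * Φ j - ∑ l, F.R j l * Φ l) := fun j k =>
    ((Pk.sum fun l _ => ((h.vP j k).mul (h.vP l k)).mul (hΦ l k)).add ((h.pP k).mul (hΦ j k))).sub (Pk.sum fun l _ => (h.RP j l k).mul (hΦ l k))
  have iv := int_mu (SFo.cd (dt (∑ l, F.v l * Φ l))).continuous (Sp.dd (TS_closed _ _) sv (1, 0))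
  have ij : ∀ j, Integrable (dx j (∑ l, F.v j * F.v l * Φ l + F.p * Φ j - ∑ l, F.R j l * Φ l)).1 mu := fun j =>
    int_mu (SFo.cd _).continuous (by rw [dx_eq]; exact Sp.dd (TS_closed _ _) (sj j) (eS j))
  simp only [SFo.add_app, SFo.sum_app]
  rw [integral_add iv (integrable_finsetSum _ fun j _ => ij j), integral_finsetSum _ fun j _ => ij j, mu_dt _ sv]
  simp only [mu_dx _ (pj _) (sj _)]
  simp
theorem weak_div {T : ℝ} {F : Tr} (h : Eu T F) (Φ : SF) (hΦ : ∀ k, Pk (kv k) Φ) :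
    ∫ z, (∑ j, F.v j * dx j Φ).1 z ∂mu = 0 := by
  have e : ∑ j, F.v j * dx j Φ = ∑ j, dx j (F.v j * Φ) := by
    have h1 : Φ * ∑ j, dx j (F.v j) = 0 := by rw [h.div0, mul_zero]
    rw [← sub_eq_zero, ← neg_eq_zero, ← h1]
    simp only [dx_mul, Fin.sum_univ_three]
    ring
  rw [e]
  have sj : ∀ j, Sp (TS (-T) T) (F.v j * Φ) := fun j => (h.vS j).mul_right _
  have ij : ∀ j, Integrable (dx j (F.v j * Φ)).1 mu := fun j =>
    int_mu (SFo.cd _).continuous (by rw [dx_eq]; exact Sp.dd (TS_closed _ _) (sj j) (eS j))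
  simp only [SFo.sum_app]
  rw [integral_finsetSum _ fun j _ => ij j]
  simp only [mu_dx _ (fun k => (h.vP _ k).mul (hΦ k)) (sj _)]
  simp
/-- passing to the limit -/
theorem mu_lim {f : ℕ → SF} {g : ℝ × Spc → ℂ} {T : ℝ} {b : ℝ × Spc → ℝ} (hs : ∀ q, Sp (TS (-T) T) (f q)) (hb : Continuous b)
    (hM : ∀ q z, ‖(f q).1 z‖ ≤ b z)
    (hl : ∀ z, Tendsto (fun q => (f q).1 z) atTop (𝓝 (g z))) (h0 : ∀ q, ∫ z, (f q).1 z ∂mu = 0) : ∫ z, g z ∂mu = 0 := by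
  have hm : MeasurableSet (TS (-T) T) := (TS_closed _ _).measurableSet
  have hbi : IntegrableOn b (TS (-T) T) mu := by
    have e : TS (-T) T = Icc (-T) T ×ˢ univ := by ext z; simp [TS]
    have h1 : IntegrableOn b (Icc (-T) T ×ˢ Icc (0 : Spc) 1) (volume.prod volume) :=
      hb.continuousOn.integrableOn_compact (isCompact_Icc.prod isCompact_Icc)
    rw [e, IntegrableOn, mu, ← Measure.prod_restrict, Measure.restrict_univ]
    rw [IntegrableOn, ← Measure.prod_restrict] at h1
    rwa [Measure.restrict_congr_set Tdom_ae]
  have := tendsto_integral_of_dominated_convergence (μ := mu) (F := fun q => (f q).1) (f := g) ((TS (-T) T).indicator b)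
    (fun q => (SFo.cd (f q)).continuous.aestronglyMeasurable)
    ((integrable_indicator_iff hm).2 hbi)
    (fun q => ae_of_all _ fun z => by
      by_cases hz : z ∈ TS (-T) T
      · rw [indicator_of_mem hz]; exact hM q z
      · rw [indicator_of_notMem hz, hs q z hz, norm_zero])
    (ae_of_all _ hl)
  simp only [h0] at this
  exact (tendsto_nhds_unique this tendsto_const_nhds)
end CI
end

noncomputable section
open MeasureTheory Set Filter Topology
open scoped ContDiff
set_option linter.unusedSectionVars false
set_option linter.unusedSimpArgs false

namespace CI
/-! initial data -/
def lf (f : ℝ → ℝ) (hf : ContDiff ℝ ∞ f) (l : (ℝ × Spc) →L[ℝ] ℝ) : SF :=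
  ⟨fun z => (f (l z) : ℂ), Complex.ofRealCLM.contDiff.comp (hf.comp l.contDiff)⟩
theorem cd_deriv {f : ℝ → ℝ} (hf : ContDiff ℝ ∞ f) : ContDiff ℝ ∞ (deriv f) := (contDiff_infty_iff_deriv.1 hf).2
theorem lf_dd (f hf l e) : dd e (lf f hf l) = ((l e : ℝ) : ℂ) • lf (deriv f) (cd_deriv hf) l := by
  ext z
  rw [dd_app, SFo.smul_app]
  have h1 := (((hf.differentiable (by simp)) (l z)).hasDerivAt.comp_hasFDerivAt z (l.hasFDerivAt (x := z)))
  have h2 := Complex.ofRealCLM.hasFDerivAt.comp z h1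
  have e' : (lf f hf l).1 = Complex.ofRealCLM ∘ (f ∘ l) := rfl
  rw [e', h2.fderiv]
  simp [lf, mul_comm]
def x0 : (ℝ × Spc) →L[ℝ] ℝ := (ContinuousLinearMap.proj 0 : Spc →L[ℝ] ℝ).comp (ContinuousLinearMap.snd ℝ ℝ Spc)
def tm (θ : ℝ → ℝ) (h : ContDiff ℝ ∞ θ) : SF := lf θ h (ContinuousLinearMap.fst ℝ ℝ Spc)
def sn (m : ℝ) : SF := lf Real.sin Real.contDiff_sin (m • x0)
def cs (m : ℝ) : SF := lf Real.cos Real.contDiff_cos (m • x0)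
theorem tm_app (θ h z) : (tm θ h).1 z = (θ z.1 : ℂ) := rfl
theorem sn_app (m z) : (sn m).1 z = (Real.sin (m * z.2 0) : ℂ) := rfl
theorem cs_app (m z) : (cs m).1 z = (Real.cos (m * z.2 0) : ℂ) := rfl
theorem tm_dt (θ h) : dt (tm θ h) = tm (deriv θ) (cd_deriv h) := by
  refine (lf_dd _ _ _ _).trans ?_
  simp [tm]
theorem tm_dx (θ h j) : dx j (tm θ h) = 0 := by
  rw [dx_eq]
  refine (lf_dd _ _ _ _).trans ?_
  simp [eS]
theorem sn_dt (m) : dt (sn m) = 0 := by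
  refine (lf_dd _ _ _ _).trans ?_
  simp [x0]
theorem cs_dt (m) : dt (cs m) = 0 := by
  refine (lf_dd _ _ _ _).trans ?_
  simp [x0]
theorem sn_dx (m : ℝ) (j) : dx j (sn m) = (if j = 0 then (m : ℂ) else 0) • cs m := by
  rw [dx_eq]
  refine (lf_dd _ _ _ _).trans ?_
  ext z
  by_cases h : j = 0
  · subst h; simp [x0, eS, ex, cs, lf]
  · simp [x0, eS, ex, h, Ne.symm h]
theorem cs_dx (m : ℝ) (j) : dx j (cs m) = (if j = 0 then -(m : ℂ) else 0) • sn m := by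
  rw [dx_eq]
  refine (lf_dd _ _ _ _).trans ?_
  ext z
  by_cases h : j = 0
  · subst h; simp [x0, eS, ex, sn, lf]
  · simp [x0, eS, ex, h, Ne.symm h]
theorem sn_b (m z) : ‖(sn m).1 z‖ ≤ 1 := by
  rw [sn_app, Complex.norm_real]; exact Real.abs_sin_le_one _
theorem cs_b (m z) : ‖(cs m).1 z‖ ≤ 1 := by
  rw [cs_app, Complex.norm_real]; exact Real.abs_cos_le_one _
theorem sn_pk (n : ℕ) (k) : Pk (kv k) (sn (2 * Real.pi * n)) := fun z => by
  rw [sn_app, sn_app]; congr 1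
  have : 2 * Real.pi * n * (z + kv k).2 0 = 2 * Real.pi * n * z.2 0 + ((n * k 0 : ℤ) : ℝ) * (2 * Real.pi) := by
    simp [kv]; ring
  rw [this, Real.sin_add_int_mul_two_pi]
theorem cs_pk (n : ℕ) (k) : Pk (kv k) (cs (2 * Real.pi * n)) := fun z => by
  rw [cs_app, cs_app]; congr 1
  have : 2 * Real.pi * n * (z + kv k).2 0 = 2 * Real.pi * n * z.2 0 + ((n * k 0 : ℤ) : ℝ) * (2 * Real.pi) := by
    simp [kv]; ring
  rw [this, Real.cos_add_int_mul_two_pi]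
theorem tm_pk (θ h k) : Pk (kv k) (tm θ h) := fun z => by
  rw [tm_app, tm_app]; simp [kv]
theorem tm_sp (θ h) {T : ℝ} (hs : ∀ t, t ∉ Icc (-T) T → θ t = 0) : Sp (TS (-T) T) (tm θ h) := fun z hz => by
  rw [tm_app, hs _ hz]; simp
theorem lf_rl (f h l) : Rl (lf f h l) := fun z => Complex.ofReal_im _
theorem bump (T : ℝ) (hT : 0 < T) : ∃ (θ : ℝ → ℝ) (h : ContDiff ℝ ∞ θ) (K : ℝ), 1 ≤ K ∧ θ 0 = 1 ∧ (∀ t, t ∉ Icc (-T) T → θ t = 0) ∧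
    (∀ t, |θ t| ≤ 1) ∧ (∀ t, |deriv θ t| ≤ K) ∧ (∀ t, |deriv (deriv θ) t| ≤ K) := by
  let f : ContDiffBump (0 : ℝ) := ⟨T / 2, T, by linarith, by linarith⟩
  have h : ContDiff ℝ ∞ (f : ℝ → ℝ) := f.contDiff
  have hc : HasCompactSupport (f : ℝ → ℝ) := f.hasCompactSupport
  obtain ⟨K1, h1⟩ := (hc.deriv).exists_bound_of_continuous (cd_deriv h).continuous
  obtain ⟨K2, h2⟩ := (hc.deriv.deriv).exists_bound_of_continuous (cd_deriv (cd_deriv h)).continuous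
  refine ⟨f, h, max 1 (max K1 K2), le_max_left _ _, ?_, ?_, ?_, ?_, ?_⟩
  · exact f.one_of_mem_closedBall (by simp [f]; linarith)
  · intro t ht
    refine f.zero_of_le_dist ?_
    rw [Real.dist_eq, sub_zero]
    by_contra hh
    push Not at hh
    exact ht (abs_le.1 hh.le)
  · intro t; rw [abs_of_nonneg f.nonneg]; exact f.le_one
  · intro t; exact (h1 t).trans ((le_max_left _ _).trans (le_max_right _ _))
  · intro t; exact (h2 t).trans ((le_max_right _ _).trans (le_max_right _ _))
def F00 (A : ℝ) (θ : ℝ → ℝ) (h : ContDiff ℝ ∞ θ) (m : ℝ) : Tr where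
  v l := (if l = 2 then (A : ℂ) else 0) • (tm θ h * sn m)
  p := 0
  R a b := (if (a = 0 ∧ b = 2) ∨ (a = 2 ∧ b = 0) then ((-(A / m) : ℝ) : ℂ) else 0) • (tm (deriv θ) (cd_deriv h) * cs m)
theorem F00_eu {A T : ℝ} {θ : ℝ → ℝ} {h : ContDiff ℝ ∞ θ} {n : ℕ} (hn : 0 < n) (hs : ∀ t, t ∉ Icc (-T) T → θ t = 0) :
    Eu T (F00 A θ h (2 * Real.pi * n)) := by
  have hs1 : Sp (TS (-T) T) (tm (deriv θ) (cd_deriv h)) := by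
    rw [← tm_dt]; exact Sp.dd (TS_closed _ _) (tm_sp θ h hs) _
  have hm : ((2 * Real.pi * n : ℝ) : ℂ) ≠ 0 := by
    have : (0 : ℝ) < 2 * Real.pi * n := by have := Real.pi_pos; positivity
    exact_mod_cast this.ne'
  refine ⟨?_, ?_, ?_, ?_, ?_, ?_, ?_, ?_, ?_, ?_, ?_, ?_⟩
  · intro l z
    simp only [F00]
    split_ifs
    · exact ((lf_rl _ _ _).mul (lf_rl _ _ _)).smul A z
    · simp
  · intro z; simp [F00]
  · intro a b z
    simp only [F00]
    split_ifs
    · exact ((lf_rl _ _ _).mul (lf_rl _ _ _)).smul _ z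
    · simp
  · intro l k; exact ((tm_pk _ _ k).mul (sn_pk n k)).smul _
  · intro k; exact Pk.zero
  · intro a b k; exact ((tm_pk _ _ k).mul (cs_pk n k)).smul _
  · intro l; exact ((tm_sp θ h hs).mul_right _).smul _
  · exact Sp.zero
  · intro a b; exact (hs1.mul_right _).smul _
  · intro a b
    simp only [F00]
    congr 2
    exact propext ⟨fun h => h.elim (fun h => Or.inr ⟨h.2, h.1⟩) fun h => Or.inl ⟨h.2, h.1⟩,
      fun h => h.elim (fun h => Or.inr ⟨h.2, h.1⟩) fun h => Or.inl ⟨h.2, h.1⟩⟩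
  · simp [F00, Fin.sum_univ_three, Derivation.map_smul, dx_mul, tm_dx, sn_dx]
  · intro b
    fin_cases b
    · simp [F00, Fin.sum_univ_three, Derivation.map_smul, dx_mul, dt_mul, tm_dx, sn_dx, cs_dx, tm_dt, sn_dt]
    · simp [F00, Fin.sum_univ_three, Derivation.map_smul, dx_mul, dt_mul, tm_dx, sn_dx, cs_dx, tm_dt, sn_dt]
    · simp [F00, Fin.sum_univ_three, Derivation.map_smul, dx_mul, dt_mul, tm_dx, sn_dx, cs_dx, tm_dt, sn_dt, -Complex.coe_smul]
      ext z
      simp only [SFo.neg_app, SFo.smul_app, SFo.mul_app]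
      push_cast at hm
      have hn' : (n : ℂ) ≠ 0 := by exact_mod_cast hn.ne'
      field_simp
theorem nsm {x : ℂ} {f g : SF} {z} {X Y W : ℝ} (hx : ‖x‖ ≤ X) (hf : ‖f.1 z‖ ≤ Y) (hg : ‖g.1 z‖ ≤ 1) (h : X * Y ≤ W) :
    ‖(x • (f * g)).1 z‖ ≤ W := by
  rw [SFo.smul_app, SFo.mul_app, norm_mul, norm_mul]
  refine le_trans ?_ h
  have hX := (norm_nonneg _).trans hx
  have hY := (norm_nonneg _).trans hf
  refine mul_le_mul hx ?_ (by positivity) hX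
  have := mul_le_mul hf hg (norm_nonneg _) hY
  linarith
theorem F00_ok {A K c G H U m : ℝ} {θ : ℝ → ℝ} {h : ContDiff ℝ ∞ θ} (hA : 0 ≤ A) (hK : 1 ≤ K) (hm : 1 ≤ m) (hH : 0 ≤ H)
    (h0 : ∀ t, |θ t| ≤ 1) (h1 : ∀ t, |deriv θ t| ≤ K) (h2 : ∀ t, |deriv (deriv θ) t| ≤ K)
    (b1 : A * K ≤ c ^ 2 * m) (b2 : A * K ≤ c ^ 2 * G) (b3 : A * K ≤ c ^ 3 * G) (b4 : A ≤ U) (b5 : A * m ≤ c * G) :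
    Ok c G H U (F00 A θ h m) := by
  have hm0 : 0 < m := by linarith
  have n0 : ∀ z, ‖(tm θ h).1 z‖ ≤ 1 := fun z => by rw [tm_app, Complex.norm_real]; exact h0 _
  have n1 : ∀ z, ‖(tm (deriv θ) (cd_deriv h)).1 z‖ ≤ K := fun z => by rw [tm_app, Complex.norm_real]; exact h1 _
  have n2 : ∀ z, ‖(tm (deriv (deriv θ)) (cd_deriv (cd_deriv h))).1 z‖ ≤ K := fun z => by rw [tm_app, Complex.norm_real]; exact h2 _
  have nv : ∀ l : Fin 3, ‖(if l = 2 then (A : ℂ) else 0)‖ ≤ A := fun l => by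
    split_ifs
    · rw [Complex.norm_real, Real.norm_of_nonneg hA]
    · simpa using hA
  have hAm : 0 ≤ A / m := by positivity
  have nR : ∀ a b : Fin 3, ‖(if (a = 0 ∧ b = 2) ∨ (a = 2 ∧ b = 0) then ((-(A / m) : ℝ) : ℂ) else 0)‖ ≤ A / m := fun a b => by
    split_ifs
    · rw [Complex.norm_real, norm_neg, Real.norm_of_nonneg hAm]
    · simpa using hAm
  have dR : ∀ j a b, dx j ((F00 A θ h m).R a b) = ((if (a = 0 ∧ b = 2) ∨ (a = 2 ∧ b = 0) then ((-(A / m) : ℝ) : ℂ) else 0) * (if j = 0 then -(m : ℂ) else 0)) •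
      (tm (deriv θ) (cd_deriv h) * sn m) := fun j a b => by
    simp only [F00, Derivation.map_smul, dx_mul, tm_dx, cs_dx, zero_mul, zero_add, mul_smul_comm, smul_smul]
  have hAK : 0 ≤ A * K := by positivity
  refine ⟨?_, ?_, ?_, ?_, ?_, ?_⟩
  · intro a b z
    refine nsm (nR a b) (n1 z) (cs_b m z) ?_
    rw [div_mul_eq_mul_div, div_le_iff₀ hm0]; exact b1
  · intro j a b z
    rw [dR]
    refine nsm (X := A) ?_ (n1 z) (sn_b m z) b2
    rw [norm_mul]
    have : ‖(if j = 0 then -(m : ℂ) else 0)‖ ≤ m := by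
      split_ifs
      · rw [norm_neg, Complex.norm_real, Real.norm_of_nonneg hm0.le]
      · simpa using hm0.le
    have := mul_le_mul (nR a b) this (norm_nonneg _) hAm
    rwa [div_mul_cancel₀ _ hm0.ne'] at this
  · intro a b z
    have e : ∑ j, (F00 A θ h m).v j * dx j ((F00 A θ h m).R a b) = 0 := by
      refine Finset.sum_eq_zero fun j _ => ?_
      rw [dR]
      by_cases hj : j = 0
      · subst hj
        simp [F00]
      · simp [hj]
    rw [e, add_zero]
    have e2 : dt ((F00 A θ h m).R a b) = (if (a = 0 ∧ b = 2) ∨ (a = 2 ∧ b = 0) then ((-(A / m) : ℝ) : ℂ) else 0) •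
        (tm (deriv (deriv θ)) (cd_deriv (cd_deriv h)) * cs m) := by
      simp only [F00, Derivation.map_smul, dt_mul, tm_dt, cs_dt, mul_zero, add_zero]
    rw [e2]
    refine nsm (nR a b) (n2 z) (cs_b m z) (le_trans ?_ b3)
    rw [div_mul_eq_mul_div]
    exact div_le_self hAK hm
  · intro l z
    exact nsm (nv l) (n0 z) (sn_b m z) (by linarith)
  · intro j l z
    have e2 : dx j ((F00 A θ h m).v l) = ((if l = 2 then (A : ℂ) else 0) * (if j = 0 then (m : ℂ) else 0)) • (tm θ h * cs m) := by
      simp only [F00, Derivation.map_smul, dx_mul, tm_dx, sn_dx, zero_mul, zero_add, mul_smul_comm, smul_smul]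
    rw [e2]
    refine nsm (X := A * m) ?_ (n0 z) (cs_b m z) (by linarith)
    rw [norm_mul]
    have : ‖(if j = 0 then (m : ℂ) else 0)‖ ≤ m := by
      split_ifs
      · rw [Complex.norm_real, Real.norm_of_nonneg hm0.le]
      · simpa using hm0.le
    exact mul_le_mul (nv l) this (norm_nonneg _) hA
  · intro j z
    have e : dx j (F00 A θ h m).p = 0 := map_zero _
    rw [e]; simp; positivity
theorem init (π : Pm) {A T : ℝ} (hA : 0 ≤ A) (hT : 0 < T) : ∀ᶠ a : ℝ in atTop, ∃ F0 : Tr, St π a T F0 ∧ F0.p = 0 ∧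
    (∃ D, ∀ l z, ‖(dt (F0.v l)).1 z‖ ≤ D) ∧ (∀ l z, ‖(F0.v l).1 z‖ ≤ A) ∧
    ∃ n : ℕ, 0 < n ∧ ∀ x : Spc, (F0.v 2).1 (0, x) = ((A * Real.sin (2 * Real.pi * n * x 0) : ℝ) : ℂ) := by
  obtain ⟨θ, h, K, hK, t0, hs, h0, h1, h2⟩ := bump T hT
  set g := π.Z - 2 - 3 * π.h with hg
  have hg0 : 0 < g := π.gap_pos
  have hh := π.h_pos
  filter_upwards [eventually_ge_atTop 0, Pm.ev (g / 2) (16 * A * K) (by linarith), Pm.ev 1 A one_pos] with a ha e1 e2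
  rw [one_mul] at e2
  set X := Real.exp ((2 * π.h + g / 2) * a) with hX
  have hX1 : 1 ≤ X := Real.one_le_exp (by positivity)
  set n := ⌈X⌉₊ with hn
  have n1 : X ≤ n := Nat.le_ceil _
  have n2 : (n : ℝ) ≤ X + 1 := (Nat.ceil_lt_add_one (by linarith)).le
  have hpi := Real.pi_gt_three
  have hpi4 := Real.pi_lt_four
  have hn0 : 0 < n := by
    have : (0 : ℝ) < n := by linarith
    exact_mod_cast this
  have m1 : X ≤ 2 * Real.pi * n := by nlinarith
  have m2 : 2 * Real.pi * n ≤ 16 * X := by nlinarith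
  have hAK : A * K ≤ 16 * A * K := by have : 0 ≤ A * K := by positivity
                                      linarith
  have hAA : 16 * A ≤ 16 * A * K := by nlinarith
  have hga : Real.exp (g / 2 * a) ≤ Real.exp (g * a) := Real.exp_le_exp.2 (by nlinarith)
  have hG : Real.exp ((π.Z - 2) * a) ≤ π.κ a * π.L a := by
    have := mul_le_mul_of_nonneg_left (π.L_low a) (π.κ_pos a).le
    refine le_trans (le_of_eq ?_) this
    rw [Pm.κ, ← Real.exp_add]; congr 1; ring
  have hL : 0 ≤ π.L a := (Real.exp_pos _).le.trans (π.L_low a)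
  have c2 : π.c a ^ 2 = Real.exp (-(2 * π.h * a)) := by rw [Pm.c, ← Real.exp_nat_mul]; congr 1; push_cast; ring
  have c3 : π.c a ^ 3 = Real.exp (-(3 * π.h * a)) := by rw [Pm.c, ← Real.exp_nat_mul]; congr 1; push_cast; ring
  have hGa : ∀ y k, k ≤ y + (π.Z - 2) * a → Real.exp k ≤ Real.exp y * (π.κ a * π.L a) := fun y k hk => by
    refine le_trans ?_ (mul_le_mul_of_nonneg_left hG (Real.exp_pos _).le)
    rw [← Real.exp_add]; exact Real.exp_le_exp.2 hk
  have hha : 0 ≤ π.h * a := by positivity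
  refine ⟨F00 A θ h (2 * Real.pi * n), ⟨F00_eu hn0 hs, F00_ok hA hK (by linarith) hL h0 h1 h2 ?_ ?_ ?_ e2 ?_⟩, rfl, ?_, ?_, n, hn0, ?_⟩
  · refine hAK.trans (e1.trans ?_)
    refine le_trans ?_ (mul_le_mul_of_nonneg_left m1 (sq_nonneg _))
    rw [c2, hX, ← Real.exp_add]
    exact Real.exp_le_exp.2 (by linarith)
  · rw [c2]; exact hAK.trans (e1.trans (hga.trans (hGa _ _ (by rw [hg]; linarith))))
  · rw [c3]; exact hAK.trans (e1.trans (hga.trans (hGa _ _ (by rw [hg]; linarith))))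
  · have h3 : A * (2 * Real.pi * n) ≤ Real.exp (g / 2 * a) * X := by
      have := mul_le_mul_of_nonneg_left m2 hA
      have := mul_le_mul_of_nonneg_right (hAA.trans e1) (by linarith : 0 ≤ X)
      linarith
    refine h3.trans ?_
    rw [hX, ← Real.exp_add]
    exact hGa _ _ (by rw [hg]; linarith)
  · refine ⟨A * K, fun l z => ?_⟩
    have e : dt ((F00 A θ h (2 * Real.pi * n)).v l) = (if l = 2 then (A : ℂ) else 0) • (tm (deriv θ) (cd_deriv h) * sn (2 * Real.pi * n)) := by
      simp only [F00, Derivation.map_smul, dt_mul, tm_dt, sn_dt, mul_zero, add_zero]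
    rw [e]
    refine nsm (X := A) (Y := K) ?_ ?_ (sn_b _ z) le_rfl
    · split_ifs
      · rw [Complex.norm_real, Real.norm_of_nonneg hA]
      · simpa using hA
    · rw [tm_app, Complex.norm_real]; exact h1 _
  · intro l z
    refine nsm (X := A) (Y := 1) ?_ ?_ (sn_b _ z) (by linarith)
    · split_ifs
      · rw [Complex.norm_real, Real.norm_of_nonneg hA]
      · simpa using hA
    · rw [tm_app, Complex.norm_real]; exact h0 _
  · intro x
    simp [F00, tm_app, sn_app, t0]
end CI
end

noncomputable section
open MeasureTheory Set Filter Topology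
open scoped ContDiff
set_option linter.unusedSectionVars false
set_option linter.unusedSimpArgs false

namespace CI
theorem hold_lim (π : Pm) {a : ℝ} (ha : 0 < a) (f : ℕ → SF) (g : ℝ × Spc → ℂ) {k B H0 α : ℝ} (hB : 0 ≤ B)
    (hα : 0 < α) (hα1 : α ≤ 1) (hk : α * π.Z < k)
    (h0 : ∀ z z', ‖(f 0).1 z - (f 0).1 z'‖ ≤ H0 * dist z z' ^ α)
    (hb : ∀ q z, ‖(f (q + 1) - f q).1 z‖ ≤ B * Real.exp (-(k * π.yq a q)))
    (ht : ∀ q z, ‖(dt (f (q + 1) - f q)).1 z‖ ≤ B * Real.exp (-(k * π.yq a q)) * π.la (π.yq a q))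
    (hx : ∀ q j z, ‖(dx j (f (q + 1) - f q)).1 z‖ ≤ B * Real.exp (-(k * π.yq a q)) * π.la (π.yq a q))
    (hg : ∀ z, Tendsto (fun q => (f q).1 z) atTop (𝓝 (g z))) :
    ∃ H, ∀ z z', ‖g z - g z'‖ ≤ H * dist z z' ^ α := by
  have hla : ∀ y, 0 ≤ π.la y := fun y => (Real.exp_pos _).le.trans (π.la_low y)
  refine ⟨_, lim_holder (fun q => (f q).1) g (fun q => 4 * B * Real.exp (-(k * π.yq a q)) * π.la (π.yq a q) ^ α) H0 α ?_ ?_ h0 ?_ hg⟩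
  · have hs := (sum_yq π ha (sub_pos.2 hk)).mul_left (4 * B * 16 ^ α)
    refine Summable.of_nonneg_of_le (fun q => ?_) (fun q => ?_) hs
    · have := Real.rpow_nonneg (hla (π.yq a q)) α
      positivity
    · have h1 : π.la (π.yq a q) ^ α ≤ 16 ^ α * Real.exp (π.Z * π.yq a q * α) := by
        have := Real.rpow_le_rpow (hla _) (π.la_up (ha.le.trans (yq_ge π ha.le q))) hα.le
        rwa [Real.mul_rpow (by norm_num) (Real.exp_pos _).le, ← Real.exp_mul] at this
      have h2 : 4 * B * 16 ^ α * Real.exp (-((k - α * π.Z) * π.yq a q)) =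
          4 * B * Real.exp (-(k * π.yq a q)) * (16 ^ α * Real.exp (π.Z * π.yq a q * α)) := by
        have : Real.exp (-((k - α * π.Z) * π.yq a q)) = Real.exp (-(k * π.yq a q)) * Real.exp (π.Z * π.yq a q * α) := by
          rw [← Real.exp_add]; congr 1; ring
        rw [this]; ring
      rw [h2]
      exact mul_le_mul_of_nonneg_left h1 (by positivity)
  · intro q
    have := Real.rpow_nonneg (hla (π.yq a q)) α
    positivity
  · intro q z z'
    have e : ((f (q + 1)).1 z - (f q).1 z) - ((f (q + 1)).1 z' - (f q).1 z') = (f (q + 1) - f q).1 z - (f (q + 1) - f q).1 z' := by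
      rw [SFo.sub_app, SFo.sub_app]
    rw [e]
    refine interp hα hα1 (Real.exp_pos _).le (hla _) dist_nonneg (by positivity) ?_ ?_
    · refine (norm_sub_le _ _).trans ?_
      have h1 := hb q z
      have h2 := hb q z'
      have : 0 ≤ B * Real.exp (-(k * π.yq a q)) := by positivity
      linarith
    · have := sf_lip (f (q + 1) - f q) (ht q) (hx q) z z'
      refine this.trans (le_of_eq ?_)
      ring
theorem pre_bd {X : Type} (f : ℕ → X → ℂ) (e : ℕ → ℝ) (he : Summable e) (h0 : ∀ q, 0 ≤ e q)
    (h : ∀ q z, ‖f (q + 1) z - f q z‖ ≤ e q) (q z) : ‖f q z - f 0 z‖ ≤ ∑' r, e r := by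
  have := dist_le_range_sum_of_dist_le (f := fun q => f q z) q (d := e) (fun {k} _ => by
    rw [dist_comm, dist_eq_norm]; exact h k z)
  rw [dist_comm, dist_eq_norm] at this
  exact this.trans (he.sum_le_tsum _ fun i _ => h0 i)

/-- the limit of an iteration -/
structure Lm (T M : ℝ) (F : ℕ → Tr) (g : Fin 3 → ℝ × Spc → ℂ) (gp : ℝ × Spc → ℂ) : Prop where
  eu : ∀ q, Eu T (F q)
  bv : ∀ q l z, ‖((F q).v l).1 z‖ ≤ M
  bp : ∀ q z, ‖(F q).p.1 z‖ ≤ M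
  bR : ∀ q a b z, ‖((F q).R a b).1 z‖ ≤ M
  lv : ∀ l z, Tendsto (fun q => ((F q).v l).1 z) atTop (𝓝 (g l z))
  lp : ∀ z, Tendsto (fun q => (F q).p.1 z) atTop (𝓝 (gp z))
  lR : ∀ a b z, Tendsto (fun q => ((F q).R a b).1 z) atTop (𝓝 0)
  cv : ∀ l, Continuous (g l)
  cp : Continuous gp
namespace Lm
variable {T M : ℝ} {F : ℕ → Tr} {g : Fin 3 → ℝ × Spc → ℂ} {gp : ℝ × Spc → ℂ}
theorem im_v (h : Lm T M F g gp) (l z) : (g l z).im = 0 := by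
  have := (Complex.continuous_im.tendsto _).comp (h.lv l z)
  refine tendsto_nhds_unique this ?_
  simp only [Function.comp_def, (h.eu _).vR l z]
  exact tendsto_const_nhds
theorem im_p (h : Lm T M F g gp) (z) : (gp z).im = 0 := by
  have := (Complex.continuous_im.tendsto _).comp (h.lp z)
  refine tendsto_nhds_unique this ?_
  simp only [Function.comp_def, (h.eu _).pR z]
  exact tendsto_const_nhds
theorem re_v (h : Lm T M F g gp) (l z) : (((g l z).re : ℝ) : ℂ) = g l z := Complex.ext rfl (by simp [h.im_v])
theorem re_p (h : Lm T M F g gp) (z) : (((gp z).re : ℝ) : ℂ) = gp z := Complex.ext rfl (by simp [h.im_p])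
theorem sp_v (h : Lm T M F g gp) (l z) (hz : z ∉ TS (-T) T) : g l z = 0 := by
  refine tendsto_nhds_unique (h.lv l z) ?_
  simp only [(h.eu _).vS l z hz]
  exact tendsto_const_nhds
theorem sp_p (h : Lm T M F g gp) (z) (hz : z ∉ TS (-T) T) : gp z = 0 := by
  refine tendsto_nhds_unique (h.lp z) ?_
  simp only [(h.eu _).pS z hz]
  exact tendsto_const_nhds
theorem pk_v (h : Lm T M F g gp) (l k z) : g l (z + kv k) = g l z := by
  refine tendsto_nhds_unique (h.lv l _) ?_
  simp only [(h.eu _).vP l k z]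
  exact h.lv l z
theorem pk_p (h : Lm T M F g gp) (k z) : gp (z + kv k) = gp z := by
  refine tendsto_nhds_unique (h.lp _) ?_
  simp only [(h.eu _).pP k z]
  exact h.lp z
theorem bd_v (h : Lm T M F g gp) (l z) : ‖g l z‖ ≤ M := le_of_tendsto' (h.lv l z).norm fun q => h.bv q l z
theorem per_v (h : Lm T M F g gp) (t : ℝ) : Per (fun (x : Spc) (l : Fin 3) => (g l (t, x)).re) := fun x k => by
  ext l
  have := h.pk_v l k (t, x)
  simp only
  rw [← this]
  simp only [kv, Prod.mk_add_mk, add_zero]; rfl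
theorem per_p (h : Lm T M F g gp) (t : ℝ) : Per (fun (x : Spc) => (gp (t, x)).re) := fun x k => by
  have := h.pk_p k (t, x)
  simp only
  rw [← this]
  simp only [kv, Prod.mk_add_mk, add_zero]; rfl
theorem euler (h : Lm T M F g gp) : IsWeakEuler (fun t x l => (g l (t, x)).re) (fun t x => (gp (t, x)).re) := by
  have hM : 0 ≤ M := (norm_nonneg _).trans (h.bd_v 0 0)
  constructor
  · intro φ hφ
    have hφl : ∀ l, ContDiff ℝ (⊤ : ℕ∞) (fun q : ℝ × Spc => φ q.1 q.2 l) := fun l => (contDiff_pi.1 hφ.1) l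
    set Φ : Fin 3 → SF := fun l => cst (fun t x => φ t x l) (hφl l) with hΦ
    have hΦp : ∀ l k, Pk (kv k) (Φ l) := fun l k => cst_pk _ _ (fun t x k => congrFun (hφ.2.1 t x k) l) k
    set G : ℝ × Spc → ℂ := fun z => ∑ l, g l z * (dt (Φ l)).1 z + ∑ j, ∑ l, g j z * g l z * (dx j (Φ l)).1 z + gp z * ∑ j, (dx j (Φ j)).1 z with hG
    have hcd : ∀ f : SF, Continuous f.1 := fun f => (SFo.cd f).continuous
    have hcG : Continuous G := by
      have := h.cv; have := h.cp
      refine ((continuous_finsetSum _ fun l _ => (h.cv l).mul (hcd _)).add (continuous_finsetSum _ fun j _ => continuous_finsetSum _ fun l _ =>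
        ((h.cv j).mul (h.cv l)).mul (hcd _))).add (h.cp.mul (continuous_finsetSum _ fun j _ => hcd _))
    have hsG : ∀ z, z ∉ TS (-T) T → G z = 0 := fun z hz => by
      simp [hG, h.sp_v _ z hz, h.sp_p z hz]
    have key : ∫ z, G z ∂mu = 0 := by
      refine mu_lim (T := T) (f := fun q => ∑ l, (F q).v l * dt (Φ l) + ∑ j, ∑ l, (F q).v j * (F q).v l * dx j (Φ l) + (F q).p * ∑ j, dx j (Φ j)
        - ∑ j, ∑ l, (F q).R j l * dx j (Φ l))
        (b := fun z => ∑ l, M * ‖(dt (Φ l)).1 z‖ + ∑ j, ∑ l, M * M * ‖(dx j (Φ l)).1 z‖ + M * ∑ j, ‖(dx j (Φ j)).1 z‖ + ∑ j, ∑ l, M * ‖(dx j (Φ l)).1 z‖)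
        ?_ ?_ ?_ ?_ (fun q => weak_q (h.eu q) Φ hΦp)
      · intro q
        exact (((Sp.sum fun l _ => ((h.eu q).vS l).mul_right _).add (Sp.sum fun j _ => Sp.sum fun l _ =>
          (((h.eu q).vS j).mul_right _).mul_right _)).add ((h.eu q).pS.mul_right _)).sub
          (Sp.sum fun j _ => Sp.sum fun l _ => ((h.eu q).RS j l).mul_right _)
      · have : ∀ f : SF, Continuous fun z => ‖f.1 z‖ := fun f => (hcd f).norm
        exact (((continuous_finsetSum _ fun l _ => (this _).const_mul _).add (continuous_finsetSum _ fun j _ => continuous_finsetSum _ fun l _ =>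
          (this _).const_mul _)).add ((continuous_finsetSum _ fun l _ => this _).const_mul _)).add
          (continuous_finsetSum _ fun j _ => continuous_finsetSum _ fun l _ => (this _).const_mul _)
      · intro q z
        simp only [SFo.add_app, SFo.sub_app, SFo.sum_app, SFo.mul_app]
        have nm : ∀ (x y : ℂ) (X : ℝ), ‖x‖ ≤ X → ‖x * y‖ ≤ X * ‖y‖ := fun x y X hx => by
          rw [norm_mul]; exact mul_le_mul_of_nonneg_right hx (norm_nonneg _)
        have nvv : ∀ j l, ‖((F q).v j).1 z * ((F q).v l).1 z‖ ≤ M * M := fun j l => by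
          rw [norm_mul]; exact mul_le_mul (h.bv q j z) (h.bv q l z) (norm_nonneg _) hM
        refine (norm_sub_le _ _).trans (add_le_add ((norm_add_le _ _).trans (add_le_add ((norm_add_le _ _).trans (add_le_add ?_ ?_)) ?_)) ?_)
        · exact norm_sum_le_of_le _ fun l _ => nm _ _ _ (h.bv q l z)
        · exact norm_sum_le_of_le _ fun j _ => norm_sum_le_of_le _ fun l _ => nm _ _ _ (nvv j l)
        · exact (nm _ _ _ (h.bp q z)).trans (mul_le_mul_of_nonneg_left (norm_sum_le _ _) hM)
        · exact norm_sum_le_of_le _ fun j _ => norm_sum_le_of_le _ fun l _ => nm _ _ _ (h.bR q j l z)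
      · intro z
        simp only [SFo.add_app, SFo.sub_app, SFo.sum_app, SFo.mul_app]
        have := (((tendsto_finsetSum Finset.univ fun l _ => (h.lv l z).mul_const ((dt (Φ l)).1 z)).add
          (tendsto_finsetSum Finset.univ fun j _ => tendsto_finsetSum Finset.univ fun l _ => ((h.lv j z).mul (h.lv l z)).mul_const ((dx j (Φ l)).1 z))).add
          ((h.lp z).mul_const (∑ j, (dx j (Φ j)).1 z))).sub
          (tendsto_finsetSum Finset.univ fun j _ => tendsto_finsetSum Finset.univ fun l _ => (h.lR j l z).mul_const ((dx j (Φ l)).1 z))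
        simpa [hG] using this
    rw [← it_mu hcG hsG] at key
    have e : ∀ t x, G (t, x) = (((∑ l, (g l (t, x)).re * pt (fun s y => φ s y l) t x) +
        (∑ j, ∑ l, (g j (t, x)).re * (g l (t, x)).re * pd j (fun y => φ t y l) x) +
        (gp (t, x)).re * ∑ j, pd j (fun y => φ t y j) x : ℝ) : ℂ) := by
      intro t x
      simp only [hG, hΦ, cst_dt, cst_dx]
      push_cast
      simp only [h.re_v, h.re_p]
    simp only [e, integral_complex_ofReal] at key
    exact_mod_cast key
  · intro ψ hψ
    set Φ : SF := cst ψ hψ.1 with hΦ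
    have hΦp : ∀ k, Pk (kv k) Φ := fun k => cst_pk _ _ hψ.2.1 k
    set G : ℝ × Spc → ℂ := fun z => ∑ j, g j z * (dx j Φ).1 z with hG
    have hcd : ∀ f : SF, Continuous f.1 := fun f => (SFo.cd f).continuous
    have hcG : Continuous G := continuous_finsetSum _ fun l _ => (h.cv l).mul (hcd _)
    have hsG : ∀ z, z ∉ TS (-T) T → G z = 0 := fun z hz => by
      simp [hG, h.sp_v _ z hz]
    have key : ∫ z, G z ∂mu = 0 := by
      refine mu_lim (T := T) (f := fun q => ∑ j, (F q).v j * dx j Φ)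
        (b := fun z => ∑ j, M * ‖(dx j Φ).1 z‖) ?_ ?_ ?_ ?_ (fun q => weak_div (h.eu q) Φ hΦp)
      · intro q
        exact Sp.sum fun l _ => ((h.eu q).vS l).mul_right _
      · exact continuous_finsetSum _ fun l _ => ((hcd _).norm).const_mul _
      · intro q z
        simp only [SFo.sum_app, SFo.mul_app]
        refine norm_sum_le_of_le _ fun l _ => ?_
        rw [norm_mul]; exact mul_le_mul_of_nonneg_right (h.bv q l z) (norm_nonneg _)
      · intro z
        simp only [SFo.sum_app, SFo.mul_app]
        exact tendsto_finsetSum Finset.univ fun l _ => (h.lv l z).mul_const ((dx l Φ).1 z)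
    rw [← it_mu hcG hsG] at key
    have e : ∀ t x, G (t, x) = ((∑ j, (g j (t, x)).re * pd j (ψ t) x : ℝ) : ℂ) := by
      intro t x
      simp only [hG, hΦ, cst_dx]
      push_cast
      simp only [h.re_v]
    simp only [e, integral_complex_ofReal] at key
    exact_mod_cast key
theorem energy (h : Lm T M F g gp) {A : ℝ} {n : ℕ} (hn : 0 < n)
    (hA : ∀ x : Spc, ‖g 2 (0, x) - ((A * Real.sin (2 * Real.pi * n * x 0) : ℝ) : ℂ)‖ ≤ 1) :
    A ^ 2 / 4 - 1 ≤ ⨆ t : ℝ, ∫ x in Tdom, ∑ i, ((g i (t, x)).re) ^ 2 := by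
  have hM : 0 ≤ M := (norm_nonneg _).trans (h.bd_v 0 0)
  have bdd : BddAbove (range fun t : ℝ => ∫ x in Tdom, ∑ i, ((g i (t, x)).re) ^ 2) := by
    refine ⟨(∑ _i : Fin 3, M ^ 2) * (volume.restrict Tdom).real univ, ?_⟩
    rintro _ ⟨t, rfl⟩
    refine (Real.le_norm_self _).trans (norm_integral_le_of_norm_le_const (ae_of_all _ fun x => norm_sum_le_of_le _ fun i _ => ?_))
    rw [norm_pow]
    exact pow_le_pow_left₀ (norm_nonneg _) ((Complex.abs_re_le_norm _).trans (h.bd_v i _)) 2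
  refine le_trans ?_ (le_ciSup bdd 0)
  have cv : ∀ i, Continuous fun x : Spc => (g i (0, x)).re := fun i =>
    Complex.continuous_re.comp ((h.cv i).comp (by fun_prop))
  have hI : ∫ x in Tdom, Real.cos (2 * Real.pi * (2 * n : ℕ) * x 0) = 0 := by
    have h1 := int_dxG (sn (2 * Real.pi * (2 * n : ℕ))) (sn_pk _) 0 0
    simp only [sn_dx, if_true, SFo.smul_app, cs_app] at h1
    rw [integral_const_mul, integral_complex_ofReal] at h1
    have hne : ((2 * Real.pi * (2 * n : ℕ) : ℝ) : ℂ) ≠ 0 := by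
      have : (0 : ℝ) < 2 * Real.pi * (2 * n : ℕ) := by
        have := Real.pi_pos
        have : 0 < 2 * n := by omega
        positivity
      exact_mod_cast this.ne'
    have := (mul_eq_zero.1 h1).resolve_left hne
    exact_mod_cast this
  have cc : Continuous fun x : Spc => Real.cos (2 * Real.pi * (2 * n : ℕ) * x 0) :=
    Real.continuous_cos.comp (continuous_const.mul (continuous_apply 0))
  have e1 : ∫ x in Tdom, ((A ^ 2 / 4 - 1) - A ^ 2 / 4 * Real.cos (2 * Real.pi * (2 * n : ℕ) * x 0)) = A ^ 2 / 4 - 1 := by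
    rw [integral_sub (int_cd continuous_const) ((int_cd cc).const_mul _), integral_const_mul, hI]
    simp
  rw [← e1]
  refine integral_mono (int_cd (continuous_const.sub (continuous_const.mul cc))) (int_cd (continuous_finsetSum _ fun i _ => (cv i).pow 2)) fun x => ?_
  have hw := hA x
  set u := A * Real.sin (2 * Real.pi * n * x 0) with hu
  have hr : |(g 2 (0, x)).re - u| ≤ 1 := by
    have := (Complex.abs_re_le_norm _).trans hw
    simpa only [Complex.sub_re, Complex.ofReal_re] using this
  have hc : Real.cos (2 * Real.pi * (2 * n : ℕ) * x 0) = 1 - 2 * Real.sin (2 * Real.pi * n * x 0) ^ 2 := by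
    have : 2 * Real.pi * (2 * n : ℕ) * x 0 = 2 * (2 * Real.pi * n * x 0) := by push_cast; ring
    rw [this, Real.cos_two_mul, Real.cos_sq']; ring
  have hu2 : A ^ 2 * Real.sin (2 * Real.pi * n * x 0) ^ 2 = u ^ 2 := by rw [hu]; ring
  simp only [Fin.sum_univ_three]
  rw [hc]
  have h1 := abs_le.1 hr
  nlinarith [sq_nonneg (g 0 (0, x)).re, sq_nonneg (g 1 (0, x)).re, sq_nonneg (u - 2 * ((g 2 (0, x)).re)), sq_nonneg (u - 2 * ((g 2 (0, x)).re - u)), sq_nonneg ((g 2 (0, x)).re - u), sq_nonneg (2 * (g 2 (0, x)).re - u)]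
end Lm
end CI
end

noncomputable section
open MeasureTheory Set Filter Topology
open scoped ContDiff
set_option linter.unusedSectionVars false
namespace CI

theorem fin_hold {α : ℝ} (g : Fin 3 → ℝ × Spc → ℂ) (h : ∀ l, ∃ H, ∀ z z', ‖g l z - g l z'‖ ≤ H * dist z z' ^ α) :
    HolderTS α (fun t x (l : Fin 3) => (g l (t, x)).re) := by
  choose H hH using h
  refine ⟨∑ l, |H l|, fun t t' x x' => ?_⟩
  have hd : 0 ≤ dist ((t, x) : ℝ × Spc) ((t', x') : ℝ × Spc) ^ α := Real.rpow_nonneg dist_nonneg _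
  have hs : 0 ≤ ∑ l, |H l| := Finset.sum_nonneg fun l _ => abs_nonneg _
  refine (pi_norm_le_iff_of_nonneg (mul_nonneg hs hd)).2 fun l => ?_
  have h1 : ‖(g l (t, x)).re - (g l (t', x')).re‖ ≤ ‖g l (t, x) - g l (t', x')‖ := by
    rw [← Complex.sub_re]; exact Complex.abs_re_le_norm _
  refine h1.trans ((hH l _ _).trans (mul_le_mul_of_nonneg_right ?_ hd))
  exact (le_abs_self _).trans (Finset.single_le_sum (f := fun l => |H l|) (fun l _ => abs_nonneg _) (Finset.mem_univ l))

theorem main_core (π : Pm) {E ε : ℝ} (hE : 0 < E) (hε : 0 < ε) :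
    ∃ (v : ℝ → Spc → Spc) (p : ℝ → Spc → ℝ),
      (∀ t, Per (v t)) ∧ (∀ t, Per (p t)) ∧
      IsWeakEuler v p ∧
      (∀ α : ℝ, 0 < α → α ≤ 1 → α * π.Z < π.h → HolderTS α v) ∧
      (∀ α : ℝ, 0 < α → α ≤ 1 → α * π.Z < 2 * π.h → HolderTS α p) ∧
      (∃ a b : ℝ, a ≤ b ∧ b - a ≤ ε ∧
        ∀ t, t ∉ Set.Icc a b → ∀ x, v t x = 0 ∧ p t x = 0) ∧
      E ≤ ⨆ t : ℝ, ∫ x in Tdom, ∑ i, (v t x i)^2 := by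
  obtain ⟨P, hP⟩ := exists_nat_ge (π.Z + π.h + 1)
  obtain ⟨C, hC, HS⟩ := st_seq π P
  have hh := π.h_pos
  have hβ := π.hβ
  obtain ⟨a, ha, hgood, hin, e1, e2, e3, e4⟩ :=
    ((eventually_gt_atTop (0 : ℝ)).and <| (eventually_forall_ge_atTop.2 (π.good_ev C hC P hP)).and <|
      (init π (A := 2 * (E + 1)) (T := ε / 4) (by linarith) (by linarith)).and <|
      (Pm.ev (1 * π.β) 2 (by linarith)).and <| (Pm.ev (π.h * π.β) 2 (by positivity)).and <|
      (Pm.ev 1 (8 / ε) one_pos).and (Pm.ev π.h (2 * C) hh)).exists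
  obtain ⟨F0, hF0, hp0, ⟨D, hD⟩, hA, n, hn, hsin⟩ := hin
  obtain ⟨F, hF, hS⟩ := HS a (ε / 4) F0 ha.le hgood hF0
  set y := π.yq a with hy
  have hya : ∀ q, a ≤ y q := yq_ge π ha.le
  have s1 : Summable fun q => Real.exp (-(π.h * y q)) := sum_yq π ha hh
  have t1 : ∑' q, C * Real.exp (-(π.h * y q)) ≤ 1 := by
    rw [tsum_mul_left]
    have h1 := tsum_yq π ha hh e2
    have h2 : 2 * C * Real.exp (-(π.h * a)) ≤ 1 := by
      rw [Real.exp_neg, ← div_eq_mul_inv]; exact (div_le_one (Real.exp_pos _)).2 e4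
    nlinarith
  have cy : ∀ q, π.c (y q) = Real.exp (-(π.h * y q)) := fun q => rfl
  have c0 : ∀ q, 0 < π.c (y q) := fun q => π.c_pos _
  have c1 : ∀ q, π.c (y q) ≤ 1 := fun q => by
    rw [cy]; exact Real.exp_le_one_iff.2 (by nlinarith [hya q])
  have c2 : ∀ q, π.c (y q) ^ 2 = Real.exp (-(2 * π.h * y q)) := fun q => by
    rw [cy, ← Real.exp_nat_mul]; congr 1; push_cast; ring
  set e : ℕ → ℝ := fun q => C * π.c (y q) with he
  have se : Summable e := s1.mul_left C
  have e0 : ∀ q, 0 ≤ e q := fun q => by have := c0 q; rw [he]; positivity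
  have te : ∑' q, e q ≤ 1 := t1
  have hTq : ∀ q, Tq π a (ε / 4) q ≤ ε / 2 := fun q => by
    have s2 : Summable fun q => Real.exp (-(1 * π.yq a q)) := sum_yq π ha one_pos
    have h1 := tsum_yq π ha one_pos e1
    have h2 := s2.sum_le_tsum (Finset.range q) fun i _ => (Real.exp_pos _).le
    have h3 : 2 * Real.exp (-(1 * a)) ≤ ε / 4 := by
      rw [Real.exp_neg, ← div_eq_mul_inv, div_le_iff₀ (Real.exp_pos _)]
      rw [div_le_iff₀ hε] at e3
      linarith
    simp only [one_mul] at h1 h2 h3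
    rw [Tq]; linarith
  have dv : ∀ l q z, ‖((F (q + 1)).v l).1 z - ((F q).v l).1 z‖ ≤ e q := fun l q z => (hS q).2.bw l z
  have dp : ∀ q z, ‖(F (q + 1)).p.1 z - (F q).p.1 z‖ ≤ e q := fun q z => by
    refine ((hS q).2.bq z).trans ?_
    have h0 := c0 q; have h1 := c1 q
    exact mul_le_mul_of_nonneg_left (by nlinarith) (by linarith)
  choose g gl gb gu using fun l => lim_fun (fun q => ((F q).v l).1) e se (dv l)
  obtain ⟨gp, pl, pb, pu⟩ := lim_fun (fun q => (F q).p.1) e se dp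
  set M := 2 * (E + 1) + 1 with hM
  have bv : ∀ q l z, ‖((F q).v l).1 z‖ ≤ M := fun q l z => by
    have h1 := (pre_bd (fun q => ((F q).v l).1) e se e0 (dv l) q z).trans te
    have h2 := hA l z
    rw [← hF] at h2
    have h3 := norm_le_norm_add_norm_sub' (((F q).v l).1 z) (((F 0).v l).1 z)
    linarith
  have LM : Lm (ε / 2) M F g gp :=
    { eu := fun q => (hS q).1.eu.mono (hTq q)
      bv := bv
      bp := fun q z => by
        have h1 := (pre_bd (fun q => (F q).p.1) e se e0 dp q z).trans te
        have h2 : (F 0).p.1 z = 0 := by rw [hF, hp0]; rfl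
        simp only [h2, sub_zero] at h1
        linarith
      bR := fun q i j z => by
        have h1 := (hS q).1.ok.bR i j z
        have h0 := c0 q; have h2 := c1 q
        nlinarith
      lv := gl
      lp := pl
      lR := fun i j z => by
        refine squeeze_zero_norm (fun q => (hS q).1.ok.bR i j z) ?_
        have := s1.tendsto_atTop_zero.pow 2
        simp only [cy]; simpa using this
      cv := fun l => (gu l).continuous (Frequently.of_forall fun q => continuous_iff_continuousAt.2 fun w => (SFo.diff ((F q).v l) w).continuousAt)
      cp := pu.continuous (Frequently.of_forall fun q => continuous_iff_continuousAt.2 fun w => (SFo.diff (F q).p w).continuousAt) }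
  have hM0 : 0 ≤ M := by linarith
  have hB : 0 ≤ C * (1 + 3 * M) := by positivity
  have hCB : C ≤ C * (1 + 3 * M) := by nlinarith
  have hla : ∀ q, 0 ≤ π.la (y q) := fun q => (Real.exp_pos _).le.trans (π.la_low _)
  have hsm : ∀ q z, π.c (y q) + ∑ m, ‖((F q).v m).1 z‖ ≤ 1 + 3 * M := fun q z => by
    have h1 : ∑ m, ‖((F q).v m).1 z‖ ≤ ∑ m : Fin 3, M := Finset.sum_le_sum fun m _ => bv q m z
    simp at h1
    linarith [c1 q]
  refine ⟨fun t x l => (g l (t, x)).re, fun t x => (gp (t, x)).re, LM.per_v, LM.per_p, LM.euler, ?_, ?_, ?_, ?_⟩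
  · intro α hα hα1 hαZ
    refine fin_hold g fun l => ?_
    set D' := |D| + π.c a * (π.κ a * π.L a) with hD'
    have hcl : 0 ≤ π.c a * (π.κ a * π.L a) := (norm_nonneg _).trans (hF0.ok.bdv 0 0 0)
    have hD'0 : 0 ≤ D' := by positivity
    have lip := sf_lip (F0.v l) (D := D') (fun z => (hD l z).trans (by linarith [le_abs_self D]))
      (fun j z => (hF0.ok.bdv j l z).trans (by linarith [abs_nonneg D]))
    refine hold_lim π ha (fun q => (F q).v l) (g l) (H0 := 4 * D' + 4 * (E + 1)) hB hα hα1 hαZ (fun z z' => ?_) (fun q z => ?_) (fun q z => ?_) (fun q j z => ?_) (gl l)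
    · simp only [hF]
      have h1 : ‖(F0.v l).1 z - (F0.v l).1 z'‖ ≤ (4 * D' + 4 * (E + 1)) * 1 := by
        have := norm_sub_le ((F0.v l).1 z) ((F0.v l).1 z')
        linarith [hA l z, hA l z']
      have h2 : ‖(F0.v l).1 z - (F0.v l).1 z'‖ ≤ (4 * D' + 4 * (E + 1)) * 1 * 1 * dist z z' := by
        refine (lip z z').trans (mul_le_mul_of_nonneg_right (by linarith) dist_nonneg)
      have := interp hα hα1 zero_le_one zero_le_one (dist_nonneg (x := z) (y := z')) (by linarith) h1 h2
      simpa using this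
    · exact ((hS q).2.bw l z).trans (mul_le_mul_of_nonneg_right hCB (c0 q).le)
    · refine ((hS q).2.btw l z).trans ?_
      rw [π.la_eq, ← cy]
      have := mul_le_mul_of_nonneg_left (hsm q z) (mul_nonneg (mul_nonneg (by linarith : (0:ℝ) ≤ C) (c0 q).le) (hla q))
      refine this.trans (le_of_eq (by ring))
    · refine ((hS q).2.bdw j l z).trans ?_
      rw [π.la_eq, ← cy]
      exact mul_le_mul_of_nonneg_right (mul_le_mul_of_nonneg_right hCB (c0 q).le) (hla q)
  · intro α hα hα1 hαZ
    obtain ⟨H, hH⟩ := hold_lim π ha (fun q => (F q).p) gp (H0 := 0) (k := 2 * π.h) hB hα hα1 hαZ (fun z z' => by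
        have h2 : ∀ z, (F 0).p.1 z = 0 := fun z => by rw [hF, hp0]; rfl
        simp only [h2]; simp) (fun q z => by
        refine ((hS q).2.bq z).trans ?_
        rw [← c2]
        exact (mul_le_mul_of_nonneg_right hCB (sq_nonneg _))) (fun q z => by
        refine ((hS q).2.btq z).trans ?_
        rw [π.la_eq, ← c2]
        have := mul_le_mul_of_nonneg_left (hsm q z) (mul_nonneg (mul_nonneg (by linarith : (0:ℝ) ≤ C) (sq_nonneg (π.c (y q)))) (hla q))
        refine this.trans (le_of_eq (by ring))) (fun q j z => by
        refine ((hS q).2.bdq j z).trans ?_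
        rw [π.la_eq, ← c2]
        exact mul_le_mul_of_nonneg_right (mul_le_mul_of_nonneg_right hCB (sq_nonneg _)) (hla q)) pl
    refine ⟨H, fun t t' x x' => ?_⟩
    refine le_trans ?_ (hH (t, x) (t', x'))
    rw [← Complex.sub_re]; exact Complex.abs_re_le_norm _
  · refine ⟨-(ε / 2), ε / 2, by linarith, by linarith, fun t ht x => ⟨?_, ?_⟩⟩
    · funext l
      have := LM.sp_v l (t, x) (fun h => ht h)
      simp [this]
    · have := LM.sp_p (t, x) (fun h => ht h)
      simp [this]
  · have := LM.energy (A := 2 * (E + 1)) hn (fun x => by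
      rw [← hsin x, ← hF]
      have := gb 2 0 (0, x)
      simp only [zero_add] at this
      exact this.trans te)
    refine le_trans ?_ this
    nlinarith

theorem main_thm (δ : ℝ) (hδ : 0 < δ) (E ε : ℝ)
    (hE : 0 < E) (hε : 0 < ε) :
    ∃ (v : ℝ → Spc → Spc) (p : ℝ → Spc → ℝ),
      (∀ t, Per (v t)) ∧ (∀ t, Per (p t)) ∧
      IsWeakEuler v p ∧
      (∀ α : ℝ, 0 < α → α < (1 + δ) / (5 + 9*δ + 4*δ^2) → HolderTS α v) ∧
      (∀ α : ℝ, 0 < α → α < 2 * ((1 + δ) / (5 + 9*δ + 4*δ^2)) → HolderTS α p) ∧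
      (∃ a b : ℝ, a ≤ b ∧ b - a ≤ ε ∧
        ∀ t, t ∉ Set.Icc a b → ∀ x, v t x = 0 ∧ p t x = 0) ∧
      E ≤ ⨆ t : ℝ, ∫ x in Tdom, ∑ i, (v t x i)^2 := by
  have hb : δ / 2 ≠ 0 := by positivity
  have h5 : (0:ℝ) < 5 + 4 * δ := by linarith
  let π : Pm :=
    { β := δ / 2, s := 2 * δ / (5 + 4 * δ), h := (1 - 2 * δ / (5 + 4 * δ)) / (2 * (δ / 2))
      Z := (2 * (1 + δ / 2) + 1 / 2) / (δ / 2)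
      hβ := by positivity
      hs := by positivity
      hs1 := by rw [div_lt_one h5]; linarith
      hh := by field_simp
      hZ := by field_simp }
  have hst : (1 + δ) / (5 + 9*δ + 4*δ^2) = 1 / (5 + 4 * δ) := by
    rw [div_eq_div_iff (by positivity) h5.ne']; ring
  have hZ : π.h = 1 / (5 + 4 * δ) * π.Z := by
    change (1 - 2 * δ / (5 + 4 * δ)) / (2 * (δ / 2)) = 1 / (5 + 4 * δ) * ((2 * (1 + δ / 2) + 1 / 2) / (δ / 2))
    field_simp; ring
  have h1 : 1 / (5 + 4 * δ) ≤ 1 / 5 := by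
    apply one_div_le_one_div_of_le <;> linarith
  have hZ0 : 0 < π.Z := by linarith [π.Z_pos]
  obtain ⟨v, p, a1, a2, a3, a4, a5, a6⟩ := main_core π hE hε
  rw [hst]
  refine ⟨v, p, a1, a2, a3, fun α hα h => a4 α hα (by linarith) ?_, fun α hα h => a5 α hα (by linarith) ?_, a6⟩
  · rw [hZ]; exact mul_lt_mul_of_pos_right h hZ0
  · rw [hZ, ← mul_assoc]; exact mul_lt_mul_of_pos_right h hZ0
end CI
end

/-- For every δ > 0, with α* = (1+δ)/(5+9δ+4δ²), there exist weak Euler flows of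
class C^α for every α < α* (pressure in C^α for α < 2α*), supported in an
arbitrarily small time interval and with arbitrarily large energy. -/
theorem euler_alpha_star_large_energy (δ : ℝ) (hδ : 0 < δ) (E ε : ℝ)
    (hE : 0 < E) (hε : 0 < ε) :
    ∃ (v : ℝ → Spc → Spc) (p : ℝ → Spc → ℝ),
      (∀ t, Per (v t)) ∧ (∀ t, Per (p t)) ∧
      IsWeakEuler v p ∧
      (∀ α : ℝ, 0 < α → α < (1 + δ) / (5 + 9*δ + 4*δ^2) → HolderTS α v) ∧
      (∀ α : ℝ, 0 < α → α < 2 * ((1 + δ) / (5 + 9*δ + 4*δ^2)) → HolderTS α p) ∧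
      (∃ a b : ℝ, a ≤ b ∧ b - a ≤ ε ∧
        ∀ t, t ∉ Set.Icc a b → ∀ x, v t x = 0 ∧ p t x = 0) ∧
      E ≤ ⨆ t : ℝ, ∫ x in Tdom, ∑ i, (v t x i)^2 := by
  exact CI.main_thm δ hδ E ε hE hε
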